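/- Fix an integer t ≥ 2. For a tree T chosen uniformly at random among all canonical t-ary trees with n internal vertices, the number d(T) of distinct depths at which leaves occur is asymptotically normally distributed as n → ∞, and a local limit theorem holds. The mean of d(T) is μ_d·n + O(1) and the variance is σ_d²·n + O(1), where the constants satisfy |μ_d − (1/2 + (t−4)/2^{t+3} + (2t²−t−14)/2^{2t+5} + (9t³+27t²−76t−144)/2^{3t+8})| ≤ 0.06 t⁴/2^{4t} and |σ_d² − (1/4 + (−t²+9t−14)/2^{t+4} + (−4t³+20t²+3t−54)/2^{2t+6})| ≤ 0.056 t⁴/2^{3t} for all t ≥ 2. -/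

import Mathlib

open scoped BigOperators
open Filter MeasureTheory

noncomputable section

/-- `hp t j = 1 + t + ⋯ + t^(j-1) = (t^j - 1)/(t-1)`. -/
def hp (t j : ℕ) : ℕ := ∑ i ∈ Finset.range j, t ^ i

/-- The series `b(q,u,v,w)`
`b = Σ_{j≥1} v q^{h_j} u^{t^j} w^j/(1−q^{h_j} u^{t^j}) ∏_{i=1}^{j−1} (1−v−q^{h_i}u^{t^i})/(1−q^{h_i}u^{t^i})`. -/
def bGF (t : ℕ) (q u v w : ℂ) : ℂ :=
  ∑' j : ℕ,
    v * q ^ hp t (j + 1) * u ^ t ^ (j + 1) * w ^ (j + 1) /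
        (1 - q ^ hp t (j + 1) * u ^ t ^ (j + 1)) *
      ∏ i ∈ Finset.Icc 1 j,
        (1 - v - q ^ hp t i * u ^ t ^ i) / (1 - q ^ hp t i * u ^ t ^ i)

/-- The series `a(q,u,v,w)` (for canonical forests with `r` roots)
`a = Σ_{j≥0} v q^{r h_j} u^{r t^j} w^j ∏_{i=1}^{j} (1−v−q^{h_i}u^{t^i})/(1−q^{h_i}u^{t^i})`. -/
def aGF (t r : ℕ) (q u v w : ℂ) : ℂ :=
  ∑' j : ℕ,
    v * q ^ (r * hp t j) * u ^ (r * t ^ j) * w ^ j *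
      ∏ i ∈ Finset.Icc 1 j,
        (1 - v - q ^ hp t i * u ^ t ^ i) / (1 - q ^ hp t i * u ^ t ^ i)

/-- A canonical `t`-ary forest with `r` (ordered) roots, encoded by its sequence of
numbers of internal vertices on each level (a canonical forest is uniquely determined
by this sequence: on each level the leaves come first, since outdegrees read from left
to right are non-decreasing).  The number `c_0` of internal vertices on level `0` is at
most `r`, each level's internal-vertex count satisfies `1 ≤ c_{k+1} ≤ t·c_k`, and the
list stops at the last level containing internal vertices. -/
structure CanonicalForest (t r : ℕ) where
  levels : List ℕ
  pos : ∀ c ∈ levels, 0 < c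
  head_le : ∀ c ∈ levels.head?, c ≤ r
  chain : levels.Chain' fun a b => b ≤ t * a

namespace CanonicalForest

variable {t r : ℕ} (T : CanonicalForest t r)

/-- the number `n(T)` of internal vertices -/
def size : ℕ := T.levels.sum

/-- the height `h(T)`: the maximal distance of a leaf from the root level -/
def height : ℕ := T.levels.length

/-- the number of internal vertices at depth `k` -/
def internAt (k : ℕ) : ℕ := T.levels.getD k 0

/-- the number of vertices at depth `k` -/
def vertsAt (k : ℕ) : ℕ := if k = 0 then r else t * T.internAt (k - 1)

/-- the number of leaves at depth `k` -/
def leavesAt (k : ℕ) : ℕ := T.vertsAt k - T.internAt k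

/-- the number `m(T)` of leaves at maximal depth -/
def lastLeaves : ℕ := T.vertsAt T.height

/-- the number `d(T)` of distinct depths at which leaves occur -/
def distinctDepths : ℕ :=
  ((Finset.range (T.height + 1)).filter fun k => 0 < T.leavesAt k).card

/-- the (leaf-)width `w(T)`: the maximal number of leaves on one level -/
def width : ℕ := (Finset.range (T.height + 1)).sup fun k => T.leavesAt k

/-- the total path length `ℓ(T)`: the sum of the depths of all vertices -/
def pathLength : ℕ := ∑ k ∈ Finset.range (T.height + 1), k * T.vertsAt k

end CanonicalForest

/-- the number of canonical `t`-ary forests with `r` roots and `n` internal vertices -/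
def forestCount (t r n : ℕ) : ℕ := Nat.card {T : CanonicalForest t r // T.size = n}

/-- the probability of an event under the uniform distribution on canonical `t`-ary
forests with `r` roots and `n` internal vertices -/
def forestProb (t r n : ℕ) (s : Set (CanonicalForest t r)) : ℝ :=
  (Nat.card {T : CanonicalForest t r // T.size = n ∧ T ∈ s} : ℝ) / forestCount t r n

/-- the expectation of a random variable under the uniform distribution on canonical
`t`-ary forests with `r` roots and `n` internal vertices -/
def forestExp (t r n : ℕ) (f : CanonicalForest t r → ℝ) : ℝ :=
  (∑ᶠ T : {T : CanonicalForest t r // T.size = n}, f T.1) / forestCount t r n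

/-- the variance of a random variable under the uniform distribution on canonical
`t`-ary forests with `r` roots and `n` internal vertices -/
def forestVar (t r n : ℕ) (f : CanonicalForest t r → ℝ) : ℝ :=
  forestExp t r n (fun T => f T ^ 2) - forestExp t r n f ^ 2

/-- the distribution function of the standard normal distribution -/
def stdGaussCDF (x : ℝ) : ℝ :=
  (Real.sqrt (2 * Real.pi))⁻¹ * ∫ u in Set.Iic x, Real.exp (-u ^ 2 / 2)

/-- the density of the standard normal distribution -/
def stdGaussPDF (x : ℝ) : ℝ :=
  (Real.sqrt (2 * Real.pi))⁻¹ * Real.exp (-x ^ 2 / 2)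

noncomputable section
open scoped BigOperators
open Filter MeasureTheory
/-! ### Combinatorics: level lists -/

open Polynomial in
/-- validity of a level list, with all entries at least `b` -/
def VL (t b : ℕ) : ℕ → List ℕ → Prop
  | _, [] => True
  | r, j :: l => (b ≤ j ∧ j ≤ r) ∧ VL t b (t * j) l

/-- number of distinct leaf depths of the forest given by a level list -/
def dL (t : ℕ) : ℕ → List ℕ → ℕ
  | _, [] => 1
  | r, j :: l => (if j < r then 1 else 0) + dL t (t * j) l

lemma VL_set_zero (t b r : ℕ) (hb : 1 ≤ b) : {l | VL t b r l ∧ l.sum = 0} = {[]} := by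
  ext l
  cases l with
  | nil => simp [VL]
  | cons j l =>
    simp only [VL, Set.mem_ofPred_eq, List.sum_cons, Set.mem_singleton_iff, reduceCtorEq, iff_false]
    omega

lemma VL_set_eq (t b r n : ℕ) (hn : 1 ≤ n) : {l | VL t b r l ∧ l.sum = n} =
    ⋃ j ∈ (↑(Finset.Icc b (min r n)) : Set ℕ), (List.cons j) '' {l | VL t b (t * j) l ∧ l.sum = n - j} := by
  ext l
  cases l with
  | nil => simp; omega
  | cons j l =>
    simp only [VL, Set.mem_ofPred_eq, List.sum_cons, Set.mem_iUnion, Set.mem_image,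
      List.cons.injEq, Finset.mem_coe, Finset.mem_Icc, exists_prop]
    constructor
    · rintro ⟨⟨⟨h1, h2⟩, h3⟩, h4⟩
      exact ⟨j, ⟨h1, by omega⟩, l, ⟨h3, by omega⟩, rfl, rfl⟩
    · rintro ⟨j', ⟨h1, h2⟩, l', ⟨h3, h4⟩, rfl, rfl⟩
      exact ⟨⟨⟨h1, by omega⟩, h3⟩, by omega⟩

lemma VL_finite (t b : ℕ) (hb : 1 ≤ b) (n : ℕ) : ∀ r, {l | VL t b r l ∧ l.sum = n}.Finite := by
  induction n using Nat.strong_induction_on with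
  | _ n ih =>
    intro r
    rcases Nat.eq_zero_or_pos n with rfl | hn
    · rw [VL_set_zero t b r hb]; exact Set.finite_singleton _
    · rw [VL_set_eq t b r n hn]
      refine Set.Finite.biUnion (Finset.finite_toSet _) ?_
      intro j hj
      have hj' := Finset.mem_Icc.1 (Finset.mem_coe.1 hj)
      exact (ih (n - j) (by omega) _).image _

/-- generating polynomial of `dL` over level lists of sum `n` with entries `≥ b` (`b ≥ 1`). -/
def LP (t b r n : ℕ) : Polynomial ℕ :=
  ∑ᶠ l ∈ {l | VL t b r l ∧ l.sum = n}, (Polynomial.X : Polynomial ℕ) ^ dL t r l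

lemma LP_zero (t b r : ℕ) (hb : 1 ≤ b) : LP t b r 0 = Polynomial.X := by
  rw [LP, VL_set_zero t b r hb, finsum_mem_singleton]; simp [dL]

lemma polymul_finsum_mem {s : Set (List ℕ)} (hs : s.Finite) (f : List ℕ → Polynomial ℕ)
    (r : Polynomial ℕ) : r * ∑ᶠ a ∈ s, f a = ∑ᶠ a ∈ s, r * f a :=
  (AddMonoidHom.mulLeft r).map_finsum_mem f hs

lemma LP_succ (t b r n : ℕ) (hb : 1 ≤ b) (hn : 1 ≤ n) : LP t b r n =
    ∑ j ∈ Finset.Icc b (min r n),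
      Polynomial.X ^ (if j < r then 1 else 0) * LP t b (t * j) (n - j) := by
  rw [LP, VL_set_eq t b r n hn]
  rw [finsum_mem_biUnion]
  · rw [finsum_mem_coe_finset]
    refine Finset.sum_congr rfl fun j hj => ?_
    rw [finsum_mem_image (List.cons_injective.injOn)]
    rw [LP, polymul_finsum_mem (VL_finite t b hb _ _)]
    refine finsum_mem_congr rfl fun l hl => ?_
    rw [dL, pow_add]
  · intro i _ j _ hij
    refine Set.disjoint_left.2 ?_
    rintro _ ⟨l, _, rfl⟩ ⟨l', _, h⟩
    simp at h; exact hij h.1.symm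
  · exact Finset.finite_toSet _
  · intro j _
    exact (VL_finite t b hb _ _).image _

lemma LP_renewal (t : ℕ) (ht : 2 ≤ t) (n : ℕ) : ∀ c, 1 ≤ c →
    LP t 1 (t * c) n = LP t 2 (t * c) n +
      ∑ m ∈ Finset.range n, LP t 2 (t * c) m * LP t 1 (t * 1) (n - 1 - m) := by
  induction n using Nat.strong_induction_on with
  | _ n ih =>
    intro c hc
    rcases Nat.eq_zero_or_pos n with rfl | hn
    · simp [LP_zero]
    have htc : 2 ≤ t * c := by nlinarith
    rw [LP_succ t 1 _ n le_rfl hn, LP_succ t 2 _ n (by norm_num) hn]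
    have hmin : 1 ≤ min (t * c) n := by omega
    rw [← Finset.add_sum_Ioc_eq_sum_Icc hmin]
    have hI : Finset.Ioc 1 (min (t * c) n) = Finset.Icc 2 (min (t * c) n) := by
      ext x; simp; omega
    rw [hI, if_pos (by omega : 1 < t * c), pow_one]
    have h1 : ∀ j ∈ Finset.Icc 2 (min (t * c) n),
        (Polynomial.X : Polynomial ℕ) ^ (if j < t * c then 1 else 0) * LP t 1 (t * j) (n - j) =
        Polynomial.X ^ (if j < t * c then 1 else 0) * LP t 2 (t * j) (n - j) +
        ∑ m ∈ Finset.range (n - j), Polynomial.X ^ (if j < t * c then 1 else 0) *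
          LP t 2 (t * j) m * LP t 1 (t * 1) (n - j - 1 - m) := by
      intro j hj
      have hj' := Finset.mem_Icc.1 hj
      rw [ih (n - j) (by omega) j (by omega), mul_add, Finset.mul_sum]
      simp only [mul_assoc]
    rw [Finset.sum_congr rfl h1, Finset.sum_add_distrib]
    obtain ⟨k, rfl⟩ : ∃ k, n = k + 1 := ⟨n - 1, by omega⟩
    rw [Finset.sum_range_succ' _ k, LP_zero t 2 _ (by norm_num)]
    have h2 : ∀ m ∈ Finset.range k, LP t 2 (t * c) (m + 1) * LP t 1 (t * 1) (k + 1 - 1 - (m + 1)) =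
        ∑ j ∈ Finset.Icc 2 (min (t * c) (m + 1)), Polynomial.X ^ (if j < t * c then 1 else 0) *
          LP t 2 (t * j) (m + 1 - j) * LP t 1 (t * 1) (k + 1 - 1 - (m + 1)) := by
      intro m hm
      rw [LP_succ t 2 _ (m + 1) (by norm_num) (by omega), Finset.sum_mul]
    rw [Finset.sum_congr rfl h2]
    have h3 : ∑ j ∈ Finset.Icc 2 (min (t * c) (k + 1)), ∑ m ∈ Finset.range (k + 1 - j),
        Polynomial.X ^ (if j < t * c then 1 else 0) *
          LP t 2 (t * j) m * LP t 1 (t * 1) (k + 1 - j - 1 - m) =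
        ∑ m ∈ Finset.range k, ∑ j ∈ Finset.Icc 2 (min (t * c) (m + 1)),
          Polynomial.X ^ (if j < t * c then 1 else 0) *
          LP t 2 (t * j) (m + 1 - j) * LP t 1 (t * 1) (k + 1 - 1 - (m + 1)) := by
      rw [Finset.sum_sigma', Finset.sum_sigma']
      refine Finset.sum_bij' (fun x _ => ⟨x.2 + x.1 - 1, x.1⟩) (fun x _ => ⟨x.2, x.1 + 1 - x.2⟩)
        ?_ ?_ ?_ ?_ ?_
      · rintro ⟨j, m⟩ h
        simp only [Finset.mem_sigma, Finset.mem_Icc, Finset.mem_range] at h ⊢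
        omega
      · rintro ⟨m, j⟩ h
        simp only [Finset.mem_sigma, Finset.mem_Icc, Finset.mem_range] at h ⊢
        omega
      · rintro ⟨j, m⟩ h
        simp only [Finset.mem_sigma, Finset.mem_Icc, Finset.mem_range] at h ⊢
        simp; omega
      · rintro ⟨m, j⟩ h
        simp only [Finset.mem_sigma, Finset.mem_Icc, Finset.mem_range] at h ⊢
        simp; omega
      · rintro ⟨j, m⟩ h
        simp only [Finset.mem_sigma, Finset.mem_Icc, Finset.mem_range] at h ⊢
        have e1 : m + j - 1 + 1 - j = m := by omega
        have e2 : k + 1 - 1 - (m + j - 1 + 1) = k + 1 - j - 1 - m := by omega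
        rw [e1, e2]
    rw [h3]
    simp only [Nat.sub_zero]
    have e3 : k + 1 - 1 - 0 = k + 1 - 1 := by omega
    ring

/-- the block polynomials -/
def BP (t : ℕ) : ℕ → Polynomial ℕ
  | 0 => 0
  | m + 1 => LP t 2 (t * 1) m

/-- the tree polynomials -/
def TP (t n : ℕ) : Polynomial ℕ := if n = 0 then 1 else LP t 1 1 n

lemma TP_succ (t n : ℕ) : TP t (n + 1) = LP t 1 (t * 1) n := by
  rw [TP, if_neg (by omega), LP_succ t 1 1 _ le_rfl (by omega)]
  have : min 1 (n + 1) = 1 := by omega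
  rw [this]; simp

/-- the renewal equation -/
lemma TP_renewal (t : ℕ) (ht : 2 ≤ t) (n : ℕ) (hn : 1 ≤ n) :
    TP t n = ∑ i ∈ Finset.range (n + 1), BP t i * TP t (n - i) := by
  obtain ⟨k, rfl⟩ : ∃ k, n = k + 1 := ⟨n - 1, by omega⟩
  rw [TP_succ, LP_renewal t ht k 1 le_rfl]
  rw [Finset.sum_range_succ', Finset.sum_range_succ]
  simp only [BP, zero_mul, add_zero, mul_one]
  have : k + 1 - (k + 1) = 0 := by omega
  rw [this, add_comm, TP, if_pos rfl, mul_one]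
  congr 1
  refine Finset.sum_congr rfl fun m hm => ?_
  have hm' := Finset.mem_range.1 hm
  have : k + 1 - (m + 1) = (k - 1 - m) + 1 := by omega
  rw [this, TP_succ, mul_one]


/-! ### relation to canonical forests -/

lemma VL_of_forest {t : ℕ} : ∀ (r : ℕ) (l : List ℕ), (∀ c ∈ l, 0 < c) →
    (∀ c ∈ l.head?, c ≤ r) → (l.IsChain fun a b => b ≤ t * a) → VL t 1 r l := by
  intro r l
  induction l generalizing r with
  | nil => intros; trivial
  | cons j l ih =>
    intro h1 h2 h3
    refine ⟨⟨h1 j (by simp), h2 j (by simp)⟩, ih (t * j) (fun c hc => h1 c (by simp [hc])) ?_ h3.tail⟩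
    intro c hc
    rw [List.isChain_cons] at h3
    exact h3.1 c hc

lemma forest_of_VL {t : ℕ} : ∀ (r : ℕ) (l : List ℕ), VL t 1 r l → (∀ c ∈ l, 0 < c) ∧
    (∀ c ∈ l.head?, c ≤ r) ∧ (l.IsChain fun a b => b ≤ t * a) := by
  intro r l
  induction l generalizing r with
  | nil => intros; simp
  | cons j l ih =>
    rintro ⟨⟨h1, h2⟩, h3⟩
    obtain ⟨h4, h5, h6⟩ := ih _ h3
    refine ⟨?_, ?_, ?_⟩
    · intro c hc
      rcases List.mem_cons.1 hc with rfl | hc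
      · exact h1
      · exact h4 c hc
    · intro c hc; simp at hc; omega
    · rw [List.isChain_cons]; exact ⟨h5, h6⟩

/-- the sum of leaf-depth indicators of a list -/
lemma dL_eq_card {t : ℕ} (ht : 1 ≤ t) : ∀ (r : ℕ) (l : List ℕ), 1 ≤ r → VL t 1 r l →
    dL t r l = ((Finset.range (l.length + 1)).filter fun k => 0 <
      (if k = 0 then r else t * l.getD (k - 1) 0) - l.getD k 0).card := by
  intro r l
  induction l generalizing r with
  | nil => intro hr _; simp [dL, Finset.filter_singleton, Nat.lt_of_lt_of_le Nat.zero_lt_one hr]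
  | cons j l ih =>
    rintro hr ⟨⟨h1, h2⟩, h3⟩
    rw [dL, ih (t * j) (by nlinarith) h3]
    rw [List.length_cons, Finset.card_filter, Finset.card_filter, Finset.sum_range_succ' _ (l.length + 1),
      add_comm]
    congr 1
    · refine Finset.sum_congr rfl fun k _ => ?_
      cases k with
      | zero => simp
      | succ k => simp
    · simp

lemma distinctDepths_eq {t r : ℕ} (ht : 1 ≤ t) (hr : 1 ≤ r) (T : CanonicalForest t r) :
    T.distinctDepths = dL t r T.levels := by
  rw [dL_eq_card ht r _ hr (VL_of_forest _ _ T.pos T.head_le T.chain)]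
  rfl

/-- the finset of level lists of trees of size `n` -/
def TL (t n : ℕ) : Finset (List ℕ) := (VL_finite t 1 le_rfl n 1).toFinset

/-- the finset of level lists (without initial one) of blocks of size `n+1` -/
def BL (t n : ℕ) : Finset (List ℕ) := (VL_finite t 2 (by norm_num) n (t * 1)).toFinset

/-- trees of size `n` as level lists -/
def treeEquiv (t n : ℕ) : {T : CanonicalForest t 1 // T.size = n} ≃ TL t n where
  toFun T := ⟨T.1.levels, by
    rw [TL, Set.Finite.mem_toFinset]
    exact ⟨VL_of_forest _ _ T.1.pos T.1.head_le T.1.chain, T.2⟩⟩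
  invFun l := ⟨⟨l.1, (forest_of_VL 1 l.1 ((VL_finite t 1 le_rfl n 1).mem_toFinset.1 l.2).1).1,
      (forest_of_VL 1 l.1 ((VL_finite t 1 le_rfl n 1).mem_toFinset.1 l.2).1).2.1,
      (forest_of_VL 1 l.1 ((VL_finite t 1 le_rfl n 1).mem_toFinset.1 l.2).1).2.2⟩,
      ((VL_finite t 1 le_rfl n 1).mem_toFinset.1 l.2).2⟩
  left_inv _ := rfl
  right_inv _ := rfl

lemma forestCount_eq (t n : ℕ) : forestCount t 1 n = (TL t n).card := by
  rw [forestCount, Nat.card_congr (treeEquiv t n)]; simp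

open Classical in
lemma forestProb_eq (t n : ℕ) (ht : 1 ≤ t) (Q : ℕ → Prop) :
    forestProb t 1 n {T | Q T.distinctDepths} =
      ((TL t n).filter fun l => Q (dL t 1 l)).card / (TL t n).card := by
  rw [forestProb, forestCount_eq]
  congr 2
  have e : {T : CanonicalForest t 1 // T.size = n ∧ T ∈ {T | Q T.distinctDepths}} ≃
      {x : {T : CanonicalForest t 1 // T.size = n} // Q x.1.distinctDepths} :=
    { toFun := fun T => ⟨⟨T.1, T.2.1⟩, T.2.2⟩
      invFun := fun T => ⟨T.1.1, T.1.2, T.2⟩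
      left_inv := fun _ => rfl
      right_inv := fun _ => rfl }
  rw [Nat.card_congr e]
  have e2 : {x : {T : CanonicalForest t 1 // T.size = n} // Q x.1.distinctDepths} ≃
      {x : TL t n // Q (dL t 1 x.1)} := by
    refine (treeEquiv t n).subtypeEquiv ?_
    intro x
    rw [distinctDepths_eq ht le_rfl]
    rfl
  have e3 : {x : TL t n // Q (dL t 1 x.1)} ≃ ((TL t n).filter fun l => Q (dL t 1 l)) :=
    { toFun := fun x => ⟨x.1.1, Finset.mem_filter.2 ⟨x.1.2, x.2⟩⟩
      invFun := fun x => ⟨⟨x.1, (Finset.mem_filter.1 x.2).1⟩, (Finset.mem_filter.1 x.2).2⟩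
      left_inv := fun _ => rfl
      right_inv := fun _ => rfl }
  rw [Nat.card_congr (e2.trans e3)]
  exact Nat.card_eq_finsetCard _

lemma forestExp_eq (t n : ℕ) (ht : 1 ≤ t) (F : ℕ → ℝ) :
    forestExp t 1 n (fun T => F T.distinctDepths) =
      (∑ l ∈ TL t n, F (dL t 1 l)) / (TL t n).card := by
  rw [forestExp, forestCount_eq]
  congr 1
  rw [← Finset.sum_coe_sort (TL t n), ← finsum_eq_sum_of_fintype]
  refine finsum_eq_of_bijective (treeEquiv t n) (treeEquiv t n).bijective ?_
  intro T
  rw [distinctDepths_eq ht le_rfl]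
  rfl

lemma TP_eq_sum (t n : ℕ) (hn : 1 ≤ n) : TP t n = ∑ l ∈ TL t n, Polynomial.X ^ dL t 1 l := by
  rw [TP, if_neg (by omega), LP, TL, finsum_mem_eq_finite_toFinset_sum _ (VL_finite t 1 le_rfl n 1)]

lemma BP_eq_sum (t n : ℕ) : BP t (n + 1) = ∑ l ∈ BL t n, Polynomial.X ^ dL t (t * 1) l := by
  rw [BP, LP, BL, finsum_mem_eq_finite_toFinset_sum _ (VL_finite t 2 (by norm_num) n (t * 1))]

lemma dL_le (t b : ℕ) (hb : 1 ≤ b) : ∀ (r : ℕ) (l : List ℕ), VL t b r l → dL t r l ≤ l.sum + 1 := by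
  intro r l
  induction l generalizing r with
  | nil => simp [dL]
  | cons j l ih =>
    rintro ⟨⟨h1, h2⟩, h3⟩
    have := ih _ h3
    rw [dL, List.sum_cons]
    split_ifs <;> omega

lemma BL_dL_le {t n : ℕ} {l : List ℕ} (hl : l ∈ BL t n) : dL t (t * 1) l ≤ n + 1 := by
  have h := (VL_finite t 2 (by norm_num) n (t * 1)).mem_toFinset.1 hl
  have := dL_le t 2 (by norm_num) _ _ h.1
  rw [h.2] at this; exact this

lemma mem_BL {t n : ℕ} {l : List ℕ} : l ∈ BL t n ↔ VL t 2 (t * 1) l ∧ l.sum = n :=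
  (VL_finite t 2 (by norm_num) n (t * 1)).mem_toFinset

lemma TL_pos (t n : ℕ) (ht : 1 ≤ t) (hn : 1 ≤ n) : 0 < (TL t n).card := by
  have key : ∀ m r : ℕ, 1 ≤ r → VL t 1 r (List.replicate m 1) := by
    intro m
    induction m with
    | zero => intros; trivial
    | succ m ih => intro r hr; exact ⟨⟨le_rfl, hr⟩, ih _ (by omega)⟩
  refine Finset.card_pos.2 ⟨List.replicate n 1, ?_⟩
  rw [TL, Set.Finite.mem_toFinset]
  exact ⟨key n 1 le_rfl, by simp⟩

end

noncomputable section
open scoped BigOperators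
open Filter MeasureTheory
/-! ### Abstract analytic core: perturbed renewal sequences -/

lemma coef_bound {b : ℕ → ℂ} {φ : ℂ → ℂ} {R M : ℝ} (hR : 1 < R)
    (hφ : DiffContOnCl ℂ φ (Metric.ball 0 R)) (hM : ∀ z ∈ Metric.sphere (0:ℂ) R, ‖φ z‖ ≤ M)
    (hs : ∀ z : ℂ, ‖z‖ < 1 → HasSum (fun n => b n * z ^ n) (φ z)) (n : ℕ) :
    ‖b n‖ ≤ M / R ^ n := by
  have hR0 : 0 < R := by linarith
  have h1 : HasFPowerSeriesAt φ (FormalMultilinearSeries.ofScalars ℂ b) 0 := by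
    rw [hasFPowerSeriesAt_iff]
    filter_upwards [Metric.ball_mem_nhds (0:ℂ) one_pos] with z hz
    have := hs z (by simpa using hz)
    simpa [FormalMultilinearSeries.coeff_ofScalars, mul_comm] using this
  have h2 : HasFPowerSeriesAt φ (FormalMultilinearSeries.ofScalars ℂ
      fun n => iteratedDeriv n φ 0 / n.factorial) 0 := h1.analyticAt.hasFPowerSeriesAt
  have h3 := (h1.eq_formalMultilinearSeries h2)
  have h4 : b n = iteratedDeriv n φ 0 / n.factorial := by
    have := congrArg (fun p => FormalMultilinearSeries.coeff p n) h3
    simpa [FormalMultilinearSeries.coeff_ofScalars] using this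
  have h5 := Complex.norm_iteratedDeriv_le_of_forall_mem_sphere_norm_le n hR0 hφ hM
  rw [h4, norm_div, Complex.norm_natCast, div_le_iff₀ (by positivity)]
  calc _ ≤ _ := h5
    _ = _ := by ring

structure RD where
  w : ℕ → ℝ
  g : ℕ → ℝ
  k : ℕ → ℝ
  f : ℕ → ℝ → ℂ
  a : ℕ → ℝ → ℂ
  R0 : ℝ
  C : ℝ
  hR0 : 1 < R0
  hw : ∀ m, 0 ≤ w m
  hw0 : w 0 = 0
  hw1 : 0 < w 1
  hsum : HasSum w 1
  hexp : Summable fun m : ℕ => (m:ℝ) ^ 3 * w m * R0 ^ m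
  f_cont : ∀ m, Continuous (f m)
  f_le : ∀ m θ, ‖f m θ‖ ≤ w m
  f_zero : ∀ m, f m 0 = w m
  f_taylor : ∀ m θ, ‖f m θ - (w m + Complex.I * θ * g m - θ ^ 2 * k m / 2)‖
    ≤ C * |θ| ^ 3 * m ^ 3 * w m
  g_le : ∀ m, |g m| ≤ C * m * w m
  k_le : ∀ m, |k m| ≤ C * m ^ 2 * w m
  gsum : HasSum g 0
  kpos : 0 < ∑' m, k m
  nonlat : ∀ (z : ℂ) (θ : ℝ), ‖z‖ ≤ 1 → |θ| ≤ Real.pi → ∑' m, f m θ * z ^ m = 1 → z = 1 ∧ θ = 0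
  a_zero : ∀ θ, a 0 θ = 1
  a_succ : ∀ n, 1 ≤ n → ∀ θ, a n θ = ∑ i ∈ Finset.range (n + 1), f i θ * a (n - i) θ

namespace RD

variable (D : RD)

/-- mean block size -/
def mean : ℝ := ∑' m : ℕ, (m:ℝ) * D.w m

/-- variance of the centered reward -/
def s2 : ℝ := ∑' m, D.k m

/-- the generating function -/
def F (z : ℂ) (θ : ℝ) : ℂ := ∑' m, D.f m θ * z ^ m

/-- the difference quotient -/
def G (ρ z : ℂ) (θ : ℝ) : ℂ := ∑' m, D.f m θ * ∑ i ∈ Finset.range m, z ^ i * ρ ^ (m - 1 - i)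

lemma R0_pos : 0 < D.R0 := by linarith [D.hR0]

lemma f0 (θ : ℝ) : D.f 0 θ = 0 := by
  have := D.f_le 0 θ
  rw [D.hw0] at this
  exact norm_le_zero_iff.1 this

lemma sum_pow (j : ℕ) (hj : j ≤ 3) : Summable fun m : ℕ => (m:ℝ) ^ j * D.w m * D.R0 ^ m := by
  refine Summable.of_nonneg_of_le (fun m => ?_) (fun m => ?_) D.hexp
  · have := D.hw m; have := D.R0_pos; positivity
  · have h0 := D.hw m; have := D.R0_pos
    rcases Nat.eq_zero_or_pos m with rfl | hm
    · simp [D.hw0]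
    · gcongr
      exact_mod_cast hm

lemma sum_pow' (j : ℕ) (hj : j ≤ 3) : Summable fun m : ℕ => (m:ℝ) ^ j * D.w m := by
  refine Summable.of_nonneg_of_le (fun m => ?_) (fun m => ?_) (D.sum_pow j hj)
  · have := D.hw m; positivity
  · have h0 := D.hw m
    exact le_mul_of_one_le_right (by positivity) (one_le_pow₀ D.hR0.le)

lemma sum_mean : Summable fun m : ℕ => (m:ℝ) * D.w m := by
  simpa using D.sum_pow' 1 (by norm_num)

lemma mean_pos : 0 < D.mean := by
  have := D.sum_mean
  refine this.tsum_pos (fun m => mul_nonneg (by positivity) (D.hw m)) 1 ?_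
  simpa using D.hw1

lemma F_norm_le (z : ℂ) (θ : ℝ) (hz : ‖z‖ ≤ D.R0) (m : ℕ) :
    ‖D.f m θ * z ^ m‖ ≤ (m:ℝ) ^ 0 * D.w m * D.R0 ^ m := by
  rw [norm_mul, norm_pow, pow_zero, one_mul]
  have := D.f_le m θ; have := D.hw m
  gcongr

lemma G_norm_le (ρ z : ℂ) (θ : ℝ) (hρ : ‖ρ‖ ≤ D.R0) (hz : ‖z‖ ≤ D.R0) (m : ℕ) :
    ‖D.f m θ * ∑ i ∈ Finset.range m, z ^ i * ρ ^ (m - 1 - i)‖ ≤ (m:ℝ) ^ 1 * D.w m * D.R0 ^ m := by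
  have h1 : ‖∑ i ∈ Finset.range m, z ^ i * ρ ^ (m - 1 - i)‖ ≤ m * D.R0 ^ m := by
    refine (norm_sum_le _ _).trans ?_
    calc _ ≤ ∑ i ∈ Finset.range m, D.R0 ^ m := by
          refine Finset.sum_le_sum fun i hi => ?_
          have hi' := Finset.mem_range.1 hi
          rw [norm_mul, norm_pow, norm_pow]
          have hp := D.R0_pos
          calc ‖z‖ ^ i * ‖ρ‖ ^ (m - 1 - i) ≤ D.R0 ^ i * D.R0 ^ (m - 1 - i) := by gcongr
            _ = D.R0 ^ (m - 1) := by rw [← pow_add]; congr 1; omega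
            _ ≤ _ := pow_le_pow_right₀ D.hR0.le (by omega)
      _ = _ := by simp
  rw [norm_mul, pow_one]
  have := D.f_le m θ; have h0 := D.hw m
  calc _ ≤ D.w m * (m * D.R0 ^ m) := by gcongr
    _ = _ := by ring

lemma F_summable (z : ℂ) (θ : ℝ) (hz : ‖z‖ ≤ D.R0) : Summable fun m => ‖D.f m θ * z ^ m‖ :=
  Summable.of_nonneg_of_le (fun _ => norm_nonneg _) (D.F_norm_le z θ hz) (D.sum_pow 0 (by norm_num))

lemma G_summable (ρ z : ℂ) (θ : ℝ) (hρ : ‖ρ‖ ≤ D.R0) (hz : ‖z‖ ≤ D.R0) :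
    Summable fun m => ‖D.f m θ * ∑ i ∈ Finset.range m, z ^ i * ρ ^ (m - 1 - i)‖ :=
  Summable.of_nonneg_of_le (fun _ => norm_nonneg _) (D.G_norm_le ρ z θ hρ hz)
    (D.sum_pow 1 (by norm_num))

lemma F_sub (ρ z : ℂ) (θ : ℝ) (hρ : ‖ρ‖ ≤ D.R0) (hz : ‖z‖ ≤ D.R0) :
    D.F z θ - D.F ρ θ = (z - ρ) * D.G ρ z θ := by
  rw [F, F, G, ← Summable.tsum_sub (D.F_summable z θ hz).of_norm (D.F_summable ρ θ hρ).of_norm,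
    ← tsum_mul_left]
  refine tsum_congr fun m => ?_
  have := (Commute.all z ρ).mul_geom_sum₂ m
  rw [mul_left_comm, this]; ring

lemma G_cont : ContinuousOn (fun p : ℂ × ℂ × ℝ => D.G p.1 p.2.1 p.2.2)
    (Metric.closedBall 0 D.R0 ×ˢ Metric.closedBall 0 D.R0 ×ˢ Set.univ) := by
  unfold G
  refine continuousOn_tsum (fun m => ?_) (D.sum_pow 1 (by norm_num)) ?_
  · have := D.f_cont m
    exact Continuous.continuousOn (by fun_prop)
  · rintro m ⟨ρ, z, θ⟩ ⟨h1, h2, _⟩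
    exact D.G_norm_le ρ z θ (by simpa using h1) (by simpa using h2) m

lemma F_cont : ContinuousOn (fun p : ℂ × ℝ => D.F p.1 p.2)
    (Metric.closedBall 0 D.R0 ×ˢ Set.univ) := by
  unfold F
  refine continuousOn_tsum (fun m => ?_) (D.sum_pow 0 (by norm_num)) ?_
  · have := D.f_cont m
    exact Continuous.continuousOn (by fun_prop)
  · rintro m ⟨z, θ⟩ ⟨h1, _⟩
    exact D.F_norm_le z θ (by simpa using h1) m

lemma F_diff (θ : ℝ) : DifferentiableOn ℂ (fun z => D.F z θ) (Metric.ball 0 D.R0) := by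
  unfold F
  refine Complex.differentiableOn_tsum_of_summable_norm (D.sum_pow 0 (by norm_num)) (fun m => ?_)
    Metric.isOpen_ball ?_
  · exact Differentiable.differentiableOn (by fun_prop)
  · intro m z hz
    exact D.F_norm_le z θ (by simpa using (Metric.mem_ball.1 hz).le) m

lemma G_diff (ρ : ℂ) (hρ : ‖ρ‖ ≤ D.R0) (θ : ℝ) :
    DifferentiableOn ℂ (fun z => D.G ρ z θ) (Metric.ball 0 D.R0) := by
  unfold G
  refine Complex.differentiableOn_tsum_of_summable_norm (D.sum_pow 1 (by norm_num)) (fun m => ?_)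
    Metric.isOpen_ball ?_
  · exact Differentiable.differentiableOn (by fun_prop)
  · intro m z hz
    exact D.G_norm_le ρ z θ hρ (by simpa using (Metric.mem_ball.1 hz).le) m

lemma F_one_zero : D.F 1 0 = 1 := by
  simp only [F, one_pow, mul_one, D.f_zero]
  exact_mod_cast congrArg (fun x : ℝ => (x:ℂ)) D.hsum.tsum_eq

lemma G_one_one_zero : D.G 1 1 0 = D.mean := by
  simp only [G, one_pow, mul_one, D.f_zero, Finset.sum_const, Finset.card_range, nsmul_eq_mul, mean]
  rw [Complex.ofReal_tsum]
  refine tsum_congr fun m => ?_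
  push_cast; ring

lemma G_one_ne_zero (z : ℂ) (hz : ‖z‖ ≤ 1) : D.G 1 z 0 ≠ 0 := by
  have hR := D.hR0
  intro h
  have h1 := D.F_sub 1 z 0 (by simpa using hR.le) (hz.trans hR.le)
  rw [h, mul_zero, D.F_one_zero, sub_eq_zero] at h1
  have h2 := (D.nonlat z 0 hz (by simp [Real.pi_pos.le]) h1).1
  rw [h2, D.G_one_one_zero] at h
  exact D.mean_pos.ne' (by exact_mod_cast h)

/-- radial projection onto the unit disc -/
lemma exists_proj (z : ℂ) (δ : ℝ) (hδ : 0 ≤ δ) (hz : ‖z‖ ≤ 1 + δ) : ∃ z' : ℂ, ‖z'‖ ≤ 1 ∧ ‖z - z'‖ ≤ δ := by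
  by_cases h : ‖z‖ ≤ 1
  · exact ⟨z, h, by simpa using hδ⟩
  · push Not at h
    refine ⟨z / ‖z‖, ?_, ?_⟩
    · rw [norm_div]; simp [(by linarith : ‖z‖ ≠ 0)]
    · have : z - z / ‖z‖ = ((‖z‖ - 1 : ℝ) / ‖z‖ : ℝ) * z := by
        have : (‖z‖ : ℂ) ≠ 0 := by exact_mod_cast (by linarith : ‖z‖ ≠ 0)
        push_cast; field_simp
      rw [this, norm_mul, Complex.norm_real, Real.norm_eq_abs, abs_of_nonneg (by
        apply div_nonneg <;> linarith), div_mul_cancel₀ _ (by linarith)]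
      linarith

lemma exists_lower_G : ∃ δ > 0, 1 + δ < D.R0 ∧ ∃ c > 0, ∀ (ρ z : ℂ) (θ : ℝ), ‖ρ - 1‖ ≤ δ →
    ‖z‖ ≤ 1 + δ → |θ| ≤ δ → c ≤ ‖D.G ρ z θ‖ := by
  have hR := D.hR0
  -- minimum on the unit disc
  have hc1 : ContinuousOn (fun z => ‖D.G 1 z 0‖) (Metric.closedBall (0:ℂ) 1) := by
    refine ContinuousOn.norm ?_
    refine D.G_cont.comp (f := fun z : ℂ => ((1:ℂ), z, (0:ℝ))) (Continuous.continuousOn (by fun_prop)) ?_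
    intro z hz
    simp only [Metric.mem_closedBall, dist_zero_right, Set.mem_prod, Set.mem_univ, and_true,
      norm_one] at hz ⊢
    exact ⟨hR.le, hz.trans hR.le⟩
  obtain ⟨z0, hz0, hmin⟩ := (isCompact_closedBall (0:ℂ) 1).exists_isMinOn
    ⟨0, by simp⟩ hc1
  set c0 := ‖D.G 1 z0 0‖ with hc0
  have hc0pos : 0 < c0 := norm_pos_iff.2 (D.G_one_ne_zero z0 (by simpa using hz0))
  -- uniform continuity
  have hK : IsCompact (Metric.closedBall (0:ℂ) D.R0 ×ˢ Metric.closedBall (0:ℂ) D.R0 ×ˢ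
      Set.Icc (-1:ℝ) 1) :=
    (isCompact_closedBall _ _).prod ((isCompact_closedBall _ _).prod isCompact_Icc)
  have huc := hK.uniformContinuousOn_of_continuous (D.G_cont.mono (by
    rintro ⟨a, b, c⟩ ⟨h1, h2, _⟩; exact ⟨h1, h2, trivial⟩))
  rw [Metric.uniformContinuousOn_iff] at huc
  obtain ⟨δ0, hδ0, huc⟩ := huc (c0 / 2) (by positivity)
  refine ⟨min (δ0 / 2) (min ((D.R0 - 1) / 2) 1), ?_, ?_, c0 / 2, by positivity, ?_⟩
  · have : 0 < (D.R0 - 1) / 2 := by linarith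
    positivity
  · have := min_le_right (δ0 / 2) (min ((D.R0 - 1) / 2) 1)
    have := min_le_left ((D.R0 - 1) / 2) 1
    linarith
  · set δ := min (δ0 / 2) (min ((D.R0 - 1) / 2) 1) with hδ
    have a1 : δ ≤ δ0 / 2 := min_le_left _ _
    have a2 : δ ≤ (D.R0 - 1) / 2 := (min_le_right _ _).trans (min_le_left _ _)
    have a3 : δ ≤ 1 := (min_le_right _ _).trans (min_le_right _ _)
    have a4 : 0 ≤ δ := by
      have : 0 < (D.R0 - 1) / 2 := by linarith
      positivity
    intro ρ z θ hρ hz hθ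
    obtain ⟨z', hz'1, hz'2⟩ := exists_proj z δ a4 hz
    have hρ1 : ‖ρ‖ ≤ D.R0 := by
      have : ‖ρ‖ ≤ ‖ρ - 1‖ + ‖(1:ℂ)‖ := by simpa using norm_add_le (ρ - 1) 1
      rw [norm_one] at this; linarith
    have h1 := huc (ρ, z, θ) ⟨by simpa using hρ1, by simp; linarith, abs_le.1 (by linarith : |θ| ≤ 1)⟩ (1, z', 0) ⟨by simpa using hR.le, by simp; linarith, by simp⟩ (by
      show max (dist ρ 1) (max (dist z z') (dist θ 0)) < δ0
      rw [dist_eq_norm, dist_eq_norm, dist_eq_norm, sub_zero, Real.norm_eq_abs]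
      refine max_lt (by linarith) (max_lt (by linarith) (by linarith)))
    have h2 : c0 ≤ ‖D.G 1 z' 0‖ := hmin (by simpa using hz'1)
    rw [dist_eq_norm] at h1
    have h3 : ‖D.G 1 z' 0‖ ≤ ‖D.G ρ z θ‖ + ‖D.G ρ z θ - D.G 1 z' 0‖ := by
      have := norm_sub_le (D.G ρ z θ) (D.G ρ z θ - D.G 1 z' 0)
      simpa using this
    linarith

end RD
end

noncomputable section
open scoped BigOperators
open Filter MeasureTheory Topology
namespace RD
variable (D : RD)

lemma k_summable : Summable D.k :=
  Summable.of_norm_bounded ((D.sum_pow' 2 (by norm_num)).mul_left D.C) fun m => by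
    have := D.k_le m
    rw [Real.norm_eq_abs]; linarith [mul_assoc D.C ((m:ℝ)^2) (D.w m)]

lemma g_summable : Summable D.g := D.gsum.summable

lemma taylor : ∃ K : ℝ, 0 < K ∧ ∀ θ : ℝ, ‖1 - D.F 1 θ - D.s2 * θ ^ 2 / 2‖ ≤ K * |θ| ^ 3 := by
  refine ⟨|D.C * ∑' m : ℕ, (m:ℝ) ^ 3 * D.w m| + 1, by positivity, fun θ => ?_⟩
  have hR := D.hR0
  have h1 : HasSum (fun m => D.f m θ) (D.F 1 θ) := by
    have := (D.F_summable 1 θ (by simpa using hR.le)).of_norm.hasSum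
    simpa [F] using this
  have h2 : HasSum (fun m => ((D.w m : ℂ) + Complex.I * θ * D.g m - θ ^ 2 * D.k m / 2))
      (((1:ℝ):ℂ) + Complex.I * θ * ((0:ℝ):ℂ) - θ ^ 2 * (D.s2:ℂ) / 2) := by
    have e1 := Complex.hasSum_ofReal.2 D.hsum
    have e2 := Complex.hasSum_ofReal.2 D.gsum
    have e3 := Complex.hasSum_ofReal.2 D.k_summable.hasSum
    exact (e1.add (e2.mul_left _)).sub ((e3.mul_left _).div_const 2)
  have h3 := h1.sub h2
  have h4 : (D.F 1 θ - (((1:ℝ):ℂ) + Complex.I * θ * ((0:ℝ):ℂ) - θ ^ 2 * (D.s2:ℂ) / 2)) =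
      -(1 - D.F 1 θ - D.s2 * θ ^ 2 / 2) := by push_cast; ring
  rw [h4] at h3
  rw [← norm_neg, ← h3.tsum_eq]
  have h5 := (D.sum_pow' 3 le_rfl).hasSum.mul_left (D.C * |θ| ^ 3)
  refine (tsum_of_norm_bounded h5 fun m => ?_).trans ?_
  · refine (D.f_taylor m θ).trans (le_of_eq (by ring))
  · have : D.C * |θ| ^ 3 * ∑' m : ℕ, (m:ℝ) ^ 3 * D.w m =
      (D.C * ∑' m : ℕ, (m:ℝ) ^ 3 * D.w m) * |θ| ^ 3 := by ring
    rw [this]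
    gcongr
    linarith [le_abs_self (D.C * ∑' m : ℕ, (m:ℝ) ^ 3 * D.w m)]

lemma a_le (n : ℕ) (θ : ℝ) : ‖D.a n θ‖ ≤ 1 := by
  induction n using Nat.strong_induction_on with
  | _ n ih =>
    rcases Nat.eq_zero_or_pos n with rfl | hn
    · simp [D.a_zero]
    · rw [D.a_succ n hn]
      refine (norm_sum_le _ _).trans ?_
      calc _ ≤ ∑ i ∈ Finset.range (n+1), D.w i := by
            refine Finset.sum_le_sum fun i hi => ?_
            rw [norm_mul]
            rcases Nat.eq_zero_or_pos i with rfl | hi0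
            · simp [D.f0, D.hw0]
            · have := ih (n - i) (by omega)
              have h2 := D.f_le i θ
              calc _ ≤ D.w i * 1 := by gcongr; exact D.hw i
                _ = _ := mul_one _
        _ ≤ 1 := sum_le_hasSum _ (fun i _ => D.hw i) D.hsum

lemma A_summable (z : ℂ) (hz : ‖z‖ < 1) (θ : ℝ) : Summable fun n => ‖D.a n θ * z ^ n‖ := by
  refine Summable.of_nonneg_of_le (fun _ => norm_nonneg _) (fun n => ?_)
    (summable_geometric_of_lt_one (norm_nonneg z) hz)
  rw [norm_mul, norm_pow]
  exact mul_le_of_le_one_left (by positivity) (D.a_le n θ)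

lemma A_eq (z : ℂ) (hz : ‖z‖ < 1) (θ : ℝ) : (∑' n, D.a n θ * z ^ n) * (1 - D.F z θ) = 1 := by
  have hR := D.hR0
  have h1 := D.A_summable z hz θ
  have h2 := D.F_summable z θ (hz.le.trans hR.le)
  have h3 := tsum_mul_tsum_eq_tsum_sum_range_of_summable_norm h2 h1
  have h4 : ∀ n, ∑ k ∈ Finset.range (n+1), D.f k θ * z ^ k * (D.a (n - k) θ * z ^ (n - k)) =
      if n = 0 then 0 else D.a n θ * z ^ n := by
    intro n
    split_ifs with hn
    · subst hn; simp [D.f0]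
    · rw [D.a_succ n (by omega), Finset.sum_mul]
      refine Finset.sum_congr rfl fun i hi => ?_
      have : z ^ n = z ^ i * z ^ (n - i) := by
        rw [← pow_add]; congr 1; have := Finset.mem_range.1 hi; omega
      rw [this]; ring
  simp only [h4] at h3
  have h5 : (∑' n, D.a n θ * z ^ n) = 1 + ∑' n, if n = 0 then 0 else D.a n θ * z ^ n := by
    rw [h1.of_norm.tsum_eq_add_tsum_ite 0]
    simp [D.a_zero]
  rw [← h3] at h5
  change _ = 1 + D.F z θ * _ at h5
  linear_combination h5

lemma A_hasSum (z : ℂ) (hz : ‖z‖ < 1) (θ : ℝ) :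
    HasSum (fun n => D.a n θ * z ^ n) (1 / (1 - D.F z θ)) := by
  have h := D.A_eq z hz θ
  have h2 := (D.A_summable z hz θ).of_norm.hasSum
  have h0 : 1 - D.F z θ ≠ 0 := right_ne_zero_of_mul (by rw [h]; exact one_ne_zero)
  rwa [eq_div_of_mul_eq h0 h] at h2

lemma F_one_tendsto : Tendsto (fun θ : ℝ => D.F 1 θ) (𝓝 0) (𝓝 1) := by
  have h := D.F_cont.comp (f := fun θ : ℝ => ((1:ℂ), θ)) (s := Set.univ)
    (Continuous.continuousOn (by fun_prop)) (by
      intro θ _; exact ⟨by simpa using D.hR0.le, trivial⟩)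
  have := (continuousOn_univ.1 h).tendsto 0
  simp only [Function.comp_def, D.F_one_zero] at this
  exact this

/-- existence of the dominant root with all quantitative information -/
lemma exists_root : ∃ δ > 0, ∃ c > 0, ∃ δ2 > 0, 1 + δ < D.R0 ∧ δ2 ≤ δ ∧
    (∀ (ρ z : ℂ) (θ : ℝ), ‖ρ - 1‖ ≤ δ → ‖z‖ ≤ 1 + δ → |θ| ≤ δ → c ≤ ‖D.G ρ z θ‖) ∧
    ∀ θ : ℝ, |θ| ≤ δ2 → ∃ ρ : ℂ, ‖ρ - 1‖ ≤ δ / 2 ∧ D.F ρ θ = 1 := by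
  obtain ⟨δ, hδ, hδR, c, hc, hG⟩ := D.exists_lower_G
  have h1 := (Metric.tendsto_nhds_nhds.1 D.F_one_tendsto) (δ / 2 * c / 2) (by positivity)
  obtain ⟨δ1, hδ1, h1⟩ := h1
  refine ⟨δ, hδ, c, hc, min (δ1 / 2) (min δ Real.pi), by have := Real.pi_pos; positivity, hδR,
    (min_le_right _ _).trans (min_le_left _ _), hG, fun θ hθ => ?_⟩
  have hθ1 : |θ| < δ1 := by
    have := hθ.trans (min_le_left _ _); linarith
  have hθ2 : |θ| ≤ δ := hθ.trans ((min_le_right _ _).trans (min_le_left _ _))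
  have h2 := h1 (x := θ) (by simpa using hθ1)
  have hball : ∀ z ∈ Metric.closedBall (1:ℂ) (δ/2), ‖z‖ ≤ 1 + δ / 2 := by
    intro z hz
    have := norm_add_le (z - 1) 1
    rw [Metric.mem_closedBall, dist_eq_norm] at hz
    simp at this; linarith
  have hkey : ∀ z ∈ Metric.closedBall (1:ℂ) (δ/2), c * ‖z - 1‖ ≤ ‖D.F z θ - D.F 1 θ‖ := by
    intro z hz
    rw [D.F_sub 1 z θ (by simpa using D.hR0.le) (by linarith [hball z hz]), norm_mul, mul_comm]
    gcongr
    exact hG 1 z θ (by simpa using hδ.le) (by linarith [hball z hz]) hθ2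
  have h3 : DiffContOnCl ℂ (fun z => D.F z θ) (Metric.ball 1 (δ/2)) := by
    refine DifferentiableOn.diffContOnCl ?_
    refine (D.F_diff θ).mono fun z hz => ?_
    have := hball z (Metric.closure_ball_subset_closedBall hz)
    simp; linarith
  have h4 := h3.ball_subset_image_closedBall (ε := δ / 2 * c) (by positivity) (by
    intro z hz
    have := hkey z (Metric.sphere_subset_closedBall hz)
    rw [← dist_eq_norm z, Metric.mem_sphere.1 hz] at this
    linarith) (by
    have : ∃ᶠ z in 𝓝[≠] (1:ℂ), z ∈ Metric.closedBall (1:ℂ) (δ/2) ∧ z ≠ 1 := by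
      refine Eventually.frequently ?_
      filter_upwards [mem_nhdsWithin_of_mem_nhds (Metric.closedBall_mem_nhds (1:ℂ) (half_pos hδ)),
        self_mem_nhdsWithin] with z h1 h2
      exact ⟨h1, h2⟩
    refine (this.filter_mono nhdsWithin_le_nhds).mono fun z hz h => ?_
    have := hkey z hz.1
    rw [h, sub_self, norm_zero] at this
    have h5 : 0 < ‖z - 1‖ := norm_pos_iff.2 (sub_ne_zero.2 hz.2)
    nlinarith)
  obtain ⟨ρ, hρ, hρ2⟩ := h4 (a := 1) (by rw [Metric.mem_ball, dist_comm]; exact h2)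
  exact ⟨ρ, by simpa [dist_eq_norm] using hρ, hρ2⟩

end RD
end

noncomputable section
open scoped BigOperators
open Filter MeasureTheory Topology
namespace RD
variable (D : RD)

lemma small_one {δ c δ2 : ℝ} (hδ : 0 < δ) (hc : 0 < c) (hδ2 : δ2 ≤ δ) (hδR : 1 + δ < D.R0)
    (hG : ∀ (ρ z : ℂ) (θ : ℝ), ‖ρ - 1‖ ≤ δ → ‖z‖ ≤ 1 + δ → |θ| ≤ δ → c ≤ ‖D.G ρ z θ‖)
    (θ : ℝ) (hθ : |θ| ≤ δ2) (ρ : ℂ) (hρ : ‖ρ - 1‖ ≤ δ / 2) (hF : D.F ρ θ = 1) (hρ1 : 1 ≤ ‖ρ‖) (n : ℕ) :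
    ‖D.a n θ - (1 / (ρ * D.G ρ ρ θ)) / ρ ^ n‖ ≤ (8 / (c * δ)) / (1 + 3 / 4 * δ) ^ n := by
  have hθ' : |θ| ≤ δ := hθ.trans hδ2
  have hρR : ‖ρ‖ ≤ 1 + δ / 2 := by
    have := norm_add_le (ρ - 1) 1
    simp at this; linarith
  have hG' : ∀ z : ℂ, ‖z‖ ≤ 1 + δ → c ≤ ‖D.G ρ z θ‖ := fun z hz => hG ρ z θ (by linarith) hz hθ'
  have hG0 : ∀ z : ℂ, ‖z‖ ≤ 1 + δ → D.G ρ z θ ≠ 0 := fun z hz h => by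
    have := hG' z hz; rw [h, norm_zero] at this; linarith
  have hhd : DifferentiableOn ℂ (fun z => 1 / D.G ρ z θ) (Metric.ball 0 (1 + δ)) := by
    refine DifferentiableOn.div (differentiableOn_const _) ?_ fun z hz => ?_
    · refine (D.G_diff ρ (by linarith) θ).mono (Metric.ball_subset_ball hδR.le)
    · exact hG0 z (by simpa using (Metric.mem_ball.1 hz).le)
  have hhd2 : DifferentiableOn ℂ (dslope (fun z => 1 / D.G ρ z θ) ρ) (Metric.ball 0 (1 + δ)) := by
    rw [Complex.differentiableOn_dslope]
    · exact hhd
    · refine Metric.isOpen_ball.mem_nhds ?_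
      simp; linarith
  have hρ0 : ρ ≠ 0 := fun h => by rw [h, norm_zero] at hρ1; linarith
  refine coef_bound (b := fun n => D.a n θ - (1 / (ρ * D.G ρ ρ θ)) / ρ ^ n)
    (φ := fun z => - dslope (fun z => 1 / D.G ρ z θ) ρ z) (by linarith) ?_ ?_ ?_ n
  · refine DifferentiableOn.diffContOnCl ?_
    refine hhd2.neg.mono fun z hz => ?_
    have := Metric.closure_ball_subset_closedBall hz
    rw [Metric.mem_closedBall, dist_zero_right] at this
    rw [Metric.mem_ball, dist_zero_right]; linarith
  · intro z hz
    rw [Metric.mem_sphere, dist_zero_right] at hz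
    have hne : z ≠ ρ := fun h => by rw [h] at hz; linarith
    rw [norm_neg, dslope_of_ne _ hne, slope_def_field, norm_div]
    have e1 : ∀ z : ℂ, ‖z‖ ≤ 1 + δ → ‖1 / D.G ρ z θ‖ ≤ 1 / c := fun z hz => by
      rw [norm_div, norm_one]; exact one_div_le_one_div_of_le hc (hG' z hz)
    have e2 : δ / 4 ≤ ‖z - ρ‖ := by
      have := norm_sub_norm_le z ρ; linarith
    calc _ ≤ (1 / c + 1 / c) / (δ / 4) := by
          gcongr
          exact (norm_sub_le _ _).trans (add_le_add (e1 z (by linarith)) (e1 ρ (by linarith)))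
      _ = _ := by field_simp; norm_num
  · intro z hz
    have hne : z ≠ ρ := fun h => by rw [h] at hz; linarith
    rw [dslope_of_ne _ hne, slope_def_field]
    have h1 := D.A_hasSum z hz θ
    have h2 : HasSum (fun n => (1 / (ρ * D.G ρ ρ θ)) / ρ ^ n * z ^ n)
        ((1 / (ρ * D.G ρ ρ θ)) * (1 - z / ρ)⁻¹) := by
      have : ‖z / ρ‖ < 1 := by
        rw [norm_div, div_lt_one (by linarith)]; linarith
      refine ((hasSum_geometric_of_norm_lt_one this).mul_left _).congr_fun ?_
      intro n; rw [div_pow]; ring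
    have h3 := h1.sub h2
    have hFz := D.F_sub ρ z θ (by linarith) (by linarith)
    have h4 : 1 - D.F z θ = (ρ - z) * D.G ρ z θ := by rw [← hF]; linear_combination -hFz
    rw [h4] at h3
    have g1 := hG0 z (by linarith)
    have g2 := hG0 ρ (by linarith)
    have hne1 : ρ - z ≠ 0 := sub_ne_zero.2 hne.symm
    have hne2 : z - ρ ≠ 0 := sub_ne_zero.2 hne
    convert! h3 using 1
    · funext n; ring
    · have : (1 - z / ρ) = (ρ - z) / ρ := by field_simp
      rw [this, inv_div]
      have : z - ρ = -(ρ - z) := by ring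
      rw [this]
      field_simp

lemma large_θ (δ : ℝ) (hδ : 0 < δ) : ∃ R > 1, ∃ M > 0, ∀ θ : ℝ, δ ≤ |θ| → |θ| ≤ Real.pi → ∀ n,
    ‖D.a n θ‖ ≤ M / R ^ n := by
  have hR := D.hR0
  have hTc : IsCompact {θ : ℝ | δ ≤ |θ| ∧ |θ| ≤ Real.pi} := by
    refine Metric.isCompact_of_isClosed_isBounded ?_ ?_
    · exact (isClosed_le continuous_const continuous_abs).inter
        (isClosed_le continuous_abs continuous_const)
    · refine (Metric.isBounded_Icc (-Real.pi) Real.pi).subset fun θ hθ => ?_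
      exact abs_le.1 hθ.2
  by_cases hne : ({θ : ℝ | δ ≤ |θ| ∧ |θ| ≤ Real.pi}).Nonempty
  swap
  · refine ⟨2, by norm_num, 1, one_pos, fun θ h1 h2 => ?_⟩
    exact (hne ⟨θ, h1, h2⟩).elim
  have hK : IsCompact (Metric.closedBall (0:ℂ) D.R0 ×ˢ {θ : ℝ | δ ≤ |θ| ∧ |θ| ≤ Real.pi}) :=
    (isCompact_closedBall _ _).prod hTc
  have hK1 : IsCompact (Metric.closedBall (0:ℂ) 1 ×ˢ {θ : ℝ | δ ≤ |θ| ∧ |θ| ≤ Real.pi}) :=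
    (isCompact_closedBall _ _).prod hTc
  have hcont : ContinuousOn (fun p : ℂ × ℝ => 1 - D.F p.1 p.2)
      (Metric.closedBall (0:ℂ) D.R0 ×ˢ {θ : ℝ | δ ≤ |θ| ∧ |θ| ≤ Real.pi}) :=
    continuousOn_const.sub (D.F_cont.mono (Set.prod_mono le_rfl (Set.subset_univ _)))
  have huc := hK.uniformContinuousOn_of_continuous hcont
  obtain ⟨⟨z0, θ0⟩, ⟨hz0, hθ0⟩, hmin⟩ := hK1.exists_isMinOn
    (((Metric.nonempty_closedBall (x := (0:ℂ))).2 zero_le_one).prod hne)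
    (hcont.mono (Set.prod_mono (Metric.closedBall_subset_closedBall hR.le) le_rfl)).norm
  set c0 := ‖1 - D.F z0 θ0‖ with hc0
  have hc0pos : 0 < c0 := by
    refine norm_pos_iff.2 (sub_ne_zero.2 fun h => ?_)
    have := (D.nonlat z0 θ0 (by simpa using hz0) hθ0.2 h.symm).2
    rw [this] at hθ0
    have := hθ0.1
    simp at this; linarith
  rw [Metric.uniformContinuousOn_iff] at huc
  obtain ⟨δ0, hδ0, huc⟩ := huc (c0 / 2) (by positivity)
  set d := min (δ0 / 2) ((D.R0 - 1) / 2) with hd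
  have hdpos : 0 < d := by
    have : 0 < (D.R0 - 1) / 2 := by linarith
    positivity
  have hd1 : d ≤ δ0 / 2 := min_le_left _ _
  have hd2 : d ≤ (D.R0 - 1) / 2 := min_le_right _ _
  have key : ∀ (z : ℂ) (θ : ℝ), ‖z‖ ≤ 1 + d → δ ≤ |θ| → |θ| ≤ Real.pi → c0 / 2 ≤ ‖1 - D.F z θ‖ := by
    intro z θ hz h1 h2
    obtain ⟨z', hz'1, hz'2⟩ := exists_proj z d hdpos.le hz
    have h3 := huc (z, θ) ⟨by simp; linarith, h1, h2⟩ (z', θ) ⟨by simp; linarith, h1, h2⟩ (by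
      show max (dist z z') (dist θ θ) < δ0
      rw [dist_eq_norm, dist_self]
      exact max_lt (by linarith) hδ0)
    have h4 : c0 ≤ ‖1 - D.F z' θ‖ := hmin (show (z', θ) ∈ _ from ⟨by simpa using hz'1, h1, h2⟩)
    rw [dist_eq_norm] at h3
    dsimp only at h3
    have h5 : ‖1 - D.F z' θ‖ ≤ ‖1 - D.F z θ‖ + ‖(1 - D.F z θ) - (1 - D.F z' θ)‖ := by
      have := norm_sub_le (1 - D.F z θ) ((1 - D.F z θ) - (1 - D.F z' θ))
      rwa [sub_sub_cancel] at this
    linarith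
  refine ⟨1 + d / 2, by linarith, 2 / c0, by positivity, fun θ h1 h2 n => ?_⟩
  refine coef_bound (b := fun n => D.a n θ) (φ := fun z => 1 / (1 - D.F z θ)) (by linarith)
    ?_ ?_ (fun z hz => D.A_hasSum z hz θ) n
  · refine DifferentiableOn.diffContOnCl ?_
    have hsub : ∀ z ∈ closure (Metric.ball (0:ℂ) (1 + d/2)), ‖z‖ ≤ 1 + d / 2 := fun z hz => by
      simpa using Metric.closure_ball_subset_closedBall hz
    refine DifferentiableOn.div (differentiableOn_const _) ?_ fun z hz h => ?_
    · refine (differentiableOn_const _).sub ((D.F_diff θ).mono fun z hz => ?_)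
      rw [Metric.mem_ball, dist_zero_right]; linarith [hsub z hz]
    · have := key z θ (by linarith [hsub z hz]) h1 h2
      rw [h, norm_zero] at this; linarith
  · intro z hz
    rw [Metric.mem_sphere, dist_zero_right] at hz
    rw [norm_div, norm_one]
    have := key z θ (by linarith) h1 h2
    calc _ ≤ 1 / (c0 / 2) := one_div_le_one_div_of_le (by positivity) this
      _ = _ := by field_simp

end RD
end

noncomputable section
open scoped BigOperators
open Filter MeasureTheory Topology
namespace RD
variable (D : RD)

lemma G_tendsto {ρ z : ℝ → ℂ} (hρ : Tendsto ρ (𝓝 0) (𝓝 1)) (hz : Tendsto z (𝓝 0) (𝓝 1)) :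
    Tendsto (fun θ => D.G (ρ θ) (z θ) θ) (𝓝 0) (𝓝 (D.mean : ℂ)) := by
  have h1 : ContinuousAt (fun p : ℂ × ℂ × ℝ => D.G p.1 p.2.1 p.2.2) ((1:ℂ), (1:ℂ), (0:ℝ)) := by
    refine D.G_cont.continuousAt ?_
    have hb : Metric.closedBall (0:ℂ) D.R0 ∈ 𝓝 (1:ℂ) :=
      Metric.closedBall_mem_nhds_of_mem (by simpa using D.hR0)
    exact prod_mem_nhds hb (prod_mem_nhds hb univ_mem)
  have h2 : Tendsto (fun θ : ℝ => (ρ θ, z θ, θ)) (𝓝 0) (𝓝 ((1:ℂ), (1:ℂ), (0:ℝ))) :=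
    hρ.prodMk_nhds (hz.prodMk_nhds tendsto_id)
  have := h1.tendsto.comp h2
  simp only [D.G_one_one_zero] at this
  exact this

lemma taylor_tendsto : Tendsto (fun θ : ℝ => (1 - D.F 1 θ) / θ ^ 2) (𝓝[≠] 0) (𝓝 ((D.s2:ℂ) / 2)) := by
  obtain ⟨K, hK, h⟩ := D.taylor
  rw [tendsto_iff_norm_sub_tendsto_zero]
  have hb : Tendsto (fun θ : ℝ => K * |θ|) (𝓝[≠] 0) (𝓝 0) := by
    have : Tendsto (fun θ : ℝ => K * |θ|) (𝓝 0) (𝓝 (K * |0|)) :=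
      Continuous.tendsto (by fun_prop) 0
    simp only [abs_zero, mul_zero] at this
    exact this.mono_left nhdsWithin_le_nhds
  refine squeeze_zero' (Eventually.of_forall fun _ => norm_nonneg _) ?_ hb
  filter_upwards [self_mem_nhdsWithin] with θ hθ
  have hθ0 : θ ≠ 0 := hθ
  have hθc : (θ:ℂ) ≠ 0 := by exact_mod_cast hθ0
  have e : (1 - D.F 1 θ) / (θ:ℂ) ^ 2 - D.s2 / 2 = (1 - D.F 1 θ - D.s2 * θ ^ 2 / 2) / (θ:ℂ)^2 := by
    field_simp
  rw [e, norm_div, norm_pow, Complex.norm_real, Real.norm_eq_abs, div_le_iff₀ (by positivity)]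
  refine (h θ).trans (le_of_eq (by ring))

lemma main_small : ∃ δ > 0, ∃ R > 1, ∃ M > 0, ∃ ρ η : ℝ → ℂ,
    (∀ θ, |θ| ≤ δ → 1 ≤ ‖ρ θ‖ ∧ ‖η θ‖ ≤ M ∧ ∀ n, ‖D.a n θ - η θ / ρ θ ^ n‖ ≤ M / R ^ n) ∧
    ρ 0 = 1 ∧ η 0 = 1 / (D.mean:ℂ) ∧ Tendsto η (𝓝 0) (𝓝 (1 / (D.mean:ℂ))) ∧
    Tendsto (fun θ : ℝ => (ρ θ - 1) / θ ^ 2) (𝓝[≠] 0) (𝓝 ((D.s2:ℂ) / (2 * D.mean))) := by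
  obtain ⟨δ, hδ, c, hc, δ2, hδ2, hδR, hδδ, hG, hroot⟩ := D.exists_root
  have hR := D.hR0
  have hmean := D.mean_pos
  have hmc : (D.mean : ℂ) ≠ 0 := by exact_mod_cast hmean.ne'
  have hpi := Real.pi_pos
  let ρ : ℝ → ℂ := fun θ => if h : |θ| ≤ δ2 then (hroot θ h).choose else 1
  have hρ : ∀ θ, |θ| ≤ δ2 → ‖ρ θ - 1‖ ≤ δ / 2 ∧ D.F (ρ θ) θ = 1 := by
    intro θ h
    simp only [ρ, dif_pos h]
    exact (hroot θ h).choose_spec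
  have hnorm : ∀ θ, |θ| ≤ δ2 → ‖ρ θ‖ ≤ 1 + δ / 2 := by
    intro θ h
    have := norm_add_le (ρ θ - 1) 1
    have := (hρ θ h).1
    simp at *; linarith
  have hsub : ∀ θ, |θ| ≤ δ2 → (ρ θ - 1) * D.G 1 (ρ θ) θ = 1 - D.F 1 θ := by
    intro θ h
    rw [← D.F_sub 1 (ρ θ) θ (by simpa using hR.le) (by linarith [hnorm θ h]), (hρ θ h).2]
  have hGlow : ∀ θ, |θ| ≤ δ2 → c ≤ ‖D.G 1 (ρ θ) θ‖ := fun θ h =>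
    hG 1 (ρ θ) θ (by simpa using hδ.le) (by linarith [hnorm θ h]) (h.trans hδδ)
  have hG0 : ∀ θ, |θ| ≤ δ2 → D.G 1 (ρ θ) θ ≠ 0 := fun θ h h0 => by
    have := hGlow θ h; rw [h0, norm_zero] at this; linarith
  have hev : ∀ᶠ θ : ℝ in 𝓝 0, |θ| ≤ δ2 := by
    filter_upwards [Metric.closedBall_mem_nhds (0:ℝ) hδ2] with θ h
    simpa using h
  have hρlim : Tendsto ρ (𝓝 0) (𝓝 1) := by
    rw [tendsto_iff_norm_sub_tendsto_zero]
    have hb : Tendsto (fun θ : ℝ => ‖1 - D.F 1 θ‖ / c) (𝓝 0) (𝓝 0) := by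
      have := ((tendsto_const_nhds (x := (1:ℂ))).sub D.F_one_tendsto).norm.div_const c
      simpa using this
    refine squeeze_zero' (Eventually.of_forall fun _ => norm_nonneg _) ?_ hb
    filter_upwards [hev] with θ h
    rw [← hsub θ h, norm_mul, le_div_iff₀ hc]
    exact mul_le_mul_of_nonneg_left (hGlow θ h) (norm_nonneg _)
  have hρ0 : ρ 0 = 1 := by
    have h0 : |(0:ℝ)| ≤ δ2 := by simpa using hδ2.le
    have := hsub 0 h0
    rw [D.F_one_zero, sub_self] at this
    rcases mul_eq_zero.1 this with h | h
    · exact sub_eq_zero.1 h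
    · exact absurd h (hG0 0 h0)
  let η : ℝ → ℂ := fun θ => 1 / (ρ θ * D.G (ρ θ) (ρ θ) θ)
  have h1le : ∀ θ, |θ| ≤ min δ2 Real.pi → 1 ≤ ‖ρ θ‖ := by
    intro θ h
    by_contra hlt
    push Not at hlt
    have := (D.nonlat (ρ θ) θ hlt.le (h.trans (min_le_right _ _)) (hρ θ (h.trans (min_le_left _ _))).2).1
    rw [this, norm_one] at hlt; linarith
  refine ⟨min δ2 Real.pi, by positivity, 1 + 3/4 * δ, by linarith, max (8 / (c * δ)) (1 / c), by positivity, ρ, η,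
    fun θ h => ⟨h1le θ h, ?_, fun n => ?_⟩, hρ0, ?_, ?_, ?_⟩
  · have h' := h.trans (min_le_left _ _)
    refine le_trans ?_ (le_max_right _ _)
    simp only [η]
    rw [norm_div, norm_one, norm_mul]
    refine one_div_le_one_div_of_le hc ?_
    have := hG (ρ θ) (ρ θ) θ (by linarith [(hρ θ h').1]) (by linarith [hnorm θ h']) (h'.trans hδδ)
    nlinarith [h1le θ h]
  · have h' := h.trans (min_le_left _ _)
    refine (D.small_one hδ hc hδδ hδR hG θ h' (ρ θ) (hρ θ h').1 (hρ θ h').2 (h1le θ h) n).trans ?_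
    gcongr
    exact le_max_left _ _
  · simp only [η, hρ0, D.G_one_one_zero, one_mul]
  · have := (hρlim.mul (D.G_tendsto hρlim hρlim))
    rw [one_mul] at this
    exact (tendsto_const_nhds (x := (1:ℂ))).div this hmc
  · have h1 := D.taylor_tendsto.div
      ((D.G_tendsto tendsto_const_nhds hρlim).mono_left nhdsWithin_le_nhds) hmc
    have h2 : (D.s2:ℂ) / 2 / D.mean = D.s2 / (2 * D.mean) := by rw [div_div]
    rw [h2] at h1
    refine h1.congr' ?_
    filter_upwards [nhdsWithin_le_nhds hev] with θ h
    simp only [Pi.div_apply]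
    rw [← hsub θ h]
    have := hG0 θ h
    rw [mul_div_right_comm, mul_div_cancel_right₀ _ this]

/-- the renewal sequence converges exponentially fast -/
lemma a_zero_asym : ∃ R > 1, ∃ M > 0, ∀ n, ‖D.a n 0 - 1 / D.mean‖ ≤ M / R ^ n := by
  obtain ⟨δ, hδ, R, hR, M, hM, ρ, η, h, h0, h1, -⟩ := D.main_small
  refine ⟨R, hR, M, hM, fun n => ?_⟩
  have := (h 0 (by simpa using hδ.le)).2.2 n
  simpa [h0, h1] using this

lemma s2_pos : 0 < D.s2 := D.kpos

/-- Gaussian limit of the scaled characteristic functions -/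
lemma a_scaled (x : ℝ) : Tendsto (fun n : ℕ => D.a n (x / Real.sqrt n)) atTop
    (𝓝 (1 / (D.mean:ℂ) * Complex.exp (-(D.s2 / (2 * D.mean) * x ^ 2)))) := by
  obtain ⟨δ, hδ, R, hR, M, hM, ρ, η, h, h0, h1, h2, h3⟩ := D.main_small
  have hsq : Tendsto (fun n : ℕ => x / Real.sqrt n) atTop (𝓝 0) := by
    refine tendsto_const_nhds.div_atTop ?_
    exact Real.tendsto_sqrt_atTop.comp tendsto_natCast_atTop_atTop
  have e1 : Tendsto (fun n : ℕ => η (x / Real.sqrt n)) atTop (𝓝 (1 / D.mean)) := h2.comp hsq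
  have e2 : Tendsto (fun n : ℕ => ρ (x / Real.sqrt n) ^ n) atTop
      (𝓝 (Complex.exp (D.s2 / (2 * D.mean) * x ^ 2))) := by
    have : Tendsto (fun n : ℕ => (n:ℂ) * (ρ (x / Real.sqrt n) - 1)) atTop
        (𝓝 (D.s2 / (2 * D.mean) * x ^ 2)) := by
      by_cases hx : x = 0
      · simp [hx, h0]
      · have hsq' : Tendsto (fun n : ℕ => x / Real.sqrt n) atTop (𝓝[≠] 0) := by
          refine tendsto_nhdsWithin_iff.2 ⟨hsq, ?_⟩
          filter_upwards [eventually_gt_atTop 0] with n hn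
          have : 0 < Real.sqrt n := Real.sqrt_pos.2 (by exact_mod_cast hn)
          exact div_ne_zero hx this.ne'
        refine ((h3.comp hsq').mul_const ((x:ℂ)^2)).congr' ?_
        filter_upwards [eventually_gt_atTop 0] with n hn
        have hs : 0 < Real.sqrt n := Real.sqrt_pos.2 (by exact_mod_cast hn)
        have hs2 : ((Real.sqrt n : ℝ) : ℂ) ^ 2 = n := by
          rw [← Complex.ofReal_pow, Real.sq_sqrt (by positivity)]; simp
        have hxc : (x:ℂ) ≠ 0 := by exact_mod_cast hx
        simp only [Function.comp_apply]
        push_cast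
        rw [div_pow, hs2]
        have hn' : (n:ℂ) ≠ 0 := by exact_mod_cast hn.ne'
        field_simp
    have := Complex.tendsto_one_add_pow_exp_of_tendsto this
    simpa using this
  have e3 : Tendsto (fun n : ℕ => η (x / Real.sqrt n) / ρ (x / Real.sqrt n) ^ n) atTop
      (𝓝 (1 / (D.mean:ℂ) * Complex.exp (-(D.s2 / (2 * D.mean) * x ^ 2)))) := by
    have := e1.div e2 (Complex.exp_ne_zero _)
    rwa [Complex.exp_neg, ← div_eq_mul_inv]
  have e4 : Tendsto (fun n : ℕ => D.a n (x / Real.sqrt n) -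
      η (x / Real.sqrt n) / ρ (x / Real.sqrt n) ^ n) atTop (𝓝 0) := by
    have hb : Tendsto (fun n : ℕ => M / R ^ n) atTop (𝓝 0) :=
      tendsto_const_nhds.div_atTop (tendsto_pow_atTop_atTop_of_one_lt hR)
    refine squeeze_zero_norm' ?_ hb
    have : ∀ᶠ n : ℕ in atTop, |x / Real.sqrt n| ≤ δ := by
      have := hsq.eventually (Metric.closedBall_mem_nhds (0:ℝ) hδ)
      filter_upwards [this] with n hn
      rwa [dist_zero_right, Real.norm_eq_abs] at hn
    filter_upwards [this] with n hn
    exact (h _ hn).2.2 n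
  have := e4.add e3
  simpa using this

/-- uniform Gaussian domination -/
lemma a_dom : ∃ R > 1, ∃ M > 0, ∃ c > 0, ∀ θ : ℝ, |θ| ≤ Real.pi → ∀ n : ℕ,
    ‖D.a n θ‖ ≤ M * Real.exp (-(c * n * θ ^ 2)) + M / R ^ n := by
  obtain ⟨δ, hδ, R, hR, M, hM, ρ, η, h, h0, h1, h2, h3⟩ := D.main_small
  set κ : ℝ := D.s2 / (2 * D.mean) with hκ
  have hκ0 : 0 < κ := div_pos D.s2_pos (by linarith [D.mean_pos])
  have h4 : Tendsto (fun θ : ℝ => ((ρ θ - 1) / θ ^ 2).re) (𝓝[≠] 0) (𝓝 κ) := by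
    have := (Complex.continuous_re.tendsto _).comp h3
    have e : ((D.s2:ℂ) / (2 * D.mean)).re = κ := by
      rw [hκ, ← Complex.ofReal_re (D.s2 / (2 * D.mean))]; push_cast; rfl
    rwa [e] at this
  have h5 := h4.eventually (lt_mem_nhds (half_lt_self hκ0))
  rw [eventually_nhdsWithin_iff, Metric.eventually_nhds_iff] at h5
  obtain ⟨δ1, hδ1, h5⟩ := h5
  set δ' := min δ (min (δ1 / 2) (1 / (κ + 1))) with hδ'
  have hδ'0 : 0 < δ' := by positivity
  obtain ⟨R', hR', M', hM', hl⟩ := D.large_θ δ' hδ'0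
  refine ⟨min R R', lt_min hR hR', max M M', by positivity, κ / 4, by positivity, fun θ hθ n => ?_⟩
  have hRR : 0 < min R R' := lt_min (by linarith) (by linarith)
  rcases le_total δ' |θ| with hθ' | hθ'
  · refine (hl θ hθ' hθ n).trans ?_
    have : M' / R' ^ n ≤ max M M' / min R R' ^ n := by
      gcongr
      · exact le_max_right _ _
      · exact min_le_right _ _
    have : 0 ≤ max M M' * Real.exp (-(κ / 4 * n * θ ^ 2)) := by positivity
    linarith
  · have a1 := h θ (hθ'.trans (min_le_left _ _))
    have a2 : |θ| ≤ δ1 / 2 := hθ'.trans ((min_le_right _ _).trans (min_le_left _ _))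
    have a3 : |θ| ≤ 1 / (κ + 1) := hθ'.trans ((min_le_right _ _).trans (min_le_right _ _))
    have hρl : 1 + κ / 2 * θ ^ 2 ≤ ‖ρ θ‖ := by
      by_cases h0' : θ = 0
      · simp [h0', h0]
      · have := h5 (y := θ) (by simp; linarith) h0'
        have e : ((ρ θ - 1) / (θ:ℂ) ^ 2).re = ((ρ θ).re - 1) / θ ^ 2 := by
          rw [← Complex.ofReal_pow, Complex.div_ofReal_re]; simp
        rw [e, lt_div_iff₀ (by positivity)] at this
        have := Complex.re_le_norm (ρ θ)
        linarith
    have hx : Real.exp (κ / 4 * θ ^ 2) ≤ 1 + κ / 2 * θ ^ 2 := by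
      have hy0 : 0 ≤ κ / 4 * θ ^ 2 := by positivity
      have hy : κ / 4 * θ ^ 2 ≤ 1 := by
        have b1 : |θ| * (κ + 1) ≤ 1 := by rwa [le_div_iff₀ (by positivity)] at a3
        have b2 : |θ| ≤ 1 := by nlinarith [abs_nonneg θ]
        rw [← sq_abs θ]
        nlinarith [abs_nonneg θ]
      have := Real.abs_exp_sub_one_sub_id_le (abs_le.2 ⟨by linarith, hy⟩)
      have := abs_le.1 this
      nlinarith
    have hpow : Real.exp (κ / 4 * n * θ ^ 2) ≤ ‖ρ θ ^ n‖ := by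
      rw [norm_pow]
      calc _ = Real.exp (κ / 4 * θ ^ 2) ^ n := by rw [← Real.exp_nat_mul]; ring_nf
        _ ≤ _ := by gcongr; exact hx.trans hρl
    have b1 : ‖D.a n θ‖ ≤ ‖η θ / ρ θ ^ n‖ + ‖D.a n θ - η θ / ρ θ ^ n‖ := by
      have := norm_add_le (η θ / ρ θ ^ n) (D.a n θ - η θ / ρ θ ^ n)
      rwa [add_sub_cancel] at this
    have b2 : ‖η θ / ρ θ ^ n‖ ≤ max M M' * Real.exp (-(κ / 4 * n * θ ^ 2)) := by
      rw [norm_div, Real.exp_neg, ← div_eq_mul_inv]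
      gcongr
      exact a1.2.1.trans (le_max_left _ _)
    have b3 : ‖D.a n θ - η θ / ρ θ ^ n‖ ≤ max M M' / min R R' ^ n := by
      refine (a1.2.2 n).trans ?_
      gcongr
      · exact le_max_left _ _
      · exact min_le_left _ _
    linarith

end RD
end

noncomputable section
open scoped BigOperators
open Filter MeasureTheory Topology
/-! ### Polynomial data -/

/-- sum of `coeff * φ` -/
def pev {K : Type*} [CommSemiring K] (φ : ℕ → K) (p : Polynomial ℕ) : K :=
  p.sum fun k c => (c : K) * φ k

section pev
variable {K : Type*} [CommSemiring K]

lemma pev_add (φ : ℕ → K) (p q : Polynomial ℕ) : pev φ (p + q) = pev φ p + pev φ q := by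
  unfold pev
  refine Polynomial.sum_add_index p q _ ?_ ?_
  · intro i; simp
  · intro i a b; push_cast; ring

lemma pev_zero (φ : ℕ → K) : pev φ 0 = 0 := by simp [pev]

lemma pev_sum {ι : Type*} (φ : ℕ → K) (s : Finset ι) (p : ι → Polynomial ℕ) :
    pev φ (∑ i ∈ s, p i) = ∑ i ∈ s, pev φ (p i) := by
  classical
  induction s using Finset.induction_on with
  | empty => simp [pev_zero]
  | insert a s ha ih => rw [Finset.sum_insert ha, Finset.sum_insert ha, pev_add, ih]

lemma pev_monomial (φ : ℕ → K) (k c : ℕ) : pev φ (Polynomial.monomial k c) = c * φ k := by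
  unfold pev
  rw [Polynomial.sum_monomial_index]; simp

lemma pev_X_pow (φ : ℕ → K) (k : ℕ) : pev φ (Polynomial.X ^ k) = φ k := by
  rw [Polynomial.X_pow_eq_monomial, pev_monomial]; simp

lemma pev_one (φ : ℕ → K) : pev φ 1 = φ 0 := by
  rw [← pow_zero Polynomial.X, pev_X_pow]

/-- product rule for functions that split as a sum of three product terms -/
lemma pev_mul (φ α β α' β' α'' β'' : ℕ → K)
    (h : ∀ j k, φ (j + k) = α j * β k + α' j * β' k + α'' j * β'' k) (p q : Polynomial ℕ) :
    pev φ (p * q) = pev α p * pev β q + pev α' p * pev β' q + pev α'' p * pev β'' q := by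
  induction p using Polynomial.induction_on' with
  | add p1 p2 h1 h2 => rw [add_mul, pev_add, h1, h2, pev_add, pev_add, pev_add]; ring
  | monomial j c =>
    induction q using Polynomial.induction_on' with
    | add p1 p2 h1 h2 => rw [mul_add, pev_add, h1, h2, pev_add, pev_add, pev_add]; ring
    | monomial k d =>
      rw [Polynomial.monomial_mul_monomial]
      simp only [pev_monomial, h]
      push_cast; ring

lemma pev_zero_fun (p : Polynomial ℕ) : pev (fun _ => (0:K)) p = 0 := by
  simp [pev, Polynomial.sum]

lemma pev_eq (φ : ℕ → K) (p : Polynomial ℕ) : pev φ p = ∑ k ∈ p.support, (p.coeff k : K) * φ k := rfl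

lemma pev_mul' (φ α β : ℕ → K)
    (h : ∀ j k, φ (j + k) = α j * β k) (p q : Polynomial ℕ) :
    pev φ (p * q) = pev α p * pev β q := by
  rw [pev_mul φ α β (fun _ => 0) (fun _ => 0) (fun _ => 0) (fun _ => 0) (fun j k => by simp [h])]
  simp [pev_zero_fun]

end pev

structure PD where
  P : ℕ → Polynomial ℕ
  A : ℕ → Polynomial ℕ
  q : ℝ
  μ : ℝ
  R0 : ℝ
  hq : 0 < q
  hR0 : 1 < R0
  P_zero : P 0 = 0
  P_deg : ∀ m k, (P m).coeff k ≠ 0 → k ≤ m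
  P_one : (P 1).coeff 1 ≠ 0
  A_zero : A 0 = 1
  A_succ : ∀ n, 1 ≤ n → A n = ∑ i ∈ Finset.range (n + 1), P i * A (n - i)
  A_pos : ∀ n, 0 < pev (fun _ => (1:ℝ)) (A n)
  hsum : HasSum (fun m => q ^ m * pev (fun _ => (1:ℝ)) (P m)) 1
  hexp : Summable fun m : ℕ => (m:ℝ) ^ 3 * (q ^ m * pev (fun _ => (1:ℝ)) (P m)) * R0 ^ m
  hmean : HasSum (fun m : ℕ => q ^ m * pev (fun k => (k:ℝ) - μ * m) (P m)) 0
  nondeg : ∃ m k : ℕ, (P m).coeff k ≠ 0 ∧ (k:ℝ) - μ * m ≠ 0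
  nonlat : ∀ (z : ℂ) (θ : ℝ), |θ| ≤ Real.pi →
    (∀ m k : ℕ, (P m).coeff k ≠ 0 → z ^ m * Complex.exp (Complex.I * θ * ((k:ℝ) - μ * m : ℝ)) = 1) →
    z = 1 ∧ θ = 0

lemma pev_nonneg (φ : ℕ → ℝ) (p : Polynomial ℕ) (h : ∀ k, p.coeff k ≠ 0 → 0 ≤ φ k) : 0 ≤ pev φ p := by
  rw [pev_eq]
  refine Finset.sum_nonneg fun k hk => ?_
  have := h k (by simpa using hk)
  positivity

lemma pev_mono (φ ψ : ℕ → ℝ) (p : Polynomial ℕ) (h : ∀ k, p.coeff k ≠ 0 → φ k ≤ ψ k) :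
    pev φ p ≤ pev ψ p := by
  rw [pev_eq, pev_eq]
  refine Finset.sum_le_sum fun k hk => ?_
  have := h k (by simpa using hk)
  gcongr

lemma pev_norm_le (φ : ℕ → ℂ) (ψ : ℕ → ℝ) (p : Polynomial ℕ) (h : ∀ k, p.coeff k ≠ 0 → ‖φ k‖ ≤ ψ k) :
    ‖pev φ p‖ ≤ pev ψ p := by
  rw [pev_eq, pev_eq]
  refine (norm_sum_le _ _).trans (Finset.sum_le_sum fun k hk => ?_)
  have := h k (by simpa using hk)
  rw [norm_mul, Complex.norm_natCast]
  gcongr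

lemma pev_abs_le (φ : ℕ → ℝ) (ψ : ℕ → ℝ) (p : Polynomial ℕ) (h : ∀ k, p.coeff k ≠ 0 → |φ k| ≤ ψ k) :
    |pev φ p| ≤ pev ψ p := by
  rw [pev_eq, pev_eq]
  refine (Finset.abs_sum_le_sum_abs _ _).trans (Finset.sum_le_sum fun k hk => ?_)
  have := h k (by simpa using hk)
  rw [abs_mul, Nat.abs_cast]
  gcongr

lemma pev_const_mul {K : Type*} [CommSemiring K] (c : K) (φ : ℕ → K) (p : Polynomial ℕ) :
    pev (fun k => c * φ k) p = c * pev φ p := by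
  rw [pev_eq, pev_eq, Finset.mul_sum]
  exact Finset.sum_congr rfl fun k _ => by ring

lemma pev_fadd {K : Type*} [CommSemiring K] (φ ψ : ℕ → K) (p : Polynomial ℕ) :
    pev (fun k => φ k + ψ k) p = pev φ p + pev ψ p := by
  rw [pev_eq, pev_eq, pev_eq, ← Finset.sum_add_distrib]
  exact Finset.sum_congr rfl fun k _ => by ring

lemma pev_ofReal (φ : ℕ → ℝ) (p : Polynomial ℕ) :
    pev (fun k => ((φ k : ℝ) : ℂ)) p = ((pev φ p : ℝ) : ℂ) := by
  rw [pev_eq, pev_eq]; push_cast; rfl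

lemma exp_taylor3 (x : ℝ) : ‖Complex.exp (Complex.I * x) - (1 + Complex.I * x - (x:ℂ) ^ 2 / 2)‖ ≤
    4 * |x| ^ 3 := by
  have hI : (Complex.I * x) ^ 2 = -(x:ℂ) ^ 2 := by rw [mul_pow, Complex.I_sq]; ring
  have hn : ‖Complex.I * (x:ℂ)‖ = |x| := by simp
  rcases le_total |x| 1 with h | h
  · have := Complex.exp_bound (x := Complex.I * x) (by rw [hn]; exact h) (n := 3) (by norm_num)
    simp only [Finset.sum_range_succ, Finset.sum_range_zero] at this
    rw [hn] at this
    have e : (0 + (Complex.I * (x:ℂ)) ^ 0 / (Nat.factorial 0 : ℂ) + (Complex.I * x) ^ 1 / (Nat.factorial 1 : ℂ) +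
      (Complex.I * x) ^ 2 / (Nat.factorial 2 : ℂ)) = (1 + Complex.I * x - (x:ℂ) ^ 2 / 2) := by
      rw [hI]; simp [Nat.factorial]; ring
    rw [e] at this
    refine this.trans ?_
    have hx : 0 ≤ |x| ^ 3 := by positivity
    norm_num [Nat.factorial]
    nlinarith
  · have h1 : ‖Complex.exp (Complex.I * x)‖ = 1 := by
      rw [mul_comm]; exact Complex.norm_exp_ofReal_mul_I x
    have h2 : ‖(x:ℂ) ^ 2 / 2‖ = |x| ^ 2 / 2 := by simp
    have : ‖Complex.exp (Complex.I * x) - (1 + Complex.I * x - (x:ℂ) ^ 2 / 2)‖ ≤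
      1 + (1 + |x| + |x| ^ 2 / 2) := by
      refine (norm_sub_le _ _).trans ?_
      rw [h1]
      gcongr
      refine (norm_sub_le _ _).trans ?_
      rw [h2]
      gcongr
      refine (norm_add_le _ _).trans ?_
      rw [hn, norm_one]
    refine this.trans ?_
    nlinarith [mul_nonneg (abs_nonneg x) (sub_nonneg.2 h), mul_nonneg (sq_nonneg |x|) (sub_nonneg.2 h)]

namespace PD
variable (D : PD)

def w (m : ℕ) : ℝ := D.q ^ m * pev (fun _ => (1:ℝ)) (D.P m)
def g (m : ℕ) : ℝ := D.q ^ m * pev (fun k => (k:ℝ) - D.μ * m) (D.P m)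
def k (m : ℕ) : ℝ := D.q ^ m * pev (fun k => ((k:ℝ) - D.μ * m) ^ 2) (D.P m)
def f (m : ℕ) (θ : ℝ) : ℂ :=
  (D.q:ℂ) ^ m * pev (fun k => Complex.exp (Complex.I * (θ * (k - D.μ * m) : ℝ))) (D.P m)
def a (m : ℕ) (θ : ℝ) : ℂ :=
  (D.q:ℂ) ^ m * pev (fun k => Complex.exp (Complex.I * (θ * (k - D.μ * m) : ℝ))) (D.A m)

lemma w_nonneg (m : ℕ) : 0 ≤ D.w m :=
  mul_nonneg (pow_nonneg D.hq.le _) (pev_nonneg _ _ fun _ _ => zero_le_one)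

lemma abs_dev (m k : ℕ) (h : (D.P m).coeff k ≠ 0) : |(k:ℝ) - D.μ * m| ≤ (1 + |D.μ|) * m := by
  have h1 : (k:ℝ) ≤ m := by exact_mod_cast D.P_deg m k h
  have h2 : (0:ℝ) ≤ k := by positivity
  refine (abs_sub _ _).trans ?_
  rw [abs_mul, Nat.abs_cast, Nat.abs_cast]
  linarith

lemma norm_e (x : ℝ) : ‖Complex.exp (Complex.I * x)‖ = 1 := by
  rw [mul_comm]; exact Complex.norm_exp_ofReal_mul_I x

lemma f_le (m : ℕ) (θ : ℝ) : ‖D.f m θ‖ ≤ D.w m := by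
  rw [f, w, norm_mul, norm_pow, Complex.norm_real, Real.norm_eq_abs, abs_of_pos D.hq]
  have := D.hq
  gcongr
  exact pev_norm_le _ _ _ fun k _ => (norm_e _).le

lemma f_taylor (m : ℕ) (θ : ℝ) :
    ‖D.f m θ - (D.w m + Complex.I * θ * D.g m - θ ^ 2 * D.k m / 2)‖
    ≤ (4 * (1 + |D.μ|) ^ 3) * |θ| ^ 3 * m ^ 3 * D.w m := by
  have hq := D.hq
  have e : D.f m θ - (D.w m + Complex.I * θ * D.g m - θ ^ 2 * D.k m / 2) =
    (D.q:ℂ) ^ m * pev (fun k => Complex.exp (Complex.I * (θ * (k - D.μ * m) : ℝ)) -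
      (1 + Complex.I * (θ * (k - D.μ * m) : ℝ) - ((θ * (k - D.μ * m) : ℝ):ℂ) ^ 2 / 2)) (D.P m) := by
    rw [f, w, g, k]
    push_cast
    rw [← pev_ofReal, ← pev_ofReal, ← pev_ofReal]
    simp only [pev_eq]
    simp only [Finset.mul_sum, Finset.sum_div, ← Finset.sum_add_distrib, ← Finset.sum_sub_distrib]
    refine Finset.sum_congr rfl fun k _ => ?_
    push_cast; ring
  rw [e, norm_mul, norm_pow, Complex.norm_real, Real.norm_eq_abs, abs_of_pos hq, w]
  have : pev (fun k : ℕ => 4 * ((1 + |D.μ|) ^ 3 * |θ| ^ 3 * m ^ 3) * 1) (D.P m) =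
    4 * ((1 + |D.μ|) ^ 3 * |θ| ^ 3 * m ^ 3) * pev (fun _ => (1:ℝ)) (D.P m) := by
    rw [← pev_const_mul]
  calc _ ≤ D.q ^ m * pev (fun k : ℕ => 4 * ((1 + |D.μ|) ^ 3 * |θ| ^ 3 * m ^ 3) * 1) (D.P m) := by
        gcongr
        refine pev_norm_le _ _ _ fun k hk => ?_
        refine (exp_taylor3 _).trans ?_
        rw [mul_one, abs_mul]
        have := D.abs_dev m k hk
        calc 4 * (|θ| * |(k:ℝ) - D.μ * m|) ^ 3 ≤ 4 * (|θ| * ((1 + |D.μ|) * m)) ^ 3 := by gcongr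
          _ = _ := by ring
    _ = _ := by rw [this]; ring

lemma g_le (m : ℕ) : |D.g m| ≤ (4 * (1 + |D.μ|) ^ 3) * m * D.w m := by
  have hq := D.hq
  rw [g, w, abs_mul, abs_pow, abs_of_pos hq]
  have h1 : |pev (fun k => (k:ℝ) - D.μ * m) (D.P m)| ≤ pev (fun _ => ((1 + |D.μ|) * m) * 1) (D.P m) :=
    pev_abs_le _ _ _ fun k hk => by rw [mul_one]; exact D.abs_dev m k hk
  rw [pev_const_mul] at h1
  have hp : 0 ≤ pev (fun _ => (1:ℝ)) (D.P m) := pev_nonneg _ _ fun _ _ => zero_le_one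
  have hb : (1 + |D.μ|) ≤ 4 * (1 + |D.μ|) ^ 3 := by
    nlinarith [abs_nonneg D.μ, sq_nonneg (|D.μ|)]
  calc _ ≤ D.q ^ m * ((4 * (1 + |D.μ|) ^ 3) * m * pev (fun _ => (1:ℝ)) (D.P m)) := by
        gcongr; refine h1.trans ?_; gcongr
    _ = _ := by ring

lemma k_le (m : ℕ) : |D.k m| ≤ (4 * (1 + |D.μ|) ^ 3) * m ^ 2 * D.w m := by
  have hq := D.hq
  rw [k, w, abs_mul, abs_pow, abs_of_pos hq]
  have h1 : |pev (fun k => ((k:ℝ) - D.μ * m) ^ 2) (D.P m)| ≤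
      pev (fun _ => ((1 + |D.μ|) ^ 2 * m ^ 2) * 1) (D.P m) :=
    pev_abs_le _ _ _ fun k hk => by
      rw [mul_one, abs_pow, ← mul_pow]
      have := D.abs_dev m k hk
      gcongr
  rw [pev_const_mul] at h1
  have hp : 0 ≤ pev (fun _ => (1:ℝ)) (D.P m) := pev_nonneg _ _ fun _ _ => zero_le_one
  have hb : (1 + |D.μ|) ^ 2 ≤ 4 * (1 + |D.μ|) ^ 3 := by
    nlinarith [abs_nonneg D.μ, sq_nonneg (1 + |D.μ|), mul_nonneg (abs_nonneg D.μ) (sq_nonneg (1 + |D.μ|))]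
  calc _ ≤ D.q ^ m * ((4 * (1 + |D.μ|) ^ 3) * m ^ 2 * pev (fun _ => (1:ℝ)) (D.P m)) := by
        gcongr; refine h1.trans ?_; gcongr
    _ = _ := by ring

lemma k_nonneg (m : ℕ) : 0 ≤ D.k m :=
  mul_nonneg (pow_nonneg D.hq.le _) (pev_nonneg _ _ fun _ _ => sq_nonneg _)

lemma nonlat' (z : ℂ) (θ : ℝ) (hz : ‖z‖ ≤ 1) (hθ : |θ| ≤ Real.pi) (h : ∑' m, D.f m θ * z ^ m = 1) :
    z = 1 ∧ θ = 0 := by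
  have hq := D.hq
  refine D.nonlat z θ hθ fun m k hk => ?_
  have hle : ∀ m, ‖D.f m θ * z ^ m‖ ≤ D.w m := fun m => by
    rw [norm_mul, norm_pow]
    calc _ ≤ D.w m * 1 := by
          have := D.f_le m θ; have := D.w_nonneg m
          gcongr; exact pow_le_one₀ (norm_nonneg _) hz
      _ = _ := mul_one _
  have hs : Summable fun m => D.f m θ * z ^ m :=
    Summable.of_norm_bounded D.hsum.summable hle
  have h1 := Complex.hasSum_re hs.hasSum
  rw [h, Complex.one_re] at h1
  have h2 := D.hsum.sub h1
  rw [sub_self] at h2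
  have hre : ∀ m, (D.f m θ * z ^ m).re ≤ D.w m := fun m => (Complex.re_le_norm _).trans (hle m)
  have h3 := (hasSum_zero_iff_of_nonneg (fun m => sub_nonneg.2 (hre m))).1 h2
  have h4 : (D.f m θ * z ^ m).re = D.w m := by
    have := congrFun h3 m
    simp only [Pi.zero_apply] at this
    change D.w m - _ = 0 at this
    linarith
  have h5 : (D.f m θ * z ^ m).re = D.q ^ m * pev (fun k => (z ^ m * Complex.exp (Complex.I * (θ * (k - D.μ * m) : ℝ))).re) (D.P m) := by
    rw [f, pev_eq, pev_eq, Finset.mul_sum, Finset.mul_sum, Finset.sum_mul, Complex.re_sum]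
    refine Finset.sum_congr rfl fun j _ => ?_
    have : (D.q:ℂ) ^ m * (((D.P m).coeff j : ℂ) * Complex.exp (Complex.I * (θ * (j - D.μ * m) : ℝ))) * z ^ m
      = ((D.q ^ m * ((D.P m).coeff j : ℝ) : ℝ) : ℂ) * (z ^ m * Complex.exp (Complex.I * (θ * (j - D.μ * m) : ℝ))) := by
      push_cast; ring
    rw [this, Complex.re_ofReal_mul]; ring
  rw [h5, w] at h4
  have h6 := mul_left_cancel₀ (pow_pos hq m).ne' h4
  have hn : ∀ j : ℕ, ‖z ^ m * Complex.exp (Complex.I * (θ * (j - D.μ * m) : ℝ))‖ ≤ 1 := fun j => by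
    rw [norm_mul, norm_pow, norm_e, mul_one]; exact pow_le_one₀ (norm_nonneg _) hz
  rw [pev_eq, pev_eq] at h6
  have h7 := (Finset.sum_eq_sum_iff_of_le (fun j _ => by
    have := (Complex.re_le_norm _).trans (hn j)
    gcongr)).1 h6 k (by simpa using hk)
  have hk' : (((D.P m).coeff k : ℕ) : ℝ) ≠ 0 := by exact_mod_cast hk
  have h8 := mul_left_cancel₀ hk' h7
  have h9 : z ^ m * Complex.exp (Complex.I * (θ * (k - D.μ * m) : ℝ)) = 1 := by
    have hnn := hn k
    set x := z ^ m * Complex.exp (Complex.I * (θ * (k - D.μ * m) : ℝ)) with hx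
    have e1 : Complex.normSq x ≤ 1 := by
      rw [Complex.normSq_eq_norm_sq]; exact pow_le_one₀ (norm_nonneg _) hnn
    rw [Complex.normSq_apply, h8] at e1
    have : x.im = 0 := by nlinarith
    exact Complex.ext h8 this
  rw [← h9]
  congr 2
  push_cast; ring

lemma a_succ (n : ℕ) (hn : 1 ≤ n) (θ : ℝ) :
    D.a n θ = ∑ i ∈ Finset.range (n + 1), D.f i θ * D.a (n - i) θ := by
  rw [a, D.A_succ n hn, pev_sum, Finset.mul_sum]
  refine Finset.sum_congr rfl fun i hi => ?_
  have hi' : i ≤ n := by have := Finset.mem_range.1 hi; omega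
  have hni : ((n - i : ℕ) : ℝ) = n - i := by push_cast [hi']; ring
  rw [pev_mul' _ (fun k => Complex.exp (Complex.I * (θ * (k - D.μ * i) : ℝ)))
    (fun k => Complex.exp (Complex.I * (θ * (k - D.μ * (n - i : ℕ)) : ℝ))), f, a]
  · have : (D.q:ℂ) ^ n = D.q ^ i * D.q ^ (n - i) := by rw [← pow_add]; congr 1; omega
    rw [this]; ring
  · intro j k
    rw [← Complex.exp_add]; congr 1
    rw [hni]; push_cast; ring

def toRD : RD where
  w := D.w
  g := D.g
  k := D.k
  f := D.f
  a := D.a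
  R0 := D.R0
  C := 4 * (1 + |D.μ|) ^ 3
  hR0 := D.hR0
  hw := D.w_nonneg
  hw0 := by simp [w, D.P_zero, pev_zero]
  hw1 := by
    rw [w, pev_eq]
    refine mul_pos (pow_pos D.hq _) (Finset.sum_pos' (fun i _ => by positivity) ⟨1, ?_, ?_⟩)
    · simpa using D.P_one
    · have := Nat.pos_of_ne_zero D.P_one
      simpa using this
  hsum := D.hsum
  hexp := D.hexp
  f_cont := fun m => by
    unfold f
    simp only [pev_eq]
    fun_prop
  f_le := D.f_le
  f_zero := fun m => by
    rw [f, w]; push_cast; rw [← pev_ofReal]; simp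
  f_taylor := D.f_taylor
  g_le := D.g_le
  k_le := D.k_le
  gsum := D.hmean
  kpos := by
    obtain ⟨m, j, h1, h2⟩ := D.nondeg
    have hs : Summable D.k := by
      have e : Summable fun m : ℕ => (4 * (1 + |D.μ|) ^ 3) * ((m:ℝ) ^ 3 * D.w m * D.R0 ^ m) := D.hexp.mul_left _
      refine Summable.of_nonneg_of_le D.k_nonneg (fun m => ?_) e
      refine (le_abs_self _).trans ((D.k_le m).trans ?_)
      have h0 := D.w_nonneg m
      have : D.w m ≤ D.w m * D.R0 ^ m := le_mul_of_one_le_right h0 (one_le_pow₀ D.hR0.le)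
      have h3 : (m:ℝ) ^ 2 ≤ m ^ 3 := by
        rcases Nat.eq_zero_or_pos m with rfl | hm
        · simp
        · exact pow_le_pow_right₀ (by exact_mod_cast hm) (by norm_num)
      calc _ ≤ (4 * (1 + |D.μ|) ^ 3) * m ^ 3 * (D.w m * D.R0 ^ m) := by gcongr
        _ = _ := by ring
    refine hs.tsum_pos D.k_nonneg m ?_
    rw [k, pev_eq]
    refine mul_pos (pow_pos D.hq _) (Finset.sum_pos' (fun i _ => by positivity) ⟨j, ?_, ?_⟩)
    · simpa using h1
    · have := Nat.pos_of_ne_zero h1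
      have h3 : 0 < ((j:ℝ) - D.μ * m) ^ 2 := by positivity
      positivity
  nonlat := D.nonlat'
  a_zero := fun θ => by simp [a, D.A_zero, pev_one]
  a_succ := D.a_succ

end PD
end

noncomputable section
open scoped BigOperators
open Filter MeasureTheory Topology
/-! ### Moments via power series -/

/-- absolutely summable coefficients -/
def SS (x : PowerSeries ℝ) : Prop := Summable fun n => ‖PowerSeries.coeff n x‖
/-- bounded coefficients -/
def BB (x : PowerSeries ℝ) : Prop := ∃ C, ∀ n, |PowerSeries.coeff n x| ≤ C

lemma SS.mul {x y : PowerSeries ℝ} (hx : SS x) (hy : SS y) : SS (x * y) := by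
  have := summable_norm_sum_mul_antidiagonal_of_summable_norm hx hy
  unfold SS; simp only [PowerSeries.coeff_mul]; exact this

lemma SS.add {x y : PowerSeries ℝ} (hx : SS x) (hy : SS y) : SS (x + y) := by
  refine Summable.of_nonneg_of_le (fun _ => norm_nonneg _) (fun n => ?_) (Summable.add hx hy)
  rw [map_add]; exact norm_add_le _ _

lemma SS.smul {x : PowerSeries ℝ} (hx : SS x) (c : ℝ) : SS (c • x) := by
  refine (Summable.mul_left ‖c‖ hx).congr fun n => ?_
  rw [map_smul, norm_smul]

lemma BB.add {x y : PowerSeries ℝ} (hx : BB x) (hy : BB y) : BB (x + y) := by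
  obtain ⟨C, h⟩ := hx
  obtain ⟨C', h'⟩ := hy
  exact ⟨C + C', fun n => by rw [map_add]; exact (abs_add_le _ _).trans (add_le_add (h n) (h' n))⟩

lemma BB.smul {x : PowerSeries ℝ} (hx : BB x) (c : ℝ) : BB (c • x) := by
  obtain ⟨C, h⟩ := hx
  exact ⟨|c| * C, fun n => by
    rw [map_smul, smul_eq_mul, abs_mul]; exact mul_le_mul_of_nonneg_left (h n) (abs_nonneg _)⟩

lemma SS.toBB {x : PowerSeries ℝ} (hx : SS x) : BB x :=
  ⟨∑' n, ‖PowerSeries.coeff n x‖, fun n => by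
    rw [← Real.norm_eq_abs]; exact hx.le_tsum n fun _ _ => norm_nonneg _⟩

lemma SS.mul_BB {x y : PowerSeries ℝ} (hx : SS x) (hy : BB y) : BB (x * y) := by
  obtain ⟨C, h⟩ := hy
  have hC : 0 ≤ C := (abs_nonneg _).trans (h 0)
  refine ⟨(∑' n, ‖PowerSeries.coeff n x‖) * C, fun n => ?_⟩
  rw [PowerSeries.coeff_mul, Finset.Nat.sum_antidiagonal_eq_sum_range_succ_mk]
  refine (Finset.abs_sum_le_sum_abs _ _).trans ?_
  calc _ ≤ ∑ i ∈ Finset.range (n+1), ‖PowerSeries.coeff i x‖ * C := by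
        refine Finset.sum_le_sum fun i _ => ?_
        rw [abs_mul, Real.norm_eq_abs]
        exact mul_le_mul_of_nonneg_left (h _) (abs_nonneg _)
    _ ≤ _ := by
        rw [← Finset.sum_mul]
        refine mul_le_mul_of_nonneg_right ?_ hC
        exact hx.sum_le_tsum _ fun _ _ => norm_nonneg _

/-- `1/(1-X)` -/
def JJ : PowerSeries ℝ := PowerSeries.mk fun _ => 1

lemma JJ_BB : BB JJ := ⟨1, fun n => by simp [JJ]⟩

lemma coeff_mul_JJ (x : PowerSeries ℝ) (n : ℕ) :
    PowerSeries.coeff n (x * JJ) = ∑ i ∈ Finset.range (n+1), PowerSeries.coeff i x := by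
  rw [PowerSeries.coeff_mul, Finset.Nat.sum_antidiagonal_eq_sum_range_succ_mk]
  simp [JJ]

lemma tail_SS (x : ℕ → ℝ) (C r s : ℝ) (hr : 0 ≤ r) (hr1 : r < 1) (h : ∀ n, |x n| ≤ C * r ^ n)
    (hs : HasSum x s) : SS (PowerSeries.mk x * JJ - s • JJ) := by
  have h1 : ∀ n, dist (∑ i ∈ Finset.range (n+1), x i) s ≤ (C * r) * r ^ n / (1 - r) := by
    intro n
    refine dist_le_of_le_geometric_of_tendsto r (C * r) hr1 (f := fun n => ∑ i ∈ Finset.range (n+1), x i) ?_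
      (hs.tendsto_sum_nat.comp (tendsto_add_atTop_nat 1)) n
    intro m
    rw [Finset.sum_range_succ _ (m+1), dist_self_add_right, Real.norm_eq_abs]
    refine (h _).trans (le_of_eq (by ring))
  have h2 : Summable fun n => (C * r) * r ^ n / (1 - r) :=
    ((summable_geometric_of_lt_one hr hr1).mul_left _).div_const _
  refine Summable.of_nonneg_of_le (fun _ => norm_nonneg _) (fun n => ?_) h2
  refine le_trans (le_of_eq ?_) (h1 n)
  rw [map_sub, coeff_mul_JJ, map_smul]
  simp [JJ, Real.dist_eq]

lemma exp_SS (x : ℕ → ℝ) (C r : ℝ) (hr : 0 ≤ r) (hr1 : r < 1) (h : ∀ n, |x n| ≤ C * r ^ n) :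
    SS (PowerSeries.mk x) := by
  refine Summable.of_nonneg_of_le (fun _ => norm_nonneg _) (fun n => ?_)
    ((summable_geometric_of_lt_one hr hr1).mul_left C)
  simpa using h n

lemma moment_core (W Gs Ks U M Q : PowerSeries ℝ) (c κ : ℝ)
    (hU : U * (1 - W) = 1) (hM : M = Gs * U + W * M) (hQ : Q = Ks * U + (2:ℝ) • (Gs * M) + W * Q)
    (hE : SS (U - c • JJ)) (hG : SS Gs) (hK : SS Ks) (hG0 : SS (Gs * JJ))
    (hK0 : SS (Ks * JJ - κ • JJ)) :
    BB M ∧ BB (Q - (κ * c ^ 2) • (JJ * JJ)) := by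
  have hM' : M = Gs * U * U := by
    have : M * (1 - W) = Gs * U := by linear_combination hM
    calc M = M * (U * (1 - W)) := by rw [hU, mul_one]
      _ = M * (1 - W) * U := by ring
      _ = _ := by rw [this]
  have hQ' : Q = Ks * U * U + (2:ℝ) • ((Gs * U) * (Gs * U) * U) := by
    have h1 : Q * (1 - W) = Ks * U + (2:ℝ) • (Gs * M) := by linear_combination hQ
    calc Q = Q * (U * (1 - W)) := by rw [hU, mul_one]
      _ = Q * (1 - W) * U := by ring
      _ = _ := by rw [h1, hM', add_mul, smul_mul_assoc]; congr 2; ring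
  set E := U - c • JJ with hEdef
  have hUE : U = c • JJ + E := by rw [hEdef]; ring
  have hUB : BB U := by rw [hUE]; exact (JJ_BB.smul c).add hE.toBB
  have hB : SS (Gs * U) := by
    have : Gs * U = c • (Gs * JJ) + Gs * E := by rw [hUE, mul_add, mul_smul_comm]
    rw [this]; exact (hG0.smul c).add (hG.mul hE)
  set K' := Ks * JJ - κ • JJ with hK'
  have hKU : Ks * U = (κ * c) • JJ + (c • K' + Ks * E) := by
    have : Ks * JJ = κ • JJ + K' := by rw [hK']; ring
    rw [hUE, mul_add, mul_smul_comm, this, smul_add, smul_smul, mul_comm c κ]; ring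
  refine ⟨?_, ?_⟩
  · rw [hM']; exact hB.mul_BB hUB
  · have e1 : SS (c • K' + Ks * E) := (hK0.smul c).add (hK.mul hE)
    have : Q - (κ * c ^ 2) • (JJ * JJ) = (κ * c) • (E * JJ) + (c • K' + Ks * E) * U +
      (2:ℝ) • ((Gs * U) * (Gs * U) * U) := by
      rw [hQ', hKU, add_mul]
      have : (κ * c) • JJ * U = (κ * c ^ 2) • (JJ * JJ) + (κ * c) • (E * JJ) := by
        rw [hUE, mul_add, mul_smul_comm, smul_mul_assoc, smul_mul_assoc, smul_smul, mul_comm JJ E]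
        congr 2; ring
      rw [this]; ring
    rw [this]
    exact (((hE.mul_BB JJ_BB).smul _).add (e1.mul_BB hUB)).add (((hB.mul hB).mul_BB hUB).smul 2)

namespace PD
variable (D : PD)

def u (n : ℕ) : ℝ := D.q ^ n * pev (fun _ => (1:ℝ)) (D.A n)
def M1 (n : ℕ) : ℝ := D.q ^ n * pev (fun k => (k:ℝ) - D.μ * n) (D.A n)
def M2 (n : ℕ) : ℝ := D.q ^ n * pev (fun k => ((k:ℝ) - D.μ * n) ^ 2) (D.A n)

lemma u_succ (n : ℕ) (hn : 1 ≤ n) : D.u n = ∑ i ∈ Finset.range (n + 1), D.w i * D.u (n - i) := by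
  rw [u, D.A_succ n hn, pev_sum, Finset.mul_sum]
  refine Finset.sum_congr rfl fun i hi => ?_
  rw [pev_mul' _ (fun _ => 1) (fun _ => 1) (fun _ _ => by simp), w, u]
  have : D.q ^ n = D.q ^ i * D.q ^ (n - i) := by
    rw [← pow_add]; congr 1; have := Finset.mem_range.1 hi; omega
  rw [this]; ring

lemma M1_succ (n : ℕ) (hn : 1 ≤ n) : D.M1 n = ∑ i ∈ Finset.range (n + 1),
    (D.g i * D.u (n - i) + D.w i * D.M1 (n - i)) := by
  rw [M1, D.A_succ n hn, pev_sum, Finset.mul_sum]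
  refine Finset.sum_congr rfl fun i hi => ?_
  have hi' : i ≤ n := by have := Finset.mem_range.1 hi; omega
  have hni : ((n - i : ℕ) : ℝ) = n - i := by push_cast [hi']; ring
  rw [pev_mul _ (fun k => (k:ℝ) - D.μ * i) (fun _ => 1) (fun _ => 1)
    (fun k => (k:ℝ) - D.μ * (n - i : ℕ)) (fun _ => 0) (fun _ => 0) (fun j k => by
      rw [hni]; push_cast; ring), w, u, g, M1]
  have : D.q ^ n = D.q ^ i * D.q ^ (n - i) := by
    rw [← pow_add]; congr 1; omega
  rw [this, pev_zero_fun]; ring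

lemma M2_succ (n : ℕ) (hn : 1 ≤ n) : D.M2 n = ∑ i ∈ Finset.range (n + 1),
    (D.k i * D.u (n - i) + 2 * (D.g i * D.M1 (n - i)) + D.w i * D.M2 (n - i)) := by
  rw [M2, D.A_succ n hn, pev_sum, Finset.mul_sum]
  refine Finset.sum_congr rfl fun i hi => ?_
  have hi' : i ≤ n := by have := Finset.mem_range.1 hi; omega
  have hni : ((n - i : ℕ) : ℝ) = n - i := by push_cast [hi']; ring
  rw [pev_mul _ (fun k => ((k:ℝ) - D.μ * i) ^ 2) (fun _ => 1) 
    (fun k => 2 * ((k:ℝ) - D.μ * i)) (fun k => (k:ℝ) - D.μ * (n - i : ℕ))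
    (fun _ => 1) (fun k => ((k:ℝ) - D.μ * (n - i : ℕ)) ^ 2) (fun j k => by
      rw [hni]; push_cast; ring), w, u, g, k, M1, M2, pev_const_mul]
  have : D.q ^ n = D.q ^ i * D.q ^ (n - i) := by
    rw [← pow_add]; congr 1; omega
  rw [this]; ring

lemma u_zero : D.u 0 = 1 := by simp [u, D.A_zero, pev_one]
lemma M1_zero : D.M1 0 = 0 := by simp [M1, D.A_zero, pev_one]
lemma M2_zero : D.M2 0 = 0 := by simp [M2, D.A_zero, pev_one]
lemma u_pos (n : ℕ) : 0 < D.u n := mul_pos (pow_pos D.hq n) (D.A_pos n)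
lemma w_zero : D.w 0 = 0 := by simp [w, D.P_zero, pev_zero]
lemma g_zero : D.g 0 = 0 := by simp [g, D.P_zero, pev_zero]
lemma k_zero : D.k 0 = 0 := by simp [k, D.P_zero, pev_zero]

lemma a_zero_eq (n : ℕ) : D.a n 0 = D.u n := by
  rw [a, u]; push_cast; rw [← pev_ofReal]; simp

lemma u_asym : ∃ R > 1, ∃ M > 0, ∀ n, |D.u n - 1 / D.toRD.mean| ≤ M / R ^ n := by
  obtain ⟨R, hR, M, hM, h⟩ := D.toRD.a_zero_asym
  refine ⟨R, hR, M, hM, fun n => ?_⟩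
  have := h n
  change ‖D.a n 0 - _‖ ≤ _ at this
  rw [a_zero_eq] at this
  rw [← Real.norm_eq_abs, ← Complex.norm_real]
  push_cast; exact this

lemma w_geom : ∃ C, ∀ m : ℕ, (m:ℝ) ^ 3 * D.w m ≤ C * (D.R0⁻¹) ^ m := by
  refine ⟨∑' m : ℕ, (m:ℝ) ^ 3 * D.w m * D.R0 ^ m, fun m => ?_⟩
  have hR : 0 < D.R0 := by linarith [D.hR0]
  have := D.hexp.le_tsum m fun j _ => by
    have := D.w_nonneg j
    change 0 ≤ (j:ℝ) ^ 3 * D.w j * D.R0 ^ j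
    positivity
  rw [inv_pow, ← div_eq_mul_inv, le_div_iff₀ (by positivity)]
  exact this

lemma g_geom : ∃ C, ∀ m : ℕ, |D.g m| ≤ C * (D.R0⁻¹) ^ m := by
  obtain ⟨C, h⟩ := D.w_geom
  refine ⟨(4 * (1 + |D.μ|) ^ 3) * C, fun m => (D.g_le m).trans ?_⟩
  rw [mul_assoc (4 * (1 + |D.μ|) ^ 3), mul_assoc (4 * (1 + |D.μ|) ^ 3)]
  refine mul_le_mul_of_nonneg_left ?_ (by positivity)
  refine le_trans ?_ (h m)
  have := D.w_nonneg m
  gcongr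
  rcases Nat.eq_zero_or_pos m with rfl | hm
  · simp
  · exact le_self_pow₀ (by exact_mod_cast hm) (by norm_num)

lemma k_geom : ∃ C, ∀ m : ℕ, |D.k m| ≤ C * (D.R0⁻¹) ^ m := by
  obtain ⟨C, h⟩ := D.w_geom
  refine ⟨(4 * (1 + |D.μ|) ^ 3) * C, fun m => (D.k_le m).trans ?_⟩
  rw [mul_assoc (4 * (1 + |D.μ|) ^ 3), mul_assoc (4 * (1 + |D.μ|) ^ 3)]
  refine mul_le_mul_of_nonneg_left ?_ (by positivity)
  refine le_trans ?_ (h m)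
  have := D.w_nonneg m
  gcongr ?_ * _
  rcases Nat.eq_zero_or_pos m with rfl | hm
  · simp
  · exact pow_le_pow_right₀ (by exact_mod_cast hm) (by norm_num)

lemma moments : (∃ C, ∀ n, |D.M1 n| ≤ C) ∧
    ∃ C, ∀ n : ℕ, |D.M2 n - D.toRD.s2 / D.toRD.mean ^ 2 * n| ≤ C := by
  have hr : 0 ≤ D.R0⁻¹ := inv_nonneg.2 (by linarith [D.hR0])
  have hr1 : D.R0⁻¹ < 1 := inv_lt_one_of_one_lt₀ D.hR0
  obtain ⟨Cg, hCg⟩ := D.g_geom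
  obtain ⟨Ck, hCk⟩ := D.k_geom
  obtain ⟨R, hR, M, hM, hu⟩ := D.u_asym
  have hk : HasSum D.k D.toRD.s2 := D.toRD.k_summable.hasSum
  have core := moment_core (PowerSeries.mk D.w) (PowerSeries.mk D.g) (PowerSeries.mk D.k)
    (PowerSeries.mk D.u) (PowerSeries.mk D.M1) (PowerSeries.mk D.M2) (1 / D.toRD.mean) D.toRD.s2
    ?_ ?_ ?_ ?_ (exp_SS _ Cg _ hr hr1 hCg) (exp_SS _ Ck _ hr hr1 hCk)
    (by simpa using tail_SS _ Cg _ _ hr hr1 hCg D.hmean) (tail_SS _ Ck _ _ hr hr1 hCk hk)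
  · obtain ⟨⟨C1, h1⟩, ⟨C2, h2⟩⟩ := core
    refine ⟨⟨C1, fun n => by simpa using h1 n⟩, C2 + |D.toRD.s2 * (1 / D.toRD.mean) ^ 2|, fun n => ?_⟩
    have := h2 n
    rw [map_sub, map_smul, coeff_mul_JJ] at this
    simp only [JJ, PowerSeries.coeff_mk, Finset.sum_const, Finset.card_range, nsmul_eq_mul, mul_one,
      smul_eq_mul] at this
    have e : D.M2 n - D.toRD.s2 / D.toRD.mean ^ 2 * n = (D.M2 n - D.toRD.s2 * (1 / D.toRD.mean) ^ 2 * ((n+1:ℕ):ℝ))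
      + D.toRD.s2 * (1 / D.toRD.mean) ^ 2 := by push_cast; ring
    rw [e]
    exact (abs_add_le _ _).trans (add_le_add this le_rfl)
  · have : PowerSeries.mk D.u = 1 + PowerSeries.mk D.w * PowerSeries.mk D.u := by
      ext n
      rw [map_add, PowerSeries.coeff_mul, Finset.Nat.sum_antidiagonal_eq_sum_range_succ_mk]
      simp only [PowerSeries.coeff_mk, PowerSeries.coeff_one]
      split_ifs with hn
      · subst hn; simp [u_zero, w_zero]
      · rw [D.u_succ n (by omega), zero_add]
    linear_combination this
  · ext n
    rw [map_add, PowerSeries.coeff_mul, Finset.Nat.sum_antidiagonal_eq_sum_range_succ_mk,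
      PowerSeries.coeff_mul, Finset.Nat.sum_antidiagonal_eq_sum_range_succ_mk, ← Finset.sum_add_distrib]
    simp only [PowerSeries.coeff_mk]
    rcases Nat.eq_zero_or_pos n with rfl | hn
    · simp [M1_zero, g_zero]
    · exact D.M1_succ n hn
  · ext n
    rw [map_add, map_add, map_smul, PowerSeries.coeff_mul, Finset.Nat.sum_antidiagonal_eq_sum_range_succ_mk,
      PowerSeries.coeff_mul, Finset.Nat.sum_antidiagonal_eq_sum_range_succ_mk,
      PowerSeries.coeff_mul, Finset.Nat.sum_antidiagonal_eq_sum_range_succ_mk, smul_eq_mul,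
      Finset.mul_sum, ← Finset.sum_add_distrib, ← Finset.sum_add_distrib]
    simp only [PowerSeries.coeff_mk]
    rcases Nat.eq_zero_or_pos n with rfl | hn
    · simp [M2_zero, g_zero, k_zero, w_zero]
    · exact D.M2_succ n hn
  · refine Summable.of_nonneg_of_le (fun _ => norm_nonneg _) (fun n => ?_)
      ((summable_geometric_of_lt_one (inv_nonneg.2 (by linarith : (0:ℝ) ≤ R))
        (inv_lt_one_of_one_lt₀ hR)).mul_left M)
    have := hu n
    rw [map_sub, map_smul]
    simp only [JJ, PowerSeries.coeff_mk, smul_eq_mul, mul_one, Real.norm_eq_abs]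
    rw [inv_pow, ← div_eq_mul_inv]; exact this

lemma u_lower : ∃ c > 0, ∀ n, c ≤ D.u n := by
  obtain ⟨R, hR, M, hM, hu⟩ := D.u_asym
  have hm := D.toRD.mean_pos
  have hlim : Tendsto (fun n : ℕ => M / R ^ n) atTop (𝓝 0) :=
    tendsto_const_nhds.div_atTop (tendsto_pow_atTop_atTop_of_one_lt hR)
  have := hlim.eventually (gt_mem_nhds (show 0 < 1 / D.toRD.mean / 2 by positivity))
  obtain ⟨N, hN⟩ := eventually_atTop.1 this
  have hne : (Finset.range (N+1)).Nonempty := ⟨0, by simp⟩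
  refine ⟨min (1 / D.toRD.mean / 2) ((Finset.range (N+1)).inf' hne D.u), ?_, fun n => ?_⟩
  · refine lt_min (by positivity) ?_
    rw [Finset.lt_inf'_iff]; exact fun i _ => D.u_pos i
  · rcases le_total N n with h | h
    · refine (min_le_left _ _).trans ?_
      have h1 := hN n h
      have h2 := abs_le.1 (hu n)
      linarith [h2.1]
    · exact (min_le_right _ _).trans (Finset.inf'_le _ (by simp; omega))

/-- mean and variance of the normalized distribution -/
lemma mean_var : (∃ C, ∀ n : ℕ, |pev (fun k => (k:ℝ)) (D.A n) / pev (fun _ => (1:ℝ)) (D.A n) - D.μ * n| ≤ C) ∧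
    ∃ C, ∀ n : ℕ, |(pev (fun k => (k:ℝ) ^ 2) (D.A n) / pev (fun _ => (1:ℝ)) (D.A n) -
      (pev (fun k => (k:ℝ)) (D.A n) / pev (fun _ => (1:ℝ)) (D.A n)) ^ 2) - D.toRD.s2 / D.toRD.mean * n| ≤ C := by
  obtain ⟨⟨C1, h1⟩, C2, h2⟩ := D.moments
  obtain ⟨c, hc, hcu⟩ := D.u_lower
  obtain ⟨R, hR, M, hM, hu⟩ := D.u_asym
  have hm := D.toRD.mean_pos
  have hC1 : 0 ≤ C1 := (abs_nonneg _).trans (h1 0)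
  have hC2 : 0 ≤ C2 := (abs_nonneg _).trans (h2 0)
  have key1 : ∀ n : ℕ, pev (fun k => (k:ℝ)) (D.A n) / pev (fun _ => (1:ℝ)) (D.A n) - D.μ * n = D.M1 n / D.u n := by
    intro n
    have ha := D.A_pos n
    have hq := pow_pos D.hq n
    rw [M1, u, mul_div_mul_left _ _ hq.ne']
    have : pev (fun k => (k:ℝ) - D.μ * n) (D.A n) = pev (fun k => (k:ℝ)) (D.A n) - D.μ * n * pev (fun _ => (1:ℝ)) (D.A n) := by
      have := pev_fadd (fun k : ℕ => (k:ℝ)) (fun _ => (-(D.μ * n)) * 1) (D.A n)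
      rw [pev_const_mul] at this
      simp only [mul_one, ← sub_eq_add_neg] at this
      rw [this]; ring
    rw [this]; field_simp
  have b1 : ∀ n, |D.M1 n / D.u n| ≤ C1 / c := fun n => by
    rw [abs_div, abs_of_pos (D.u_pos n)]
    exact div_le_div₀ hC1 (h1 n) hc (hcu n)
  have key2 : ∀ n : ℕ, (pev (fun k => (k:ℝ) ^ 2) (D.A n) / pev (fun _ => (1:ℝ)) (D.A n) -
      (pev (fun k => (k:ℝ)) (D.A n) / pev (fun _ => (1:ℝ)) (D.A n)) ^ 2) = D.M2 n / D.u n - (D.M1 n / D.u n) ^ 2 := by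
    intro n
    have ha := D.A_pos n
    have hq := pow_pos D.hq n
    rw [← key1 n, M2, u, mul_div_mul_left _ _ hq.ne']
    have : pev (fun k => ((k:ℝ) - D.μ * n) ^ 2) (D.A n) = pev (fun k => (k:ℝ) ^ 2) (D.A n)
        - 2 * (D.μ * n) * pev (fun k => (k:ℝ)) (D.A n) + (D.μ * n) ^ 2 * pev (fun _ => (1:ℝ)) (D.A n) := by
      simp only [pev_eq, Finset.mul_sum, ← Finset.sum_add_distrib, ← Finset.sum_sub_distrib]
      exact Finset.sum_congr rfl fun k _ => by ring
    rw [this]; field_simp; ring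
  refine ⟨⟨C1 / c, fun n => by rw [key1]; exact b1 n⟩, ?_⟩
  -- n * (u_n - 1/m) bounded
  have hb : ∃ C3, ∀ n : ℕ, (n:ℝ) * (M / R ^ n) ≤ C3 := by
    have hs : Summable fun n : ℕ => (n:ℝ) ^ 1 * (R⁻¹) ^ n :=
      summable_pow_mul_geometric_of_norm_lt_one 1 (by
        rw [norm_inv, Real.norm_eq_abs, abs_of_pos (by linarith)]; exact inv_lt_one_of_one_lt₀ hR)
    refine ⟨M * ∑' n : ℕ, (n:ℝ) ^ 1 * (R⁻¹) ^ n, fun n => ?_⟩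
    have hR0 : 0 ≤ R⁻¹ := inv_nonneg.2 (by linarith)
    have := hs.le_tsum n fun j _ => by positivity
    calc _ = M * ((n:ℝ) ^ 1 * (R⁻¹) ^ n) := by rw [inv_pow]; ring
      _ ≤ _ := by gcongr
  obtain ⟨C3, h3⟩ := hb
  set κ := D.toRD.s2 / D.toRD.mean with hκ
  have hκ0 : 0 < κ := div_pos D.toRD.s2_pos hm
  have b2 : ∀ n : ℕ, |D.M2 n / D.u n - κ * n| ≤ (C2 + κ * C3) / c := by
    intro n
    have hun := D.u_pos n
    have : D.M2 n / D.u n - κ * n = (D.M2 n - κ * n * D.u n) / D.u n := by field_simp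
    rw [this, abs_div, abs_of_pos hun]
    have e : |D.M2 n - κ * n * D.u n| ≤ C2 + κ * C3 := by
      have : D.M2 n - κ * n * D.u n = (D.M2 n - D.toRD.s2 / D.toRD.mean ^ 2 * n) -
        κ * (n * (D.u n - 1 / D.toRD.mean)) := by rw [hκ]; field_simp; ring
      rw [this]
      refine (abs_sub _ _).trans (add_le_add (h2 n) ?_)
      rw [abs_mul, abs_of_pos hκ0, abs_mul, Nat.abs_cast]
      gcongr
      refine le_trans ?_ (h3 n)
      gcongr
      exact hu n
    exact div_le_div₀ ((abs_nonneg _).trans e) e hc (hcu n)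
  refine ⟨(C2 + κ * C3) / c + (C1 / c) ^ 2, fun n => ?_⟩
  rw [key2]
  have : D.M2 n / D.u n - (D.M1 n / D.u n) ^ 2 - κ * n = (D.M2 n / D.u n - κ * n) - (D.M1 n / D.u n) ^ 2 := by ring
  rw [this]
  refine (abs_sub _ _).trans (add_le_add (b2 n) ?_)
  rw [abs_pow]
  have := b1 n
  gcongr

end PD
end

noncomputable section
open scoped BigOperators
open Filter MeasureTheory Topology
namespace PD
variable (D : PD)

/-- standard deviation constant -/
def σ : ℝ := Real.sqrt (D.toRD.s2 / D.toRD.mean)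

lemma σ_pos : 0 < D.σ := Real.sqrt_pos.2 (div_pos D.toRD.s2_pos D.toRD.mean_pos)
lemma σ_sq : D.σ ^ 2 = D.toRD.s2 / D.toRD.mean :=
  Real.sq_sqrt (div_pos D.toRD.s2_pos D.toRD.mean_pos).le

lemma u_tendsto : Tendsto D.u atTop (𝓝 (1 / D.toRD.mean)) := by
  obtain ⟨R, hR, M, hM, hu⟩ := D.u_asym
  have hlim : Tendsto (fun n : ℕ => M / R ^ n) atTop (𝓝 0) :=
    tendsto_const_nhds.div_atTop (tendsto_pow_atTop_atTop_of_one_lt hR)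
  rw [tendsto_iff_norm_sub_tendsto_zero]
  exact squeeze_zero (fun _ => norm_nonneg _) hu hlim

/-- law of the normalised variable -/
def law (n : ℕ) : Measure ℝ := ∑ k ∈ (D.A n).support,
  ENNReal.ofReal ((D.A n).coeff k / pev (fun _ => (1:ℝ)) (D.A n)) •
    Measure.dirac (((k:ℝ) - D.μ * n) / (D.σ * Real.sqrt n))

lemma law_apply (n : ℕ) {s : Set ℝ} (hs : MeasurableSet s) : D.law n s =
    ENNReal.ofReal (pev (fun k => s.indicator (fun _ => (1:ℝ)) (((k:ℝ) - D.μ * n) / (D.σ * Real.sqrt n))) (D.A n)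
      / pev (fun _ => (1:ℝ)) (D.A n)) := by
  have hp := D.A_pos n
  set tot := pev (fun _ => (1:ℝ)) (D.A n) with htot
  rw [law, ← htot, Measure.finsetSum_apply, pev_eq, Finset.sum_div, ENNReal.ofReal_sum_of_nonneg]
  · refine Finset.sum_congr rfl fun k _ => ?_
    rw [Measure.smul_apply, Measure.dirac_apply' _ hs, smul_eq_mul]
    by_cases h : ((k:ℝ) - D.μ * n) / (D.σ * Real.sqrt n) ∈ s
    · simp [h]
    · simp [h]
  · intro k _
    have : 0 ≤ s.indicator (fun _ => (1:ℝ)) (((k:ℝ) - D.μ * n) / (D.σ * Real.sqrt n)) :=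
      Set.indicator_nonneg (fun _ _ => zero_le_one) _
    positivity

instance law_prob (n : ℕ) : IsProbabilityMeasure (D.law n) := ⟨by
  rw [D.law_apply n MeasurableSet.univ]
  simp [(D.A_pos n).ne']⟩

lemma law_charFun (n : ℕ) (t : ℝ) : charFun (D.law n) t = D.a n (t / D.σ / Real.sqrt n) / D.u n := by
  have hp := D.A_pos n
  rw [charFun_apply_real, law, integral_finsetSum_measure]
  · simp only [integral_smul_measure, integral_dirac]
    rw [a, u]
    set tot := pev (fun _ => (1:ℝ)) (D.A n) with htot
    rw [pev_eq]
    push_cast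
    rw [mul_div_mul_left _ _ (pow_ne_zero _ (by exact_mod_cast D.hq.ne')), Finset.sum_div]
    refine Finset.sum_congr rfl fun k _ => ?_
    rw [ENNReal.toReal_ofReal (by positivity), Complex.real_smul]
    push_cast
    rw [div_mul_eq_mul_div]
    congr 3
    field_simp
  · intro i _
    refine Integrable.smul_measure ?_ ENNReal.ofReal_ne_top
    exact integrable_dirac (by simp)

theorem clt (x : ℝ) : Tendsto (fun n : ℕ =>
    pev (fun k => Set.indicator {k : ℕ | ((k:ℝ) - D.μ * n) / (D.σ * Real.sqrt n) ≤ x} (fun _ => (1:ℝ)) k) (D.A n)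
      / pev (fun _ => (1:ℝ)) (D.A n)) atTop (𝓝 (stdGaussCDF x)) := by
  let μs : ℕ → ProbabilityMeasure ℝ := fun n => ⟨D.law n, inferInstance⟩
  let μ0 : ProbabilityMeasure ℝ := ⟨ProbabilityTheory.gaussianReal 0 1, inferInstance⟩
  have hσ := D.σ_pos
  have hm := D.toRD.mean_pos
  have hlim : Tendsto μs atTop (𝓝 μ0) := by
    rw [ProbabilityMeasure.tendsto_iff_tendsto_charFun]
    intro t
    have e0 : charFun (μ0 : Measure ℝ) t = Complex.exp (-(t ^ 2 / 2)) := by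
      show charFun (ProbabilityTheory.gaussianReal 0 1) t = _
      rw [ProbabilityTheory.charFun_gaussianReal]; congr 1; push_cast; ring
    have e1 : ∀ n, charFun (μs n : Measure ℝ) t = D.a n (t / D.σ / Real.sqrt n) / D.u n :=
      fun n => D.law_charFun n t
    simp only [e0, e1]
    have h1 := D.toRD.a_scaled (t / D.σ)
    have h2 : Tendsto (fun n => (D.u n : ℂ)) atTop (𝓝 ((1 / D.toRD.mean : ℝ) : ℂ)) :=
      (Complex.continuous_ofReal.tendsto _).comp D.u_tendsto
    have h3 := h1.div h2 (by
      rw [Complex.ofReal_ne_zero]; positivity)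
    convert! h3 using 2
    have hmc : (D.toRD.mean : ℂ) ≠ 0 := by exact_mod_cast hm.ne'
    have h1m : ((1 / D.toRD.mean : ℝ) : ℂ) = 1 / (D.toRD.mean : ℂ) := by push_cast; rfl
    rw [h1m, mul_div_cancel_left₀ _ (by simp [hmc])]
    congr 1
    have hsq : ((D.σ:ℂ)) ^ 2 = D.toRD.s2 / D.toRD.mean := by exact_mod_cast D.σ_sq
    have hσc : (D.σ : ℂ) ≠ 0 := by exact_mod_cast hσ.ne'
    have : (D.toRD.s2 : ℂ) = D.σ ^ 2 * D.toRD.mean := by rw [hsq]; field_simp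
    rw [this]; push_cast; field_simp
  have hE := ProbabilityMeasure.tendsto_measure_of_null_frontier_of_tendsto' hlim (E := Set.Iic x) (by
    rw [frontier_Iic]
    have := ProbabilityTheory.nullSingletonClass_gaussianReal (μ := 0) (v := 1) one_ne_zero
    exact measure_singleton (μ := ProbabilityTheory.gaussianReal 0 1) x)
  have hE' := (ENNReal.tendsto_toReal (measure_ne_top _ _)).comp hE
  have e2 : ((μ0 : Measure ℝ) (Set.Iic x)).toReal = stdGaussCDF x := by
    show (ProbabilityTheory.gaussianReal 0 1 (Set.Iic x)).toReal = _
    rw [ProbabilityTheory.gaussianReal_apply_eq_integral _ one_ne_zero, ENNReal.toReal_ofReal, stdGaussCDF,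
      ← integral_const_mul]
    · simp [ProbabilityTheory.gaussianPDFReal_def]
    · exact integral_nonneg fun _ => ProbabilityTheory.gaussianPDFReal_nonneg _ _ _
  rw [e2] at hE'
  refine hE'.congr fun n => ?_
  show (D.law n (Set.Iic x)).toReal = _
  rw [D.law_apply n measurableSet_Iic, ENNReal.toReal_ofReal]
  · rfl
  · refine div_nonneg (pev_nonneg _ _ fun k _ => ?_) (D.A_pos n).le
    exact Set.indicator_nonneg (fun _ _ => zero_le_one) _

end PD
end

noncomputable section
open scoped BigOperators
open Filter MeasureTheory Topology
namespace PD
variable (D : PD)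

lemma int_orth (j : ℤ) : ∫ θ in (-Real.pi)..Real.pi, Complex.exp (Complex.I * (θ * j : ℝ)) =
    if j = 0 then 2 * (Real.pi : ℂ) else 0 := by
  split_ifs with h
  · subst h; simp; ring
  · have hc : Complex.I * (j:ℂ) ≠ 0 := by simp [h]
    have e : ∀ θ : ℝ, Complex.exp (Complex.I * (θ * j : ℝ)) = Complex.exp (Complex.I * j * θ) := by
      intro θ; congr 1; push_cast; ring
    simp only [e]
    rw [integral_exp_mul_complex hc, div_eq_zero_iff]
    left
    rw [sub_eq_zero]
    have : Complex.I * j * (Real.pi:ℂ) = Complex.I * j * ((-Real.pi : ℝ):ℂ) + j * (2 * Real.pi * Complex.I) := by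
      push_cast; ring
    rw [this, Complex.exp_add, Complex.exp_int_mul_two_pi_mul_I, mul_one]

lemma a_cont (n : ℕ) : Continuous (D.a n) := by
  unfold a
  simp only [pev_eq]
  fun_prop

/-- coefficient count -/
def cnt (n : ℕ) (k : ℤ) : ℝ := pev (fun j => Set.indicator {j : ℕ | (j:ℤ) = k} (fun _ => (1:ℝ)) j) (D.A n)

lemma fourier_inv (n : ℕ) (k : ℤ) :
    ∫ θ in (-Real.pi)..Real.pi, D.a n θ * Complex.exp (-(Complex.I * (θ * (k - D.μ * n) : ℝ))) =
      2 * Real.pi * ((D.q ^ n * D.cnt n k : ℝ) : ℂ) := by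
  have e : ∀ θ : ℝ, D.a n θ * Complex.exp (-(Complex.I * (θ * (k - D.μ * n) : ℝ))) =
      ∑ j ∈ (D.A n).support, (D.q:ℂ) ^ n * ((D.A n).coeff j : ℂ) *
        Complex.exp (Complex.I * (θ * ((j - k : ℤ) : ℝ) : ℝ)) := by
    intro θ
    rw [a, pev_eq, Finset.mul_sum, Finset.sum_mul]
    refine Finset.sum_congr rfl fun j _ => ?_
    rw [mul_assoc, mul_assoc, mul_assoc, ← Complex.exp_add]
    congr 3
    push_cast; ring
  simp only [e]
  rw [intervalIntegral.integral_finsetSum]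
  · simp only [intervalIntegral.integral_const_mul, int_orth, cnt]
    rw [pev_eq]
    push_cast
    rw [Finset.mul_sum, Finset.mul_sum]
    refine Finset.sum_congr rfl fun j _ => ?_
    by_cases h : (j:ℤ) = k
    · have h' : (j:ℤ) - k = 0 := by omega
      simp [h, h']; ring
    · have h' : (j:ℤ) - k ≠ 0 := by omega
      simp [h, h']
  · intro j _
    exact Continuous.intervalIntegrable (by fun_prop) _ _

/-- the limit integrand -/
def gl (x : ℝ) : ℂ := 1 / (D.toRD.mean : ℂ) * Complex.exp (-(D.toRD.s2 / (2 * D.toRD.mean) * x ^ 2))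

/-- truncated integrand -/
def tr (n : ℕ) (x : ℝ) : ℂ :=
  Set.indicator (Set.Ioc (-(Real.pi * Real.sqrt n)) (Real.pi * Real.sqrt n)) (fun x => D.a n (x / Real.sqrt n)) x

lemma gl_integrable : Integrable D.gl := by
  have hb : 0 < D.toRD.s2 / (2 * D.toRD.mean) := div_pos D.toRD.s2_pos (by linarith [D.toRD.mean_pos])
  have := (integrable_cexp_neg_mul_sq (b := ((D.toRD.s2 / (2 * D.toRD.mean) : ℝ) : ℂ)) (by rw [Complex.ofReal_re]; exact hb)).const_mul
    (1 / (D.toRD.mean : ℂ))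
  refine this.congr (Eventually.of_forall fun x => ?_)
  simp only [gl]; push_cast; rw [neg_mul]

lemma tr_meas (n : ℕ) : Measurable (D.tr n) :=
  Measurable.indicator (((D.a_cont n).comp (by fun_prop)).measurable) measurableSet_Ioc

lemma J_tendsto : (∀ n, 1 ≤ n → Integrable (D.tr n)) ∧
    Tendsto (fun n => ∫ x, ‖D.tr n x - D.gl x‖) atTop (𝓝 0) := by
  obtain ⟨R, hR, M, hM, c, hc, hdom⟩ := D.toRD.a_dom
  have hpi := Real.pi_pos
  set c' := min c (Real.log R / Real.pi ^ 2) with hc'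
  have hlog : 0 < Real.log R := Real.log_pos hR
  have hc'0 : 0 < c' := lt_min hc (by positivity)
  have hI : Integrable fun x : ℝ => 2 * M * Real.exp (-c' * x ^ 2) := (integrable_exp_neg_mul_sq hc'0).const_mul _
  have hb : ∀ n : ℕ, 1 ≤ n → ∀ x, ‖D.tr n x‖ ≤ 2 * M * Real.exp (-c' * x ^ 2) := by
    intro n hn x
    have hn0 : (0:ℝ) < n := by exact_mod_cast hn
    have hsn : 0 < Real.sqrt n := Real.sqrt_pos.2 hn0
    unfold tr
    by_cases hx : x ∈ Set.Ioc (-(Real.pi * Real.sqrt n)) (Real.pi * Real.sqrt n)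
    · rw [Set.indicator_of_mem hx]
      have hx2 : |x| ≤ Real.pi * Real.sqrt n := abs_le.2 ⟨hx.1.le, hx.2⟩
      have h1 : |x / Real.sqrt n| ≤ Real.pi := by
        rw [abs_div, abs_of_pos hsn, div_le_iff₀ hsn]; exact hx2
      have hsq : x ^ 2 ≤ Real.pi ^ 2 * n := by
        rw [← sq_abs]
        calc |x| ^ 2 ≤ (Real.pi * Real.sqrt n) ^ 2 := by gcongr
          _ = _ := by rw [mul_pow, Real.sq_sqrt hn0.le]
      refine (hdom _ h1 n).trans ?_
      have e1 : c * n * (x / Real.sqrt n) ^ 2 = c * x ^ 2 := by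
        rw [div_pow, Real.sq_sqrt hn0.le]; field_simp
      rw [e1]
      have e2 : M / R ^ n ≤ M * Real.exp (-c' * x ^ 2) := by
        have : R ^ n = Real.exp (n * Real.log R) := by
          rw [mul_comm, Real.exp_mul, Real.exp_log (by linarith), Real.rpow_natCast]
        rw [this, div_eq_mul_inv, ← Real.exp_neg]
        gcongr
        have : c' * x ^ 2 ≤ Real.log R / Real.pi ^ 2 * (Real.pi ^ 2 * n) := by
          gcongr
          exact min_le_right _ _
        have e3 : Real.log R / Real.pi ^ 2 * (Real.pi ^ 2 * n) = n * Real.log R := by field_simp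
        linarith
      have e4 : M * Real.exp (-(c * x ^ 2)) ≤ M * Real.exp (-c' * x ^ 2) := by
        gcongr
        have : c' ≤ c := min_le_left _ _
        nlinarith [sq_nonneg x]
      linarith
    · rw [Set.indicator_of_notMem hx]; simp; positivity
  have hInt : ∀ n, 1 ≤ n → Integrable (D.tr n) := fun n hn =>
    hI.mono' (D.tr_meas n).aestronglyMeasurable (Eventually.of_forall (hb n hn))
  refine ⟨hInt, ?_⟩
  have h0 : (0:ℝ) = ∫ x : ℝ, (0:ℝ) := by simp
  rw [h0]
  refine tendsto_integral_filter_of_dominated_convergence (fun x => 2 * M * Real.exp (-c' * x ^ 2) + ‖D.gl x‖) ?_ ?_ ?_ ?_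
  · filter_upwards [eventually_ge_atTop 1] with n hn
    exact ((hInt n hn).sub D.gl_integrable).norm.aestronglyMeasurable
  · filter_upwards [eventually_ge_atTop 1] with n hn
    refine Eventually.of_forall fun x => ?_
    rw [norm_norm]
    exact (norm_sub_le _ _).trans (add_le_add (hb n hn x) le_rfl)
  · exact hI.add D.gl_integrable.norm
  · refine Eventually.of_forall fun x => ?_
    have h1 : Tendsto (fun n => D.tr n x) atTop (𝓝 (D.gl x)) := by
      refine (D.toRD.a_scaled x).congr' ?_
      have hs : Tendsto (fun n : ℕ => Real.pi * Real.sqrt n) atTop atTop :=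
        (Real.tendsto_sqrt_atTop.comp tendsto_natCast_atTop_atTop).const_mul_atTop hpi
      filter_upwards [hs.eventually_gt_atTop |x|] with n hn
      rw [tr, Set.indicator_of_mem]
      · rfl
      · exact ⟨(abs_lt.1 hn).1, (abs_lt.1 hn).2.le⟩
    have h2 := (tendsto_iff_norm_sub_tendsto_zero.1 h1)
    exact h2

lemma gl_fourier (z : ℝ) : ∫ x : ℝ, D.gl x * Complex.exp (-(Complex.I * (x * z : ℝ))) =
    ((2 * Real.pi / (D.toRD.mean * D.σ) * stdGaussPDF (z / D.σ) : ℝ) : ℂ) := by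
  have hm := D.toRD.mean_pos
  have hσ := D.σ_pos
  have hpi := Real.pi_pos
  set b : ℝ := D.σ ^ 2 / 2 with hb
  have hb0 : 0 < b := by positivity
  have hbs : D.toRD.s2 / (2 * D.toRD.mean) = b := by rw [hb, D.σ_sq]; field_simp
  have hbs' : (D.toRD.s2 : ℂ) / (2 * D.toRD.mean) = b := by rw [← hbs]; push_cast; rfl
  have key := fourierIntegral_gaussian (b := (b:ℂ)) (by simpa using hb0) (-(z:ℂ))
  have e : ∀ x : ℝ, D.gl x * Complex.exp (-(Complex.I * (x * z : ℝ))) =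
      1 / (D.toRD.mean : ℂ) * (Complex.exp (Complex.I * (-(z:ℂ)) * x) * Complex.exp (-(b:ℂ) * x ^ 2)) := by
    intro x
    rw [gl, hbs']
    have : -(Complex.I * ((x * z : ℝ):ℂ)) = Complex.I * (-(z:ℂ)) * x := by push_cast; ring
    rw [this, neg_mul]; ring
  simp only [e]
  rw [integral_const_mul, key]
  have e1 : ((Real.pi:ℂ) / b) ^ (1/2 : ℂ) = ((Real.sqrt (Real.pi / b) : ℝ) : ℂ) := by
    rw [Real.sqrt_eq_rpow, Complex.ofReal_cpow (by positivity)]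
    push_cast; rfl
  have e2 : Complex.exp (-(-(z:ℂ)) ^ 2 / (4 * b)) = ((Real.exp (-(z / D.σ) ^ 2 / 2) : ℝ) : ℂ) := by
    rw [Complex.ofReal_exp]; congr 1
    have hσc : (D.σ : ℂ) ≠ 0 := by exact_mod_cast hσ.ne'
    rw [hb]; push_cast; field_simp; ring
  have e3 : Real.sqrt (Real.pi / b) = Real.sqrt (2 * Real.pi) / D.σ := by
    rw [Real.sqrt_eq_iff_mul_self_eq (by positivity) (by positivity)]
    have : Real.sqrt (2 * Real.pi) * Real.sqrt (2 * Real.pi) = 2 * Real.pi := Real.mul_self_sqrt (by positivity)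
    rw [div_mul_div_comm, this, hb]; field_simp
  rw [e1, e2, e3, stdGaussPDF]
  have hs : Real.sqrt (2 * Real.pi) ^ 2 = 2 * Real.pi := Real.sq_sqrt (by positivity)
  have hs0 : 0 < Real.sqrt (2 * Real.pi) := by positivity
  have e4 : 1 / D.toRD.mean * (Real.sqrt (2 * Real.pi) / D.σ * Real.exp (-(z / D.σ) ^ 2 / 2)) =
    2 * Real.pi / (D.toRD.mean * D.σ) * ((Real.sqrt (2 * Real.pi))⁻¹ * Real.exp (-(z / D.σ) ^ 2 / 2)) := by
    nth_rewrite 2 [← hs]; field_simp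
  rw [← e4]; push_cast; ring

lemma llt_key (n : ℕ) (hn : 1 ≤ n) (k : ℤ) (hInt : Integrable (D.tr n)) :
    |Real.sqrt n * (2 * Real.pi * (D.q ^ n * D.cnt n k)) -
      2 * Real.pi / (D.toRD.mean * D.σ) * stdGaussPDF ((k - D.μ * n) / (D.σ * Real.sqrt n))| ≤
    ∫ x, ‖D.tr n x - D.gl x‖ := by
  have hn0 : (0:ℝ) < n := by exact_mod_cast hn
  have hsn : 0 < Real.sqrt n := Real.sqrt_pos.2 hn0
  have hpi := Real.pi_pos
  set z : ℝ := (k - D.μ * n) / Real.sqrt n with hz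
  have hzz : (k - D.μ * n) / (D.σ * Real.sqrt n) = z / D.σ := by rw [hz, div_div, mul_comm D.σ]
  have nrm : ∀ x : ℝ, ‖Complex.exp (-(Complex.I * (x * z : ℝ)))‖ = 1 := by
    intro x
    have : -(Complex.I * ((x * z : ℝ):ℂ)) = Complex.I * ((-(x * z) : ℝ):ℂ) := by push_cast; ring
    rw [this]; exact norm_e _
  have cont : Continuous fun x : ℝ => Complex.exp (-(Complex.I * (x * z : ℝ))) := by fun_prop
  have e1 : ∫ x, D.tr n x * Complex.exp (-(Complex.I * (x * z : ℝ))) =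
      ((Real.sqrt n * (2 * Real.pi * (D.q ^ n * D.cnt n k)) : ℝ) : ℂ) := by
    have h1 : ∀ x, D.tr n x * Complex.exp (-(Complex.I * (x * z : ℝ))) =
      Set.indicator (Set.Ioc (-(Real.pi * Real.sqrt n)) (Real.pi * Real.sqrt n))
        (fun x => (fun θ => D.a n θ * Complex.exp (-(Complex.I * (θ * (k - D.μ * n) : ℝ)))) (x / Real.sqrt n)) x := by
      intro x
      unfold tr
      by_cases hx : x ∈ Set.Ioc (-(Real.pi * Real.sqrt n)) (Real.pi * Real.sqrt n)
      · rw [Set.indicator_of_mem hx, Set.indicator_of_mem hx]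
        congr 5
        rw [hz]; ring
      · rw [Set.indicator_of_notMem hx, Set.indicator_of_notMem hx, zero_mul]
    simp only [h1]
    rw [integral_indicator measurableSet_Ioc, ← intervalIntegral.integral_of_le (by nlinarith),
      intervalIntegral.integral_comp_div (fun θ => D.a n θ * Complex.exp (-(Complex.I * (θ * (k - D.μ * n) : ℝ)))) hsn.ne']
    have e3 : -(Real.pi * Real.sqrt n) / Real.sqrt n = -Real.pi := by field_simp
    have e4 : (Real.pi * Real.sqrt n) / Real.sqrt n = Real.pi := by field_simp
    rw [e3, e4, fourier_inv, Complex.real_smul]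
    push_cast; ring
  rw [hzz, ← Real.norm_eq_abs, ← Complex.norm_real, Complex.ofReal_sub, ← e1, ← D.gl_fourier z, ← integral_sub]
  · refine (norm_integral_le_integral_norm _).trans (le_of_eq ?_)
    congr 1
    funext x
    rw [← sub_mul, norm_mul, nrm, mul_one]
  · exact hInt.mul_bdd (c := 1) cont.aestronglyMeasurable (Eventually.of_forall fun x => (nrm x).le)
  · exact D.gl_integrable.mul_bdd (c := 1) cont.aestronglyMeasurable (Eventually.of_forall fun x => (nrm x).le)

lemma pdf_le (x : ℝ) : 0 ≤ stdGaussPDF x ∧ stdGaussPDF x ≤ 1 := by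
  unfold stdGaussPDF
  have hpi := Real.pi_gt_three
  have h1 : 1 ≤ Real.sqrt (2 * Real.pi) := by rw [Real.one_le_sqrt]; linarith
  refine ⟨by positivity, ?_⟩
  have h2 : Real.exp (-x ^ 2 / 2) ≤ 1 := by rw [Real.exp_le_one_iff]; nlinarith [sq_nonneg x]
  exact mul_le_one₀ (inv_le_one_of_one_le₀ h1) (Real.exp_nonneg _) h2

theorem llt (ε : ℝ) (hε : 0 < ε) : ∃ N : ℕ, ∀ n : ℕ, N ≤ n → ∀ k : ℤ,
    |D.σ * Real.sqrt n * (D.cnt n k / pev (fun _ => (1:ℝ)) (D.A n))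
      - stdGaussPDF (((k : ℝ) - D.μ * n) / (D.σ * Real.sqrt n))| ≤ ε := by
  obtain ⟨hInt, hJ⟩ := D.J_tendsto
  obtain ⟨c, hc, hcu⟩ := D.u_lower
  have hm := D.toRD.mean_pos
  have hσ := D.σ_pos
  have hpi := Real.pi_pos
  have hlim : Tendsto (fun n => D.σ / (2 * Real.pi * c) * (∫ x, ‖D.tr n x - D.gl x‖) + |1 / D.toRD.mean - D.u n| / c)
      atTop (𝓝 (D.σ / (2 * Real.pi * c) * 0 + 0 / c)) := by
    refine (hJ.const_mul _).add (Tendsto.div_const ?_ _)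
    have := (tendsto_const_nhds (x := 1 / D.toRD.mean)).sub D.u_tendsto
    rw [sub_self] at this
    simpa using this.abs
  rw [mul_zero, zero_div, add_zero] at hlim
  obtain ⟨N, hN⟩ := eventually_atTop.1 (hlim.eventually (ge_mem_nhds hε))
  refine ⟨max N 1, fun n hn k => ?_⟩
  have hn1 : 1 ≤ n := (le_max_right _ _).trans hn
  refine le_trans ?_ (hN n ((le_max_left _ _).trans hn))
  have key := D.llt_key n hn1 k (hInt n hn1)
  set J := ∫ x, ‖D.tr n x - D.gl x‖ with hJd
  obtain ⟨hp0, hp1⟩ := pdf_le (((k : ℝ) - D.μ * n) / (D.σ * Real.sqrt n))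
  set p := stdGaussPDF (((k : ℝ) - D.μ * n) / (D.σ * Real.sqrt n)) with hp
  have hu : D.cnt n k / pev (fun _ => (1:ℝ)) (D.A n) = D.q ^ n * D.cnt n k / D.u n := by
    rw [u, mul_div_mul_left _ _ (pow_ne_zero _ D.hq.ne')]
  rw [hu]
  have hu0 : 0 < D.u n := D.u_pos n
  set X := D.q ^ n * D.cnt n k with hX
  set U := D.u n with hU
  have e : D.σ * Real.sqrt n * (X / U) - p =
      D.σ / (2 * Real.pi * U) * (Real.sqrt n * (2 * Real.pi * X) - 2 * Real.pi / (D.toRD.mean * D.σ) * p) +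
      p * ((1 / D.toRD.mean - U) / U) := by field_simp; ring
  have hUc := hcu n
  have hJ0 : 0 ≤ J := (abs_nonneg _).trans key
  rw [e]
  refine (abs_add_le _ _).trans (add_le_add ?_ ?_)
  · rw [abs_mul, abs_of_pos (by positivity)]
    gcongr
  · rw [abs_mul, abs_div, abs_of_nonneg hp0, abs_of_pos hu0]
    calc p * (|1 / D.toRD.mean - U| / U) ≤ 1 * (|1 / D.toRD.mean - U| / c) := by gcongr
      _ = _ := one_mul _

end PD
end

noncomputable section
open scoped BigOperators
open Filter MeasureTheory Topology
lemma geom_two (n N : ℕ) (hN : N ≤ n) : ∑ j ∈ Finset.Icc 2 N, (1.62:ℝ) ^ (n - j) ≤ 1.62 ^ n := by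
  have key : ∀ N, N ≤ n → 1 ≤ N → ∑ j ∈ Finset.Icc 2 N, (1.62:ℝ) ^ (n - j) ≤ 1.62 ^ n - 1.62 ^ (n - N) * (1 / 0.62) := by
    intro N hN h1
    induction N, h1 using Nat.le_induction with
    | base =>
      obtain ⟨k, rfl⟩ : ∃ k, n = k + 1 := ⟨n - 1, by omega⟩
      simp only [Nat.add_sub_cancel, pow_succ]
      have : (0:ℝ) ≤ 1.62 ^ k := by positivity
      simp only [show Finset.Icc 2 1 = ∅ from rfl, Finset.sum_empty]
      norm_num at this ⊢
    | succ m hm ih =>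
      rw [Finset.sum_Icc_succ_top (by omega)]
      have := ih (by omega)
      have e : (1.62:ℝ) ^ (n - m) = 1.62 ^ (n - (m+1)) * 1.62 := by
        rw [← pow_succ]; congr 1; omega
      rw [e] at this
      have h3 : (0:ℝ) ≤ 1.62 ^ (n - (m+1)) := by positivity
      refine (add_le_add this le_rfl).trans ?_
      norm_num at h3 ⊢; nlinarith
  rcases Nat.eq_zero_or_pos N with h | h
  · subst h; simp only [show Finset.Icc 2 0 = ∅ from rfl, Finset.sum_empty]; positivity
  · refine (key N hN h).trans ?_
    have h3 : (0:ℝ) ≤ 1.62 ^ (n - N) := by positivity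
    linarith [mul_nonneg h3 (by norm_num : (0:ℝ) ≤ 1 / 0.62)]

lemma LP_growth (t : ℕ) : ∀ n r : ℕ, pev (fun _ => (1:ℝ)) (LP t 2 r n) ≤ 1.62 ^ n := by
  intro n
  induction n using Nat.strong_induction_on with
  | _ n ih =>
    intro r
    rcases Nat.eq_zero_or_pos n with h | h
    · subst h; rw [LP_zero _ _ _ (by norm_num), ← pow_one Polynomial.X, pev_X_pow]; simp
    · rw [LP_succ t 2 r n (by norm_num) h, pev_sum]
      refine le_trans (Finset.sum_le_sum fun j hj => ?_) (geom_two n (min r n) (min_le_right _ _))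
      rw [Finset.mem_Icc] at hj
      rw [pev_mul' _ (fun _ => 1) (fun _ => 1) (fun _ _ => by simp), pev_X_pow, one_mul]
      exact ih _ (by omega) _

lemma LP_nonneg (t b r n : ℕ) : 0 ≤ pev (fun _ => (1:ℝ)) (LP t b r n) :=
  pev_nonneg _ _ fun _ _ => zero_le_one

lemma BP_nonneg (t n : ℕ) : 0 ≤ pev (fun _ => (1:ℝ)) (BP t n) :=
  pev_nonneg _ _ fun _ _ => zero_le_one

lemma BP_growth (t n : ℕ) : pev (fun _ => (1:ℝ)) (BP t n) ≤ 1.62 ^ n := by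
  cases n with
  | zero => simp [BP, pev_zero]
  | succ n =>
    refine (LP_growth t n _).trans ?_
    gcongr <;> norm_num

lemma BP_coeff_of_mem {t n : ℕ} {l : List ℕ} (hl : l ∈ BL t n) : (BP t (n+1)).coeff (dL t (t*1) l) ≠ 0 := by
  rw [BP_eq_sum, Polynomial.finsetSum_coeff]
  refine (Finset.sum_pos' (fun _ _ => Nat.zero_le _) ⟨l, hl, ?_⟩).ne'
  simp

lemma BP_deg (t m k : ℕ) (h : (BP t m).coeff k ≠ 0) : k ≤ m := by
  cases m with
  | zero => simp [BP] at h
  | succ n =>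
    rw [BP_eq_sum, Polynomial.finsetSum_coeff] at h
    obtain ⟨l, hl, h2⟩ := Finset.exists_ne_zero_of_sum_ne_zero h
    rw [Polynomial.coeff_X_pow] at h2
    have : k = dL t (t*1) l := by by_contra h3; rw [if_neg h3] at h2; exact h2 rfl
    rw [this]; exact BL_dL_le hl

lemma BP_card (t n : ℕ) : pev (fun _ => (1:ℝ)) (BP t (n+1)) = (BL t n).card := by
  rw [BP_eq_sum, pev_sum]
  simp [pev_X_pow]

lemma BL_card_ge {t n : ℕ} (s : Finset (List ℕ)) (hs : s ⊆ BL t n) (c : ℕ) (hc : c ≤ s.card) :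
    (c:ℝ) ≤ pev (fun _ => (1:ℝ)) (BP t (n+1)) := by
  rw [BP_card]; exact_mod_cast hc.trans (Finset.card_le_card hs)

/-- the block generating function at v = 1 -/
def PG (t : ℕ) (q : ℝ) : ℝ := ∑' m, q ^ m * pev (fun _ => (1:ℝ)) (BP t m)

lemma PG_bound (t : ℕ) {q : ℝ} (hq : |q| ≤ 0.6) (m : ℕ) : ‖q ^ m * pev (fun _ => (1:ℝ)) (BP t m)‖ ≤ (0.972:ℝ) ^ m := by
  rw [norm_mul, norm_pow, Real.norm_eq_abs, Real.norm_eq_abs, abs_of_nonneg (BP_nonneg t m)]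
  calc |q| ^ m * pev (fun _ => (1:ℝ)) (BP t m) ≤ 0.6 ^ m * 1.62 ^ m := by
        gcongr
        · exact BP_nonneg t m
        · exact BP_growth t m
    _ = _ := by rw [← mul_pow]; norm_num

lemma PG_summable (t : ℕ) {q : ℝ} (hq : |q| ≤ 0.6) : Summable fun m => q ^ m * pev (fun _ => (1:ℝ)) (BP t m) :=
  Summable.of_norm_bounded (summable_geometric_of_lt_one (by norm_num) (by norm_num)) (PG_bound t hq)

lemma PG_cont (t : ℕ) : ContinuousOn (PG t) (Set.Icc 0 0.6) := by
  refine continuousOn_tsum (u := fun m => (0.972:ℝ) ^ m) (fun m => by fun_prop)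
    (summable_geometric_of_lt_one (by norm_num) (by norm_num)) fun m q hq => ?_
  exact PG_bound t (abs_le.2 ⟨by linarith [hq.1], hq.2⟩) m

lemma PG_large (t : ℕ) (ht : 2 ≤ t) : 1 < PG t 0.6 := by
  have h := (PG_summable t (q := 0.6) (by rw [abs_of_pos] <;> norm_num)).sum_le_tsum (Finset.range 9)
    (fun m _ => mul_nonneg (by positivity) (BP_nonneg t m))
  refine lt_of_lt_of_le ?_ h
  have b1 := BL_card_ge (t := t) (n := 0) {[]} (by intro l hl; simp at hl; subst hl; simp [mem_BL, VL]) 1 (by simp)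
  have b3 := BL_card_ge (t := t) (n := 2) {[2]} (by intro l hl; simp at hl; subst hl; simp [mem_BL, VL, ht]) 1 (by simp)
  have b5 := BL_card_ge (t := t) (n := 4) {[2,2]} (by
    intro l hl; simp at hl; subst hl; simp [mem_BL, VL, ht]; omega) 1 (by simp)
  have b6 := BL_card_ge (t := t) (n := 5) {[2,3]} (by
    intro l hl; simp at hl; subst hl; simp [mem_BL, VL, ht]; omega) 1 (by simp)
  have b7 := BL_card_ge (t := t) (n := 6) {[2,4],[2,2,2]} (by
    intro l hl; simp at hl; rcases hl with hl | hl <;> subst hl <;> simp [mem_BL, VL, ht] <;> omega) 2 (by decide)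
  have b8 := BL_card_ge (t := t) (n := 7) {[2,2,3]} (by
    intro l hl; simp at hl; subst hl; simp [mem_BL, VL, ht]; omega) 1 (by simp)
  have b2 := BP_nonneg t 2
  have b4 := BP_nonneg t 4
  simp only [Finset.sum_range_succ, Finset.sum_range_zero]
  simp only [zero_add, Nat.reduceAdd, Nat.cast_one, Nat.cast_ofNat] at b1 b3 b5 b6 b7 b8
  have b0 := BP_nonneg t 0
  norm_num
  linarith

lemma exists_q0 (t : ℕ) (ht : 2 ≤ t) : ∃ q : ℝ, 0 < q ∧ q < 0.6 ∧ PG t q = 1 := by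
  have h0 : PG t 0 = 0 := by
    unfold PG
    rw [tsum_eq_single 0]
    · simp [BP, pev_zero]
    · intro m hm; simp [hm]
  have := intermediate_value_Icc (by norm_num : (0:ℝ) ≤ 0.6) (PG_cont t)
  obtain ⟨q, hq, hq1⟩ := this (show (1:ℝ) ∈ Set.Icc (PG t 0) (PG t 0.6) from
    ⟨by rw [h0]; norm_num, (PG_large t ht).le⟩)
  refine ⟨q, lt_of_le_of_ne hq.1 ?_, lt_of_le_of_ne hq.2 ?_, hq1⟩
  · rintro rfl; rw [h0] at hq1; norm_num at hq1
  · rintro rfl; linarith [PG_large t ht]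

def q0 (t : ℕ) (ht : 2 ≤ t) : ℝ := (exists_q0 t ht).choose
lemma q0_pos (t : ℕ) (ht : 2 ≤ t) : 0 < q0 t ht := (exists_q0 t ht).choose_spec.1
lemma q0_lt (t : ℕ) (ht : 2 ≤ t) : q0 t ht < 0.6 := (exists_q0 t ht).choose_spec.2.1
lemma q0_PG (t : ℕ) (ht : 2 ≤ t) : PG t (q0 t ht) = 1 := (exists_q0 t ht).choose_spec.2.2

lemma q0_abs (t : ℕ) (ht : 2 ≤ t) : |q0 t ht| ≤ 0.6 := by
  rw [abs_of_pos (q0_pos t ht)]; exact (q0_lt t ht).le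

lemma poly_geo_summable (k : ℕ) {r : ℝ} (h0 : 0 ≤ r) (h1 : r < 1) : Summable fun m : ℕ => (m:ℝ) ^ k * r ^ m :=
  summable_pow_mul_geometric_of_norm_lt_one k (by rw [Real.norm_eq_abs, abs_of_nonneg h0]; exact h1)

lemma w_le (t : ℕ) (ht : 2 ≤ t) (m : ℕ) : q0 t ht ^ m * pev (fun _ => (1:ℝ)) (BP t m) ≤ (0.972:ℝ) ^ m :=
  (le_abs_self _).trans (PG_bound t (q0_abs t ht) m)

lemma w_nn (t : ℕ) (ht : 2 ≤ t) (m : ℕ) : 0 ≤ q0 t ht ^ m * pev (fun _ => (1:ℝ)) (BP t m) :=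
  mul_nonneg (pow_nonneg (q0_pos t ht).le _) (BP_nonneg t m)

lemma N_summable (t : ℕ) (ht : 2 ≤ t) :
    Summable fun m : ℕ => (m:ℝ) * (q0 t ht ^ m * pev (fun _ => (1:ℝ)) (BP t m)) := by
  refine Summable.of_nonneg_of_le (fun m => mul_nonneg (by positivity) (w_nn t ht m)) (fun m => ?_)
    (poly_geo_summable 1 (r := 0.972) (by norm_num) (by norm_num))
  rw [pow_one]
  exact mul_le_mul_of_nonneg_left (w_le t ht m) (by positivity)

lemma BPk_le (t m : ℕ) : pev (fun k => (k:ℝ)) (BP t m) ≤ m * pev (fun _ => (1:ℝ)) (BP t m) := by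
  rw [← pev_const_mul]
  refine pev_mono _ _ _ fun k hk => ?_
  rw [mul_one]; exact_mod_cast BP_deg t m k hk

lemma D_summable (t : ℕ) (ht : 2 ≤ t) :
    Summable fun m : ℕ => (q0 t ht ^ m * pev (fun k => (k:ℝ)) (BP t m)) := by
  have hq := q0_pos t ht
  refine Summable.of_nonneg_of_le (fun m => mul_nonneg (by positivity) (pev_nonneg _ _ fun _ _ => by positivity)) (fun m => ?_)
    (N_summable t ht)
  calc _ ≤ q0 t ht ^ m * (m * pev (fun _ => (1:ℝ)) (BP t m)) := by gcongr; exact BPk_le t m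
    _ = _ := by ring

/-- mean block size -/
def EN (t : ℕ) (ht : 2 ≤ t) : ℝ := ∑' m : ℕ, (m:ℝ) * (q0 t ht ^ m * pev (fun _ => (1:ℝ)) (BP t m))
def ED (t : ℕ) (ht : 2 ≤ t) : ℝ := ∑' m : ℕ, (q0 t ht ^ m * pev (fun k => (k:ℝ)) (BP t m))

lemma EN_pos (t : ℕ) (ht : 2 ≤ t) : 0 < EN t ht := by
  have b1 := BL_card_ge (t := t) (n := 0) {[]} (by intro l hl; simp at hl; subst hl; simp [mem_BL, VL]) 1 (by simp)
  refine (N_summable t ht).tsum_pos (fun m => mul_nonneg (by positivity) (w_nn t ht m)) 1 ?_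
  have := q0_pos t ht
  have : 0 < pev (fun _ => (1:ℝ)) (BP t 1) := lt_of_lt_of_le (by norm_num) b1
  positivity

lemma cexp_period {θ : ℝ} (hθ : |θ| ≤ Real.pi) (h : Complex.exp (Complex.I * θ) = 1) : θ = 0 := by
  rw [Complex.exp_eq_one_iff] at h
  obtain ⟨n, hn⟩ := h
  have h2 : Complex.I * (θ:ℂ) = Complex.I * ((n * (2 * Real.pi) : ℝ) : ℂ) := by rw [hn]; push_cast; ring
  have h3 := mul_left_cancel₀ Complex.I_ne_zero h2
  have h4 : θ = n * (2 * Real.pi) := by exact_mod_cast h3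
  have hpi := Real.pi_pos
  have h5 : |(n:ℝ)| < 1 := by
    rw [h4, abs_mul, abs_of_pos (by positivity : (0:ℝ) < 2 * Real.pi)] at hθ
    nlinarith [abs_nonneg (n:ℝ)]
  have h6 : n = 0 := by
    rw [← Int.cast_abs] at h5
    have : |n| < 1 := by exact_mod_cast h5
    exact Int.abs_lt_one_iff.1 this
  rw [h4, h6]; simp

lemma nonlat_aux {t : ℕ} (ht : 2 ≤ t) {μ : ℝ} (z : ℂ) (θ : ℝ) (hθ : |θ| ≤ Real.pi)
    (h : ∀ m k : ℕ, (BP t m).coeff k ≠ 0 → z ^ m * Complex.exp (Complex.I * θ * ((k:ℝ) - μ * m : ℝ)) = 1) :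
    z = 1 ∧ θ = 0 := by
  set ζ := z * Complex.exp (Complex.I * (-(θ * μ) : ℝ)) with hζ
  set e := Complex.exp (Complex.I * θ) with he
  have h' : ∀ m k : ℕ, (BP t m).coeff k ≠ 0 → ζ ^ m * e ^ k = 1 := by
    intro m k hk
    rw [← h m k hk, hζ, he, mul_pow, ← Complex.exp_nat_mul, ← Complex.exp_nat_mul, mul_assoc, ← Complex.exp_add]
    congr 2; push_cast; ring
  have h1 := h' 1 _ (BP_coeff_of_mem (t := t) (n := 0) (l := []) (by simp [mem_BL, VL]))
  simp only [dL, pow_one] at h1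
  have he0 : e ≠ 0 := Complex.exp_ne_zero _
  have e1 : e = 1 := by
    rcases eq_or_lt_of_le ht with h2 | h2
    · subst h2
      have h3 := h' 3 _ (BP_coeff_of_mem (t := 2) (n := 2) (l := [2]) (by simp [mem_BL, VL]))
      have h5 := h' 5 _ (BP_coeff_of_mem (t := 2) (n := 4) (l := [2,2]) (by simp [mem_BL, VL]))
      simp [dL] at h3 h5
      have a1 : ζ ^ 2 = 1 := by
        have : ζ ^ 3 * e = ζ ^ 2 * (ζ * e) := by ring
        rw [this, h1, mul_one] at h3; exact h3
      have a2 : ζ ^ 5 * e ^ 2 = ζ ^ 2 * ζ * (ζ * e) ^ 2 := by ring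
      rw [h5, h1, a1] at a2
      have : ζ = 1 := by simpa using a2.symm
      rw [this, one_mul] at h1; exact h1
    · have h3 := h' 3 _ (BP_coeff_of_mem (t := t) (n := 2) (l := [2]) (by simp [mem_BL, VL, ht]))
      have h2' : 2 < t := h2
      simp [dL, h2'] at h3
      have a2 : ζ ^ 3 * e ^ 2 = ζ * (ζ * e) ^ 2 := by ring
      rw [h3, h1] at a2
      have : ζ = 1 := by simpa using a2.symm
      rw [this, one_mul] at h1; exact h1
  have hθ0 := cexp_period hθ e1
  refine ⟨?_, hθ0⟩
  rw [e1, mul_one] at h1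
  rw [hζ, hθ0] at h1
  simpa using h1

/-- the renewal data for `t`-ary trees -/
def pd (t : ℕ) (ht : 2 ≤ t) : PD where
  P := BP t
  A := TP t
  q := q0 t ht
  μ := ED t ht / EN t ht
  R0 := 1.02
  hq := q0_pos t ht
  hR0 := by norm_num
  P_zero := rfl
  P_deg := BP_deg t
  P_one := by
    have := BP_coeff_of_mem (t := t) (n := 0) (l := []) (by simp [mem_BL, VL])
    simpa [dL] using this
  A_zero := by simp [TP]
  A_succ := TP_renewal t ht
  A_pos := by
    intro n
    rcases Nat.eq_zero_or_pos n with h | h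
    · subst h; simp [TP, pev_one]
    · rw [TP_eq_sum t n h, pev_sum]
      simp only [pev_X_pow, Finset.sum_const, nsmul_eq_mul, mul_one]
      exact_mod_cast TL_pos t n (by omega) h
  hsum := by
    have := (PG_summable t (q0_abs t ht)).hasSum
    have h2 := q0_PG t ht
    unfold PG at h2
    rwa [h2] at this
  hexp := by
    refine Summable.of_nonneg_of_le (fun m => mul_nonneg (mul_nonneg (by positivity) (w_nn t ht m)) (by positivity)) (fun m => ?_)
      (poly_geo_summable 3 (r := 0.972 * 1.02) (by norm_num) (by norm_num))
    have hw := w_le t ht m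
    calc (m:ℝ) ^ 3 * (q0 t ht ^ m * pev (fun _ => (1:ℝ)) (BP t m)) * (1.02:ℝ) ^ m
        ≤ (m:ℝ) ^ 3 * (0.972:ℝ) ^ m * (1.02:ℝ) ^ m := by gcongr
      _ = _ := by rw [mul_pow]; ring
  hmean := by
    have h1 := ((D_summable t ht).hasSum).sub ((N_summable t ht).hasSum.mul_left (ED t ht / EN t ht))
    have h2 : (∑' m : ℕ, (q0 t ht ^ m * pev (fun k => (k:ℝ)) (BP t m))) - (ED t ht / EN t ht) *
      (∑' m : ℕ, (m:ℝ) * (q0 t ht ^ m * pev (fun _ => (1:ℝ)) (BP t m))) = 0 := by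
      have := (EN_pos t ht).ne'
      show ED t ht - ED t ht / EN t ht * EN t ht = 0
      field_simp; ring
    rw [h2] at h1
    refine h1.congr_fun ?_
    intro m
    have : pev (fun k => (k:ℝ) - ED t ht / EN t ht * m) (BP t m) = pev (fun k => (k:ℝ)) (BP t m) +
      pev (fun k => (- (ED t ht / EN t ht * m)) * 1) (BP t m) := by
      rw [← pev_fadd]; congr 1; funext k; ring
    rw [this, pev_const_mul]; ring
  nondeg := by
    by_cases h : (1:ℝ) - ED t ht / EN t ht = 0
    · refine ⟨3, _, BP_coeff_of_mem (t := t) (n := 2) (l := [2]) (by simp [mem_BL, VL, ht]), ?_⟩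
      have h1 : ED t ht / EN t ht = 1 := by linarith
      rw [h1]
      have : dL t (t * 1) [2] ≤ 2 := by simp [dL]; split_ifs <;> simp
      have h2 : (dL t (t * 1) [2] : ℝ) ≤ 2 := by exact_mod_cast this
      intro h3
      push_cast at h3
      linarith
    · refine ⟨1, _, BP_coeff_of_mem (t := t) (n := 0) (l := []) (by simp [mem_BL, VL]), ?_⟩
      simpa [dL] using h
  nonlat := fun z θ hθ h => nonlat_aux ht z θ hθ h

lemma pev_TP {t n : ℕ} (hn : 1 ≤ n) (φ : ℕ → ℝ) : pev φ (TP t n) = ∑ l ∈ TL t n, φ (dL t 1 l) := by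
  rw [TP_eq_sum t n hn, pev_sum]; simp only [pev_X_pow]

lemma pev_TP_one {t n : ℕ} (hn : 1 ≤ n) : pev (fun _ => (1:ℝ)) (TP t n) = (TL t n).card := by
  rw [pev_TP hn]; simp

lemma exp_TP {t n : ℕ} (ht : 2 ≤ t) (hn : 1 ≤ n) (F : ℕ → ℝ) :
    forestExp t 1 n (fun T => F T.distinctDepths) = pev F (TP t n) / pev (fun _ => (1:ℝ)) (TP t n) := by
  rw [forestExp_eq t n (by omega), pev_TP hn, pev_TP_one hn]

lemma prob_TP {t n : ℕ} (ht : 2 ≤ t) (hn : 1 ≤ n) (Q : ℕ → Prop) :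
    forestProb t 1 n {T | Q T.distinctDepths} =
      pev (fun k => Set.indicator {k : ℕ | Q k} (fun _ => (1:ℝ)) k) (TP t n) / pev (fun _ => (1:ℝ)) (TP t n) := by
  classical
  rw [forestProb_eq t n (by omega), pev_TP hn, pev_TP_one hn]
  congr 1
  rw [Finset.card_filter]
  push_cast
  refine Finset.sum_congr rfl fun l _ => ?_
  simp [Set.indicator_apply]

/-- all the probabilistic claims -/
theorem prob_claims (t : ℕ) (ht : 2 ≤ t) :
      (∃ C : ℝ, ∀ n : ℕ, 1 ≤ n →
        |forestExp t 1 n (fun T => (T.distinctDepths : ℝ)) - (pd t ht).μ * n| ≤ C) ∧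
      (∃ C : ℝ, ∀ n : ℕ, 1 ≤ n →
        |forestVar t 1 n (fun T => (T.distinctDepths : ℝ)) - (pd t ht).σ^2 * n| ≤ C) ∧
      (∀ x : ℝ, Filter.Tendsto
        (fun n : ℕ => forestProb t 1 n
          {T | ((T.distinctDepths : ℝ) - (pd t ht).μ * n) / ((pd t ht).σ * Real.sqrt n) ≤ x})
        Filter.atTop (nhds (stdGaussCDF x))) ∧
      (∀ ε : ℝ, 0 < ε → ∃ N : ℕ, ∀ n : ℕ, N ≤ n → ∀ k : ℤ,
        |(pd t ht).σ * Real.sqrt n * forestProb t 1 n {T | (T.distinctDepths : ℤ) = k}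
            - stdGaussPDF (((k : ℝ) - (pd t ht).μ * n) / ((pd t ht).σ * Real.sqrt n))| ≤ ε) := by
  obtain ⟨⟨C1, h1⟩, C2, h2⟩ := (pd t ht).mean_var
  refine ⟨⟨C1, fun n hn => ?_⟩, ⟨C2, fun n hn => ?_⟩, fun x => ?_, fun ε hε => ?_⟩
  · rw [exp_TP ht hn (fun k => (k:ℝ))]; exact h1 n
  · rw [forestVar, exp_TP ht hn (fun k => (k:ℝ)), exp_TP ht hn (fun k => (k:ℝ)^2), (pd t ht).σ_sq]; exact h2 n
  · refine ((pd t ht).clt x).congr' ?_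
    filter_upwards [eventually_ge_atTop 1] with n hn
    exact (prob_TP ht hn (fun k => ((k : ℝ) - (pd t ht).μ * n) / ((pd t ht).σ * Real.sqrt n) ≤ x)).symm
  · obtain ⟨N, hN⟩ := (pd t ht).llt ε hε
    refine ⟨max N 1, fun n hn k => ?_⟩
    rw [prob_TP ht (le_trans (le_max_right _ _) hn) (fun j => (j:ℤ) = k)]
    exact hN n (le_trans (le_max_left _ _) hn) k

end

noncomputable section
open scoped BigOperators
open Filter MeasureTheory Topology
section seqs
variable {𝕜 : Type*} [NormedField 𝕜]

def yq (t : ℕ) (q : 𝕜) : ℕ → 𝕜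
  | 0 => q
  | i + 1 => q * (yq t q i) ^ t

def YQ (t : ℕ) (q : 𝕜) (i : ℕ) : 𝕜 := yq t q i / (1 - yq t q i)

def WQ (t : ℕ) (q v : 𝕜) (i : ℕ) : 𝕜 := 1 - v * (1 + YQ t q i)

def piQ (t : ℕ) (q v : 𝕜) (k i : ℕ) : 𝕜 := ∏ l ∈ Finset.range i, WQ t q v (k + l)

def SQ (t : ℕ) (q v : 𝕜) (k : ℕ) : 𝕜 := ∑' i, piQ t q v k i * YQ t q (k + i)

lemma yq_norm {t : ℕ} (ht : 2 ≤ t) {q : 𝕜} (hq : ‖q‖ ≤ 0.65) (i : ℕ) : ‖yq t q i‖ ≤ 0.65 ^ (2 * i + 1) := by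
  induction i with
  | zero => simpa [yq] using hq
  | succ i ih =>
    rw [yq, norm_mul, norm_pow]
    have h1 : ‖yq t q i‖ ≤ 1 := ih.trans (pow_le_one₀ (by norm_num) (by norm_num))
    have h2 : ‖yq t q i‖ ^ t ≤ ‖yq t q i‖ ^ 2 := pow_le_pow_of_le_one (norm_nonneg _) h1 ht
    have h3 : ‖yq t q i‖ ^ 2 ≤ (0.65 ^ (2 * i + 1)) ^ 2 := pow_le_pow_left₀ (norm_nonneg _) ih 2
    calc ‖q‖ * ‖yq t q i‖ ^ t ≤ 0.65 * (0.65 ^ (2 * i + 1)) ^ 2 := by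
          gcongr; exact h2.trans h3
      _ = 0.65 ^ (4 * i + 3) := by ring
      _ ≤ 0.65 ^ (2 * (i + 1) + 1) := pow_le_pow_of_le_one (by norm_num) (by norm_num) (by omega)

lemma yq_norm' {t : ℕ} (ht : 2 ≤ t) {q : 𝕜} (hq : ‖q‖ ≤ 0.65) (i : ℕ) : ‖yq t q i‖ ≤ 0.65 ^ (i + 1) :=
  (yq_norm ht hq i).trans (pow_le_pow_of_le_one (by norm_num) (by norm_num) (by omega))

lemma yq_norm_le {t : ℕ} (ht : 2 ≤ t) {q : 𝕜} (hq : ‖q‖ ≤ 0.65) (i : ℕ) : ‖yq t q i‖ ≤ 0.65 :=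
  (yq_norm ht hq i).trans (by
    calc (0.65:ℝ) ^ (2*i+1) ≤ 0.65 ^ 1 := pow_le_pow_of_le_one (by norm_num) (by norm_num) (by omega)
      _ = 0.65 := by norm_num)

lemma one_sub_norm (y : 𝕜) : 1 - ‖y‖ ≤ ‖1 - y‖ := by
  have := norm_sub_norm_le (1:𝕜) y; rwa [norm_one] at this

lemma yq_ne {t : ℕ} (ht : 2 ≤ t) {q : 𝕜} (hq : ‖q‖ ≤ 0.65) (i : ℕ) : 1 - yq t q i ≠ 0 := by
  have h1 := one_sub_norm (yq t q i)
  have h2 := yq_norm_le ht hq i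
  intro h; rw [h, norm_zero] at h1; linarith

lemma YQ_norm {t : ℕ} (ht : 2 ≤ t) {q : 𝕜} (hq : ‖q‖ ≤ 0.65) (i : ℕ) : ‖YQ t q i‖ ≤ 3 * ‖yq t q i‖ := by
  rw [YQ, norm_div]
  have h1 := one_sub_norm (yq t q i)
  have h2 := yq_norm_le ht hq i
  rw [div_le_iff₀ (by linarith)]
  have h0 := norm_nonneg (yq t q i)
  nlinarith

lemma WQ_eq {t : ℕ} (ht : 2 ≤ t) {q : 𝕜} (hq : ‖q‖ ≤ 0.65) (v : 𝕜) (i : ℕ) :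
    WQ t q v i = (1 - v - yq t q i) / (1 - yq t q i) := by
  have := yq_ne ht hq i
  rw [WQ, YQ]; field_simp; ring

lemma WQ_norm {t : ℕ} (ht : 2 ≤ t) {q v : 𝕜} (hq : ‖q‖ ≤ 0.65) (hv : ‖1 - v‖ ≤ 0.1) (i : ℕ) :
    ‖WQ t q v i‖ ≤ (if i = 0 then 2.2 else 1) := by
  rw [WQ_eq ht hq, norm_div]
  have h1 := one_sub_norm (yq t q i)
  have h2 := yq_norm_le ht hq i
  rw [div_le_iff₀ (by linarith)]
  have h3 := norm_sub_le (1 - v) (yq t q i)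
  split_ifs with h
  · linarith
  · have : ‖yq t q i‖ ≤ 0.65 ^ 3 := (yq_norm ht hq i).trans
      (pow_le_pow_of_le_one (by norm_num) (by norm_num) (by omega))
    norm_num at this ⊢
    linarith

lemma piQ_norm {t : ℕ} (ht : 2 ≤ t) {q v : 𝕜} (hq : ‖q‖ ≤ 0.65) (hv : ‖1 - v‖ ≤ 0.1) (k i : ℕ) :
    ‖piQ t q v k i‖ ≤ 2.2 := by
  have key : ∀ k : ℕ, 1 ≤ k → ∀ i, ‖piQ t q v k i‖ ≤ 1 := by
    intro k hk i
    rw [piQ, norm_prod]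
    refine Finset.prod_le_one (fun _ _ => norm_nonneg _) fun l _ => ?_
    have := WQ_norm ht hq hv (k + l)
    rwa [if_neg (by omega)] at this
  rcases Nat.eq_zero_or_pos k with h | h
  · subst h
    rcases i with _ | i
    · simp [piQ]; norm_num
    · have : piQ t q v 0 (i+1) = WQ t q v 0 * piQ t q v 1 i := by
        rw [piQ, Finset.prod_range_succ']
        simp only [piQ]
        rw [mul_comm]; congr 1
        exact Finset.prod_congr rfl fun l _ => by congr 1; omega
      rw [this, norm_mul]
      have h1 := WQ_norm ht hq hv 0
      simp only [if_true] at h1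
      have h2 := key 1 le_rfl i
      have := norm_nonneg (piQ t q v 1 i)
      nlinarith [norm_nonneg (WQ t q v 0)]
  · exact (key k h i).trans (by norm_num)

lemma SQ_term {t : ℕ} (ht : 2 ≤ t) {q v : 𝕜} (hq : ‖q‖ ≤ 0.65) (hv : ‖1 - v‖ ≤ 0.1) (k i : ℕ) :
    ‖piQ t q v k i * YQ t q (k + i)‖ ≤ 7 * 0.65 ^ i := by
  rw [norm_mul]
  have h1 := piQ_norm ht hq hv k i
  have h2 := YQ_norm ht hq (k+i)
  have h3 : ‖yq t q (k+i)‖ ≤ 0.65 ^ i := (yq_norm ht hq _).trans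
      (pow_le_pow_of_le_one (by norm_num) (by norm_num) (by omega))
  have h4 := norm_nonneg (YQ t q (k+i))
  have h5 := norm_nonneg (piQ t q v k i)
  nlinarith

lemma geo65 (C : ℝ) : Summable fun i : ℕ => C * (0.65:ℝ) ^ i :=
  (summable_geometric_of_lt_one (by norm_num) (by norm_num)).mul_left C

variable [CompleteSpace 𝕜]

lemma SQ_summable {t : ℕ} (ht : 2 ≤ t) {q v : 𝕜} (hq : ‖q‖ ≤ 0.65) (hv : ‖1 - v‖ ≤ 0.1) (k : ℕ) :
    Summable fun i => piQ t q v k i * YQ t q (k + i) :=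
  Summable.of_norm_bounded (geo65 7) (SQ_term ht hq hv k)

lemma SQ_rec {t : ℕ} (ht : 2 ≤ t) {q v : 𝕜} (hq : ‖q‖ ≤ 0.65) (hv : ‖1 - v‖ ≤ 0.1) (k : ℕ) :
    SQ t q v k = YQ t q k + WQ t q v k * SQ t q v (k + 1) := by
  rw [SQ, (SQ_summable ht hq hv k).tsum_eq_zero_add]
  congr 1
  · simp [piQ]
  · rw [SQ, ← tsum_mul_left]
    refine tsum_congr fun i => ?_
    have : piQ t q v k (i+1) = WQ t q v k * piQ t q v (k+1) i := by
      rw [piQ, Finset.prod_range_succ']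
      simp only [piQ]
      rw [mul_comm]; congr 1
      exact Finset.prod_congr rfl fun l _ => by congr 1; omega
    rw [this, show k + (i+1) = k + 1 + i by omega]; ring

end seqs

end

noncomputable section
open scoped BigOperators
open Filter MeasureTheory Topology
lemma geom_two' (n N : ℕ) (hN : N ≤ n) : 1.02 * ∑ j ∈ Finset.Icc 2 N, (1.63:ℝ) ^ (n - j) ≤ 1.63 ^ n := by
  have key : ∀ N, N ≤ n → 1 ≤ N → 1.02 * ∑ j ∈ Finset.Icc 2 N, (1.63:ℝ) ^ (n - j) + 1.63 ^ (n - N) * 1.63 ≤ 1.63 ^ n := by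
    intro N
    induction N with
    | zero => intro _ h; omega
    | succ N ih =>
      intro h1 _
      rcases Nat.eq_zero_or_pos N with h | h
      · subst h
        simp only [zero_add]
        rw [Finset.Icc_eq_empty (by norm_num), Finset.sum_empty, ← pow_succ]
        rw [show n - 1 + 1 = n by omega]; simp
      · rw [Finset.sum_Icc_succ_top (by omega)]
        have := ih (by omega) h
        rw [show n - N = n - (N+1) + 1 by omega, pow_succ] at this
        have h3 : (0:ℝ) ≤ 1.63 ^ (n - (N+1)) := by positivity
        nlinarith
  rcases Nat.eq_zero_or_pos N with h | h
  · subst h; simp; positivity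
  · have := key N hN h
    have h3 : (0:ℝ) ≤ 1.63 ^ (n - N) * 1.63 := by positivity
    linarith

lemma LPv_growth (t : ℕ) {v : ℝ} (hv0 : 0 ≤ v) (hv : v ≤ 1.02) : ∀ n r : ℕ,
    pev (fun k => v ^ k) (LP t 2 r n) ≤ 1.02 * 1.63 ^ n := by
  intro n
  induction n using Nat.strong_induction_on with
  | _ n ih =>
    intro r
    rcases Nat.eq_zero_or_pos n with h | h
    · subst h
      rw [LP_zero t 2 r (by norm_num), ← pow_one Polynomial.X, pev_X_pow]; simpa using hv
    · rw [LP_succ t 2 r n (by norm_num) h, pev_sum]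
      calc _ ≤ ∑ j ∈ Finset.Icc 2 (min r n), 1.02 * (1.02 * (1.63:ℝ) ^ (n - j)) := by
            refine Finset.sum_le_sum fun j hj => ?_
            rw [Finset.mem_Icc] at hj
            rw [pev_mul' (fun k => v ^ k) (fun k => v ^ k) (fun k => v ^ k) (fun j k => pow_add v j k), pev_X_pow]
            have h1 := ih (n - j) (by omega) (t * j)
            have h2 : v ^ (if j < r then 1 else 0) ≤ 1.02 := by
              split_ifs <;> norm_num <;> linarith
            have h3 : 0 ≤ pev (fun k => v ^ k) (LP t 2 (t*j) (n-j)) := pev_nonneg _ _ fun _ _ => by positivity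
            gcongr
        _ = 1.02 * (1.02 * ∑ j ∈ Finset.Icc 2 (min r n), (1.63:ℝ) ^ (n - j)) := by
            rw [← Finset.mul_sum, ← Finset.mul_sum]
        _ ≤ _ := by gcongr; exact geom_two' n _ (min_le_right _ _)

structure QV (q v : ℝ) : Prop where
  q0 : 0 ≤ q
  q1 : q ≤ 0.6
  v0 : 0.98 ≤ v
  v1 : v ≤ 1.02

namespace QV
variable {q v : ℝ}

lemma hq (H : QV q v) : ‖q‖ ≤ 0.65 := by rw [Real.norm_eq_abs, abs_of_nonneg H.q0]; linarith [H.q1]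
lemma hv (H : QV q v) : ‖1 - v‖ ≤ 0.1 := by rw [Real.norm_eq_abs, abs_le]; constructor <;> linarith [H.v0, H.v1]

end QV

def KK (t : ℕ) (q v : ℝ) (r : ℕ) : ℝ := ∑' n, q ^ n * pev (fun k => v ^ k) (LP t 2 r n)

lemma KK_term {q v : ℝ} (H : QV q v) (t r n : ℕ) :
    ‖q ^ n * pev (fun k => v ^ k) (LP t 2 r n)‖ ≤ 1.02 * 0.978 ^ n := by
  have h0 := H.v0
  have h1 := LPv_growth t (by linarith) H.v1 n r
  have h3 : 0 ≤ pev (fun k => v ^ k) (LP t 2 r n) := pev_nonneg _ _ fun _ _ => by positivity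
  have h4 := H.q0
  rw [Real.norm_eq_abs, abs_of_nonneg (by positivity)]
  calc _ ≤ (0.6:ℝ) ^ n * (1.02 * (1.63:ℝ) ^ n) := by gcongr; exact H.q1
    _ = 1.02 * (0.6 * 1.63:ℝ) ^ n := by rw [mul_pow]; ring
    _ = _ := by norm_num

lemma geo978 (C : ℝ) : Summable fun i : ℕ => C * (0.978:ℝ) ^ i :=
  (summable_geometric_of_lt_one (by norm_num) (by norm_num)).mul_left C

lemma KK_summable {q v : ℝ} (H : QV q v) (t r : ℕ) :
    Summable fun n => q ^ n * pev (fun k => v ^ k) (LP t 2 r n) :=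
  Summable.of_norm_bounded (geo978 _) (KK_term H t r)

lemma KK_bound {q v : ℝ} (H : QV q v) (t r : ℕ) : |KK t q v r| ≤ 1.02 * (1 - 0.978)⁻¹ := by
  have := tsum_of_norm_bounded ((hasSum_geometric_of_lt_one (r := (0.978:ℝ)) (by norm_num) (by norm_num)).mul_left 1.02) (KK_term H t r)
  simpa [KK] using this

lemma hasSum_shift {a : ℕ → ℝ} {s q : ℝ} (j : ℕ) (h : HasSum (fun n => q ^ n * a n) s) :
    HasSum (fun n => if j ≤ n then q ^ n * a (n - j) else 0) (q ^ j * s) := by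
  have h1 := h.mul_left (q ^ j)
  rw [← hasSum_nat_add_iff' j (f := fun n => if j ≤ n then q ^ n * a (n - j) else 0)]
  have : ∑ i ∈ Finset.range j, (if j ≤ i then q ^ i * a (i - j) else 0) = 0 :=
    Finset.sum_eq_zero fun i hi => by rw [if_neg]; have := Finset.mem_range.1 hi; omega
  rw [this, sub_zero]
  have h2 : (fun n => if j ≤ n + j then q ^ (n+j) * a (n + j - j) else 0) = fun n => q ^ j * (q ^ n * a n) := by
    funext n
    rw [if_pos (by omega), Nat.add_sub_cancel, pow_add]; ring
  rw [h2]; exact h1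

lemma KK_rec {q v : ℝ} (H : QV q v) (t r : ℕ) :
    KK t q v r = v + ∑ j ∈ Finset.Icc 2 r, v ^ (if j < r then 1 else 0) * (q ^ j * KK t q v (t * j)) := by
  have hs : ∀ j, HasSum (fun n => if j ≤ n then q ^ n * pev (fun k => v ^ k) (LP t 2 (t*j) (n - j)) else 0)
      (q ^ j * KK t q v (t*j)) := fun j => hasSum_shift (a := fun n => pev (fun k => v ^ k) (LP t 2 (t*j) n)) j (KK_summable H t (t*j)).hasSum
  have h1 := (hasSum_ite_eq (0:ℕ) v).add (hasSum_sum (s := Finset.Icc 2 r) fun j _ => (hs j).mul_left (v ^ (if j < r then 1 else 0)))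
  rw [KK, ← h1.tsum_eq]
  refine tsum_congr fun n => ?_
  rcases Nat.eq_zero_or_pos n with h | h
  · subst h
    rw [LP_zero t 2 r (by norm_num), ← pow_one Polynomial.X, pev_X_pow, if_pos rfl, Finset.sum_eq_zero]
    · simp
    · intro j hj; rw [Finset.mem_Icc] at hj; rw [if_neg (by omega : ¬ j ≤ 0), mul_zero]
  · rw [LP_succ t 2 r n (by norm_num) h, pev_sum, if_neg (by omega), zero_add, Finset.mul_sum]
    have hsub : Finset.Icc 2 (min r n) ⊆ Finset.Icc 2 r := Finset.Icc_subset_Icc_right (min_le_left _ _)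
    rw [← Finset.sum_subset hsub]
    · refine Finset.sum_congr rfl fun j hj => ?_
      rw [Finset.mem_Icc] at hj
      rw [pev_mul' (fun k => v ^ k) (fun k => v ^ k) (fun k => v ^ k) (fun j k => pow_add v j k), pev_X_pow, if_pos (by omega : j ≤ n)]
      ring
    · intro j hj hj'
      rw [Finset.mem_Icc] at hj hj'
      rw [if_neg (by omega : ¬ j ≤ n), mul_zero]

/-- real block generating function -/
def PV (t : ℕ) (q v : ℝ) : ℝ := ∑' m, q ^ m * pev (fun k => v ^ k) (BP t m)

lemma PV_eq {q v : ℝ} (H : QV q v) (t : ℕ) : PV t q v = q * KK t q v (t * 1) := by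
  have h : Summable fun m => q ^ m * pev (fun k => v ^ k) (BP t m) := by
    rw [← summable_nat_add_iff 1]
    refine ((KK_summable H t (t*1)).mul_left q).congr fun m => ?_
    show _ = q ^ (m+1) * pev (fun k => v ^ k) (LP t 2 (t*1) m)
    ring
  rw [PV, h.tsum_eq_zero_add, KK, ← tsum_mul_left]
  have : pev (fun k => v ^ k) (BP t 0) = 0 := by simp [BP, pev_zero]
  rw [this, mul_zero, zero_add]
  refine tsum_congr fun m => ?_
  show q ^ (m+1) * pev (fun k => v ^ k) (LP t 2 (t*1) m) = _
  ring

/-- `x_i` -/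
def xq (t : ℕ) (q : ℝ) : ℕ → ℝ
  | 0 => 1
  | i + 1 => (yq t q i) ^ t

lemma q_mul_xq (t : ℕ) (q : ℝ) (i : ℕ) : q * xq t q i = yq t q i := by
  cases i <;> simp [xq, yq]

lemma xq_norm {t : ℕ} (ht : 2 ≤ t) {q : ℝ} (hq : ‖q‖ ≤ 0.65) (i : ℕ) : ‖xq t q i‖ ≤ 0.65 ^ i := by
  cases i with
  | zero => simp [xq]
  | succ i =>
    rw [xq, norm_pow]
    have ih := yq_norm' ht hq i
    have h1 : ‖yq t q i‖ ≤ 1 := ih.trans (pow_le_one₀ (by norm_num) (by norm_num))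
    exact (pow_le_of_le_one (norm_nonneg _) h1 (by omega)).trans ih

lemma pixq_term {t : ℕ} (ht : 2 ≤ t) {q v : ℝ} (H : QV q v) {c : ℕ} (hc : 1 ≤ c) (i : ℕ) :
    ‖piQ t q v 0 i * xq t q i ^ c‖ ≤ 2.2 * 0.65 ^ i := by
  rw [norm_mul, norm_pow]
  have h := xq_norm ht H.hq i
  have h1 : ‖xq t q i‖ ≤ 1 := h.trans (pow_le_one₀ (by norm_num) (by norm_num))
  have h2 := (pow_le_of_le_one (norm_nonneg (xq t q i)) h1 (by omega : c ≠ 0)).trans h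
  have h3 := piQ_norm ht H.hq H.hv 0 i
  gcongr

def EE (t : ℕ) (q v : ℝ) (c : ℕ) : ℝ := ∑' i, piQ t q v 0 i * xq t q i ^ c

lemma EE_summable {t : ℕ} (ht : 2 ≤ t) {q v : ℝ} (H : QV q v) {c : ℕ} (hc : 1 ≤ c) :
    Summable fun i => piQ t q v 0 i * xq t q i ^ c :=
  Summable.of_norm_bounded (geo65 _) (pixq_term ht H hc)

lemma EE_bound {t : ℕ} (ht : 2 ≤ t) {q v : ℝ} (H : QV q v) {c : ℕ} (hc : 1 ≤ c) : |EE t q v c| ≤ 2.2 * (1 - 0.65)⁻¹ := by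
  have := tsum_of_norm_bounded ((hasSum_geometric_of_lt_one (r := (0.65:ℝ)) (by norm_num) (by norm_num)).mul_left 2.2) (pixq_term ht H hc)
  simpa [EE] using this

def HH (t : ℕ) (q v : ℝ) : ℝ := 1 - v * SQ t q v 0 + v * (q * EE t q v 1)

lemma fin_sum (v y : ℝ) (hy : 1 - y ≠ 0) (N : ℕ) (hN : 2 ≤ N) :
    ∑ j ∈ Finset.Icc 2 N, v ^ (if j < N then 1 else 0) * y ^ j
      = v * (y / (1 - y) - y) + (1 - v - y) / (1 - y) * y ^ N := by
  obtain ⟨M, rfl⟩ : ∃ M, N = M + 1 := ⟨N - 1, by omega⟩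
  rw [Finset.sum_Icc_succ_top (by omega), if_neg (by omega)]
  have : ∀ M, 1 ≤ M → ∑ j ∈ Finset.Icc 2 M, v * y ^ j = v * (y / (1 - y) - y) - v * y ^ (M+1) / (1 - y) := by
    intro M hM
    induction M, hM using Nat.le_induction with
    | base => simp; field_simp; ring
    | succ M hM ih => rw [Finset.sum_Icc_succ_top (by omega), ih]; field_simp; ring
  have h2 : ∑ j ∈ Finset.Icc 2 M, v ^ (if j < M + 1 then 1 else 0) * y ^ j = ∑ j ∈ Finset.Icc 2 M, v * y ^ j := by
    refine Finset.sum_congr rfl fun j hj => ?_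
    rw [Finset.mem_Icc] at hj; rw [if_pos (by omega), pow_one]
  rw [h2, this M (by omega)]; field_simp; ring

lemma EE_rec {t : ℕ} (ht : 2 ≤ t) {q v : ℝ} (H : QV q v) {c : ℕ} (hc : 1 ≤ c) :
    EE t q v c = HH t q v + ∑ j ∈ Finset.Icc 2 (t * c), v ^ (if j < t * c then 1 else 0) * (q ^ j * EE t q v j) := by
  have htc : 2 ≤ t * c := by nlinarith
  have h1 : HasSum (fun i => ∑ j ∈ Finset.Icc 2 (t * c), v ^ (if j < t * c then 1 else 0) * (q ^ j * (piQ t q v 0 i * xq t q i ^ j)))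
      (∑ j ∈ Finset.Icc 2 (t * c), v ^ (if j < t * c then 1 else 0) * (q ^ j * EE t q v j)) := by
    refine hasSum_sum fun j hj => ?_
    rw [Finset.mem_Icc] at hj
    exact ((EE_summable ht H (c := j) (by omega)).hasSum.mul_left _).mul_left _
  have h2 : (fun i => ∑ j ∈ Finset.Icc 2 (t * c), v ^ (if j < t * c then 1 else 0) * (q ^ j * (piQ t q v 0 i * xq t q i ^ j)))
      = fun i => v * (piQ t q v 0 i * YQ t q (0 + i)) - v * (q * (piQ t q v 0 i * xq t q i ^ 1))
          + piQ t q v 0 (i+1) * xq t q (i+1) ^ c := by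
    funext i
    have : ∀ j, v ^ (if j < t * c then 1 else 0) * (q ^ j * (piQ t q v 0 i * xq t q i ^ j))
       = piQ t q v 0 i * (v ^ (if j < t * c then 1 else 0) * yq t q i ^ j) := by
      intro j; rw [← q_mul_xq, mul_pow]; ring
    simp_rw [this]
    rw [← Finset.mul_sum, fin_sum v _ (yq_ne ht H.hq i) _ htc]
    have h3 : piQ t q v 0 (i+1) = piQ t q v 0 i * ((1 - v - yq t q i) / (1 - yq t q i)) := by
      rw [piQ, Finset.prod_range_succ, ← piQ, zero_add, WQ_eq ht H.hq]
    rw [h3, xq, zero_add, YQ, pow_one, ← pow_mul]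
    have := q_mul_xq t q i
    linear_combination (v * piQ t q v 0 i) * this
  rw [h2] at h1
  have h4 := (((SQ_summable ht H.hq H.hv 0).hasSum.mul_left v).sub ((EE_summable ht H (c := 1) le_rfl).hasSum.mul_left q |>.mul_left v)).add
    ((summable_nat_add_iff 1).2 (EE_summable ht H hc)).hasSum
  have h5 := h1.unique h4
  rw [h5, EE, (EE_summable ht H hc).tsum_eq_zero_add, HH, SQ, EE]
  simp only [piQ, Finset.range_zero, Finset.prod_empty, xq, one_pow]
  ring

lemma geomS2 {q : ℝ} (h0 : 0 ≤ q) (h1 : q ≤ 0.6) (N : ℕ) : ∑ j ∈ Finset.Icc 2 N, q ^ j ≤ 0.9 := by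
  have : ∀ N, 1 ≤ N → ∑ j ∈ Finset.Icc 2 N, (0.6:ℝ) ^ j = 0.9 - 0.6 ^ (N+1) / 0.4 := by
    intro M hM
    induction M, hM using Nat.le_induction with
    | base => simp; norm_num
    | succ M hM ih => rw [Finset.sum_Icc_succ_top (by omega), ih]; ring
  have h2 : ∑ j ∈ Finset.Icc 2 N, q ^ j ≤ ∑ j ∈ Finset.Icc 2 N, (0.6:ℝ) ^ j :=
    Finset.sum_le_sum fun j _ => pow_le_pow_left₀ h0 h1 j
  rcases Nat.eq_zero_or_pos N with h | h
  · subst h; simp; norm_num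
  · rw [this N h] at h2
    have : (0:ℝ) ≤ 0.6 ^ (N+1) / 0.4 := by positivity
    linarith

lemma DD_zero {t : ℕ} (ht : 2 ≤ t) {q v : ℝ} (H : QV q v) {c : ℕ} (hc : 1 ≤ c) :
    HH t q v * KK t q v (t * c) = v * EE t q v c := by
  set D : ℕ → ℝ := fun c => HH t q v * KK t q v (t * c) - v * EE t q v c with hD
  have hrec : ∀ c, 1 ≤ c → D c = ∑ j ∈ Finset.Icc 2 (t * c), v ^ (if j < t * c then 1 else 0) * (q ^ j * D j) := by
    intro c hc
    simp only [hD]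
    rw [KK_rec H, EE_rec ht H hc, mul_add, mul_add, Finset.mul_sum, Finset.mul_sum]
    have : ∀ j, v ^ (if j < t * c then 1 else 0) * (q ^ j * (HH t q v * KK t q v (t * j) - v * EE t q v j))
      = HH t q v * (v ^ (if j < t * c then 1 else 0) * (q ^ j * KK t q v (t * j))) - v * (v ^ (if j < t * c then 1 else 0) * (q ^ j * EE t q v j)) := by
      intro j; ring
    simp_rw [this]
    rw [Finset.sum_sub_distrib]; ring
  obtain ⟨M, hM0, hM⟩ : ∃ M : ℝ, 0 ≤ M ∧ ∀ c, 1 ≤ c → |D c| ≤ M := by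
    refine ⟨|HH t q v| * (1.02 * (1 - 0.978)⁻¹) + |v| * (2.2 * (1 - 0.65)⁻¹), by positivity, fun c hc => ?_⟩
    refine (abs_sub _ _).trans ?_
    rw [abs_mul, abs_mul]
    gcongr
    · exact KK_bound H t _
    · exact EE_bound ht H hc
  have hit : ∀ n : ℕ, ∀ c, 1 ≤ c → |D c| ≤ 0.918 ^ n * M := by
    intro n
    induction n with
    | zero => simpa using hM
    | succ n ih =>
      intro c hc
      rw [hrec c hc]
      have hv0 := H.v0
      have hq0 := H.q0
      calc _ ≤ ∑ j ∈ Finset.Icc 2 (t * c), 1.02 * (q ^ j * (0.918 ^ n * M)) := by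
            refine (Finset.abs_sum_le_sum_abs _ _).trans (Finset.sum_le_sum fun j hj => ?_)
            rw [Finset.mem_Icc] at hj
            have h2 : v ^ (if j < t * c then 1 else 0) ≤ 1.02 := by
              have := H.v1
              split_ifs <;> norm_num <;> linarith
            have h3 : 0 ≤ v ^ (if j < t * c then 1 else 0) := by positivity
            rw [abs_mul, abs_mul, abs_of_nonneg h3, abs_of_nonneg (by positivity : 0 ≤ q ^ j)]
            have := ih j (by omega)
            gcongr
        _ = 1.02 * (∑ j ∈ Finset.Icc 2 (t * c), q ^ j) * (0.918 ^ n * M) := by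
            rw [Finset.mul_sum, Finset.sum_mul]; exact Finset.sum_congr rfl fun j _ => by ring
        _ ≤ 1.02 * 0.9 * (0.918 ^ n * M) := by
            gcongr; exact geomS2 H.q0 H.q1 _
        _ = _ := by ring
  have hlim : Tendsto (fun n : ℕ => (0.918:ℝ) ^ n * M) atTop (𝓝 0) := by
    have := (tendsto_pow_atTop_nhds_zero_of_lt_one (r := (0.918:ℝ)) (by norm_num) (by norm_num)).mul_const M
    simpa using this
  have h0 : |D c| ≤ 0 := ge_of_tendsto' hlim fun n => hit n c hc
  have : D c = 0 := abs_eq_zero.1 (le_antisymm h0 (abs_nonneg _))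
  exact sub_eq_zero.1 this

lemma main_identity {t : ℕ} (ht : 2 ≤ t) {q v : ℝ} (H : QV q v) :
    HH t q v * (1 - PV t q v) = 1 - v * SQ t q v 0 := by
  have h := DD_zero ht H (c := 1) le_rfl
  rw [PV_eq H]
  have : HH t q v = 1 - v * SQ t q v 0 + v * (q * EE t q v 1) := rfl
  linear_combination this - q * h

lemma main_identity' {t : ℕ} (ht : 2 ≤ t) {q v : ℝ} (H : QV q v) :
    (1 - q) * HH t q v * (1 - PV t q v) = 1 - q - v * q - v * (1 - v - q) * SQ t q v 1 := by
  rw [mul_assoc, main_identity ht H, SQ_rec ht H.hq H.hv 0, WQ_eq ht H.hq, YQ]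
  have : 1 - q ≠ 0 := by linarith [H.q1]
  simp only [yq]; field_simp; ring

end

noncomputable section
open scoped BigOperators
open Filter MeasureTheory Topology
/-- second order expansion at `0` -/
def Jet (f : ℝ → ℝ) (a b c : ℝ) : Prop :=
  (fun s : ℝ => f s - (a + b * s + c * s ^ 2)) =o[𝓝 0] fun s : ℝ => s ^ 2

namespace Jet
variable {f g : ℝ → ℝ} {a b c a' b' c' : ℝ}

lemma of_eq (h : Jet f a b c) (h1 : a = a') (h2 : b = b') (h3 : c = c') : Jet f a' b' c' := by
  subst h1 h2 h3; exact h

lemma congr (h : Jet f a b c) (e : f =ᶠ[𝓝 0] g) : Jet g a b c := by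
  refine Asymptotics.IsLittleO.congr' h ?_ EventuallyEq.rfl
  filter_upwards [e] with s hs
  rw [hs]

lemma const (a : ℝ) : Jet (fun _ => a) a 0 0 := by
  unfold Jet
  simp

lemma add (hf : Jet f a b c) (hg : Jet g a' b' c') : Jet (fun s => f s + g s) (a + a') (b + b') (c + c') := by
  have := Asymptotics.IsLittleO.add hf hg
  refine this.congr_left fun s => ?_
  ring

lemma neg (hf : Jet f a b c) : Jet (fun s => - f s) (-a) (-b) (-c) := by
  have := Asymptotics.IsLittleO.neg_left hf
  refine this.congr_left fun s => ?_
  ring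

lemma sub (hf : Jet f a b c) (hg : Jet g a' b' c') : Jet (fun s => f s - g s) (a - a') (b - b') (c - c') := by
  simpa [sub_eq_add_neg] using hf.add hg.neg

lemma poly_tendsto (a b c : ℝ) : Tendsto (fun s : ℝ => a + b * s + c * s ^ 2) (𝓝 0) (𝓝 a) := by
  have : Continuous fun s : ℝ => a + b * s + c * s ^ 2 := by fun_prop
  simpa using this.tendsto 0

lemma tendsto (hf : Jet f a b c) : Tendsto f (𝓝 0) (𝓝 a) := by
  have h1 : Tendsto (fun s : ℝ => s ^ 2) (𝓝 0) (𝓝 0) := by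
    have : Continuous fun s : ℝ => s ^ 2 := by fun_prop
    simpa using this.tendsto 0
  have h2 := hf.trans_tendsto h1
  have h3 := h2.add (poly_tendsto a b c)
  simpa using h3

lemma mul (hf : Jet f a b c) (hg : Jet g a' b' c') :
    Jet (fun s => f s * g s) (a * a') (a * b' + b * a') (a * c' + b * b' + c * a') := by
  have h1 : (fun s : ℝ => (f s - (a + b * s + c * s ^ 2)) * g s) =o[𝓝 0] fun s : ℝ => s ^ 2 := by
    have := Asymptotics.IsLittleO.mul_isBigO hf (hg.tendsto.isBigO_one ℝ)
    simpa using this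
  have h2 : (fun s : ℝ => (a + b * s + c * s ^ 2) * (g s - (a' + b' * s + c' * s ^ 2))) =o[𝓝 0] fun s : ℝ => s ^ 2 := by
    have := Asymptotics.IsBigO.mul_isLittleO ((poly_tendsto a b c).isBigO_one ℝ) hg
    simpa using this
  have h3 : (fun s : ℝ => ((b * c' + c * b') * s + c * c' * s ^ 2) * s ^ 2) =o[𝓝 0] fun s : ℝ => s ^ 2 := by
    have h : Tendsto (fun s : ℝ => ((b * c' + c * b') * s + c * c' * s ^ 2)) (𝓝 0) (𝓝 0) := by
      have := poly_tendsto 0 (b * c' + c * b') (c * c')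
      simpa using this
    have := Asymptotics.IsLittleO.mul_isBigO ((Asymptotics.isLittleO_one_iff ℝ).2 h) (Asymptotics.isBigO_refl (fun s : ℝ => s ^ 2) (𝓝 0))
    simpa using this
  refine ((h1.add h2).add h3).congr_left fun s => ?_
  ring

lemma inv (hf : Jet f a b c) (ha : a ≠ 0) :
    Jet (fun s => (f s)⁻¹) a⁻¹ (- b / a ^ 2) (b ^ 2 / a ^ 3 - c / a ^ 2) := by
  have hp : Jet (fun s => a⁻¹ + (- b / a ^ 2) * s + (b ^ 2 / a ^ 3 - c / a ^ 2) * s ^ 2) a⁻¹ (- b / a ^ 2) (b ^ 2 / a ^ 3 - c / a ^ 2) := by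
    unfold Jet; simp
  have h1 := ((const 1).sub (hf.mul hp)).of_eq (a' := 0) (b' := 0) (c' := 0) (by field_simp; ring) (by field_simp; ring)
    (by field_simp; ring)
  have h2 : Tendsto (fun s => (f s)⁻¹) (𝓝 0) (𝓝 a⁻¹) := hf.tendsto.inv₀ ha
  have h3 := Asymptotics.IsBigO.mul_isLittleO (h2.isBigO_one ℝ) h1
  simp only [one_mul] at h3
  refine Asymptotics.IsLittleO.congr' h3 ?_ EventuallyEq.rfl
  filter_upwards [hf.tendsto.eventually_ne ha] with s hs
  field_simp
  ring

lemma unique (hf : Jet f a b c) (hg : Jet f a' b' c') : a = a' ∧ b = b' ∧ c = c' := by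
  have h0 : a = a' := tendsto_nhds_unique hf.tendsto hg.tendsto
  subst h0
  have hd := Asymptotics.IsLittleO.sub hg hf
  have hd' : (fun s : ℝ => (b - b') * s + (c - c') * s ^ 2) =o[𝓝[≠] 0] fun s : ℝ => s ^ 2 :=
    (hd.congr_left fun s => by ring).mono nhdsWithin_le_nhds
  have hne : ∀ᶠ s : ℝ in 𝓝[≠] 0, s ≠ 0 := eventually_mem_nhdsWithin
  have hid : Tendsto (fun s : ℝ => s) (𝓝[≠] 0) (𝓝 0) := tendsto_id.mono_left nhdsWithin_le_nhds
  have hb : b = b' := by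
    have h1 : Tendsto (fun s : ℝ => ((b - b') * s + (c - c') * s ^ 2) / s ^ 2 * s) (𝓝[≠] 0) (𝓝 0) := by
      have := hd'.tendsto_div_nhds_zero.mul hid
      simpa using this
    have h2 : Tendsto (fun s : ℝ => (b - b') + (c - c') * s) (𝓝[≠] 0) (𝓝 (b - b')) := by
      have := (hid.const_mul (c - c')).const_add (b - b')
      simpa using this
    have h3 : Tendsto (fun s : ℝ => (b - b') + (c - c') * s) (𝓝[≠] 0) (𝓝 0) := by
      refine h1.congr' ?_
      filter_upwards [hne] with s hs
      field_simp
    have := tendsto_nhds_unique h2 h3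
    linarith
  subst hb
  have h1 : Tendsto (fun s : ℝ => ((b - b) * s + (c - c') * s ^ 2) / s ^ 2) (𝓝[≠] 0) (𝓝 0) := hd'.tendsto_div_nhds_zero
  have h3 : Tendsto (fun _ : ℝ => (c - c')) (𝓝[≠] 0) (𝓝 0) := by
    refine h1.congr' ?_
    filter_upwards [hne] with s hs
    field_simp; ring
  have := tendsto_nhds_unique tendsto_const_nhds h3
  exact ⟨rfl, rfl, by linarith⟩

lemma of_bound (C : ℝ) (h : ∀ᶠ s : ℝ in 𝓝 0, |f s - (a + b * s + c * s ^ 2)| ≤ C * |s| ^ 3) : Jet f a b c := by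
  have h1 : (fun s : ℝ => f s - (a + b * s + c * s ^ 2)) =O[𝓝 0] fun s : ℝ => s ^ 3 := by
    refine Asymptotics.IsBigO.of_bound C ?_
    filter_upwards [h] with s hs
    simpa [Real.norm_eq_abs, abs_pow] using hs
  refine h1.trans_isLittleO ?_
  exact Asymptotics.isLittleO_pow_pow (by norm_num)

lemma exp_bound3 (x : ℝ) : |Real.exp x - (1 + x + x ^ 2 / 2)| ≤ |x| ^ 3 * Real.exp |x| := by
  have h := Complex.norm_exp_sub_sum_le_norm_mul_exp (x : ℂ) 3
  simp only [Finset.sum_range_succ, Finset.sum_range_zero] at h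
  rw [Complex.norm_real, Real.norm_eq_abs] at h
  norm_num [Nat.factorial] at h
  rw [← Real.norm_eq_abs, ← Complex.norm_real]
  simpa using h

lemma exp (r : ℝ) : Jet (fun s => Real.exp (r * s)) 1 r (r ^ 2 / 2) := by
  refine of_bound (|r| ^ 3 * Real.exp |r|) ?_
  have : ∀ᶠ s : ℝ in 𝓝 0, |s| < 1 := by
    have := Metric.ball_mem_nhds (0:ℝ) one_pos
    filter_upwards [this] with s hs
    simpa using hs
  filter_upwards [this] with s hs
  have h := exp_bound3 (r * s)
  have e : 1 + r * s + r ^ 2 / 2 * s ^ 2 = 1 + r * s + (r * s) ^ 2 / 2 := by ring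
  rw [e]
  refine h.trans ?_
  rw [abs_mul, mul_pow]
  have : Real.exp (|r| * |s|) ≤ Real.exp |r| := Real.exp_le_exp.2 (by nlinarith [abs_nonneg r, abs_nonneg s])
  calc |r| ^ 3 * |s| ^ 3 * Real.exp (|r| * |s|) ≤ |r| ^ 3 * |s| ^ 3 * Real.exp |r| := by gcongr
    _ = _ := by ring

/-- `c·exp(rs)` -/
lemma cexp (k r : ℝ) : Jet (fun s => k * Real.exp (r * s)) k (k * r) (k * (r ^ 2 / 2)) :=
  ((const k).mul (exp r)).of_eq (by ring) (by ring) (by ring)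

end Jet

/-- jet from a complex analytic function with Cauchy bounds -/
lemma jet_of_complex {g : ℂ → ℂ} {f : ℝ → ℝ} {ρ M : ℝ} (hρ : 0 < ρ)
    (hd : DifferentiableOn ℂ g (Metric.closedBall 0 ρ))
    (hM : ∀ z, ‖z‖ ≤ ρ → ‖g z‖ ≤ M) (hfg : ∀ s : ℝ, |s| ≤ ρ → g s = (f s : ℂ)) :
    ∃ b c : ℝ, Jet f (f 0) b c ∧ |b| ≤ M / ρ ∧ |c| ≤ M / ρ ^ 2 := by
  lift ρ to NNReal using hρ.le
  have hρ' : (0:NNReal) < ρ := by exact_mod_cast hρ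
  have hp := hd.hasFPowerSeriesOnBall hρ'
  set p := cauchyPowerSeries g 0 ρ with hpdef
  have hM0 : 0 ≤ M := (norm_nonneg _).trans (hM 0 (by simp))
  have hbound : ∀ n, ‖p.coeff n‖ ≤ M / (ρ:ℝ) ^ n := by
    intro n
    have h1 := norm_cauchyPowerSeries_le g 0 ρ n
    have h2 : ‖p.coeff n‖ ≤ ‖p n‖ := by
      have := (p n).le_opNorm (fun _ => 1)
      simpa using this
    have h3 : (2 * Real.pi)⁻¹ * ∫ θ in (0:ℝ)..2 * Real.pi, ‖g (circleMap 0 ρ θ)‖ ≤ M := by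
      have h4 : ‖∫ θ in (0:ℝ)..2 * Real.pi, ‖g (circleMap 0 ρ θ)‖‖ ≤ M * |2 * Real.pi - 0| := by
        refine intervalIntegral.norm_integral_le_of_norm_le_const fun θ _ => ?_
        rw [norm_norm]
        exact hM _ (by simp)
      have hpi := Real.pi_pos
      rw [sub_zero, abs_of_pos (by positivity)] at h4
      have h5 := (le_abs_self _).trans h4
      rw [inv_mul_le_iff₀ (by positivity)]
      linarith
    refine h2.trans (h1.trans ?_)
    have h6 : |(ρ:ℝ)|⁻¹ ^ n = 1 / (ρ:ℝ) ^ n := by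
      rw [abs_of_pos hρ, inv_pow, one_div]
    rw [h6, div_eq_mul_one_div M]
    gcongr
  have hO := hp.hasFPowerSeriesAt.isBigO_sub_partialSum_pow 3
  simp only [zero_add] at hO
  have h0 : p.coeff 0 = (f 0 : ℂ) := by
    have : g 0 = p.coeff 0 := by
      have := hp.coeff_zero (fun _ => 1)
      rw [← this]; simp
    rw [← this]
    have := hfg 0 (by simp)
    simpa using this
  refine ⟨(p.coeff 1).re, (p.coeff 2).re, ?_, (Complex.abs_re_le_norm _).trans (by simpa using hbound 1),
    (Complex.abs_re_le_norm _).trans (hbound 2)⟩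
  have hcont : Tendsto (fun s : ℝ => (s : ℂ)) (𝓝 0) (𝓝 0) := by
    have := Complex.continuous_ofReal.tendsto 0
    simpa using this
  have hO' := hO.comp_tendsto hcont
  obtain ⟨C, hC⟩ := hO'.bound
  refine Jet.of_bound C ?_
  have hsmall : ∀ᶠ s : ℝ in 𝓝 0, |s| ≤ ρ := by
    filter_upwards [Metric.ball_mem_nhds (0:ℝ) hρ] with s hs
    have : |s| < ρ := by simpa using hs
    exact this.le
  filter_upwards [hC, hsmall] with s h1 h2
  simp only [Function.comp, norm_pow, norm_norm, Complex.norm_real, Real.norm_eq_abs] at h1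
  have h3 : p.partialSum 3 (s:ℂ) = p.coeff 0 + p.coeff 1 * s + p.coeff 2 * s ^ 2 := by
    simp only [FormalMultilinearSeries.partialSum, Finset.sum_range_succ, Finset.sum_range_zero,
      FormalMultilinearSeries.apply_eq_pow_smul_coeff]
    simp; ring
  rw [h3, hfg s h2, h0] at h1
  have h4 := (Complex.abs_re_le_norm _).trans h1
  have h5 : ((f s : ℂ) - ((f 0 : ℂ) + p.coeff 1 * s + p.coeff 2 * s ^ 2)).re = f s - (f 0 + (p.coeff 1).re * s + (p.coeff 2).re * s ^ 2) := by
    have e : (p.coeff 2 * (s:ℂ) ^ 2).re = (p.coeff 2).re * s ^ 2 := by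
      rw [← Complex.ofReal_pow, Complex.re_mul_ofReal]
    simp only [Complex.sub_re, Complex.add_re, Complex.ofReal_re, Complex.re_mul_ofReal, e]
  rw [h5] at h4
  rwa [abs_abs] at h4

end

noncomputable section
open scoped BigOperators
open Filter MeasureTheory Topology
lemma yq_ofReal (t : ℕ) (q : ℝ) (i : ℕ) : yq t (q:ℂ) i = ((yq t q i : ℝ) : ℂ) := by
  induction i with
  | zero => rfl
  | succ i ih => simp [yq, ih]

lemma YQ_ofReal (t : ℕ) (q : ℝ) (i : ℕ) : YQ t (q:ℂ) i = ((YQ t q i : ℝ) : ℂ) := by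
  simp [YQ, yq_ofReal]

lemma WQ_ofReal (t : ℕ) (q v : ℝ) (i : ℕ) : WQ t (q:ℂ) (v:ℂ) i = ((WQ t q v i : ℝ) : ℂ) := by
  simp [WQ, YQ_ofReal]

lemma SQ_ofReal (t : ℕ) (q v : ℝ) (k : ℕ) : SQ t (q:ℂ) (v:ℂ) k = ((SQ t q v k : ℝ) : ℂ) := by
  rw [SQ, SQ, Complex.ofReal_tsum]
  refine tsum_congr fun i => ?_
  simp [piQ, YQ_ofReal, WQ_ofReal]

def hh (t : ℕ) : ℕ → ℕ
  | 0 => 1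
  | i + 1 => 1 + t * hh t i

lemma yq_eq_pow {𝕜 : Type*} [NormedField 𝕜] (t : ℕ) (q : 𝕜) (i : ℕ) : yq t q i = q ^ hh t i := by
  induction i with
  | zero => simp [yq, hh]
  | succ i ih => rw [yq, hh, ih, pow_add, pow_one, mul_comm t, pow_mul]

lemma hh_three {t : ℕ} (ht : 2 ≤ t) : 15 ≤ hh t 3 := by
  simp only [hh]; nlinarith [mul_self_nonneg t, Nat.mul_le_mul ht ht]

/-- tail bound -/
lemma SQ3_norm {t : ℕ} (ht : 2 ≤ t) {q v : ℂ} (hq : ‖q‖ ≤ 0.65) (hv : ‖1 - v‖ ≤ 0.1) :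
    ‖SQ t q v 3‖ ≤ 1.11 * ‖q‖ ^ hh t 3 := by
  have hy3 : ∀ i, ‖yq t q (3+i)‖ ≤ 0.05 := fun i => (yq_norm ht hq (3+i)).trans (by
    calc (0.65:ℝ) ^ (2*(3+i)+1) ≤ 0.65 ^ 7 := pow_le_pow_of_le_one (by norm_num) (by norm_num) (by omega)
      _ ≤ 0.05 := by norm_num)
  have hy : ∀ i, ‖yq t q (3+i)‖ ≤ ‖q‖ ^ hh t 3 * 0.05 ^ i := by
    intro i
    induction i with
    | zero => rw [yq_eq_pow, norm_pow]; simp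
    | succ i ih =>
      rw [show 3 + (i+1) = (3+i)+1 by omega, yq, norm_mul, norm_pow]
      have h1 : ‖yq t q (3+i)‖ ^ t ≤ ‖yq t q (3+i)‖ ^ 2 :=
        pow_le_pow_of_le_one (norm_nonneg _) ((hy3 i).trans (by norm_num)) ht
      have h0 := norm_nonneg (yq t q (3+i))
      calc ‖q‖ * ‖yq t q (3+i)‖ ^ t ≤ 1 * (‖yq t q (3+i)‖ * 0.05) := by
            have := hy3 i
            gcongr
            · linarith
            · nlinarith
        _ ≤ 1 * (‖q‖ ^ hh t 3 * 0.05 ^ i * 0.05) := by gcongr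
        _ = _ := by ring
  have hY : ∀ i, ‖YQ t q (3+i)‖ ≤ (1/0.95 * ‖q‖ ^ hh t 3) * 0.05 ^ i := by
    intro i
    rw [YQ, norm_div]
    have h1 := one_sub_norm (yq t q (3+i))
    have h2 := hy3 i
    rw [div_le_iff₀ (by linarith)]
    have h3 := hy i
    have h4 : 0 ≤ ‖q‖ ^ hh t 3 * 0.05 ^ i := by positivity
    nlinarith
  have hpi : ∀ i, ‖piQ t q v 3 i‖ ≤ 1 := by
    intro i
    rw [piQ, norm_prod]
    refine Finset.prod_le_one (fun _ _ => norm_nonneg _) fun l _ => ?_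
    have := WQ_norm ht hq hv (3 + l)
    rwa [if_neg (by omega)] at this
  have hs := (hasSum_geometric_of_lt_one (r := (0.05:ℝ)) (by norm_num) (by norm_num)).mul_left (1/0.95 * ‖q‖ ^ hh t 3)
  have := tsum_of_norm_bounded hs (f := fun i => piQ t q v 3 i * YQ t q (3+i)) (fun i => by
    rw [norm_mul]
    calc _ ≤ 1 * ((1/0.95 * ‖q‖ ^ hh t 3) * 0.05 ^ i) := by
          gcongr
          · exact hpi i
          · exact hY i
      _ = _ := by ring)
  refine this.trans ?_
  have h0 : 0 ≤ ‖q‖ ^ hh t 3 := by positivity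
  norm_num
  nlinarith

lemma path_q {q α : ℝ} (hq0 : 0 ≤ q) (hq : q ≤ 0.6) (hα : |α| ≤ 1) {s : ℂ} (hs : ‖s‖ < 0.075) :
    ‖(q:ℂ) * Complex.exp (α * s)‖ ≤ 0.65 := by
  rw [norm_mul, Complex.norm_real, Real.norm_eq_abs, abs_of_nonneg hq0]
  have h1 : ‖Complex.exp (α * s)‖ ≤ 1.0829 := by
    refine (Complex.norm_exp_le_exp_norm _).trans ?_
    rw [norm_mul, Complex.norm_real, Real.norm_eq_abs]
    have h2 : |α| * ‖s‖ ≤ 0.075 := by nlinarith [norm_nonneg s, abs_nonneg α]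
    refine (Real.exp_le_exp.2 h2).trans ?_
    have := Real.exp_bound' (x := 0.075) (by norm_num) (by norm_num) (n := 2) (by norm_num)
    norm_num [Finset.sum_range_succ, Nat.factorial] at this ⊢
    linarith
  nlinarith [norm_nonneg (Complex.exp (α * s))]

lemma path_v {β : ℝ} (hβ : |β| ≤ 1) {s : ℂ} (hs : ‖s‖ < 0.075) :
    ‖1 - Complex.exp (β * s)‖ ≤ 0.1 := by
  rw [norm_sub_rev]
  have h2 : ‖(β:ℂ) * s‖ ≤ 0.075 := by
    rw [norm_mul, Complex.norm_real, Real.norm_eq_abs]; nlinarith [norm_nonneg s, abs_nonneg β]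
  have := Complex.norm_exp_sub_one_sub_id_le (x := (β:ℂ) * s) (h2.trans (by norm_num))
  have h3 := norm_sub_norm_le (Complex.exp (β * s) - 1) ((β:ℂ)*s)
  nlinarith [norm_nonneg ((β:ℂ)*s)]

lemma SQ3_diff {t : ℕ} (ht : 2 ≤ t) {q α β : ℝ} (hq0 : 0 ≤ q) (hq : q ≤ 0.6) (hα : |α| ≤ 1) (hβ : |β| ≤ 1) :
    DifferentiableOn ℂ (fun s : ℂ => SQ t ((q:ℂ) * Complex.exp (α * s)) (Complex.exp (β * s)) 3) (Metric.ball 0 0.075) := by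
  have hyd : ∀ i, Differentiable ℂ fun s : ℂ => yq t ((q:ℂ) * Complex.exp (α * s)) i := by
    intro i; simp_rw [yq_eq_pow]; fun_prop
  have hYd : ∀ i, DifferentiableOn ℂ (fun s : ℂ => YQ t ((q:ℂ) * Complex.exp (α * s)) i) (Metric.ball 0 0.075) := by
    intro i
    refine (hyd i).differentiableOn.div ((differentiable_const _).sub (hyd i)).differentiableOn fun s hs => ?_
    exact yq_ne ht (path_q hq0 hq hα (by simpa using hs)) i
  have hWd : ∀ i, DifferentiableOn ℂ (fun s : ℂ => WQ t ((q:ℂ) * Complex.exp (α * s)) (Complex.exp (β * s)) i) (Metric.ball 0 0.075) := by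
    intro i
    unfold WQ
    have := hYd i
    have h2 : DifferentiableOn ℂ (fun s : ℂ => Complex.exp (β * s)) (Metric.ball 0 0.075) := by
      apply Differentiable.differentiableOn; fun_prop
    exact (differentiableOn_const _).sub (h2.mul ((differentiableOn_const _).add this))
  refine Complex.differentiableOn_tsum_of_summable_norm (geo65 7) (fun i => ?_) Metric.isOpen_ball fun i s hs => ?_
  · refine DifferentiableOn.mul ?_ (hYd _)
    unfold piQ
    exact DifferentiableOn.fun_finsetProd fun l _ => hWd _
  · have hs' : ‖s‖ < 0.075 := by simpa using hs
    exact SQ_term ht (path_q hq0 hq hα hs') (path_v hβ hs') 3 i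

lemma SQ3_jet {t : ℕ} (ht : 2 ≤ t) {q α β : ℝ} (hq0 : 0 ≤ q) (hq : q ≤ 0.6) (hα : |α| ≤ 1) (hβ : |β| ≤ 1) :
    ∃ b c : ℝ, Jet (fun s : ℝ => SQ t (q * Real.exp (α * s)) (Real.exp (β * s)) 3) (SQ t q 1 3) b c ∧
      |b| ≤ 3.02 * q ^ hh t 3 * hh t 3 ∧ |c| ≤ 3.02 * q ^ hh t 3 * hh t 3 ^ 2 := by
  have h15 : (15:ℝ) ≤ hh t 3 := by exact_mod_cast hh_three ht
  have hpos : (0:ℝ) < hh t 3 := by linarith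
  set ρ : ℝ := 1 / hh t 3 with hρ
  have hρ0 : 0 < ρ := by positivity
  have hρ1 : ρ < 0.075 := by
    rw [hρ, div_lt_iff₀ hpos]; linarith
  obtain ⟨b, c, h1, h2, h3⟩ := jet_of_complex (g := fun s : ℂ => SQ t ((q:ℂ) * Complex.exp (α * s)) (Complex.exp (β * s)) 3)
    (f := fun s : ℝ => SQ t (q * Real.exp (α * s)) (Real.exp (β * s)) 3) (ρ := ρ) (M := 3.02 * q ^ hh t 3) hρ0
    ((SQ3_diff ht hq0 hq hα hβ).mono (Metric.closedBall_subset_ball hρ1))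
    (fun z hz => by
      have hz' : ‖z‖ < 0.075 := lt_of_le_of_lt hz hρ1
      refine (SQ3_norm ht (path_q hq0 hq hα hz') (path_v hβ hz')).trans ?_
      rw [norm_mul, Complex.norm_real, Real.norm_eq_abs, abs_of_nonneg hq0, mul_pow]
      have e1 : ‖Complex.exp (α * z)‖ ^ hh t 3 ≤ 2.7182818286 := by
        have e2 : ‖Complex.exp (α * z)‖ ≤ Real.exp ρ := by
          refine (Complex.norm_exp_le_exp_norm _).trans (Real.exp_le_exp.2 ?_)
          rw [norm_mul, Complex.norm_real, Real.norm_eq_abs]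
          nlinarith [norm_nonneg z, abs_nonneg α]
        calc _ ≤ Real.exp ρ ^ hh t 3 := by gcongr
          _ = Real.exp 1 := by rw [← Real.exp_nat_mul, hρ]; congr 1; field_simp
          _ ≤ _ := Real.exp_one_lt_d9.le
      have e3 : 0 ≤ q ^ hh t 3 := by positivity
      nlinarith)
    (fun s _ => by
      rw [← SQ_ofReal]; push_cast; rfl)
  have e : SQ t (q * Real.exp (α * 0)) (Real.exp (β * 0)) 3 = SQ t q 1 3 := by simp
  rw [e] at h1
  refine ⟨b, c, h1, h2.trans (le_of_eq ?_), h3.trans (le_of_eq ?_)⟩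
  · rw [hρ]; field_simp
  · rw [hρ]; field_simp

end

noncomputable section
open scoped BigOperators
open Filter MeasureTheory Topology
section pvjet
variable (t : ℕ) (ht : 2 ≤ t)

lemma pd_hexp : Summable fun m : ℕ => (m:ℝ) ^ 3 * (q0 t ht ^ m * pev (fun _ => (1:ℝ)) (BP t m)) * 1.02 ^ m :=
  (pd t ht).hexp

def M1 (α β : ℝ) : ℝ := ∑' m : ℕ, q0 t ht ^ m * pev (fun k => α * m + β * k) (BP t m)
def M2 (α β : ℝ) : ℝ := ∑' m : ℕ, q0 t ht ^ m * pev (fun k => (α * m + β * k) ^ 2) (BP t m)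

lemma lin_bound {α β : ℝ} (hα : |α| ≤ 1) (hβ : |β| ≤ 1) {m k : ℕ} (hk : k ≤ m) : |α * m + β * k| ≤ 2 * m := by
  have hk' : (k:ℝ) ≤ m := by exact_mod_cast hk
  refine (abs_add_le _ _).trans ?_
  rw [abs_mul, abs_mul, Nat.abs_cast, Nat.abs_cast]
  have : (0:ℝ) ≤ k := by positivity
  nlinarith [abs_nonneg α, abs_nonneg β]

lemma pev_const (c : ℝ) (p : Polynomial ℕ) : pev (fun _ => c) p = c * pev (fun _ => (1:ℝ)) p := by
  rw [← pev_const_mul]; simp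

lemma term_bound (φ : ℕ → ℝ) (C : ℝ) (m : ℕ) (h : ∀ k, k ≤ m → |φ k| ≤ C) :
    |q0 t ht ^ m * pev φ (BP t m)| ≤ C * (q0 t ht ^ m * pev (fun _ => (1:ℝ)) (BP t m)) := by
  have hq := q0_pos t ht
  rw [abs_mul, abs_of_nonneg (by positivity : 0 ≤ q0 t ht ^ m)]
  have h1 := pev_abs_le φ (fun _ => C) (BP t m) (fun k hk => h k (BP_deg t m k hk))
  rw [pev_const] at h1
  calc _ ≤ q0 t ht ^ m * (C * pev (fun _ => (1:ℝ)) (BP t m)) := by gcongr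
    _ = _ := by ring

lemma pow_dom (m : ℕ) (j : ℕ) (hj : 1 ≤ j) (hj3 : j ≤ 3) : (m:ℝ) ^ j ≤ (m:ℝ) ^ 3 * 1.02 ^ m := by
  have h1 : (1:ℝ) ≤ 1.02 ^ m := one_le_pow₀ (by norm_num)
  have h2 : (m:ℝ) ^ j ≤ (m:ℝ) ^ 3 := by
    rcases Nat.eq_zero_or_pos m with h | h
    · subst h; simp [show j ≠ 0 by omega]
    · exact pow_le_pow_right₀ (by exact_mod_cast h) hj3
  have : (0:ℝ) ≤ (m:ℝ) ^ 3 := by positivity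
  nlinarith

lemma M1_summable {α β : ℝ} (hα : |α| ≤ 1) (hβ : |β| ≤ 1) :
    Summable fun m : ℕ => q0 t ht ^ m * pev (fun k => α * m + β * k) (BP t m) := by
  refine Summable.of_norm_bounded ((pd_hexp t ht).mul_left 2) fun m => ?_
  rw [Real.norm_eq_abs]
  refine (term_bound t ht _ (2 * m) m fun k hk => lin_bound hα hβ hk).trans ?_
  have h := pow_dom m 1 le_rfl (by norm_num)
  rw [pow_one] at h
  have := w_nn t ht m
  nlinarith

lemma M2_summable {α β : ℝ} (hα : |α| ≤ 1) (hβ : |β| ≤ 1) :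
    Summable fun m : ℕ => q0 t ht ^ m * pev (fun k => (α * m + β * k) ^ 2) (BP t m) := by
  refine Summable.of_norm_bounded ((pd_hexp t ht).mul_left 4) fun m => ?_
  rw [Real.norm_eq_abs]
  refine (term_bound t ht _ ((2 * m) ^ 2) m fun k hk => ?_).trans ?_
  · rw [abs_pow]; exact pow_le_pow_left₀ (abs_nonneg _) (lin_bound hα hβ hk) 2
  have h := pow_dom m 2 (by norm_num) (by norm_num)
  have := w_nn t ht m
  nlinarith

lemma PV_path (α β s : ℝ) : PV t (q0 t ht * Real.exp (α * s)) (Real.exp (β * s))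
    = ∑' m : ℕ, q0 t ht ^ m * pev (fun k => Real.exp ((α * m + β * k) * s)) (BP t m) := by
  unfold PV
  refine tsum_congr fun m => ?_
  rw [mul_pow, mul_assoc, ← pev_const_mul]
  congr 2
  funext k
  rw [← Real.exp_nat_mul, ← Real.exp_nat_mul, ← Real.exp_add]
  congr 1; ring

lemma PV_jet {α β : ℝ} (hα : |α| ≤ 1) (hβ : |β| ≤ 1) :
    Jet (fun s => PV t (q0 t ht * Real.exp (α * s)) (Real.exp (β * s))) 1 (M1 t ht α β) (M2 t ht α β / 2) := by
  refine Jet.of_bound (8 * ∑' m : ℕ, (m:ℝ) ^ 3 * (q0 t ht ^ m * pev (fun _ => (1:ℝ)) (BP t m)) * 1.02 ^ m) ?_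
  have hsm : ∀ᶠ s : ℝ in 𝓝 0, |s| < 0.005 := by
    filter_upwards [Metric.ball_mem_nhds (0:ℝ) (by norm_num : (0:ℝ) < 0.005)] with s hs
    simpa using hs
  filter_upwards [hsm] with s hs
  rw [PV_path]
  have h1 := (pd t ht).hsum
  have h2 := (M1_summable t ht hα hβ).hasSum.mul_right s
  have h3 := (M2_summable t ht hα hβ).hasSum.mul_right (s ^ 2 / 2)
  have hpoly := (h1.add h2).add h3
  have hdiff : ∀ m : ℕ, ‖q0 t ht ^ m * pev (fun k => Real.exp ((α * m + β * k) * s)) (BP t m) -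
      (q0 t ht ^ m * pev (fun _ => (1:ℝ)) (BP t m) + q0 t ht ^ m * pev (fun k => α * m + β * k) (BP t m) * s
       + q0 t ht ^ m * pev (fun k => (α * m + β * k) ^ 2) (BP t m) * (s ^ 2 / 2))‖
      ≤ 8 * |s| ^ 3 * ((m:ℝ) ^ 3 * (q0 t ht ^ m * pev (fun _ => (1:ℝ)) (BP t m)) * 1.02 ^ m) := by
    intro m
    have e : q0 t ht ^ m * pev (fun k => Real.exp ((α * m + β * k) * s)) (BP t m) -
      (q0 t ht ^ m * pev (fun _ => (1:ℝ)) (BP t m) + q0 t ht ^ m * pev (fun k => α * m + β * k) (BP t m) * s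
       + q0 t ht ^ m * pev (fun k => (α * m + β * k) ^ 2) (BP t m) * (s ^ 2 / 2))
      = q0 t ht ^ m * pev (fun k => Real.exp ((α * m + β * k) * s) - (1 + (α * m + β * k) * s + ((α * m + β * k) * s) ^ 2 / 2)) (BP t m) := by
      have e2 : pev (fun k : ℕ => Real.exp ((α * m + β * k) * s)) (BP t m)
        = pev (fun k : ℕ => Real.exp ((α * m + β * k) * s) - (1 + (α * m + β * k) * s + ((α * m + β * k) * s) ^ 2 / 2)) (BP t m)
         + (pev (fun _ => (1:ℝ)) (BP t m) + (s * pev (fun k : ℕ => α * m + β * k) (BP t m)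
           + (s ^ 2 / 2) * pev (fun k : ℕ => (α * m + β * k) ^ 2) (BP t m))) := by
        rw [← pev_const_mul, ← pev_const_mul, ← pev_fadd, ← pev_fadd, ← pev_fadd]
        congr 1; funext k; ring
      rw [e2]; ring
    rw [e, Real.norm_eq_abs]
    refine (term_bound t ht _ ((2 * m) ^ 3 * |s| ^ 3 * 1.02 ^ m) m fun k hk => ?_).trans (le_of_eq (by ring))
    refine (Jet.exp_bound3 _).trans ?_
    have hl := lin_bound hα hβ hk
    rw [abs_mul, mul_pow]
    have h5 : Real.exp (|α * m + β * k| * |s|) ≤ 1.02 ^ m := by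
      have h6 : |α * m + β * k| * |s| ≤ m * 0.01 := by
        have : (0:ℝ) ≤ m := by positivity
        nlinarith [abs_nonneg s, abs_nonneg (α * m + β * k)]
      refine (Real.exp_le_exp.2 h6).trans ?_
      rw [Real.exp_nat_mul]
      gcongr
      have := Real.exp_bound' (x := 0.01) (by norm_num) (by norm_num) (n := 2) (by norm_num)
      norm_num [Finset.sum_range_succ, Nat.factorial] at this ⊢
      linarith
    gcongr
  have hsumE : Summable fun m : ℕ => q0 t ht ^ m * pev (fun k => Real.exp ((α * m + β * k) * s)) (BP t m) := by
    have hd := Summable.of_norm_bounded ((pd_hexp t ht).mul_left (8 * |s| ^ 3)) hdiff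
    refine (hd.add hpoly.summable).congr fun m => ?_
    exact sub_add_cancel _ _
  have h7 := tsum_of_norm_bounded ((pd_hexp t ht).hasSum.mul_left (8 * |s| ^ 3)) hdiff
  have h8 := (hsumE.hasSum.sub hpoly).tsum_eq
  rw [← Real.norm_eq_abs]
  have h9 : (∑' m : ℕ, q0 t ht ^ m * pev (fun k => Real.exp ((α * m + β * k) * s)) (BP t m)) -
      (1 + M1 t ht α β * s + M2 t ht α β / 2 * s ^ 2)
      = ∑' m : ℕ, (q0 t ht ^ m * pev (fun k => Real.exp ((α * m + β * k) * s)) (BP t m) -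
      (q0 t ht ^ m * pev (fun _ => (1:ℝ)) (BP t m) + q0 t ht ^ m * pev (fun k => α * m + β * k) (BP t m) * s
       + q0 t ht ^ m * pev (fun k => (α * m + β * k) ^ 2) (BP t m) * (s ^ 2 / 2))) := by
    refine Eq.trans ?_ h8.symm
    show _ = _ - (1 + M1 t ht α β * s + M2 t ht α β * (s ^ 2 / 2))
    ring
  rw [h9]
  refine h7.trans (le_of_eq (by ring))

lemma M1_L : M1 t ht 1 0 = (pd t ht).toRD.mean := by
  show _ = ∑' m : ℕ, (m:ℝ) * (q0 t ht ^ m * pev (fun _ => (1:ℝ)) (BP t m))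
  unfold M1
  refine tsum_congr fun m => ?_
  rw [show (fun k : ℕ => (1:ℝ) * m + 0 * k) = fun k => (m:ℝ) by funext k; ring, pev_const]; ring

lemma M1_D : M1 t ht (-(pd t ht).μ) 1 = 0 := by
  have := (pd t ht).hmean.tsum_eq
  rw [← this]
  unfold M1
  refine tsum_congr fun m => ?_
  show _ = q0 t ht ^ m * pev _ (BP t m)
  congr 2; funext k; ring

lemma M2_D : M2 t ht (-(pd t ht).μ) 1 = (pd t ht).toRD.s2 := by
  show _ = ∑' m : ℕ, q0 t ht ^ m * pev (fun k => ((k:ℝ) - (pd t ht).μ * m) ^ 2) (BP t m)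
  unfold M2
  refine tsum_congr fun m => ?_
  congr 2; funext k; ring

lemma mu_nonneg : 0 ≤ (pd t ht).μ := by
  show 0 ≤ ED t ht / EN t ht
  refine div_nonneg (tsum_nonneg fun m => ?_) (EN_pos t ht).le
  have := q0_pos t ht
  have : 0 ≤ pev (fun k => (k:ℝ)) (BP t m) := pev_nonneg _ _ fun _ _ => by positivity
  positivity

lemma mu_le_one : (pd t ht).μ ≤ 1 := by
  show ED t ht / EN t ht ≤ 1
  rw [div_le_one (EN_pos t ht)]
  refine Summable.tsum_le_tsum (fun m => ?_) (D_summable t ht) (N_summable t ht)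
  have := BPk_le t m
  have h := q0_pos t ht
  calc q0 t ht ^ m * pev (fun k => (k:ℝ)) (BP t m) ≤ q0 t ht ^ m * (m * pev (fun _ => (1:ℝ)) (BP t m)) := by gcongr
    _ = _ := by ring

end pvjet

end

noncomputable section
open scoped BigOperators
open Filter MeasureTheory Topology
lemma tendsto_exp_path (α : ℝ) : Tendsto (fun s : ℝ => Real.exp (α * s)) (𝓝 0) (𝓝 1) := (Jet.exp α).tendsto

lemma QV_path {q : ℝ} (hq0 : 0 < q) (hq : q < 0.6) (α β : ℝ) :
    ∀ᶠ s : ℝ in 𝓝 0, QV (q * Real.exp (α * s)) (Real.exp (β * s)) := by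
  have h1 : Tendsto (fun s : ℝ => q * Real.exp (α * s)) (𝓝 0) (𝓝 q) := by
    simpa using (tendsto_exp_path α).const_mul q
  have h2 := tendsto_exp_path β
  filter_upwards [h1.eventually (gt_mem_nhds hq), h2.eventually (gt_mem_nhds (show (1:ℝ) < 1.02 by norm_num)),
    h2.eventually (lt_mem_nhds (show (0.98:ℝ) < 1 by norm_num))] with s e1 e2 e3
  exact ⟨by positivity, e1.le, e3.le, e2.le⟩

lemma QV_base {q : ℝ} (hq0 : 0 < q) (hq : q < 0.6) : QV q 1 := ⟨hq0.le, hq.le, by norm_num, by norm_num⟩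

section cont
variable {t : ℕ} {q : ℝ}

lemma yq_tendsto (ht : 2 ≤ t) (hq0 : 0 < q) (hq : q < 0.6) (α : ℝ) (i : ℕ) : Tendsto (fun s : ℝ => yq t (q * Real.exp (α * s)) i) (𝓝 0) (𝓝 (yq t q i)) := by
  have h1 : Tendsto (fun s : ℝ => q * Real.exp (α * s)) (𝓝 0) (𝓝 q) := by
    simpa using (tendsto_exp_path α).const_mul q
  simp_rw [yq_eq_pow]
  exact h1.pow _

lemma YQ_tendsto (ht : 2 ≤ t) (hq0 : 0 < q) (hq : q < 0.6) (α : ℝ) (i : ℕ) : Tendsto (fun s : ℝ => YQ t (q * Real.exp (α * s)) i) (𝓝 0) (𝓝 (YQ t q i)) := by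
  have h := yq_tendsto ht hq0 hq α i
  exact h.div (h.const_sub 1) (yq_ne ht (QV_base hq0 hq).hq i)

lemma piQ_tendsto (ht : 2 ≤ t) (hq0 : 0 < q) (hq : q < 0.6) (α β : ℝ) (k i : ℕ) : Tendsto (fun s : ℝ => piQ t (q * Real.exp (α * s)) (Real.exp (β * s)) k i) (𝓝 0) (𝓝 (piQ t q 1 k i)) := by
  unfold piQ
  refine tendsto_finsetProd _ fun l _ => ?_
  unfold WQ
  exact ((tendsto_exp_path β).mul ((YQ_tendsto ht hq0 hq α (k+l)).const_add 1)).const_sub 1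

lemma SQ_tendsto (ht : 2 ≤ t) (hq0 : 0 < q) (hq : q < 0.6) (α β : ℝ) (k : ℕ) : Tendsto (fun s : ℝ => SQ t (q * Real.exp (α * s)) (Real.exp (β * s)) k) (𝓝 0) (𝓝 (SQ t q 1 k)) := by
  refine tendsto_tsum_of_dominated_convergence (geo65 7) (fun i => ?_) ?_
  · exact (piQ_tendsto ht hq0 hq α β k i).mul (YQ_tendsto ht hq0 hq α (k+i))
  · filter_upwards [QV_path hq0 hq α β] with s H i
    exact SQ_term ht H.hq H.hv k i

lemma xq_tendsto (ht : 2 ≤ t) (hq0 : 0 < q) (hq : q < 0.6) (α : ℝ) (i : ℕ) : Tendsto (fun s : ℝ => xq t (q * Real.exp (α * s)) i) (𝓝 0) (𝓝 (xq t q i)) := by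
  cases i with
  | zero => exact tendsto_const_nhds
  | succ i => exact (yq_tendsto ht hq0 hq α i).pow t

lemma EE_tendsto (ht : 2 ≤ t) (hq0 : 0 < q) (hq : q < 0.6) (α β : ℝ) : Tendsto (fun s : ℝ => EE t (q * Real.exp (α * s)) (Real.exp (β * s)) 1) (𝓝 0) (𝓝 (EE t q 1 1)) := by
  refine tendsto_tsum_of_dominated_convergence (geo65 2.2) (fun i => ?_) ?_
  · exact (piQ_tendsto ht hq0 hq α β 0 i).mul ((xq_tendsto ht hq0 hq α i).pow 1)
  · filter_upwards [QV_path hq0 hq α β] with s H i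
    exact pixq_term ht H le_rfl i

lemma HH_tendsto (ht : 2 ≤ t) (hq0 : 0 < q) (hq : q < 0.6) (α β : ℝ) : Tendsto (fun s : ℝ => (1 - q * Real.exp (α * s)) * HH t (q * Real.exp (α * s)) (Real.exp (β * s))) (𝓝 0)
    (𝓝 ((1 - q) * HH t q 1)) := by
  have h1 : Tendsto (fun s : ℝ => q * Real.exp (α * s)) (𝓝 0) (𝓝 q) := by
    simpa using (tendsto_exp_path α).const_mul q
  have hv := tendsto_exp_path β
  unfold HH
  exact (h1.const_sub 1).mul (((hv.mul (SQ_tendsto ht hq0 hq α β 0)).const_sub 1).add (hv.mul (h1.mul (EE_tendsto ht hq0 hq α β))))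

end cont

lemma jet_cont_mul {p G : ℝ → ℝ} {b c G0 A B C : ℝ} (hp : Jet p 0 b c) (hG : Tendsto G (𝓝 0) (𝓝 G0))
    (hf : Jet (fun s => G s * p s) A B C) : A = 0 ∧ B = G0 * b ∧ (b = 0 → C = G0 * c) := by
  have hA : A = 0 := by
    have := hG.mul hp.tendsto
    rw [mul_zero] at this
    exact tendsto_nhds_unique hf.tendsto this
  subst hA
  have hne : ∀ᶠ s : ℝ in 𝓝[≠] 0, s ≠ 0 := eventually_mem_nhdsWithin
  have hid : Tendsto (fun s : ℝ => s) (𝓝[≠] 0) (𝓝 0) := tendsto_id.mono_left nhdsWithin_le_nhds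
  have first : ∀ {f : ℝ → ℝ} {b c : ℝ}, Jet f 0 b c → Tendsto (fun s => f s / s) (𝓝[≠] 0) (𝓝 b) := by
    intro f b c h
    have h1 := ((h.mono nhdsWithin_le_nhds : (fun s : ℝ => f s - (0 + b * s + c * s ^ 2)) =o[𝓝[≠] 0] fun s : ℝ => s ^ 2)).tendsto_div_nhds_zero
    have h2 := (h1.mul hid).add ((hid.const_mul c).const_add b)
    rw [mul_zero, mul_zero, add_zero, zero_add] at h2
    refine h2.congr' ?_
    filter_upwards [hne] with s hs
    field_simp; ring
  have second : ∀ {f : ℝ → ℝ} {c : ℝ}, Jet f 0 0 c → Tendsto (fun s => f s / s ^ 2) (𝓝[≠] 0) (𝓝 c) := by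
    intro f c h
    have h1 := ((h.mono nhdsWithin_le_nhds : (fun s : ℝ => f s - (0 + 0 * s + c * s ^ 2)) =o[𝓝[≠] 0] fun s : ℝ => s ^ 2)).tendsto_div_nhds_zero
    have h2 := h1.add_const c
    rw [zero_add] at h2
    refine h2.congr' ?_
    filter_upwards [hne] with s hs
    field_simp; ring
  have hG' := hG.mono_left (nhdsWithin_le_nhds (s := {0}ᶜ))
  have hB : B = G0 * b := by
    refine tendsto_nhds_unique (first hf) ((hG'.mul (first hp)).congr fun s => ?_)
    ring
  refine ⟨rfl, hB, fun hb => ?_⟩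
  subst hb
  rw [mul_zero] at hB
  subst hB
  refine tendsto_nhds_unique (second hf) ((hG'.mul (second hp)).congr fun s => ?_)
  ring

def aF (h Y : ℝ) : ℝ := h * Y * (1 + Y)
def bF (h Y : ℝ) : ℝ := h ^ 2 * Y * (1 + Y) * (1 + 2 * Y)

lemma YQ_jet {t : ℕ} (ht : 2 ≤ t) {q : ℝ} (hq0 : 0 < q) (hq : q < 0.6) (α : ℝ) (i : ℕ) :
    Jet (fun s => YQ t (q * Real.exp (α * s)) i) (YQ t q i) (α * aF (hh t i) (YQ t q i)) (α ^ 2 * bF (hh t i) (YQ t q i) / 2) := by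
  have hy : Jet (fun s => yq t (q * Real.exp (α * s)) i) (yq t q i) (yq t q i * (hh t i * α)) (yq t q i * ((hh t i * α) ^ 2 / 2)) := by
    have := Jet.cexp (yq t q i) (hh t i * α)
    refine this.congr (Eventually.of_forall fun s => ?_)
    show yq t q i * Real.exp (hh t i * α * s) = yq t (q * Real.exp (α * s)) i
    rw [yq_eq_pow, yq_eq_pow, mul_pow, ← Real.exp_nat_mul]
    congr 2; ring
  have hne := yq_ne ht (QV_base hq0 hq).hq i
  have := hy.mul (((Jet.const 1).sub hy).inv hne)
  refine (this.congr (Eventually.of_forall fun s => ?_)).of_eq ?_ ?_ ?_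
  · show _ * _ = _
    rw [YQ, div_eq_mul_inv]
  · rw [YQ, div_eq_mul_inv]
  · unfold aF YQ; field_simp; ring
  · unfold bF YQ; field_simp; ring

lemma SQ_step {t : ℕ} (ht : 2 ≤ t) {q : ℝ} (hq0 : 0 < q) (hq : q < 0.6) (α β : ℝ) (k : ℕ) {z0 z1 z2 : ℝ}
    (hz : Jet (fun s => SQ t (q * Real.exp (α * s)) (Real.exp (β * s)) (k+1)) z0 z1 z2)
    {h Y a b : ℝ} (hh' : h = hh t k) (hY : Y = YQ t q k) (ha : a = aF h Y) (hb : b = bF h Y) :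
    Jet (fun s => SQ t (q * Real.exp (α * s)) (Real.exp (β * s)) k)
      (Y * (1 - z0)) (α * a - Y * z1 - (β * (1 + Y) + α * a) * z0)
      (α ^ 2 * b / 2 - Y * z2 - (β * (1 + Y) + α * a) * z1 - (β ^ 2 * (1 + Y) + 2 * α * β * a + α ^ 2 * b) / 2 * z0) := by
  subst hh' hY ha hb
  have hYj := YQ_jet ht hq0 hq α k
  have hW := (Jet.const 1).sub ((Jet.exp β).mul ((Jet.const 1).add hYj))
  have := hYj.add (hW.mul hz)
  refine (this.congr ?_).of_eq (by ring) (by ring) (by ring)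
  filter_upwards [QV_path hq0 hq α β] with s H
  rw [SQ_rec ht H.hq H.hv k]
  rfl

lemma Phi_jet {q : ℝ} (α β : ℝ) {S : ℝ → ℝ} {s0 s1 s2 : ℝ} (hS : Jet S s0 s1 s2) :
    Jet (fun s => 1 - q * Real.exp (α * s) - Real.exp (β * s) * (q * Real.exp (α * s))
        - Real.exp (β * s) * (1 - Real.exp (β * s) - q * Real.exp (α * s)) * S s)
      (1 - 2 * q + q * s0)
      (- α * q - (α + β) * q + q * s1 + (β + (α + β) * q) * s0)
      (- α ^ 2 * q / 2 - (α + β) ^ 2 * q / 2 + q * s2 + (β + (α + β) * q) * s1 + (3 * β ^ 2 + (α + β) ^ 2 * q) / 2 * s0) := by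
  have hq := Jet.cexp q α
  have hv := Jet.exp β
  have := (((Jet.const 1).sub hq).sub (hv.mul hq)).sub ((hv.mul (((Jet.const 1).sub hv).sub hq)).mul hS)
  exact this.of_eq (by ring) (by ring) (by ring)

lemma dir_eqs {t : ℕ} (ht : 2 ≤ t) {α β : ℝ} (hα : |α| ≤ 1) (hβ : |β| ≤ 1) {s0 s1 s2 : ℝ}
    (hS : Jet (fun s => SQ t (q0 t ht * Real.exp (α * s)) (Real.exp (β * s)) 1) s0 s1 s2) :
    1 - 2 * q0 t ht + q0 t ht * s0 = 0 ∧
    - α * q0 t ht - (α + β) * q0 t ht + q0 t ht * s1 + (β + (α + β) * q0 t ht) * s0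
      = ((1 - q0 t ht) * HH t (q0 t ht) 1) * (- M1 t ht α β) ∧
    (M1 t ht α β = 0 → - α ^ 2 * q0 t ht / 2 - (α + β) ^ 2 * q0 t ht / 2 + q0 t ht * s2 + (β + (α + β) * q0 t ht) * s1
      + (3 * β ^ 2 + (α + β) ^ 2 * q0 t ht) / 2 * s0 = ((1 - q0 t ht) * HH t (q0 t ht) 1) * (- (M2 t ht α β / 2))) := by
  have h0 := q0_pos t ht
  have h1 := q0_lt t ht
  have hP := ((Jet.const 1).sub (PV_jet t ht hα hβ)).of_eq (sub_self 1) (zero_sub _) (zero_sub _)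
  have hG := HH_tendsto ht h0 h1 α β
  have hPhi := Phi_jet (q := q0 t ht) α β hS
  have hPhi' := hPhi.congr (g := fun s => ((1 - q0 t ht * Real.exp (α * s)) * HH t (q0 t ht * Real.exp (α * s)) (Real.exp (β * s)))
     * (1 - PV t (q0 t ht * Real.exp (α * s)) (Real.exp (β * s)))) (by
    filter_upwards [QV_path h0 h1 α β] with s H
    rw [main_identity' ht H])
  obtain ⟨e1, e2, e3⟩ := jet_cont_mul hP hG hPhi'
  exact ⟨e1, e2, fun h => e3 (by rw [h, neg_zero])⟩

/-- the numbers of the final real system -/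
structure Sys (t : ℕ) (q μ V : ℝ) : Prop where
  q_pos : 0 < q
  q_lt : q < 0.6
  mu0 : 0 ≤ μ
  mu1 : μ ≤ 1
  V0 : 0 ≤ V
  sys : ∃ ζ lm δ η z l d e S SL SD SE Y a b Y2 a2 b2 : ℝ,
    |ζ| ≤ 3.02 * q ^ hh t 3 ∧ |lm| ≤ 3.02 * q ^ hh t 3 * hh t 3 ∧ |δ| ≤ 3.02 * q ^ hh t 3 * hh t 3 ∧
    |η| ≤ 3.02 * q ^ hh t 3 * hh t 3 ^ 2 ∧
    Y = q ^ (t+1) / (1 - q ^ (t+1)) ∧ a = aF (t+1) Y ∧ b = bF (t+1) Y ∧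
    Y2 = q ^ (t^2+t+1) / (1 - q ^ (t^2+t+1)) ∧ a2 = aF (t^2+t+1) Y2 ∧ b2 = bF (t^2+t+1) Y2 ∧
    z = Y2 * (1 - ζ) ∧ l = a2 - Y2 * lm - a2 * ζ ∧ d = - μ * a2 - Y2 * δ - ((1 + Y2) - μ * a2) * ζ ∧
    e = μ ^ 2 * b2 / 2 - Y2 * η - ((1 + Y2) - μ * a2) * δ - ((1 + Y2) - 2 * μ * a2 + μ ^ 2 * b2) / 2 * ζ ∧
    S = Y * (1 - z) ∧ SL = a - Y * l - a * z ∧ SD = - μ * a - Y * d - ((1 + Y) - μ * a) * z ∧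
    SE = μ ^ 2 * b / 2 - Y * e - ((1 + Y) - μ * a) * d - ((1 + Y) - 2 * μ * a + μ ^ 2 * b) / 2 * z ∧
    q * (2 - S) = 1 ∧ 2 * μ - 1 + (3 - μ - S) * S + SD = 0 ∧
    V * (2 - S - SL) = μ ^ 2 + (1 - μ) ^ 2 - (6 - 3 * S + (1 - μ) ^ 2) * S - 2 * (3 - μ - S) * SD - 2 * SE

lemma sys_pd (t : ℕ) (ht : 2 ≤ t) : Sys t (q0 t ht) (pd t ht).μ ((pd t ht).σ ^ 2) := by
  have h0 := q0_pos t ht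
  have h1 := q0_lt t ht
  have hm0 := mu_nonneg t ht
  have hm1 := mu_le_one t ht
  refine ⟨h0, h1, hm0, hm1, by positivity, ?_⟩
  set q := q0 t ht with hq
  set μ := (pd t ht).μ with hμ
  have hα : |(-μ)| ≤ 1 := by rw [abs_neg, abs_of_nonneg hm0]; exact hm1
  obtain ⟨lm, x1, jL, bL1, _⟩ := SQ3_jet ht h0.le h1.le (α := 1) (β := 0) (by simp) (by simp)
  obtain ⟨δ, η, jD, bD1, bD2⟩ := SQ3_jet ht h0.le h1.le (α := -μ) (β := 1) hα (by simp)
  set ζ := SQ t q 1 3 with hζ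
  have bζ : |ζ| ≤ 3.02 * q ^ hh t 3 := by
    have := SQ3_norm ht (q := (q:ℂ)) (v := ((1:ℝ):ℂ)) (by
      rw [Complex.norm_real]; exact (QV_base h0 h1).hq) (by simp; norm_num)
    rw [SQ_ofReal, Complex.norm_real, Complex.norm_real, Real.norm_eq_abs, Real.norm_eq_abs, abs_of_pos h0] at this
    have : 0 ≤ q ^ hh t 3 := by positivity
    linarith
  have hY1 : YQ t q 1 = q ^ (t+1) / (1 - q ^ (t+1)) := by
    rw [YQ, yq_eq_pow, show hh t 1 = t + 1 by simp [hh]; ring]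
  have hY2 : YQ t q 2 = q ^ (t^2+t+1) / (1 - q ^ (t^2+t+1)) := by
    rw [YQ, yq_eq_pow, show hh t 2 = t^2 + t + 1 by simp [hh]; ring]
  have hh1 : ((t:ℝ)+1) = hh t 1 := by simp [hh]; ring
  have hh2 : ((t:ℝ)^2+t+1) = hh t 2 := by simp [hh]; ring
  have jL2 := SQ_step ht h0 h1 1 0 2 jL hh2 rfl rfl rfl
  have jD2 := SQ_step ht h0 h1 (-μ) 1 2 jD hh2 rfl rfl rfl
  have jL1 := SQ_step ht h0 h1 1 0 1 jL2 hh1 rfl rfl rfl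
  have jD1 := SQ_step ht h0 h1 (-μ) 1 1 jD2 hh1 rfl rfl rfl
  obtain ⟨e1, e2, _⟩ := dir_eqs ht (by simp) (by simp) jL1
  obtain ⟨e1', e2', e3'⟩ := dir_eqs ht hα (by simp) jD1
  rw [M1_L] at e2
  have e3 := e3' (M1_D t ht)
  rw [M1_D] at e2'
  rw [M2_D] at e3
  rw [(pd t ht).σ_sq]
  have hmean := (pd t ht).toRD.mean_pos
  simp only [← hq, ← hμ, ← hζ] at e1 e2 e1' e2' e3
  generalize YQ t q 1 = Y at *
  generalize YQ t q 2 = Y2 at *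
  obtain ⟨a, ha⟩ : ∃ a, a = aF ((t:ℝ)+1) Y := ⟨_, rfl⟩
  obtain ⟨b, hb⟩ : ∃ a, a = bF ((t:ℝ)+1) Y := ⟨_, rfl⟩
  obtain ⟨a2, ha2⟩ : ∃ a, a = aF ((t:ℝ)^2+t+1) Y2 := ⟨_, rfl⟩
  obtain ⟨b2, hb2⟩ : ∃ a, a = bF ((t:ℝ)^2+t+1) Y2 := ⟨_, rfl⟩
  simp only [← ha, ← hb, ← ha2, ← hb2] at e1 e2 e1' e2' e3
  obtain ⟨z, hz⟩ : ∃ z, z = Y2 * (1 - ζ) := ⟨_, rfl⟩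
  obtain ⟨l, hl⟩ : ∃ l, l = a2 - Y2 * lm - a2 * ζ := ⟨_, rfl⟩
  obtain ⟨d, hd⟩ : ∃ d, d = - μ * a2 - Y2 * δ - ((1 + Y2) - μ * a2) * ζ := ⟨_, rfl⟩
  obtain ⟨e, he⟩ : ∃ e, e = μ ^ 2 * b2 / 2 - Y2 * η - ((1 + Y2) - μ * a2) * δ - ((1 + Y2) - 2 * μ * a2 + μ ^ 2 * b2) / 2 * ζ := ⟨_, rfl⟩
  obtain ⟨S, hS⟩ : ∃ S, S = Y * (1 - z) := ⟨_, rfl⟩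
  obtain ⟨SL, hSL⟩ : ∃ S, S = a - Y * l - a * z := ⟨_, rfl⟩
  obtain ⟨SD, hSD⟩ : ∃ S, S = - μ * a - Y * d - ((1 + Y) - μ * a) * z := ⟨_, rfl⟩
  obtain ⟨SE, hSE⟩ : ∃ S, S = μ ^ 2 * b / 2 - Y * e - ((1 + Y) - μ * a) * d - ((1 + Y) - 2 * μ * a + μ ^ 2 * b) / 2 * z := ⟨_, rfl⟩
  have E1 : q * (2 - S) = 1 := by
    rw [hS, hz]; linear_combination -e1
  have E2 : 2 * q - q * SL - q * S = ((1 - q) * HH t q 1) * (pd t ht).toRD.mean := by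
    rw [hS, hSL, hl, hz]; linear_combination -e2
  have E3 : μ * q - (1 - μ) * q + q * SD + (1 + (1 - μ) * q) * S = 0 := by
    rw [hS, hSD, hd, hz]; linear_combination e2'
  have E4 : - μ ^ 2 * q / 2 - (1 - μ) ^ 2 * q / 2 + q * SE + (1 + (1 - μ) * q) * SD
      + (3 + (1 - μ) ^ 2 * q) / 2 * S = ((1 - q) * HH t q 1) * (- ((pd t ht).toRD.s2 / 2)) := by
    rw [hS, hSD, hSE, he, hd, hz]; linear_combination e3
  clear e1 e2 e1' e2' e3
  refine ⟨ζ, lm, δ, η, z, l, d, e, S, SL, SD, SE, Y, a, b, Y2, a2, b2, bζ, bL1, bD1, bD2, hY1, ha, hb, hY2, ha2, hb2,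
    hz, hl, hd, he, hS, hSL, hSD, hSE, E1, ?_, ?_⟩
  · refine mul_left_cancel₀ h0.ne' ?_
    linear_combination E3 + S * E1
  · refine mul_left_cancel₀ h0.ne' ?_
    have : (pd t ht).toRD.s2 / (pd t ht).toRD.mean * (2 * q - q * SL - q * S) = ((1 - q) * HH t q 1) * (pd t ht).toRD.s2 := by
      rw [E2]; field_simp
    linear_combination this + 2 * E4 + 3 * S * E1 + 2 * SD * E1

end

noncomputable section
open scoped BigOperators
open Filter MeasureTheory Topology
lemma sq_pow_dec (m0 : ℕ) (h0 : 4 ≤ m0) (m : ℕ) (hm : m0 ≤ m) :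
    (m:ℝ) ^ 2 * 0.6 ^ m ≤ (m0:ℝ) ^ 2 * 0.6 ^ m0 := by
  induction m, hm using Nat.le_induction with
  | base => exact le_rfl
  | succ m hm ih =>
    refine le_trans ?_ ih
    have h4 : (4:ℝ) ≤ m := by exact_mod_cast h0.trans hm
    have : (0:ℝ) < 0.6 ^ m := by positivity
    rw [pow_succ (0.6:ℝ) m]; push_cast
    nlinarith [mul_nonneg this.le (mul_nonneg (sub_nonneg.2 h4) (sub_nonneg.2 h4)), mul_nonneg this.le (sub_nonneg.2 h4)]

set_option maxHeartbeats 1000000 in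
/-- crude bounds for the tail quantities, `t ≥ 4` -/
lemma tail_bounds {t : ℕ} (ht : 4 ≤ t) {q μ ζ lm δ η z l d e Y2 a2 b2 : ℝ} (hq0 : 0 < q) (hq : q < 0.6)
    (m0 : 0 ≤ μ) (m1 : μ ≤ 1)
    (hζ : |ζ| ≤ 3.02 * q ^ hh t 3) (hlm : |lm| ≤ 3.02 * q ^ hh t 3 * hh t 3) (hδ : |δ| ≤ 3.02 * q ^ hh t 3 * hh t 3)
    (hη : |η| ≤ 3.02 * q ^ hh t 3 * hh t 3 ^ 2)
    (hY2 : Y2 = q ^ (t^2+t+1) / (1 - q ^ (t^2+t+1))) (ha2 : a2 = aF (t^2+t+1) Y2) (hb2 : b2 = bF (t^2+t+1) Y2)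
    (hz : z = Y2 * (1 - ζ)) (hl : l = a2 - Y2 * lm - a2 * ζ) (hd : d = - μ * a2 - Y2 * δ - ((1 + Y2) - μ * a2) * ζ)
    (he : e = μ ^ 2 * b2 / 2 - Y2 * η - ((1 + Y2) - μ * a2) * δ - ((1 + Y2) - 2 * μ * a2 + μ ^ 2 * b2) / 2 * ζ) :
    |z| ≤ 1.1 * q ^ (t^2+t+1) ∧ |l| ≤ 1.1 * ((t:ℝ)^2+t+1) * q ^ (t^2+t+1) ∧
    |d| ≤ 1.1 * ((t:ℝ)^2+t+1) * q ^ (t^2+t+1) ∧ |e| ≤ 1.1 * ((t:ℝ)^2+t+1)^2 * q ^ (t^2+t+1) := by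
  set y := q ^ (t^2+t+1) with hy
  have hy0 : 0 < y := by positivity
  obtain ⟨H, hH⟩ : ∃ H : ℝ, H = (t:ℝ)^2+t+1 := ⟨_, rfl⟩
  have hn : 21 ≤ t^2+t+1 := by nlinarith
  have hH21 : 21 ≤ H := by rw [hH]; exact_mod_cast hn
  have hHy : H ^ 2 * y ≤ 0.01 := by
    have h1 := sq_pow_dec 21 (by norm_num) (t^2+t+1) hn
    have h2 : y ≤ 0.6 ^ (t^2+t+1) := pow_le_pow_left₀ hq0.le hq.le _
    have h3 : H ^ 2 * y ≤ H ^ 2 * 0.6 ^ (t^2+t+1) := by gcongr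
    push_cast at h1
    rw [← hH] at h1
    refine h3.trans (h1.trans ?_)
    norm_num
  have hHyy : 21 * y ≤ H * y := mul_le_mul_of_nonneg_right hH21 hy0.le
  have hHHyy : 21 * (H * y) ≤ H ^ 2 * y := by
    rw [pow_two, mul_assoc]; exact mul_le_mul_of_nonneg_right hH21 (by positivity)
  have hHy1 : H * y ≤ 0.0005 := by linarith only [hHy, hHHyy]
  have hy1 : y ≤ 0.00003 := by linarith only [hHy1, hHyy]
  have hh3 : hh t 3 = t * (t^2+t+1) + 1 := by simp [hh]; ring
  obtain ⟨m, hm⟩ : ∃ m, hh t 3 = (t^2+t+1) + m ∧ 64 ≤ m ∧ hh t 3 ≤ 2 * m := by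
    refine ⟨hh t 3 - (t^2+t+1), ?_, ?_, ?_⟩ <;> rw [hh3]
    · have : t^2+t+1 ≤ t * (t^2+t+1) := Nat.le_mul_of_pos_left _ (by omega)
      omega
    · have : 4 * (t^2+t+1) ≤ t * (t^2+t+1) := Nat.mul_le_mul_right _ ht
      omega
    · have : 4 * (t^2+t+1) ≤ t * (t^2+t+1) := Nat.mul_le_mul_right _ ht
      omega
  have hq3 : (hh t 3 : ℝ) ^ 2 * q ^ hh t 3 ≤ 0.000000001 * y := by
    rw [hm.1, pow_add, ← hy, ← hm.1]
    have h1 := sq_pow_dec 64 (by norm_num) m hm.2.1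
    have h2 : q ^ m ≤ 0.6 ^ m := pow_le_pow_left₀ hq0.le hq.le _
    have h3 : (hh t 3 : ℝ) ≤ 2 * m := by exact_mod_cast hm.2.2
    have h4 : (hh t 3 : ℝ) ^ 2 * q ^ m ≤ (2 * m) ^ 2 * 0.6 ^ m := by gcongr
    have h5 : (hh t 3 : ℝ) ^ 2 * q ^ m ≤ 0.000000001 := by
      refine h4.trans ?_
      rw [mul_pow, mul_assoc]
      refine (mul_le_mul_of_nonneg_left h1 (by norm_num)).trans ?_
      norm_num
    calc _ = ((hh t 3 : ℝ) ^ 2 * q ^ m) * y := by ring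
      _ ≤ _ := by gcongr
  have hh1 : (1:ℝ) ≤ hh t 3 := by
    have : 15 ≤ hh t 3 := hh_three (by omega)
    exact_mod_cast (by omega : 1 ≤ hh t 3)
  have hq30 : 0 < q ^ hh t 3 := by positivity
  have b3 : |η| ≤ 0.00000001 * y := by refine hη.trans ?_; linarith only [hq3, hy0]
  have hq31 : (hh t 3 : ℝ) * q ^ hh t 3 ≤ 0.000000001 * y := by
    refine le_trans ?_ hq3
    exact mul_le_mul_of_nonneg_right (le_self_pow₀ hh1 (by norm_num)) hq30.le
  have b1 : |lm| ≤ 0.00000001 * y := by refine hlm.trans ?_; linarith only [hq31, hy0]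
  have b2' : |δ| ≤ 0.00000001 * y := by refine hδ.trans ?_; linarith only [hq31, hy0]
  have hq32 : q ^ hh t 3 ≤ 0.000000001 * y := by
    exact (le_mul_of_one_le_left hq30.le hh1).trans hq31
  have b0 : |ζ| ≤ 0.00000001 * y := by refine hζ.trans ?_; linarith only [hq32, hy0]
  have hYa : y ≤ Y2 := by
    rw [hY2]; exact le_div_self hy0.le (by linarith only [hy1]) (by linarith only [hy0])
  have hYb : Y2 ≤ 1.001 * y := by
    rw [hY2, div_le_iff₀ (by linarith only [hy1])]
    have : y * y ≤ 0.00003 * y := mul_le_mul_of_nonneg_right hy1 hy0.le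
    linarith only [this, hy0]
  have hY0 : 0 < Y2 := hy0.trans_le hYa
  have hY1 : Y2 ≤ 0.00004 := by linarith only [hYb, hy1]
  rw [← hH] at ha2 hb2 ⊢
  have ha0 : 0 ≤ a2 := by rw [ha2, aF]; positivity
  have ha1 : a2 ≤ 1.01 * (H * y) := by
    rw [ha2, aF]
    calc H * Y2 * (1 + Y2) ≤ H * (1.001 * y) * (1 + 0.00004) := by gcongr
      _ ≤ _ := by linarith only [mul_pos (by linarith only [hH21] : 0 < H) hy0]
  have hb0 : 0 ≤ b2 := by rw [hb2, bF]; positivity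
  have hb1 : b2 ≤ 1.01 * (H ^ 2 * y) := by
    rw [hb2, bF]
    calc H ^ 2 * Y2 * (1 + Y2) * (1 + 2 * Y2) ≤ H ^ 2 * (1.001 * y) * (1 + 0.00004) * (1 + 2 * 0.00004) := by gcongr
      _ ≤ _ := by linarith only [mul_pos (pow_pos (by linarith only [hH21] : 0 < H) 2) hy0]
  have am : ∀ {u v U W : ℝ}, |u| ≤ U → |v| ≤ W → |u * v| ≤ U * W := by
    intro u v U W h1 h2
    rw [abs_mul]; exact mul_le_mul h1 h2 (abs_nonneg _) ((abs_nonneg _).trans h1)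
  have aY : |Y2| ≤ 1.001 * y := by rw [abs_of_pos hY0]; exact hYb
  have a001 : a2 ≤ 0.001 := by linarith only [ha1, hHy1]
  have b02 : b2 ≤ 0.02 := by linarith only [hb1, hHy]
  have aa : |a2| ≤ 0.001 := by rw [abs_of_nonneg ha0]; exact a001
  have aY' : |Y2| ≤ 1 := by rw [abs_of_pos hY0]; linarith only [hY1]
  have am' : 0 ≤ μ * a2 := mul_nonneg m0 ha0
  have am1 : μ * a2 ≤ a2 := mul_le_of_le_one_left ha0 m1
  have mm0 : 0 ≤ μ ^ 2 * b2 := by positivity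
  have mm1 : μ ^ 2 * b2 ≤ b2 := mul_le_of_le_one_left hb0 (pow_le_one₀ m0 m1)
  have ac : |(1 + Y2) - μ * a2| ≤ 1.1 := by rw [abs_le]; constructor <;> linarith only [hY0, hY1, am', am1, a001]
  have ac2 : |((1 + Y2) - 2 * μ * a2 + μ ^ 2 * b2) / 2| ≤ 1.1 := by rw [abs_le]; constructor <;> linarith only [hY0, hY1, am', am1, a001, mm0, mm1, b02]
  have z1 := am aY' b0
  have l1 := am aY' b1
  have l2 := am aa b0
  have d1 := am aY' b2'
  have d2 := am ac b0
  have e1 := am aY' b3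
  have e2 := am ac b2'
  have e3 := am ac2 b0
  simp only [abs_le] at z1 l1 l2 d1 d2 e1 e2 e3 ⊢
  rw [hz, hl, hd, he, mul_assoc 1.1 H, mul_assoc 1.1 (H^2)]
  obtain ⟨z1, z1'⟩ := z1
  obtain ⟨l1, l1'⟩ := l1
  obtain ⟨l2, l2'⟩ := l2
  obtain ⟨d1, d1'⟩ := d1
  obtain ⟨d2, d2'⟩ := d2
  obtain ⟨e1, e1'⟩ := e1
  obtain ⟨e2, e2'⟩ := e2
  obtain ⟨e3, e3'⟩ := e3
  refine ⟨⟨?_, ?_⟩, ⟨?_, ?_⟩, ⟨?_, ?_⟩, ⟨?_, ?_⟩⟩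
  · linarith only [z1', hY0, hy0]
  · linarith only [z1, hYb, hy0]
  · linarith only [l1', l2', ha0, hHyy, hy0]
  · linarith only [l1, l2, ha1, hHyy, hy0]
  · linarith only [d1', d2', am1, ha1, hHyy, hy0]
  · linarith only [d1, d2, am', ha1, hHyy, hy0]
  · linarith only [e1', e2', e3', mm0, hHHyy, hHyy, hy0]
  · linarith only [e1, e2, e3, mm1, hb1, hHHyy, hHyy, hy0]

end

noncomputable section
open scoped BigOperators
open Filter MeasureTheory Topology
/-- numerator of the variance constant, without tail -/
def NV (h Y μ : ℝ) : ℝ := μ ^ 2 + (1 - μ) ^ 2 - (6 - 3 * Y + (1 - μ) ^ 2) * Y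
  + 2 * (3 - μ - Y) * μ * aF h Y - μ ^ 2 * bF h Y

lemma abs_mul_le' {u v U W : ℝ} (h1 : |u| ≤ U) (h2 : |v| ≤ W) : |u * v| ≤ U * W := by
  rw [abs_mul]; exact mul_le_mul h1 h2 (abs_nonneg _) ((abs_nonneg _).trans h1)

set_option maxHeartbeats 2000000 in
lemma simple_sys {t : ℕ} (ht : 4 ≤ t) {q μ V : ℝ} (H : Sys t q μ V) :
    ∃ Y z : ℝ, Y = q ^ (t+1) / (1 - q ^ (t+1)) ∧ |z| ≤ 1.1 * q ^ (t^2+t+1) ∧ q * (2 - Y * (1 - z)) = 1 ∧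
      |μ * (2 - Y - aF (t+1) Y) - (1 - 3 * Y + Y ^ 2)| ≤ 0.22 * (((t:ℝ)^2+t+1) * q ^ (t^2+t+1)) ∧
      |V * (2 - Y - aF (t+1) Y) - NV (t+1) Y μ| ≤ 0.6 * (((t:ℝ)^2+t+1)^2 * q ^ (t^2+t+1)) := by
  obtain ⟨hq0, hq, m0, m1, V0, ζ, lm, δ, η, z, l, d, e, S, SL, SD, SE, Y, a, b, Y2, a2, b2, hζ, hlm, hδ, hη, hY, ha, hb,
    hY2, ha2, hb2, hz, hl, hd, he, hS, hSL, hSD, hSE, E1, E2, E3⟩ := H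
  obtain ⟨bz, bl, bd, be⟩ := tail_bounds ht hq0 hq m0 m1 hζ hlm hδ hη hY2 ha2 hb2 hz hl hd he
  refine ⟨Y, z, hY, bz, by rw [← hS]; exact E1, ?_⟩
  rw [← ha]
  clear hζ hlm hδ hη hz hl hd he hY2 ha2 hb2
  set y2 := q ^ (t^2+t+1) with hy2
  have hy20 : 0 < y2 := by positivity
  obtain ⟨h2, hh2⟩ : ∃ h2 : ℝ, h2 = (t:ℝ)^2+t+1 := ⟨_, rfl⟩
  have hn : 21 ≤ t^2+t+1 := by nlinarith only [ht]
  have hH21 : 21 ≤ h2 := by rw [hh2]; exact_mod_cast hn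
  have hHy : h2 ^ 2 * y2 ≤ 0.01 := by
    have h1 := sq_pow_dec 21 (by norm_num) (t^2+t+1) hn
    have h2' : y2 ≤ 0.6 ^ (t^2+t+1) := pow_le_pow_left₀ hq0.le hq.le _
    have h3 : h2 ^ 2 * y2 ≤ h2 ^ 2 * 0.6 ^ (t^2+t+1) := by gcongr
    push_cast at h1
    rw [← hh2] at h1
    refine h3.trans (h1.trans ?_)
    norm_num
  rw [← hh2] at bl bd be ⊢
  have hHyy : 21 * y2 ≤ h2 * y2 := mul_le_mul_of_nonneg_right hH21 hy20.le
  have hHHyy : 21 * (h2 * y2) ≤ h2 ^ 2 * y2 := by rw [pow_two, mul_assoc]; exact mul_le_mul_of_nonneg_right hH21 (by positivity)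
  rw [mul_assoc] at bl bd be
  obtain ⟨y, hy⟩ : ∃ y, y = q ^ (t+1) := ⟨_, rfl⟩
  rw [← hy] at hY
  have hy0 : 0 < y := by rw [hy]; positivity
  obtain ⟨h, hh'⟩ : ∃ h : ℝ, h = (t:ℝ)+1 := ⟨_, rfl⟩
  rw [← hh'] at ha hb
  have hh5 : 5 ≤ h := by rw [hh']; have : (4:ℝ) ≤ t := by exact_mod_cast ht
                         linarith only [this]
  have hhy : h ^ 2 * y ≤ 1.944 := by
    have h1 := sq_pow_dec 5 (by norm_num) (t+1) (by omega)
    have h2' : y ≤ 0.6 ^ (t+1) := by rw [hy]; exact pow_le_pow_left₀ hq0.le hq.le _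
    have h3 : h ^ 2 * y ≤ h ^ 2 * 0.6 ^ (t+1) := by gcongr
    push_cast at h1
    rw [← hh'] at h1
    refine h3.trans (h1.trans ?_)
    norm_num
  have hhy1 : h * y ≤ 0.3888 := by
    have : 5 * (h * y) ≤ h ^ 2 * y := by rw [pow_two, mul_assoc]; exact mul_le_mul_of_nonneg_right hh5 (by positivity)
    linarith only [this, hhy]
  have hy1 : y ≤ 0.07776 := by
    have : 5 * y ≤ h * y := mul_le_mul_of_nonneg_right hh5 hy0.le
    linarith only [this, hhy1]
  have hYa : y ≤ Y := by rw [hY]; exact le_div_self hy0.le (by linarith only [hy1]) (by linarith only [hy0])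
  have hYb : Y ≤ 1.0844 * y := by 
    rw [hY, div_le_iff₀ (by linarith only [hy1])]
    have : y * y ≤ 0.07776 * y := mul_le_mul_of_nonneg_right hy1 hy0.le
    linarith only [this, hy0]
  have hY0 : 0 < Y := hy0.trans_le hYa
  have hY1 : Y ≤ 0.085 := by linarith only [hYb, hy1]
  have ha0 : 0 ≤ a := by rw [ha, aF]; positivity
  have ha1 : a ≤ 0.46 := by
    rw [ha, aF]
    calc h * Y * (1 + Y) ≤ h * (1.0844 * y) * (1 + 0.085) := by gcongr
      _ ≤ _ := by linarith only [hhy1]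
  have hb0 : 0 ≤ b := by rw [hb, bF]; positivity
  have hb1 : b ≤ 3 := by
    rw [hb, bF]
    calc h ^ 2 * Y * (1 + Y) * (1 + 2 * Y) ≤ h ^ 2 * (1.0844 * y) * (1 + 0.085) * (1 + 2 * 0.085) := by gcongr
      _ ≤ _ := by linarith only [hhy]
  have y2t : h2 * y2 ≤ 0.0005 := by linarith only [hHy, hHHyy]
  have y2s : y2 ≤ 0.0001 := by linarith only [hHyy, y2t]
  have aY : |Y| ≤ 0.085 := by rw [abs_of_pos hY0]; exact hY1
  have bz' := abs_le.1 bz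
  have bl' := abs_le.1 bl
  have bd' := abs_le.1 bd
  have be' := abs_le.1 be
  have zY := abs_le.1 (abs_mul_le' aY bz)
  have dY := abs_le.1 (abs_mul_le' aY bd)
  have lY := abs_le.1 (abs_mul_le' aY bl)
  have aa : |a| ≤ 0.46 := by rw [abs_of_nonneg ha0]; exact ha1
  have za := abs_le.1 (abs_mul_le' aa bz)
  have hS' : S = Y - Y * z := by rw [hS]; ring
  have S0 : 0 ≤ S := by rw [hS]; apply mul_nonneg hY0.le; linarith only [bz'.2, y2s]
  have S1 : S ≤ 0.1 := by rw [hS']; linarith only [zY.1, y2s, hY1]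
  have am0 : 0 ≤ μ * a := mul_nonneg m0 ha0
  have am1 : μ * a ≤ a := mul_le_of_le_one_left ha0 m1
  have mm0 : 0 ≤ (1 - μ) ^ 2 := sq_nonneg _
  have mm1 : (1 - μ) ^ 2 ≤ 1 := pow_le_one₀ (sub_nonneg.2 m1) (sub_le_self _ m0)
  have mu2 : μ ^ 2 ≤ 1 := pow_le_one₀ m0 m1
  have bb0 : 0 ≤ μ ^ 2 * b := by positivity
  have bb1 : μ ^ 2 * b ≤ b := mul_le_of_le_one_left hb0 mu2
  constructor
  · have key : μ * (2 - Y - a) - (1 - 3 * Y + Y ^ 2) = Y * d + z * ((1 + Y - μ * a) + Y * (3 - μ - Y - S)) := by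
      rw [hSD] at E2
      linear_combination E2 - (3 - μ - S - Y) * hS'
    have cz : |(1 + Y - μ * a) + Y * (3 - μ - Y - S)| ≤ 1.5 := by
      have hh0 : 0 ≤ Y * (3 - μ - Y - S) := mul_nonneg hY0.le (by linarith only [m1, hY1, S1])
      have : Y * (3 - μ - Y - S) ≤ 0.085 * 3 := mul_le_mul hY1 (by linarith only [m0, hY0, S0]) (by linarith only [m1, hY1, S1]) (by norm_num)
      rw [abs_le]; constructor <;> linarith only [hh0, this, hY0, hY1, am0, am1, ha1]
    rw [key]
    have t1 := abs_mul_le' aY bd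
    have t2 := abs_mul_le' bz cz
    refine (abs_add_le _ _).trans ?_
    linarith only [t1, t2, hHyy, hy20]
  · have dd : |1 + Y - μ * a| ≤ 1.085 := by rw [abs_le]; constructor <;> linarith only [hY0, hY1, am0, am1, ha1]
    have dz := abs_le.1 (abs_mul_le' dd bz)
    have dd' := abs_le.1 (abs_mul_le' dd bd)
    have hSDb : |SD| ≤ 0.5 := by
      rw [hSD, abs_le]; constructor <;> linarith only [am0, am1, ha1, dY.1, dY.2, dz.1, dz.2, y2t, y2s]
    have hSDp : |(3 - μ - S) * SD| ≤ 3 * 0.5 := abs_mul_le' (by rw [abs_le]; constructor <;> linarith only [m0, m1, S0, S1]) hSDb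
    have c1 : |((1 + Y) - 2 * μ * a + μ ^ 2 * b) / 2| ≤ 2.1 := by rw [abs_le]; constructor <;> linarith only [hY0, hY1, am0, am1, ha1, bb0, bb1, hb1]
    have c1z := abs_le.1 (abs_mul_le' c1 bz)
    have eY := abs_le.1 (abs_mul_le' aY be)
    have hSEb : -0.1 ≤ SE := by
      rw [hSE]; linarith only [bb0, eY.2, dd'.2, c1z.2, y2t, y2s, hHy, hy20]
    have hV : V ≤ 4 := by
      have h1 : 1.4 ≤ 2 - S - SL := by rw [hSL]; linarith only [S1, ha1, lY.1, za.1, y2t, y2s]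
      have h2 : 0 ≤ (6 - 3 * S + (1 - μ) ^ 2) * S := mul_nonneg (by linarith only [S1, mm0]) S0
      have h3 := (abs_le.1 hSDp).1
      have h5 : V * (2 - S - SL) ≤ 5.3 := by rw [E3]; linarith only [h2, h3, hSEb, mu2, mm1]
      have h6 : V * 1.4 ≤ V * (2 - S - SL) := mul_le_mul_of_nonneg_left h1 V0
      linarith only [h5, h6]
    have hVa : |V| ≤ 4 := by rw [abs_of_nonneg V0]; exact hV
    have key : V * (2 - Y - a) - NV h Y μ = e * (2 * Y) + d * (2 * (3 - μ - S) * Y + 2 * (1 + Y - μ * a)) - l * (V * Y)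
        + z * (- (V * Y) - V * a + Y * (6 + (1 - μ) ^ 2 - 3 * (S + Y)) + 2 * (μ * a) * Y + 2 * (3 - μ - S) * (1 + Y - μ * a)
          + ((1 + Y) - 2 * (μ * a) + μ ^ 2 * b)) := by
      rw [NV, ← ha, ← hb]
      rw [hSE, hSL, hSD] at E3
      rw [hS'] at E3 ⊢
      linear_combination E3
    have VY0 : 0 ≤ V * Y := mul_nonneg V0 hY0.le
    have VY1 : V * Y ≤ 4 * 0.085 := mul_le_mul hV hY1 hY0.le (by norm_num)
    have Va0 : 0 ≤ V * a := mul_nonneg V0 ha0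
    have Va1 : V * a ≤ 4 * 0.46 := mul_le_mul hV ha1 ha0 (by norm_num)
    have p10 : 0 ≤ (3 - μ - S) * Y := mul_nonneg (by linarith only [m1, S1]) hY0.le
    have p11 : (3 - μ - S) * Y ≤ 3 * 0.085 := mul_le_mul (by linarith only [m0, S0]) hY1 hY0.le (by norm_num)
    have p20 : 0 ≤ Y * (6 + (1 - μ) ^ 2 - 3 * (S + Y)) := mul_nonneg hY0.le (by linarith only [mm0, S1, hY1])
    have p21 : Y * (6 + (1 - μ) ^ 2 - 3 * (S + Y)) ≤ 0.085 * 7 := mul_le_mul hY1 (by linarith only [mm1, S0, hY0]) (by linarith only [mm0, S1, hY1]) (by norm_num)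
    have p30 : 0 ≤ μ * a * Y := mul_nonneg am0 hY0.le
    have p31 : μ * a * Y ≤ 0.46 * 0.085 := mul_le_mul (by linarith only [am1, ha1]) hY1 hY0.le (by norm_num)
    have p40 : 0 ≤ (3 - μ - S) * (1 + Y - μ * a) := mul_nonneg (by linarith only [m1, S1]) (by linarith only [am1, ha1, hY0])
    have p41 : (3 - μ - S) * (1 + Y - μ * a) ≤ 3 * 1.085 := mul_le_mul (by linarith only [m0, S0]) (by linarith only [am0, hY1]) (by linarith only [am1, ha1, hY0]) (by norm_num)
    have ce : |2 * Y| ≤ 0.17 := by rw [abs_le]; constructor <;> linarith only [hY0, hY1]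
    have cd : |2 * (3 - μ - S) * Y + 2 * (1 + Y - μ * a)| ≤ 2.8 := by rw [abs_le]; constructor <;> linarith only [p10, p11, hY0, hY1, am0, am1, ha1]
    have cl : |V * Y| ≤ 0.34 := by rw [abs_le]; constructor <;> linarith only [VY0, VY1]
    have cz : |- (V * Y) - V * a + Y * (6 + (1 - μ) ^ 2 - 3 * (S + Y)) + 2 * (μ * a) * Y + 2 * (3 - μ - S) * (1 + Y - μ * a)
          + ((1 + Y) - 2 * (μ * a) + μ ^ 2 * b)| ≤ 16 := by rw [abs_le]; constructor <;> linarith only [VY0, VY1, Va0, Va1, p20, p21, p30, p31, p40, p41, hY0, hY1, am0, am1, ha1, bb0, bb1, hb1]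
    have t1 := abs_mul_le' be ce
    have t2 := abs_mul_le' bd cd
    have t3 := abs_mul_le' bl cl
    have t4 := abs_mul_le' bz cz
    rw [← hh', key]
    refine (abs_add_le _ _).trans ?_
    refine (add_le_add_left (abs_sub _ _) _).trans ?_
    refine (add_le_add_left (add_le_add_left (abs_add_le _ _) _) _).trans ?_
    linarith only [t1, t2, t3, t4, hHHyy, hHyy, hy20]

end

noncomputable section
open scoped BigOperators
open Filter MeasureTheory Topology
def w3F (x r : ℝ) : ℝ := x - (1/2 + r) * x^2 + ((1 - r)/8 + r/2 + r^2) * x^3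
def MF (x r : ℝ) : ℝ := 2 - r * x - x * (1 + r * x)
def FmF (r w : ℝ) : ℝ := 1/2 + (1 - 5*r)/4 * w + (2*(1-r)^2 - r*(1-r) - 14*r^2)/8 * w^2
  + (9*(1-r)^3 + 27*r*(1-r)^2 - 76*r^2*(1-r) - 144*r^3)/32 * w^3
def FvF (r w : ℝ) : ℝ := r/4 + (-(1-r)^2 + 9*r*(1-r) - 14*r^2)/8 * w
  + (-4*(1-r)^3 + 20*r*(1-r)^2 + 3*r^2*(1-r) - 54*r^3)/16 * w^2
/-- `r` times the variance numerator in the variables `x, r` -/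
def NvF (x r μ : ℝ) : ℝ := r * (μ^2 + (1-μ)^2) - r * (6 - 3*(r*x) + (1-μ)^2) * (r*x)
  + 2 * r * (3 - μ - r*x) * μ * (x * (1 + r*x)) - μ^2 * (x * (1 + r*x) * (1 + 2*r*x))
def m2F (x r : ℝ) : ℝ := (1-5*r)*x/4 + ((1-5*r)*(1+r) + 2*r*(1+2*r))*x^2/8

lemma rpow_bd {r : ℝ} (h0 : 0 ≤ r) (h1 : r ≤ 1/8) (j : ℕ) : 0 ≤ r ^ j ∧ r ^ j ≤ (1/8) ^ j :=
  ⟨by positivity, pow_le_pow_left₀ h0 h1 j⟩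

lemma horner_bd {x Q R b c : ℝ} (hx0 : 0 ≤ x) (hx : x ≤ 0.035) (hQ : |Q| ≤ b) (hR : |R| ≤ c) : |Q + x * R| ≤ b + 0.035 * c := by
  refine (abs_add_le _ _).trans (add_le_add hQ (abs_mul_le' ?_ hR))
  rw [abs_of_nonneg hx0]; exact hx

set_option maxHeartbeats 1000000 in
lemma GM_id {x r : ℝ} (h0 : 0 ≤ r) (h1 : r ≤ 1/8) (hx0 : 0 ≤ x) (hx : x ≤ 0.035) :
    ∃ R : ℝ, |R| ≤ 149/100 ∧ MF x r * FmF r (w3F x r) - (1 - 3*(r*x) + (r*x)^2) = x^4 * (((-21/32) + (-27/16) * r + (275/32) * r^2 + (263/16) * r^3 + (19/16) * r^4) + x * R) := by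
  obtain ⟨a2, b2⟩ := rpow_bd h0 h1 2
  obtain ⟨a3, b3⟩ := rpow_bd h0 h1 3
  obtain ⟨a4, b4⟩ := rpow_bd h0 h1 4
  obtain ⟨a5, b5⟩ := rpow_bd h0 h1 5
  obtain ⟨a6, b6⟩ := rpow_bd h0 h1 6
  obtain ⟨a7, b7⟩ := rpow_bd h0 h1 7
  obtain ⟨a8, b8⟩ := rpow_bd h0 h1 8
  obtain ⟨a9, b9⟩ := rpow_bd h0 h1 9
  obtain ⟨a10, b10⟩ := rpow_bd h0 h1 10
  norm_num at b2 b3 b4 b5 b6 b7 b8 b9 b10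
  have q5 : |(111/128) + (399/128) * r + (-865/128) * r^2 + (-4847/128) * r^3 + (-3355/64) * r^4 + (-221/16) * r^5| ≤ 29/20 := by rw [abs_le]; constructor <;> linarith
  have q6 : |(-143/256) + (-645/256) * r + (231/256) * r^2 + (6591/256) * r^3 + (4999/64) * r^4 + (11649/128) * r^5 + (103/4) * r^6| ≤ 24/25 := by rw [abs_le]; constructor <;> linarith
  have q7 : |(221/1024) + (565/512) * r + (239/256) * r^2 + (-4037/512) * r^3 + (-41113/1024) * r^4 + (-689/8) * r^5 + (-2973/32) * r^6 + (-453/16) * r^7| ≤ 2/5 := by rw [abs_le]; constructor <;> linarith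
  have q8 : |(-27/512) + (-557/2048) * r + (-395/1024) * r^2 + (1223/1024) * r^3 + (295/32) * r^4 + (56103/2048) * r^5 + (56357/1024) * r^6 + (7695/128) * r^7 + (75/4) * r^8| ≤ 1/10 := by rw [abs_le]; constructor <;> linarith
  have q9 : |(63/8192) + (243/8192) * r + (1/1024) * r^2 + (-1093/4096) * r^3 + (-6777/8192) * r^4 + (-7953/8192) * r^5 + (-13551/4096) * r^6 + (-11913/1024) * r^7 + (-665/32) * r^8 + (-125/16) * r^9| ≤ 1/50 := by rw [abs_le]; constructor <;> linarith
  have q10 : |(-9/16384) + (9/8192) * r + (427/16384) * r^2 + (921/8192) * r^3 + (1565/16384) * r^4 + (-8121/8192) * r^5 + (-68559/16384) * r^6 + (-65433/8192) * r^7 + (-5809/1024) * r^8 + (237/128) * r^9 + (25/16) * r^10| ≤ 1/100 := by rw [abs_le]; constructor <;> linarith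
  have q11 : |(-9/16384) * r + (-81/16384) * r^2 + (-89/4096) * r^3 + (-281/8192) * r^4 + (2031/16384) * r^5 + (14979/16384) * r^6 + (22983/8192) * r^7 + (4983/1024) * r^8 + (637/128) * r^9 + (25/16) * r^10| ≤ 1/100 := by rw [abs_le]; constructor <;> linarith
  have s10 := horner_bd hx0 hx q10 q11
  have s9 := horner_bd hx0 hx q9 s10
  have s8 := horner_bd hx0 hx q8 s9
  have s7 := horner_bd hx0 hx q7 s8
  have s6 := horner_bd hx0 hx q6 s7
  have s5 := horner_bd hx0 hx q5 s6
  refine ⟨_, s5.trans (by norm_num), ?_⟩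
  simp only [MF, FmF, FvF, NvF, w3F, m2F]
  ring

set_option maxHeartbeats 1000000 in
lemma GV_id {x r : ℝ} (h0 : 0 ≤ r) (h1 : r ≤ 1/8) (hx0 : 0 ≤ x) (hx : x ≤ 0.035) :
    ∃ R : ℝ, |R| ≤ 81/100 ∧ NvF x r (1/2 + m2F x r) - MF x r * FvF r (w3F x r) = x^3 * (((-27/32) + (9/2) * r + (111/32) * r^2 + (-55/2) * r^3 + (-19/8) * r^4) + x * R) := by
  obtain ⟨a2, b2⟩ := rpow_bd h0 h1 2
  obtain ⟨a3, b3⟩ := rpow_bd h0 h1 3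
  obtain ⟨a4, b4⟩ := rpow_bd h0 h1 4
  obtain ⟨a5, b5⟩ := rpow_bd h0 h1 5
  obtain ⟨a6, b6⟩ := rpow_bd h0 h1 6
  obtain ⟨a7, b7⟩ := rpow_bd h0 h1 7
  obtain ⟨a8, b8⟩ := rpow_bd h0 h1 8
  norm_num at b2 b3 b4 b5 b6 b7 b8
  have q4 : |(27/64) + (-171/64) * r + (-59/64) * r^2 + (183/64) * r^3 + (1093/32) * r^4 + (423/32) * r^5| ≤ 79/100 := by rw [abs_le]; constructor <;> linarith
  have q5 : |(-13/64) + (45/64) * r + (69/32) * r^2 + (35/16) * r^3 + (-469/32) * r^4 + (-2419/64) * r^5 + (-925/64) * r^6| ≤ 17/50 := by rw [abs_le]; constructor <;> linarith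
  have q6 : |(5/128) + (-1/4) * r + (-7/512) * r^2 + (163/512) * r^3 + (171/512) * r^4 + (509/512) * r^5 + (1079/64) * r^6 + (33/4) * r^7| ≤ 2/25 := by rw [abs_le]; constructor <;> linarith
  have q7 : |(-1/256) + (9/256) * r + (-77/1024) * r^2 + (3/256) * r^3 + (-387/512) * r^4 + (41/32) * r^5 + (4087/1024) * r^6 + (-163/64) * r^7 + (-33/16) * r^8| ≤ 1/100 := by rw [abs_le]; constructor <;> linarith
  have q8 : |(-1/256) * r + (1/128) * r^2 + (43/1024) * r^3 + (281/1024) * r^4 + (-143/1024) * r^5 + (-1129/1024) * r^6 + (-295/64) * r^7 + (-33/16) * r^8| ≤ 1/100 := by rw [abs_le]; constructor <;> linarith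
  have s7 := horner_bd hx0 hx q7 q8
  have s6 := horner_bd hx0 hx q6 s7
  have s5 := horner_bd hx0 hx q5 s6
  have s4 := horner_bd hx0 hx q4 s5
  refine ⟨_, s4.trans (by norm_num), ?_⟩
  simp only [MF, FmF, FvF, NvF, w3F, m2F]
  ring

end

noncomputable section
open scoped BigOperators
open Filter MeasureTheory Topology
lemma w_bounds {x r w : ℝ} (h0 : 0 ≤ r) (h1 : r ≤ 1/8) (hx0 : 0 < x) (hx : x ≤ 0.035) (hw : |w - w3F x r| ≤ 0.046 * x^4) :
    x * (1 - 0.64 * x) ≤ w ∧ w ≤ x ∧ 0 ≤ w3F x r ∧ w3F x r ≤ x := by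
  have k0 : 0 ≤ (1 - r)/8 + r/2 + r^2 := by nlinarith
  have k1 : (1 - r)/8 + r/2 + r^2 ≤ 0.2 := by nlinarith
  have x2 : x^2 ≤ 0.035 * x := by nlinarith
  have x20 : 0 < x^2 := by positivity
  have x3 : x^3 ≤ 0.035 * x^2 := by nlinarith
  have x30 : 0 < x^3 := by positivity
  have x4 : x^4 ≤ 0.035 * x^3 := by nlinarith
  have p1 : 0 ≤ ((1 - r)/8 + r/2 + r^2) * x^3 := by positivity
  have p2 : ((1 - r)/8 + r/2 + r^2) * x^3 ≤ 0.2 * x^3 := by gcongr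
  have p3 : 0 ≤ r * x^2 := by positivity
  have p4 : r * x^2 ≤ 1/8 * x^2 := by gcongr
  rw [abs_le] at hw
  have e : w3F x r = x - 1/2 * x^2 - r * x^2 + ((1 - r)/8 + r/2 + r^2) * x^3 := by rw [w3F]; ring
  refine ⟨?_, ?_, ?_, ?_⟩ <;> linarith

lemma M_bounds {x r : ℝ} (h0 : 0 ≤ r) (h1 : r ≤ 1/8) (hx0 : 0 < x) (hx : x ≤ 0.035) :
    2 - 1.2 * x ≤ MF x r ∧ MF x r ≤ 2 := by
  have p1 : 0 ≤ r * x := by positivity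
  have p2 : r * x ≤ 1/8 * x := by gcongr
  have p3 : r * x * x ≤ 1/8 * x * 0.035 := by gcongr
  have p4 : 0 ≤ r * x * x := by positivity
  have e : MF x r = 2 - r * x - x - r * x * x := by rw [MF]; ring
  rw [e]
  constructor <;> linarith

set_option maxHeartbeats 1000000 in
lemma mu_pure {x r w μ : ℝ} (h0 : 0 < r) (h1 : r ≤ 1/8) (hx0 : 0 < x) (hx : x ≤ 0.035) (hw : |w - w3F x r| ≤ 0.046 * x^4)
    (hμ : |μ * MF x r - (1 - 3*(r*x) + (r*x)^2)| ≤ 0.22 * (r^4 * x^4)) :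
    |μ - FmF r w| ≤ 0.96 * ((1-r)^4 * w^4) := by
  obtain ⟨wl, wu, v0, v1⟩ := w_bounds h0.le h1 hx0 hx hw
  obtain ⟨M0, M1⟩ := M_bounds h0.le h1 hx0 hx
  obtain ⟨R, hR, hG⟩ := GM_id h0.le h1 hx0.le hx
  obtain ⟨v, hv⟩ : ∃ v, v = w3F x r := ⟨_, rfl⟩
  obtain ⟨M, hM⟩ : ∃ M, M = MF x r := ⟨_, rfl⟩
  obtain ⟨N, hN⟩ : ∃ N, N = 1 - 3*(r*x) + (r*x)^2 := ⟨_, rfl⟩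
  rw [← hv] at hw v0 v1 hG
  rw [← hM] at hμ M0 M1 hG
  rw [← hN] at hμ hG
  obtain ⟨a2, b2⟩ := rpow_bd h0.le h1 2
  obtain ⟨a3, b3⟩ := rpow_bd h0.le h1 3
  obtain ⟨a4, b4⟩ := rpow_bd h0.le h1 4
  norm_num at b2 b3 b4
  have x4 : 0 < x^4 := by positivity
  have hw0 : 0 < w := lt_of_lt_of_le (mul_pos hx0 (by linarith only [hx])) wl
  have hxR : |x * R| ≤ 0.035 * 1.49 := abs_mul_le' (by rw [abs_of_pos hx0]; exact hx) (hR.trans (by norm_num))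
  obtain ⟨Q, hQ⟩ : ∃ Q, Q = ((-21/32) + (-27/16) * r + (275/32) * r^2 + (263/16) * r^3 + (19/16) * r^4) + x * R := ⟨_, rfl⟩
  have hQb : |Q| ≤ 0.8 := by
    have h3 := abs_le.1 hxR
    rw [hQ, abs_le]
    constructor
    · nlinarith only [sq_nonneg (r - 0.08), h3.1, a2, a3, a4, h0, h1]
    · nlinarith only [h3.2, a2, a3, a4, b2, b3, b4, h0, h1]
  have hG' : M * FmF r v - N = x^4 * Q := by rw [hG, hQ]
  have t1 : |M * (μ - FmF r v)| ≤ 0.801 * x^4 := by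
    have e : M * (μ - FmF r v) = (μ * M - N) - x^4 * Q := by linear_combination -hG'
    have h2 : |x^4 * Q| ≤ x^4 * 0.8 := abs_mul_le' (by rw [abs_of_pos x4]) hQb
    have h3 : r^4 * x^4 ≤ 1/4096 * x^4 := by gcongr
    rw [e]
    refine (abs_sub _ _).trans ?_
    linarith only [hμ, h2, h3, x4]
  have t2 : |μ - FmF r v| ≤ 0.42 * x^4 := by
    rw [abs_mul, abs_of_pos (by linarith only [M0, hx] : 0 < M)] at t1
    have : 1.95 * |μ - FmF r v| ≤ M * |μ - FmF r v| := mul_le_mul_of_nonneg_right (by linarith only [M0, hx]) (abs_nonneg _)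
    linarith only [this, t1, x4]
  have t3 : |FmF r v - FmF r w| ≤ 0.046 * x^4 * 0.3 := by
    have e : FmF r v - FmF r w = (v - w) * ((1 - 5*r)/4 + (2 - 5*r - 11*r^2)/8 * (v + w)
        + (9 - 103*r^2 - 50*r^3)/32 * (v^2 + v*w + w^2)) := by
      simp only [FmF]; ring
    rw [e]
    refine abs_mul_le' (by rw [abs_sub_comm]; exact hw) ?_
    have g1 : |(1 - 5*r)/4| ≤ 1/4 := by rw [abs_le]; constructor <;> linarith only [h0, h1]
    have g2 : |(2 - 5*r - 11*r^2)/8| ≤ 1/4 := by rw [abs_le]; constructor <;> linarith only [h0, h1, a2, b2]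
    have g3 : |(9 - 103*r^2 - 50*r^3)/32| ≤ 9/32 := by rw [abs_le]; constructor <;> linarith only [h0, h1, a2, b2, a3, b3]
    have g4 : |v + w| ≤ 0.07 := by rw [abs_le]; constructor <;> linarith only [v0, v1, hw0, wu, hx]
    have g5 : |v^2 + v*w + w^2| ≤ 0.01 := by
      have y1 : v^2 ≤ 0.035^2 := by gcongr; linarith
      have y2 : w^2 ≤ 0.035^2 := by gcongr; linarith
      have y3 : v * w ≤ 0.035 * 0.035 := by gcongr <;> linarith
      rw [abs_of_nonneg (by positivity)]; linarith
    have g6 := abs_mul_le' g2 g4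
    have g7 := abs_mul_le' g3 g5
    refine (abs_add_le _ _).trans ?_
    refine (add_le_add_left (abs_add_le _ _) _).trans ?_
    linarith only [g1, g6, g7]
  have t4 : |μ - FmF r w| ≤ 0.44 * x^4 := by
    have : μ - FmF r w = (μ - FmF r v) + (FmF r v - FmF r w) := by ring
    rw [this]
    refine (abs_add_le _ _).trans ?_
    linarith only [t2, t3, x4]
  refine t4.trans ?_
  have u1 : 0.977 * x ≤ w := by
    have : x * 0.977 ≤ x * (1 - 0.64 * x) := mul_le_mul_of_nonneg_left (by linarith) hx0.le
    linarith
  have u2 : (0.977 * x)^4 ≤ w^4 := by gcongr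
  have u3 : (7/8:ℝ)^4 ≤ (1-r)^4 := by gcongr; linarith
  calc 0.44 * x^4 ≤ 0.96 * ((7/8)^4 * (0.977 * x)^4) := by rw [mul_pow]; norm_num; linarith
    _ ≤ _ := by gcongr

set_option maxHeartbeats 2000000 in
lemma V_pure {x r w μ V : ℝ} (h0 : 0 < r) (h1 : r ≤ 1/8) (hx0 : 0 < x) (hx : x ≤ 0.035) (hxr : x ≤ 2.2 * r^2)
    (hw : |w - w3F x r| ≤ 0.046 * x^4)
    (hμ : |μ * MF x r - (1 - 3*(r*x) + (r*x)^2)| ≤ 0.22 * (r^4 * x^4))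
    (hV : |r * V * MF x r - NvF x r μ| ≤ 0.6 * (r^5 * x^4)) :
    |r * V - FvF r w| ≤ 0.448 * ((1-r)^4 * w^3) := by
  obtain ⟨wl, wu, v0, v1⟩ := w_bounds h0.le h1 hx0 hx hw
  obtain ⟨M0, M1⟩ := M_bounds h0.le h1 hx0 hx
  obtain ⟨R, hR, hG⟩ := GV_id h0.le h1 hx0.le hx
  obtain ⟨a2, b2⟩ := rpow_bd h0.le h1 2
  obtain ⟨a3, b3⟩ := rpow_bd h0.le h1 3
  obtain ⟨a4, b4⟩ := rpow_bd h0.le h1 4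
  obtain ⟨a5, b5⟩ := rpow_bd h0.le h1 5
  norm_num at b2 b3 b4 b5
  have x2 : 0 < x^2 := by positivity
  have x3 : 0 < x^3 := by positivity
  have x4 : 0 < x^4 := by positivity
  have x43 : x^4 ≤ 0.035 * x^3 := by
    have : x * x^3 ≤ 0.035 * x^3 := by gcongr
    calc x^4 = x * x^3 := by ring
      _ ≤ _ := this
  have x32 : x^3 ≤ 0.035 * x^2 := by
    have : x * x^2 ≤ 0.035 * x^2 := by gcongr
    calc x^3 = x * x^2 := by ring
      _ ≤ _ := this
  have x21 : x^2 ≤ 0.035 * x := by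
    rw [pow_two]; gcongr
  have mid : 2 * (MF x r * (1/2 + m2F x r)) - 2 * (1 - 3*(r*x) + (r*x)^2)
      = x^3 * ((-1/4 - r/4 + 13/4 * r^2 + r^3/4) + x * (-r/4 + r^2/2 + r^3/4)) := by
    simp only [MF, m2F]; ring
  obtain ⟨v, hv⟩ : ∃ v, v = w3F x r := ⟨_, rfl⟩
  obtain ⟨M, hM⟩ : ∃ M, M = MF x r := ⟨_, rfl⟩
  obtain ⟨N, hN⟩ : ∃ N, N = 1 - 3*(r*x) + (r*x)^2 := ⟨_, rfl⟩
  have hm2 : |m2F x r| ≤ 0.27 * x := by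
    have g1 : |(1 - 5*r)/4| ≤ 1/4 := by rw [abs_le]; constructor <;> linarith only [h0, h1]
    have g2 : |((1-5*r)*(1+r) + 2*r*(1+2*r))/8| ≤ 1/8 := by
      have : ((1-5*r)*(1+r) + 2*r*(1+2*r))/8 = (1 - 2*r - r^2)/8 := by ring
      rw [this, abs_le]; constructor <;> linarith only [h0, h1, a2, b2]
    have g3 := abs_mul_le' g1 (le_of_eq (abs_of_pos hx0))
    have g4 := abs_mul_le' g2 (le_of_eq (abs_of_pos x2))
    have : m2F x r = (1 - 5*r)/4 * x + ((1-5*r)*(1+r) + 2*r*(1+2*r))/8 * x^2 := by simp only [m2F]; ring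
    rw [this]
    refine (abs_add_le _ _).trans ?_
    linarith only [g3, g4, x21, hx0]
  obtain ⟨m, hm⟩ : ∃ m, m = m2F x r := ⟨_, rfl⟩
  rw [← hv] at hw v0 v1 hG
  rw [← hM] at hμ hV M0 M1 hG mid
  rw [← hN] at hμ mid
  rw [← hm] at hG mid hm2
  have hc : |(-1/4 - r/4 + 13/4 * r^2 + r^3/4) + x * (-r/4 + r^2/2 + r^3/4)| ≤ 0.31 := by
    have g1 : |(-1/4 - r/4 + 13/4 * r^2 + r^3/4)| ≤ 0.3 := by rw [abs_le]; constructor <;> linarith only [h0, h1, a2, b2, a3, b3]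
    have g2 : |(-r/4 + r^2/2 + r^3/4)| ≤ 0.05 := by rw [abs_le]; constructor <;> linarith only [h0, h1, a2, b2, a3, b3]
    exact (horner_bd hx0.le hx g1 g2).trans (by norm_num)
  have d1 : |μ - (1/2 + m)| ≤ 0.081 * x^3 := by
    have t1 : |M * (μ - (1/2 + m))| ≤ 0.156 * x^3 := by
      have e : M * (μ - (1/2 + m)) = (μ * M - N) - (x^3 * ((-1/4 - r/4 + 13/4 * r^2 + r^3/4) + x * (-r/4 + r^2/2 + r^3/4))) / 2 := by
        linear_combination -mid/2
      have h2 := abs_mul_le' (le_of_eq (abs_of_pos x3)) hc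
      have h3 : r^4 * x^4 ≤ 1/4096 * (0.035 * x^3) := by gcongr
      rw [e]
      refine (abs_sub _ _).trans ?_
      rw [abs_div, abs_two]
      linarith only [hμ, h2, h3, x3]
    rw [abs_mul, abs_of_pos (by linarith only [M0, hx] : 0 < M)] at t1
    have : 1.95 * |μ - (1/2 + m)| ≤ M * |μ - (1/2 + m)| := mul_le_mul_of_nonneg_right (by linarith only [M0, hx]) (abs_nonneg _)
    linarith only [this, t1, x3]
  have d1' := abs_le.1 d1
  have hm2' := abs_le.1 hm2
  have rx0 : 0 ≤ r * x := by positivity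
  have rx1 : r * x ≤ 1/8 * x := by gcongr
  have d2 : |NvF x r μ - NvF x r (1/2 + m)| ≤ 0.081 * x^3 * (2.5 * x) := by
    have e : NvF x r μ - NvF x r (1/2 + m) = (μ - (1/2 + m)) * (r * (2 * (μ + (1/2 + m)) - 2)
        + r * ((r*x) * (2 - (μ + (1/2+m)))) + (r * (x * (1 + r*x))) * (2 * (3 - r*x - (μ + (1/2+m))))
        - (x * (1 + r*x) * (1 + 2*r*x)) * (μ + (1/2+m))) := by
      simp only [NvF]; ring
    rw [e]
    refine abs_mul_le' d1 ?_
    have ra : |r| ≤ 1/8 := by rw [abs_of_pos h0]; exact h1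
    have g1 : |2 * (μ + (1/2 + m)) - 2| ≤ 1.2 * x := by rw [abs_le]; constructor <;> linarith only [d1'.1, d1'.2, hm2'.1, hm2'.2, x32, x21, x2, x3, hx0, hx, rx0, rx1]
    have g2 : |2 - (μ + (1/2+m))| ≤ 1.1 := by rw [abs_le]; constructor <;> linarith only [d1'.1, d1'.2, hm2'.1, hm2'.2, x32, x21, x2, x3, hx0, hx, rx0, rx1]
    have g3 : |2 * (3 - r*x - (μ + (1/2+m)))| ≤ 4.2 := by rw [abs_le]; constructor <;> linarith only [d1'.1, d1'.2, hm2'.1, hm2'.2, x32, x21, x2, x3, hx0, hx, rx0, rx1]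
    have g4 : |μ + (1/2+m)| ≤ 1.05 := by rw [abs_le]; constructor <;> linarith only [d1'.1, d1'.2, hm2'.1, hm2'.2, x32, x21, x2, x3, hx0, hx, rx0, rx1]
    have g5 : |r * x| ≤ 1/8 * x := by rw [abs_of_nonneg rx0]; exact rx1
    have g6 : |x * (1 + r*x)| ≤ x * 1.01 := abs_mul_le' (le_of_eq (abs_of_pos hx0)) (by rw [abs_le]; constructor <;> linarith only [rx0, rx1, hx, hx0])
    have g7 : |x * (1 + r*x) * (1 + 2*r*x)| ≤ x * 1.01 * 1.01 := abs_mul_le' g6 (by rw [abs_le]; constructor <;> linarith only [rx0, rx1, hx, hx0])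
    have f1 := abs_mul_le' ra g1
    have f2 := abs_mul_le' ra (abs_mul_le' g5 g2)
    have f3 := abs_mul_le' (abs_mul_le' ra g6) g3
    have f4 := abs_mul_le' g7 g4
    refine (abs_sub _ _).trans ?_
    refine (add_le_add_left (abs_add_le _ _) _).trans ?_
    refine (add_le_add_left (add_le_add_left (abs_add_le _ _) _) _).trans ?_
    linarith only [f1, f2, f3, f4, hx0]
  have d3 : |FvF r v - FvF r w| ≤ 0.046 * x^4 * 0.2 := by
    have e : FvF r v - FvF r w = (v - w) * ((-1 + 11*r - 24*r^2)/8 + (-4 + 32*r - 49*r^2 - 33*r^3)/16 * (v + w)) := by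
      simp only [FvF]; ring
    rw [e]
    refine abs_mul_le' (by rw [abs_sub_comm]; exact hw) ?_
    have k2 : r^2 ≤ 1/8 * r := by rw [pow_two]; gcongr
    have k3 : r^3 ≤ 1/64 * r := by
      have : r^2 * r ≤ 1/64 * r := by gcongr
      calc r^3 = r^2 * r := by ring
        _ ≤ _ := this
    have g1 : |(-1 + 11*r - 24*r^2)/8| ≤ 0.18 := by rw [abs_le]; constructor <;> linarith only [k2, h0, h1, a2]
    have g2 : |(-4 + 32*r - 49*r^2 - 33*r^3)/16| ≤ 1/4 := by rw [abs_le]; constructor <;> linarith only [k2, k3, h0, h1, a2, a3]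
    have g4 : |v + w| ≤ 0.07 := by rw [abs_le]; constructor <;> linarith only [v0, v1, wl, wu, hx, hx0, x21]
    have g6 := abs_mul_le' g2 g4
    refine (abs_add_le _ _).trans ?_
    linarith only [g1, g6]
  obtain ⟨Q0, hQ0⟩ : ∃ Q0, Q0 = (-27/32) + (9/2) * r + (111/32) * r^2 + (-55/2) * r^3 + (-19/8) * r^4 := ⟨_, rfl⟩
  have hG' : NvF x r (1/2 + m) - M * FvF r v = x^3 * Q0 + x^4 * R := by rw [hG, hQ0]; ring
  have hQneg : |Q0| = -Q0 := by
    refine abs_of_nonpos ?_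
    rw [hQ0]; linarith only [h0, h1, a2, b2, a3, b3, a4, b4]
  have tot : |M * (r * V - FvF r w)| ≤ x^3 * (-Q0) + 1.1 * x^4 := by
    have e : M * (r * V - FvF r w) = (r * V * M - NvF x r μ) + (NvF x r μ - NvF x r (1/2 + m)) + M * (FvF r v - FvF r w)
        + x^3 * Q0 + x^4 * R := by linear_combination hG'
    have f1 : |M * (FvF r v - FvF r w)| ≤ 2 * (0.046 * x^4 * 0.2) := abs_mul_le' (by rw [abs_of_pos (by linarith only [M0, hx])]; exact M1) d3
    have f2 := abs_mul_le' (le_of_eq (abs_of_pos x3)) hQneg.le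
    have f3 := abs_mul_le' (le_of_eq (abs_of_pos x4)) hR
    have f4 : r^5 * x^4 ≤ 1/32768 * x^4 := by gcongr
    rw [e]
    refine (abs_add_le _ _).trans ?_
    refine (add_le_add_left (abs_add_le _ _) _).trans ?_
    refine (add_le_add_left (add_le_add_left (abs_add_le _ _) _) _).trans ?_
    refine (add_le_add_left (add_le_add_left (add_le_add_left (abs_add_le _ _) _) _) _).trans ?_
    have : x^3 * x = x^4 := by ring
    linarith only [this, f1, f2, f3, f4, d2, hV, x4]
  have Mpos : 0 < M := by linarith only [M0, hx]
  rw [abs_mul, abs_of_pos Mpos] at tot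
  refine le_of_mul_le_mul_left (tot.trans ?_) Mpos
  have u2 : (x * (1 - 0.64 * x))^3 ≤ w^3 := pow_le_pow_left₀ (mul_nonneg hx0.le (by linarith only [hx])) wl 3
  have u3 : 1 - 2 * x ≤ (1 - 0.64 * x)^3 := by
    have : (1 - 0.64 * x)^3 = 1 - 1.92*x + 1.2288*x^2 - 0.262144*x^3 := by ring
    linarith only [this, x32, x2, hx0]
  have u4 : (2 - 1.2 * x) * (1 - 2 * x) ≥ 2 - 5.2 * x := by linarith only [x2]
  have u5 : x^3 * (1 - 2 * x) ≤ w^3 := by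
    rw [mul_pow] at u2
    exact (mul_le_mul_of_nonneg_left u3 x3.le).trans u2
  have u6 : (2 - 1.2 * x) * (x^3 * (1 - 2 * x)) ≤ M * w^3 :=
    mul_le_mul M0 u5 (mul_nonneg x3.le (by linarith only [hx])) Mpos.le
  have u7 : x^3 * (2 - 5.2 * x) ≤ M * w^3 := by
    refine le_trans ?_ u6
    calc x^3 * (2 - 5.2 * x) ≤ x^3 * ((2 - 1.2 * x) * (1 - 2 * x)) := mul_le_mul_of_nonneg_left u4 x3.le
      _ = _ := by ring
  have rr : 0 ≤ (1-r)^4 := by positivity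
  have rr1 : (1-r)^4 ≤ 1 := pow_le_one₀ (by linarith only [h1]) (by linarith only [h0])
  have rl : 1 - 4*r + 6*r^2 - 4*r^3 ≤ (1-r)^4 := by
    have : (1-r)^4 = 1 - 4*r + 6*r^2 - 4*r^3 + r^4 := by ring
    linarith only [this, a4]
  have fin : -Q0 + 1.1 * x ≤ 0.448 * ((1-r)^4 * (2 - 5.2 * x)) := by
    have k1 : (1-r)^4 * x ≤ x := mul_le_of_le_one_left hx0.le rr1
    have k3 : r^3 ≤ 1/64 * r := by
      have : r^2 * r ≤ 1/64 * r := by gcongr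
      calc r^3 = r^2 * r := by ring
        _ ≤ _ := this
    have k2 : r^2 ≤ 1/8 * r := by rw [pow_two]; gcongr
    have k4 : r^4 ≤ 1/512 * r := by
      have : r^3 * r ≤ 1/512 * r := by gcongr
      calc r^4 = r^3 * r := by ring
        _ ≤ _ := this
    have : (1-r)^4 * (2 - 5.2 * x) = 2 * (1-r)^4 - 5.2 * ((1-r)^4 * x) := by ring
    rw [this, hQ0]
    linarith only [k1, k2, k3, k4, rl, hxr, hx0, h0, h1, a2, a3, a4]
  calc x^3 * (-Q0) + 1.1 * x^4 = x^3 * (-Q0 + 1.1 * x) := by ring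
    _ ≤ x^3 * (0.448 * ((1-r)^4 * (2 - 5.2 * x))) := mul_le_mul_of_nonneg_left fin x3.le
    _ = 0.448 * (1-r)^4 * (x^3 * (2 - 5.2 * x)) := by ring
    _ ≤ 0.448 * (1-r)^4 * (M * w^3) := mul_le_mul_of_nonneg_left u7 (by positivity)
    _ = _ := by ring

end

noncomputable section
open scoped BigOperators
open Filter MeasureTheory Topology
lemma cube_pow_dec (m : ℕ) (hm : 8 ≤ m) : (m:ℝ) ^ 3 * 0.5045 ^ m ≤ 2.15 := by
  induction m, hm using Nat.le_induction with
  | base => norm_num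
  | succ m hm ih =>
    refine le_trans ?_ ih
    have h4 : (8:ℝ) ≤ m := by exact_mod_cast hm
    have : (0:ℝ) < 0.5045 ^ m := by positivity
    rw [pow_succ (0.5045:ℝ) m]; push_cast
    have : ((m:ℝ) + 1)^3 * 0.5045 ≤ m^3 := by nlinarith [mul_nonneg (sub_nonneg.2 h4) (sub_nonneg.2 h4), mul_nonneg (mul_nonneg (sub_nonneg.2 h4) (sub_nonneg.2 h4)) (sub_nonneg.2 h4)]
    calc ((m:ℝ) + 1)^3 * (0.5045 ^ m * 0.5045) = (((m:ℝ) + 1)^3 * 0.5045) * 0.5045 ^ m := by ring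
      _ ≤ _ := by gcongr

/-- Bonferroni bounds -/
lemma bonf {u : ℝ} (h0 : 0 ≤ u) (h1 : u ≤ 1) (n : ℕ) :
    (1 - u)^n ≤ 1 - n * u + n * (n - 1) / 2 * u^2 ∧
    1 - n * u + n * (n - 1) / 2 * u^2 - n * (n - 1) * (n - 2) / 6 * u^3 ≤ (1 - u)^n := by
  induction n with
  | zero => simp
  | succ n ih =>
    obtain ⟨i1, i2⟩ := ih
    have hn : (0:ℝ) ≤ n * (n - 1) := by
      rcases Nat.eq_zero_or_pos n with h | h
      · simp [h]
      · have : (1:ℝ) ≤ n := by exact_mod_cast h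
        nlinarith
    have hn2 : (0:ℝ) ≤ n * (n - 1) * (n - 2) := by
      rcases Nat.lt_or_ge n 2 with h | h
      · interval_cases n <;> norm_num
      · have : (2:ℝ) ≤ n := by exact_mod_cast h
        exact mul_nonneg hn (by linarith)
    have u3 : 0 ≤ u^3 := by positivity
    have u4 : 0 ≤ u^4 := by positivity
    rw [pow_succ]
    push_cast
    constructor
    · have := mul_le_mul_of_nonneg_right i1 (sub_nonneg.2 h1)
      nlinarith [mul_nonneg hn u3]
    · have := mul_le_mul_of_nonneg_right i2 (sub_nonneg.2 h1)
      nlinarith [mul_nonneg hn2 u4]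

set_option maxHeartbeats 1000000 in
lemma large_data {t : ℕ} (ht : 7 ≤ t) {q μ V : ℝ} (H : Sys t q μ V) :
    ∃ x r w : ℝ, 0 < r ∧ r ≤ 1/8 ∧ 0 < x ∧ x ≤ 0.035 ∧ x ≤ 2.2 * r^2 ∧ |w - w3F x r| ≤ 0.046 * x^4 ∧
      |μ * MF x r - (1 - 3*(r*x) + (r*x)^2)| ≤ 0.22 * (r^4 * x^4) ∧ |r * V * MF x r - NvF x r μ| ≤ 0.6 * (r^5 * x^4) ∧
      r * (t + 1) = 1 ∧ r * w = 1 / 2^(t+1) := by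
  obtain ⟨Y, z, hY, hz, hS, h1, h2⟩ := simple_sys (by omega) H
  have hq0 := H.q_pos
  have hq := H.q_lt
  clear H
  obtain ⟨h, hh'⟩ : ∃ h : ℝ, h = (t:ℝ)+1 := ⟨_, rfl⟩
  have h8 : 8 ≤ h := by
    have : (7:ℝ) ≤ t := by exact_mod_cast ht
    linarith
  obtain ⟨y, hy⟩ : ∃ y, y = q ^ (t+1) := ⟨_, rfl⟩
  obtain ⟨y2, hy2⟩ : ∃ y2, y2 = q ^ (t^2+t+1) := ⟨_, rfl⟩
  obtain ⟨h22, hh2⟩ : ∃ h2 : ℝ, h2 = (t:ℝ)^2+t+1 := ⟨_, rfl⟩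
  have hy0 : 0 < y := by rw [hy]; positivity
  have hy20 : 0 < y2 := by rw [hy2]; positivity
  have tail : 1.1 * (h22^2 * y2) ≤ y^4 := by
    obtain ⟨m, hm⟩ : ∃ m, t^2+t+1 = 4*(t+1) + m := Nat.exists_eq_add_of_le (by nlinarith)
    have hm25 : 25 ≤ m := by nlinarith
    have hm3 : t^2+t+1 ≤ 3 * m := by nlinarith
    have e1 := sq_pow_dec 25 (by norm_num) m hm25
    have e2 : h22 ≤ 3 * m := by rw [hh2]; exact_mod_cast hm3
    have e20 : 0 ≤ h22 := by rw [hh2]; positivity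
    have e3 : q^m ≤ 0.6^m := pow_le_pow_left₀ hq0.le hq.le _
    have e4 : y2 = y^4 * q^m := by rw [hy2, hm, pow_add, hy, ← pow_mul, mul_comm (t+1) 4]
    have e5 : h22^2 * q^m ≤ (3*m)^2 * 0.6^m := by gcongr
    have e6 : h22^2 * q^m ≤ 0.1 := by
      refine e5.trans ?_
      rw [mul_pow, mul_assoc]
      refine (mul_le_mul_of_nonneg_left e1 (by norm_num)).trans ?_
      norm_num
    calc 1.1 * (h22^2 * y2) = 1.1 * (h22^2 * q^m) * y^4 := by rw [e4]; ring
      _ ≤ 1 * y^4 := by gcongr; linarith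
      _ = y^4 := one_mul _
  rw [← hy2] at hz h1 h2
  rw [← hh2, ← hh'] at h1 h2
  rw [← hy] at hY
  have h22l : 1 ≤ h22 := by rw [hh2]; nlinarith [(Nat.cast_nonneg t : (0:ℝ) ≤ t), sq_nonneg (t:ℝ)]
  have hh22 : h22 * y2 ≤ h22^2 * y2 := by exact mul_le_mul_of_nonneg_right (le_self_pow₀ h22l (by norm_num)) hy20.le
  have hhy2 : y2 ≤ h22 * y2 := le_mul_of_one_le_left hy20.le h22l
  have hysm : y ≤ 0.017 := by
    have e1 : y ≤ 0.6^(t+1) := by rw [hy]; exact pow_le_pow_left₀ hq0.le hq.le _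
    have e2 : (0.6:ℝ)^(t+1) ≤ 0.6^8 := pow_le_pow_of_le_one (by norm_num) (by norm_num) (by omega)
    refine e1.trans (e2.trans ?_)
    norm_num
  have hYa : y ≤ Y := by rw [hY]; exact le_div_self hy0.le (by linarith) (by linarith)
  have hYb : Y ≤ 0.0175 := by
    rw [hY, div_le_iff₀ (by linarith)]; linarith
  have hY0 : 0 < Y := by linarith
  have y4Y : y^4 ≤ Y^4 := by gcongr
  have Y4 : Y^4 ≤ 0.0175^4 := by gcongr
  norm_num at Y4
  have hzY : |z| ≤ Y^4 := by linarith
  have hz' := abs_le.1 hzY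
  have hS1 : Y * (1 - z) ≤ 0.0175 * 1.0001 := mul_le_mul hYb (by linarith) (by linarith) (by norm_num)
  have hS0 : 0 ≤ Y * (1 - z) := mul_nonneg hY0.le (by linarith)
  have hq' : q ≤ 0.5045 := by
    have : q * (2 - 0.0176) ≤ q * (2 - Y * (1 - z)) := by gcongr; linarith
    linarith
  have hhy : h^3 * y ≤ 2.15 := by
    have e0 := cube_pow_dec (t+1) (by omega)
    have e1 : y ≤ 0.5045^(t+1) := by rw [hy]; exact pow_le_pow_left₀ hq0.le hq' _
    push_cast at e0
    rw [← hh'] at e0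
    refine le_trans ?_ e0
    gcongr
  have hy3 : y ≤ 0.0042 := by
    have : (8:ℝ)^3 * y ≤ h^3 * y := by gcongr
    linarith
  have hYc : Y ≤ 1.005 * y := by
    rw [hY, div_le_iff₀ (by linarith)]
    have : y * y ≤ 0.0042 * y := mul_le_mul_of_nonneg_right hy3 hy0.le
    linarith
  have hh3Y : h^3 * Y ≤ 2.2 := by
    have : h^3 * Y ≤ h^3 * (1.005 * y) := by gcongr
    linarith
  have hpos : 0 < h := by linarith
  have hYy : y * (1 + Y) = Y := by
    have : (1 - y) ≠ 0 := by linarith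
    rw [hY]; field_simp; ring
  obtain ⟨S, hSd⟩ : ∃ S, S = Y * (1 - z) := ⟨_, rfl⟩
  rw [← hSd] at hS hS1 hS0
  obtain ⟨p, hp⟩ : ∃ p, p = (1 - S/2)^(t+1) := ⟨_, rfl⟩
  have hyp : y * p = 1 / 2^(t+1) := by
    rw [hy, hp, ← mul_pow, show q * (1 - S/2) = 1/2 by linarith, div_pow, one_pow]
  obtain ⟨r, hr⟩ : ∃ r, r = 1/h := ⟨_, rfl⟩
  obtain ⟨x, hx⟩ : ∃ x, x = h * Y := ⟨_, rfl⟩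
  have r0 : 0 < r := by rw [hr]; positivity
  have rh : r * h = 1 := by rw [hr]; field_simp
  have r8 : r ≤ 1/8 := by rw [hr]; exact one_div_le_one_div_of_le (by norm_num) h8
  have hYx : Y = r * x := by rw [hx, ← mul_assoc, rh, one_mul]
  have x0 : 0 < x := by rw [hx]; positivity
  have xr : x ≤ 2.2 * r^2 := by
    have : x = (h^3 * Y) * r^2 := by
      rw [hx]; linear_combination (-(h * Y) * (r*h+1)) * rh
    rw [this]; gcongr
  have x1 : x ≤ 0.035 := by
    have : r^2 ≤ (1/8)^2 := by gcongr
    linarith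
  -- the power
  obtain ⟨s, hs⟩ : ∃ s, s = h * S := ⟨_, rfl⟩
  have B := bonf (u := S/2) (by linarith) (by linarith) (t+1)
  push_cast at B
  rw [← hp, ← hh'] at B
  have hSs : S = r * s := by rw [hs, ← mul_assoc, rh, one_mul]
  have hs0 : 0 ≤ s := by rw [hs]; positivity
  have hsx : s = x - x * z := by rw [hs, hSd, hx]; ring
  have B1 : p ≤ 1 - s/2 + (1 - r) * s^2/8 := by
    refine B.1.trans (le_of_eq ?_)
    rw [hSs]; linear_combination (-s/2 + s^2/8 * (r * h + 1) - r * s^2/8) * rh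
  have B2 : 1 - s/2 + (1 - r) * s^2/8 - (1 - r) * (1 - 2*r) * s^3/48 ≤ p := by
    refine le_trans (le_of_eq ?_) B.2
    have e2 : r^2 * (h * (h-1)) = 1 - r := by linear_combination (r*h+1 - r) * rh
    have e3 : r^3 * (h * (h-1) * (h-2)) = (1 - r) * (1 - 2*r) := by
      linear_combination (r*h-2*r) * e2 + (1-r) * rh
    rw [hSs]; linear_combination (s/2) * rh - s^2/8 * e2 + s^3/48 * e3
  have Y4x : Y^4 ≤ 1/4096 * x^4 := by
    rw [hYx, mul_pow]
    have : r^4 ≤ (1/8)^4 := by gcongr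
    have : r^4 * x^4 ≤ (1/8)^4 * x^4 := by gcongr
    linarith
  have x20 : 0 < x^2 := by positivity
  have x30 : 0 < x^3 := by positivity
  have x40 : 0 < x^4 := by positivity
  have x43 : x^4 ≤ 0.035 * x^3 := by
    have : x * x^3 ≤ 0.035 * x^3 := by gcongr
    calc x^4 = x * x^3 := by ring
      _ ≤ _ := this
  have zx := abs_mul_le' (le_of_eq (abs_of_pos x0)) hzY
  have zx' := abs_le.1 zx
  have xY4 : x * Y^4 ≤ 0.00001 * x^3 := by
    have e1 : x * Y^4 ≤ 0.035 * Y^4 := by gcongr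
    have : 0 < Y^4 := by positivity
    linarith
  have sx1 : s ≤ x + 0.00001 * x^3 := by rw [hsx]; linarith
  have sx2 : x - 0.00001 * x^3 ≤ s := by rw [hsx]; linarith
  have x3s : x^3 ≤ 0.035 * x^2 := by
    have : x * x^2 ≤ 0.035 * x^2 := by gcongr
    calc x^3 = x * x^2 := by ring
      _ ≤ _ := this
  have x2s : x^2 ≤ 0.035 * x := by rw [pow_two]; gcongr
  have s1 : s ≤ 1.001 * x := by linarith
  have sd : |(s - x) * (-1/2 + (1-r)/8 * (s + x))| ≤ 0.00001 * x^3 * 0.6 := by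
    refine abs_mul_le' (by rw [abs_le]; constructor <;> linarith) ?_
    have g0 : 0 ≤ (1-r)/8 * (s + x) := mul_nonneg (by linarith) (by linarith)
    have g1 : (1-r)/8 * (s + x) ≤ 1/8 * 0.08 := mul_le_mul (by linarith) (by linarith) (by linarith) (by norm_num)
    rw [abs_le]; constructor <;> linarith
  have sd' := abs_le.1 sd
  have se : 1 - s/2 + (1 - r) * s^2/8 = 1 - x/2 + (1-r) * x^2/8 + (s - x) * (-1/2 + (1-r)/8 * (s + x)) := by ring
  have s3 : (1 - r) * (1 - 2*r) * s^3/48 ≤ 0.0211 * x^3 := by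
    have e1 : s^3 ≤ (1.001 * x)^3 := by gcongr
    have e2 : (1 - r) * (1 - 2*r) ≤ 1 * 1 := mul_le_mul (by linarith) (by linarith) (by linarith) (by norm_num)
    have e3 : (1 - r) * (1 - 2*r) * s^3 ≤ (1 * 1) * (1.001 * x)^3 := mul_le_mul e2 e1 (by positivity) (by norm_num)
    rw [mul_pow] at e3
    norm_num at e3
    linarith
  have P1 : p - (1 - x/2 + (1-r) * x^2/8) ≤ 0.0001 * x^3 := by linarith
  have P2 : -(0.0215 * x^3) ≤ p - (1 - x/2 + (1-r) * x^2/8) := by linarith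
  clear B B1 B2 se s3 sd sd' 
  have hw : (1 + r * x) * (h * y * p) = x * p := by
    rw [← hYx, hx]; linear_combination h * p * hYy
  refine ⟨x, r, h * y * p, r0, r8, x0, x1, xr, ?_, ?_, ?_, by rw [← hh']; exact rh, ?_⟩
  · obtain ⟨w, hwd⟩ : ∃ w, w = h * y * p := ⟨_, rfl⟩
    rw [← hwd] at hw ⊢
    have key : (1 + r * x) * (w - w3F x r) = x * (p - (1 - x/2 + (1-r) * x^2/8)) - r * ((1-r)/8 + r/2 + r^2) * x^4 := by
      rw [w3F]; linear_combination hw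
    have r2 : r^2 ≤ 1/8 * r := by rw [pow_two]; gcongr
    have r20 : 0 ≤ r^2 := sq_nonneg r
    have k0 : 0 ≤ r * ((1-r)/8 + r/2 + r^2) := mul_nonneg r0.le (by linarith)
    have k1 : r * ((1-r)/8 + r/2 + r^2) ≤ 1/8 * 0.19 := mul_le_mul r8 (by linarith) (by linarith) (by norm_num)
    have kk0 : 0 ≤ r * ((1-r)/8 + r/2 + r^2) * x^4 := mul_nonneg k0 x40.le
    have kk1 : r * ((1-r)/8 + r/2 + r^2) * x^4 ≤ 1/8 * 0.19 * x^4 := mul_le_mul_of_nonneg_right k1 x40.le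
    have l1 := mul_le_mul_of_nonneg_left P1 x0.le
    have l2 := mul_le_mul_of_nonneg_left P2 x0.le
    have e : x * x^3 = x^4 := by ring
    have ab : |(1 + r * x) * (w - w3F x r)| ≤ 0.046 * x^4 := by
      rw [key, abs_le]; constructor <;> linarith
    have rx0 : 0 ≤ r * x := by positivity
    rw [abs_mul, abs_of_pos (by linarith : 0 < 1 + r * x)] at ab
    refine le_trans ?_ ab
    exact le_mul_of_one_le_left (abs_nonneg _) (by linarith)
  · have e : μ * MF x r - (1 - 3*(r*x) + (r*x)^2) = μ * (2 - Y - aF h Y) - (1 - 3 * Y + Y^2) := by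
      rw [MF, aF, hYx]; linear_combination (-μ * x * (1 + r * x)) * rh * (-1)
    rw [e, ← mul_pow, ← hYx]
    linarith
  · have e : r * V * MF x r - NvF x r μ = r * (V * (2 - Y - aF h Y) - NV h Y μ) := by
      have ea : aF h Y = x * (1 + r*x) := by rw [aF, hYx]; linear_combination (x * (1 + r * x)) * rh
      have eb : r * bF h Y = x * (1 + r*x) * (1 + 2*r*x) := by
        rw [bF, hYx]; linear_combination (x * (1 + r * x) * (1 + 2*r*x)) * (r * h + 1) * rh
      rw [NV, ea]
      rw [MF, NvF, ← eb, hYx]; ring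
    rw [e, abs_mul, abs_of_pos r0]
    calc r * _ ≤ r * (0.6 * Y^4) := by gcongr; linarith
      _ = _ := by rw [hYx]; ring
  · rw [← hyp]; linear_combination y * p * rh

end

noncomputable section
open scoped BigOperators
open Filter MeasureTheory Topology
/-- the two final numerical estimates -/
def Bds (t : ℕ) (μ V : ℝ) : Prop :=
  |μ - (1/2 + ((t : ℝ) - 4)/2^(t+3) + (2*(t : ℝ)^2 - t - 14)/2^(2*t+5)
          + (9*(t : ℝ)^3 + 27*t^2 - 76*t - 144)/2^(3*t+8))|
        ≤ 0.06 * (t : ℝ)^4 / 2^(4*t) ∧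
      |V - (1/4 + (-(t : ℝ)^2 + 9*t - 14)/2^(t+4)
          + (-4*(t : ℝ)^3 + 20*t^2 + 3*t - 54)/2^(2*t+6))|
        ≤ 0.056 * (t : ℝ)^4 / 2^(3*t)

lemma bds_large {t : ℕ} (ht : 7 ≤ t) {q μ V : ℝ} (H : Sys t q μ V) : Bds t μ V := by
  obtain ⟨x, r, w, r0, r8, x0, x1, xr, hw, hμ, hV, rt, rw'⟩ := large_data ht H
  have b1 := mu_pure r0 r8 x0 x1 hw hμ
  have b2 := V_pure r0 r8 x0 x1 xr hw hμ hV
  clear hw hμ hV H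
  obtain ⟨E, hE⟩ : ∃ E : ℝ, E = 2^(t+1) := ⟨_, rfl⟩
  have E0 : 0 < E := by rw [hE]; positivity
  rw [← hE] at rw'
  obtain ⟨T, hT⟩ : ∃ T : ℝ, T = (t:ℝ) := ⟨_, rfl⟩
  rw [← hT] at rt
  have e3 : (2:ℝ)^(t+3) = 4 * E := by rw [hE]; ring
  have e4 : (2:ℝ)^(t+4) = 8 * E := by rw [hE]; ring
  have e5 : (2:ℝ)^(2*t+5) = 8 * E^2 := by rw [hE]; ring
  have e6 : (2:ℝ)^(2*t+6) = 16 * E^2 := by rw [hE]; ring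
  have e8 : (2:ℝ)^(3*t+8) = 32 * E^3 := by rw [hE]; ring
  have e9 : (2:ℝ)^(3*t) = E^3 / 8 := by rw [hE]; ring
  have e10 : (2:ℝ)^(4*t) = E^4 / 16 := by rw [hE]; ring
  rw [Bds, ← hT, e3, e4, e5, e6, e8, e9, e10]
  have hTr : T * r = 1 - r := by linear_combination rt
  have wE : r * w * E = 1 := by rw [rw']; field_simp
  have hw0 : w = (T + 1) / E := by
    rw [eq_div_iff E0.ne']
    linear_combination (T + 1) * wE - w * E * rt
  have hr : r = 1 / (T + 1) := by
    have : T + 1 ≠ 0 := by intro h; rw [h] at rt; simp at rt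
    rw [eq_div_iff this]; exact rt
  have hT1 : T + 1 ≠ 0 := by intro h; rw [h] at rt; simp at rt
  constructor
  · have e : FmF r w = 1/2 + (T - 4)/(4*E) + (2*T^2 - T - 14)/(8*E^2) + (9*T^3 + 27*T^2 - 76*T - 144)/(32*E^3) := by
      rw [FmF, hw0, hr]; field_simp; ring
    have e' : 0.96 * ((1-r)^4 * w^4) = 0.06 * T^4 / (E^4/16) := by
      rw [hw0, hr]; field_simp; ring
    rw [← e, ← e']; exact b1
  · have e : FvF r w = r * (1/4 + (-T^2 + 9*T - 14)/(8*E) + (-4*T^3 + 20*T^2 + 3*T - 54)/(16*E^2)) := by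
      rw [FvF, hw0, hr]; field_simp; ring
    have e' : 0.448 * ((1-r)^4 * w^3) = r * (0.056 * T^4 / (E^3/8)) := by
      rw [hw0, hr]; field_simp; ring
    rw [e, e', ← mul_sub, abs_mul, abs_of_pos r0] at b2
    exact le_of_mul_le_mul_left b2 r0

end

noncomputable section
open scoped BigOperators
open Filter MeasureTheory Topology
/-- `x` lies in the interval `[lo, hi]` -/
def Iv (x lo hi : ℝ) : Prop := lo ≤ x ∧ x ≤ hi

lemma Iv.add {x y a b c d L U : ℝ} (hx : Iv x a b) (hy : Iv y c d) (h : L ≤ a + c ∧ b + d ≤ U) :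
    Iv (x + y) L U := ⟨by linarith [hx.1, hy.1, h.1], by linarith [hx.2, hy.2, h.2]⟩

lemma Iv.sub {x y a b c d L U : ℝ} (hx : Iv x a b) (hy : Iv y c d) (h : L ≤ a - d ∧ b - c ≤ U) :
    Iv (x - y) L U := ⟨by linarith [hx.1, hy.2, h.1], by linarith [hx.2, hy.1, h.2]⟩

lemma Iv.mul {x y a b c d L U : ℝ} (hx : Iv x a b) (hy : Iv y c d)
    (h : (L ≤ a * c ∧ L ≤ a * d ∧ L ≤ b * c ∧ L ≤ b * d) ∧
      (a * c ≤ U ∧ a * d ≤ U ∧ b * c ≤ U ∧ b * d ≤ U)) : Iv (x * y) L U := by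
  obtain ⟨x1, x2⟩ := hx
  obtain ⟨y1, y2⟩ := hy
  obtain ⟨⟨l1, l2, l3, l4⟩, u1, u2, u3, u4⟩ := h
  constructor
  · rcases le_total 0 x with s | s
    · have := mul_le_mul_of_nonneg_left y1 s
      rcases le_total 0 c with s' | s'
      · linarith [mul_le_mul_of_nonneg_right x1 s']
      · linarith [mul_le_mul_of_nonpos_right x2 s']
    · have := mul_le_mul_of_nonpos_left y2 s
      rcases le_total 0 d with s' | s'
      · linarith [mul_le_mul_of_nonneg_right x1 s']
      · linarith [mul_le_mul_of_nonpos_right x2 s']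
  · rcases le_total 0 x with s | s
    · have := mul_le_mul_of_nonneg_left y2 s
      rcases le_total 0 d with s' | s'
      · linarith [mul_le_mul_of_nonneg_right x2 s']
      · linarith [mul_le_mul_of_nonpos_right x1 s']
    · have := mul_le_mul_of_nonpos_left y1 s
      rcases le_total 0 c with s' | s'
      · linarith [mul_le_mul_of_nonneg_right x2 s']
      · linarith [mul_le_mul_of_nonpos_right x1 s']

lemma Iv.mulp {x y a b c d L U : ℝ} (hx : Iv x a b) (hy : Iv y c d)
    (h : 0 ≤ a ∧ 0 ≤ c ∧ L ≤ a * c ∧ b * d ≤ U) : Iv (x * y) L U :=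
  ⟨h.2.2.1.trans (mul_le_mul hx.1 hy.1 h.2.1 (h.1.trans hx.1)),
    (mul_le_mul hx.2 hy.2 (h.2.1.trans hy.1) (h.1.trans (hx.1.trans hx.2))).trans h.2.2.2⟩

lemma Iv.pow {x a b L U : ℝ} (n : ℕ) (hx : Iv x a b) (h : 0 ≤ a ∧ L ≤ a ^ n ∧ b ^ n ≤ U) :
    Iv (x ^ n) L U :=
  ⟨h.2.1.trans (pow_le_pow_left₀ h.1 hx.1 n), (pow_le_pow_left₀ (h.1.trans hx.1) hx.2 n).trans h.2.2⟩

/-- interval for a quotient given implicitly by `x * D = N` -/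
lemma Iv.quot {x D N a b c d L U : ℝ} (hD : Iv D a b) (hN : Iv N c d) (hx : x * D = N)
    (h : 0 < a ∧ (L * a ≤ c ∧ L * b ≤ c) ∧ (d ≤ U * a ∧ d ≤ U * b)) : Iv x L U := by
  obtain ⟨D1, D2⟩ := hD
  obtain ⟨N1, N2⟩ := hN
  obtain ⟨a0, ⟨l1, l2⟩, u1, u2⟩ := h
  have D0 : 0 < D := a0.trans_le D1
  constructor
  · refine le_of_mul_le_mul_right ?_ D0
    rcases le_total 0 L with s | s
    · linarith [mul_le_mul_of_nonneg_left D2 s]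
    · linarith [mul_le_mul_of_nonpos_left D1 s]
  · refine le_of_mul_le_mul_right ?_ D0
    rcases le_total 0 U with s | s
    · linarith [mul_le_mul_of_nonneg_left D1 s]
    · linarith [mul_le_mul_of_nonpos_left D2 s]

/-- interval for `q^h/(1-q^h)` -/
lemma Iv.geo {q a b Y L U : ℝ} (h : ℕ) (hq : Iv q a b) (hY : Y = q ^ h / (1 - q ^ h))
    (H : 0 ≤ a ∧ 0 < 1 - b ^ h ∧ L * (1 - a ^ h) ≤ a ^ h ∧ b ^ h ≤ U * (1 - b ^ h)) : Iv Y L U := by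
  obtain ⟨a0, b1, l, u⟩ := H
  have h1 : a ^ h ≤ q ^ h := pow_le_pow_left₀ a0 hq.1 h
  have h2 : q ^ h ≤ b ^ h := pow_le_pow_left₀ (a0.trans hq.1) hq.2 h
  have h0 : 0 < 1 - q ^ h := by linarith
  have h0' : 0 < 1 - a ^ h := by linarith
  have e1 : L ≤ a ^ h / (1 - a ^ h) := by rw [le_div_iff₀ h0']; exact l
  have e2 : b ^ h / (1 - b ^ h) ≤ U := by rw [div_le_iff₀ b1]; exact u
  have p0 : 0 ≤ a ^ h := pow_nonneg a0 h
  constructor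
  · rw [hY]; exact e1.trans (div_le_div₀ (p0.trans h1) h1 h0 (by linarith))
  · rw [hY]; exact le_trans (div_le_div₀ (by linarith) h2 b1 (by linarith)) e2

/-- one step of the fixed point iteration for `q` -/
lemma Iv.step {q a b Y z zl zu : ℝ} (h : ℕ) (L U : ℝ) (hq : Iv q a b) (hY : Y = q ^ h / (1 - q ^ h))
    (hz : Iv z zl zu) (E : q * (2 - Y * (1 - z)) = 1) (yl yu : ℝ)
    (H : 0 ≤ a ∧ 0 < 1 - b ^ h ∧ yl * (1 - a ^ h) ≤ a ^ h ∧ b ^ h ≤ yu * (1 - b ^ h))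
    (H2 : 0 ≤ yl ∧ zu ≤ 1 ∧ yu * (1 - zl) < 2 ∧
      L * (2 - yl * (1 - zu)) ≤ 1 ∧ 0 ≤ L ∧ 1 ≤ U * (2 - yu * (1 - zl)) ∧ 0 ≤ U) : Iv q L U := by
  obtain ⟨i1, i2⟩ := Iv.geo h hq hY H
  obtain ⟨z1, z2⟩ := hz
  obtain ⟨y0, zz, p2, l, L0, u, U0⟩ := H2
  have s1 : yl * (1 - zu) ≤ Y * (1 - z) := by
    apply mul_le_mul i1 (by linarith) (by linarith) (by linarith)
  have s2 : Y * (1 - z) ≤ yu * (1 - zl) := by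
    apply mul_le_mul i2 (by linarith) (by linarith) (by linarith)
  have D0 : 0 < 2 - Y * (1 - z) := by linarith
  constructor
  · refine le_of_mul_le_mul_right ?_ D0
    rw [E]
    linarith [mul_le_mul_of_nonneg_left s1 L0]
  · refine le_of_mul_le_mul_right ?_ D0
    rw [E]
    linarith [mul_le_mul_of_nonneg_left s2 U0]

lemma Iv.of_abs {x B c : ℝ} (h : |x| ≤ B) (hB : B ≤ c) : Iv x (-c) c :=
  ⟨by linarith [(abs_le.mp h).1], by linarith [(abs_le.mp h).2]⟩

/-- the equation for `μ` in solved form -/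
lemma mu_solved {μ S SD Y a d z Y2 a2 δ ζ : ℝ} (hSD : SD = - μ * a - Y * d - ((1 + Y) - μ * a) * z)
    (hd : d = - μ * a2 - Y2 * δ - ((1 + Y2) - μ * a2) * ζ) (E2 : 2 * μ - 1 + (3 - μ - S) * S + SD = 0) :
    μ * (2 - S - a + Y * a2 * (1 - ζ) + a * z) =
      1 - (3 - S) * S - Y * (Y2 * δ + (1 + Y2) * ζ) + (1 + Y) * z := by
  subst hd hSD
  linear_combination E2

end

noncomputable section
open scoped BigOperators
open Filter MeasureTheory Topology
set_option maxHeartbeats 4000000 in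
lemma bds_2 {q μ V : ℝ} (H : Sys 2 q μ V) : Bds 2 μ V := by
  obtain ⟨hq0, hq, m0, m1, V0, ζ, lm, δ, η, z, l, d, e, S, SL, SD, SE, Y, a, b, Y2, a2, b2, hζ, hlm, hδ, hη, hY, ha, hb, hY2,
    ha2, hb2, hz, hl, hd, he, hS, hSL, hSD, hSE, E1, E2, E3⟩ := H
  rw [show hh 2 3 = 15 by simp [hh]] at hζ hlm hδ hη
  norm_num at hY hY2 hζ hlm hδ hη
  rw [hS] at E1
  have ha : a = 3 * Y * (1 + Y) := by rw [ha, aF]; norm_num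
  have hb : b = 9 * Y * (1 + Y) * (1 + 2 * Y) := by rw [hb, bF]; norm_num
  have ha2 : a2 = 7 * Y2 * (1 + Y2) := by rw [ha2, aF]; norm_num
  have hb2 : b2 = 49 * Y2 * (1 + Y2) * (1 + 2 * Y2) := by rw [hb2, bF]; norm_num
  have E4 := mu_solved hSD hd E2
  have q0 : Iv q 0 0.6 := ⟨hq0.le, hq.le⟩
  have tP : q ^ 15 ≤ 0.000470184985 := (q0.pow 15 (L := 0) (U := 0.000470184985) (by norm_num)).2
  have iζ : Iv ζ (-0.001419958655) 0.001419958655 := Iv.of_abs hζ (by linarith only [tP])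
  have ilm : Iv lm (-0.021299379821) 0.021299379821 := Iv.of_abs hlm (by linarith only [tP])
  have iδ : Iv δ (-0.021299379821) 0.021299379821 := Iv.of_abs hδ (by linarith only [tP])
  have iη : Iv η (-0.319490697308) 0.319490697308 := Iv.of_abs hη (by linarith only [tP])
  have iY2 : Iv Y2 0 0.02879981038 := q0.geo 7 hY2 (by norm_num)
  have c0 : Iv (1:ℝ) 1 1 := ⟨le_rfl, le_rfl⟩
  have i1 := c0.sub iζ (L := 0.99858004134) (U := 1.00141995866) (by norm_num)
  have i2 := iY2.mulp i1 (L := 0) (U := 0.02884070493) (by norm_num)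
  have iz : Iv z 0 0.02884070493 := by rw [hz]; exact i2
  have q1 := Iv.step 3 0.5 0.579882 q0 hY iz E1 0 0.275511 (by norm_num) (by norm_num)
  have q2 := Iv.step 3 0.537269 0.568902 q1 hY iz E1 0.142857 0.242226 (by norm_num) (by norm_num)
  have q3 := Iv.step 3 0.548925 0.563596 q2 hY iz E1 0.183553 0.225678 (by norm_num) (by norm_num)
  have q4 := Iv.step 3 0.553239 0.561186 q3 hY iz E1 0.19818 0.218058 (by norm_num) (by norm_num)
  have q5 := Iv.step 3 0.554929 0.560123 q4 hY iz E1 0.20385 0.214675 (by norm_num) (by norm_num)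
  have q6 := Iv.step 3 0.555606 0.55966 q5 hY iz E1 0.20611 0.213198 (by norm_num) (by norm_num)
  have tP : q ^ 15 ≤ 0.000165525163 := (q6.pow 15 (L := 0) (U := 0.000165525163) (by norm_num)).2
  have iζ : Iv ζ (-0.000499885993) 0.000499885993 := Iv.of_abs hζ (by linarith only [tP])
  have ilm : Iv lm (-0.007498289884) 0.007498289884 := Iv.of_abs hlm (by linarith only [tP])
  have iδ : Iv δ (-0.007498289884) 0.007498289884 := Iv.of_abs hδ (by linarith only [tP])
  have iη : Iv η (-0.112474348259) 0.112474348259 := Iv.of_abs hη (by linarith only [tP])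
  have iY2 : Iv Y2 0.01661595901 0.01749861614 := q6.geo 7 hY2 (by norm_num)
  have i3 := c0.sub iζ (L := 0.999500114) (U := 1.000499886) (by norm_num)
  have i4 := iY2.mulp i3 (L := 0.01660765292) (U := 0.01750736346) (by norm_num)
  have iz : Iv z 0.01660765292 0.01750736346 := by rw [hz]; exact i4
  have q7 := Iv.step 3 0.556606 0.5583557 q6 hY iz E1 0.2070216 0.2125568 (by norm_num) (by norm_num)
  have q8 := Iv.step 3 0.5570182 0.5578059 q7 hY iz E1 0.2083748 0.2107617 (by norm_num) (by norm_num)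
  have q9 := Iv.step 3 0.557189 0.5575757 q8 hY iz E1 0.2089349 0.2100091 (by norm_num) (by norm_num)
  have q10 := Iv.step 3 0.5572599 0.5574796 q9 hY iz E1 0.2091674 0.2096947 (by norm_num) (by norm_num)
  have q11 := Iv.step 3 0.5572894 0.5574395 q10 hY iz E1 0.2092639 0.2095635 (by norm_num) (by norm_num)
  have tP : q ^ 15 ≤ 0.000155943075 := (q11.pow 15 (L := 0) (U := 0.000155943075) (by norm_num)).2
  have iζ : Iv ζ (-0.000470948087) 0.000470948087 := Iv.of_abs hζ (by linarith only [tP])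
  have ilm : Iv lm (-0.007064221298) 0.007064221298 := Iv.of_abs hlm (by linarith only [tP])
  have iδ : Iv δ (-0.007064221298) 0.007064221298 := Iv.of_abs hδ (by linarith only [tP])
  have iη : Iv η (-0.105963319463) 0.105963319463 := Iv.of_abs hη (by linarith only [tP])
  have iY2 : Iv Y2 0.01697762258 0.01701020259 := q11.geo 7 hY2 (by norm_num)
  have i5 := c0.sub iζ (L := 0.99952905191) (U := 1.00047094809) (by norm_num)
  have i6 := iY2.mulp i5 (L := 0.016969627) (U := 0.01701821352) (by norm_num)
  have iz : Iv z 0.016969627 0.01701821352 := by rw [hz]; exact i6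
  have q12 := Iv.step 3 0.55733351 0.55739916 q11 hY iz E1 0.20930418 0.20950879 (by norm_num) (by norm_num)
  have q13 := Iv.step 3 0.55735186 0.55738236 q12 hY iz E1 0.20936429 0.20945379 (by norm_num) (by norm_num)
  have q14 := Iv.step 3 0.5573595 0.55737537 q13 hY iz E1 0.2093893 0.20943088 (by norm_num) (by norm_num)
  have q15 := Iv.step 3 0.55736268 0.55737245 q14 hY iz E1 0.20939971 0.20942135 (by norm_num) (by norm_num)
  have tP : q ^ 15 ≤ 0.000155661954 := (q15.pow 15 (L := 0) (U := 0.000155661954) (by norm_num)).2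
  have iζ : Iv ζ (-0.000470099102) 0.000470099102 := Iv.of_abs hζ (by linarith only [tP])
  have ilm : Iv lm (-0.007051486517) 0.007051486517 := Iv.of_abs hlm (by linarith only [tP])
  have iδ : Iv δ (-0.007051486517) 0.007051486517 := Iv.of_abs hδ (by linarith only [tP])
  have iη : Iv η (-0.105772297743) 0.105772297743 := Iv.of_abs hη (by linarith only [tP])
  have iY2 : Iv Y2 0.01699352155 0.01699564227 := q15.geo 7 hY2 (by norm_num)
  have i7 := c0.sub iζ (L := 0.99952990089) (U := 1.00047009911) (by norm_num)
  have i8 := iY2.mulp i7 (L := 0.01698553291) (U := 0.01700363191) (by norm_num)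
  have iz : Iv z 0.01698553291 0.01700363191 := by rw [hz]; exact i8
  have iY : Iv Y 0.20940404941 0.20941736766 := q15.geo 3 hY (by norm_num)
  have c1 : Iv (3:ℝ) 3 3 := ⟨le_rfl, le_rfl⟩
  have i9 := c1.mulp iY (L := 0.62821214823) (U := 0.62825210298) (by norm_num)
  have i10 := c0.add iY (L := 1.20940404941) (U := 1.20941736766) (by norm_num)
  have i11 := i9.mulp i10 (L := 0.75976231595) (U := 0.75981900462) (by norm_num)
  have ia : Iv a 0.75976231595 0.75981900462 := by rw [ha]; exact i11
  have c2 : Iv (9:ℝ) 9 9 := ⟨le_rfl, le_rfl⟩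
  have i12 := c2.mulp iY (L := 1.88463644469) (U := 1.88475630894) (by norm_num)
  have i13 := c0.add iY (L := 1.20940404941) (U := 1.20941736766) (by norm_num)
  have i14 := i12.mulp i13 (L := 2.27928694787) (U := 2.27945701384) (by norm_num)
  have c3 : Iv (2:ℝ) 2 2 := ⟨le_rfl, le_rfl⟩
  have i15 := c3.mulp iY (L := 0.41880809882) (U := 0.41883473532) (by norm_num)
  have i16 := c0.add i15 (L := 1.41880809882) (U := 1.41883473532) (by norm_num)
  have i17 := i14.mulp i16 (L := 3.23387078117) (U := 3.23417278891) (by norm_num)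
  have ib : Iv b 3.23387078117 3.23417278891 := by rw [hb]; exact i17
  have c4 : Iv (7:ℝ) 7 7 := ⟨le_rfl, le_rfl⟩
  have i18 := c4.mulp iY2 (L := 0.11895465085) (U := 0.11896949589) (by norm_num)
  have i19 := c0.add iY2 (L := 1.01699352155) (U := 1.01699564227) (by norm_num)
  have i20 := i18.mulp i19 (L := 0.12097610927) (U := 0.12099145889) (by norm_num)
  have ia2 : Iv a2 0.12097610927 0.12099145889 := by rw [ha2]; exact i20
  have c5 : Iv (49:ℝ) 49 49 := ⟨le_rfl, le_rfl⟩
  have i21 := c5.mulp iY2 (L := 0.83268255595) (U := 0.83278647123) (by norm_num)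
  have i22 := c0.add iY2 (L := 1.01699352155) (U := 1.01699564227) (by norm_num)
  have i23 := i21.mulp i22 (L := 0.8468327649) (U := 0.84694021219) (by norm_num)
  have i24 := c3.mulp iY2 (L := 0.0339870431) (U := 0.03399128454) (by norm_num)
  have i25 := c0.add i24 (L := 1.0339870431) (U := 1.03399128454) (by norm_num)
  have i26 := i23.mulp i25 (L := 0.87561410657) (U := 0.87572879794) (by norm_num)
  have ib2 : Iv b2 0.87561410657 0.87572879794 := by rw [hb2]; exact i26
  have i27 := c0.sub iz (L := 0.98299636809) (U := 0.98301446709) (by norm_num)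
  have i28 := iY.mulp i27 (L := 0.20584342003) (U := 0.20586030207) (by norm_num)
  have iS : Iv S 0.20584342003 0.20586030207 := by rw [hS]; exact i28
  have i29 := c3.sub iS (L := 1.79413969793) (U := 1.79415657997) (by norm_num)
  have i30 := i29.sub ia (L := 1.03432069331) (U := 1.03439426402) (by norm_num)
  have i31 := iY.mulp ia2 (L := 0.02533288716) (U := 0.02533771284) (by norm_num)
  have i32 := c0.sub iζ (L := 0.99952990089) (U := 1.00047009911) (by norm_num)
  have i33 := i31.mulp i32 (L := 0.02532097819) (U := 0.02534962408) (by norm_num)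
  have i34 := i30.add i33 (L := 1.0596416715) (U := 1.0597438881) (by norm_num)
  have i35 := ia.mulp iz (L := 0.01290496782) (U := 0.01291968268) (by norm_num)
  have i36 := i34.add i35 (L := 1.07254663932) (U := 1.07266357078) (by norm_num)
  have i37 := c1.sub iS (L := 2.79413969793) (U := 2.79415657997) (by norm_num)
  have i38 := i37.mulp iS (L := 0.57515527146) (U := 0.57520591759) (by norm_num)
  have i39 := c0.sub i38 (L := 0.42479408241) (U := 0.42484472854) (by norm_num)
  have i40 := iY2.mul iδ (L := (-0.00011984455)) (U := 0.00011984455) (by norm_num)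
  have i41 := c0.add iY2 (L := 1.01699352155) (U := 1.01699564227) (by norm_num)
  have i42 := i41.mul iζ (L := (-0.00047808874)) (U := 0.00047808874) (by norm_num)
  have i43 := i40.add i42 (L := (-0.00059793329)) (U := 0.00059793329) (by norm_num)
  have i44 := iY.mul i43 (L := (-0.00012521762)) (U := 0.00012521762) (by norm_num)
  have i45 := i39.sub i44 (L := 0.42466886479) (U := 0.42496994616) (by norm_num)
  have i46 := c0.add iY (L := 1.20940404941) (U := 1.20941736766) (by norm_num)
  have i47 := i46.mulp iz (L := 0.02054237228) (U := 0.02056448775) (by norm_num)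
  have i48 := i45.add i47 (L := 0.44521123707) (U := 0.44553443391) (by norm_num)
  have iμ : Iv μ 0.41505207149 0.41539865735 := i36.quot i48 E4 (by norm_num)
  have hl : l = a2 - Y2 * lm - a2 * ζ := hl
  have i49 := iY2.mul ilm (L := (-0.00011984455)) (U := 0.00011984455) (by norm_num)
  have i50 := ia2.sub i49 (L := 0.12085626472) (U := 0.12111130344) (by norm_num)
  have i51 := ia2.mul iζ (L := (-0.00005687798)) (U := 0.00005687798) (by norm_num)
  have i52 := i50.sub i51 (L := 0.12079938674) (U := 0.12116818142) (by norm_num)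
  have il : Iv l 0.12079938674 0.12116818142 := by rw [hl]; exact i52
  have hd : d = 0 - μ * a2 - Y2 * δ - ((1 + Y2) - μ * a2) * ζ := by rw [hd]; ring
  have i53 := iμ.mulp ia2 (L := 0.05021138475) (U := 0.05025968958) (by norm_num)
  have c6 : Iv (0:ℝ) 0 0 := ⟨le_rfl, le_rfl⟩
  have i54 := c6.sub i53 (L := (-0.05025968958)) (U := (-0.05021138475)) (by norm_num)
  have i55 := iY2.mul iδ (L := (-0.00011984455)) (U := 0.00011984455) (by norm_num)
  have i56 := i54.sub i55 (L := (-0.05037953413)) (U := (-0.0500915402)) (by norm_num)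
  have i57 := c0.add iY2 (L := 1.01699352155) (U := 1.01699564227) (by norm_num)
  have i58 := iμ.mulp ia2 (L := 0.05021138475) (U := 0.05025968958) (by norm_num)
  have i59 := i57.sub i58 (L := 0.96673383197) (U := 0.96678425752) (by norm_num)
  have i60 := i59.mul iζ (L := (-0.00045448442)) (U := 0.00045448442) (by norm_num)
  have i61 := i56.sub i60 (L := (-0.05083401855)) (U := (-0.04963705578)) (by norm_num)
  have id : Iv d (-0.05083401855) (-0.04963705578) := by rw [hd]; exact i61
  have he : e = 0.5 * (μ ^ 2 * b2) - Y2 * η - ((1 + Y2) - μ * a2) * δ - 0.5 * ((1 + Y2) - 2 * μ * a2 + μ ^ 2 * b2) * ζ := by rw [he]; ring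
  have i62 := iμ.pow 2 (L := 0.17226822204) (U := 0.17255604453) (by norm_num)
  have i63 := i62.mulp ib2 (L := 0.15084048533) (U := 0.15111229746) (by norm_num)
  have c7 : Iv (0.5:ℝ) 0.5 0.5 := ⟨le_rfl, le_rfl⟩
  have i64 := c7.mulp i63 (L := 0.07542024266) (U := 0.07555614873) (by norm_num)
  have i65 := iY2.mul iη (L := (-0.00179766814)) (U := 0.00179766814) (by norm_num)
  have i66 := i64.sub i65 (L := 0.07362257452) (U := 0.07735381687) (by norm_num)
  have i67 := c0.add iY2 (L := 1.01699352155) (U := 1.01699564227) (by norm_num)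
  have i68 := iμ.mulp ia2 (L := 0.05021138475) (U := 0.05025968958) (by norm_num)
  have i69 := i67.sub i68 (L := 0.96673383197) (U := 0.96678425752) (by norm_num)
  have i70 := i69.mul iδ (L := (-0.00681726616)) (U := 0.00681726616) (by norm_num)
  have i71 := i66.sub i70 (L := 0.06680530836) (U := 0.08417108303) (by norm_num)
  have i72 := c0.add iY2 (L := 1.01699352155) (U := 1.01699564227) (by norm_num)
  have i73 := c3.mulp iμ (L := 0.83010414298) (U := 0.8307973147) (by norm_num)
  have i74 := i73.mulp ia2 (L := 0.1004227695) (U := 0.10051937915) (by norm_num)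
  have i75 := i72.sub i74 (L := 0.9164741424) (U := 0.91657287277) (by norm_num)
  have i76 := i62.mulp ib2 (L := 0.15084048533) (U := 0.15111229746) (by norm_num)
  have i77 := i75.add i76 (L := 1.06731462773) (U := 1.06768517023) (by norm_num)
  have i78 := c7.mulp i77 (L := 0.53365731386) (U := 0.53384258512) (by norm_num)
  have i79 := i78.mul iζ (L := (-0.00025095892)) (U := 0.00025095892) (by norm_num)
  have i80 := i71.sub i79 (L := 0.06655434944) (U := 0.08442204195) (by norm_num)
  have ie : Iv e 0.06655434944 0.08442204195 := by rw [he]; exact i80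
  have i81 := iY.mulp il (L := 0.02529588074) (U := 0.0253747216) (by norm_num)
  have i82 := ia.sub i81 (L := 0.73438759435) (U := 0.73452312388) (by norm_num)
  have i83 := ia.mulp iz (L := 0.01290496782) (U := 0.01291968268) (by norm_num)
  have i84 := i82.sub i83 (L := 0.72146791167) (U := 0.72161815606) (by norm_num)
  have iSL : Iv SL 0.72146791167 0.72161815606 := by rw [hSL]; exact i84
  have hSD : SD = 0 - μ * a - Y * d - ((1 + Y) - μ * a) * z := by rw [hSD]; ring
  have i85 := iμ.mulp ia (L := 0.31534092307) (U := 0.31562779435) (by norm_num)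
  have i86 := c6.sub i85 (L := (-0.31562779435)) (U := (-0.31534092307)) (by norm_num)
  have i87 := iY.mul id (L := (-0.01064552636)) (U := (-0.01039420048)) (by norm_num)
  have i88 := i86.sub i87 (L := (-0.30523359387)) (U := (-0.30469539671)) (by norm_num)
  have i89 := c0.add iY (L := 1.20940404941) (U := 1.20941736766) (by norm_num)
  have i90 := iμ.mulp ia (L := 0.31534092307) (U := 0.31562779435) (by norm_num)
  have i91 := i89.sub i90 (L := 0.89377625506) (U := 0.89407644459) (by norm_num)
  have i92 := i91.mulp iz (L := 0.01518126599) (U := 0.01520254677) (by norm_num)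
  have i93 := i88.sub i92 (L := (-0.32043614064)) (U := (-0.3198766627)) (by norm_num)
  have iSD : Iv SD (-0.32043614064) (-0.3198766627) := by rw [hSD]; exact i93
  have hSE : SE = 0.5 * (μ ^ 2 * b) - Y * e - ((1 + Y) - μ * a) * d - 0.5 * ((1 + Y) - 2 * μ * a + μ ^ 2 * b) * z := by rw [hSE]; ring
  have i94 := i62.mulp ib (L := 0.55709316977) (U := 0.55807606379) (by norm_num)
  have i95 := c7.mulp i94 (L := 0.27854658488) (U := 0.2790380319) (by norm_num)
  have i96 := iY.mulp ie (L := 0.01393675027) (U := 0.0176794418) (by norm_num)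
  have i97 := i95.sub i96 (L := 0.26086714308) (U := 0.26510128163) (by norm_num)
  have i98 := c0.add iY (L := 1.20940404941) (U := 1.20941736766) (by norm_num)
  have i99 := iμ.mulp ia (L := 0.31534092307) (U := 0.31562779435) (by norm_num)
  have i100 := i98.sub i99 (L := 0.89377625506) (U := 0.89407644459) (by norm_num)
  have i101 := i100.mul id (L := (-0.04544949857)) (U := (-0.04436442182)) (by norm_num)
  have i102 := i97.sub i101 (L := 0.3052315649) (U := 0.3105507802) (by norm_num)
  have i103 := c0.add iY (L := 1.20940404941) (U := 1.20941736766) (by norm_num)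
  have i104 := c3.mulp iμ (L := 0.83010414298) (U := 0.8307973147) (by norm_num)
  have i105 := i104.mulp ia (L := 0.63068184615) (U := 0.6312555887) (by norm_num)
  have i106 := i103.sub i105 (L := 0.57814846071) (U := 0.57873552151) (by norm_num)
  have i107 := i62.mulp ib (L := 0.55709316977) (U := 0.55807606379) (by norm_num)
  have i108 := i106.add i107 (L := 1.13524163048) (U := 1.1368115853) (by norm_num)
  have i109 := c7.mulp i108 (L := 0.56762081524) (U := 0.56840579265) (by norm_num)
  have i110 := i109.mulp iz (L := 0.00964134203) (U := 0.00966496288) (by norm_num)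
  have i111 := i102.sub i110 (L := 0.29556660202) (U := 0.30090943817) (by norm_num)
  have iSE : Iv SE 0.29556660202 0.30090943817 := by rw [hSE]; exact i111
  have i112 := c3.sub iS (L := 1.79413969793) (U := 1.79415657997) (by norm_num)
  have i113 := i112.sub iSL (L := 1.07252154187) (U := 1.0726886683) (by norm_num)
  have i114 := c0.sub iμ (L := 0.58460134265) (U := 0.58494792851) (by norm_num)
  have i115 := i114.pow 2 (L := 0.34175872982) (U := 0.34216407907) (by norm_num)
  have i116 := i62.add i115 (L := 0.51402695186) (U := 0.5147201236) (by norm_num)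
  have i117 := c1.mulp iS (L := 0.61753026009) (U := 0.61758090621) (by norm_num)
  have c8 : Iv (6:ℝ) 6 6 := ⟨le_rfl, le_rfl⟩
  have i118 := c8.sub i117 (L := 5.38241909379) (U := 5.38246973991) (by norm_num)
  have i119 := i118.add i115 (L := 5.72417782361) (U := 5.72463381898) (by norm_num)
  have i120 := i119.mulp iS (L := 1.17828434007) (U := 1.17847484722) (by norm_num)
  have i121 := i116.sub i120 (L := (-0.66444789536)) (U := (-0.66356421647)) (by norm_num)
  have i122 := c1.sub iμ (L := 2.58460134265) (U := 2.58494792851) (by norm_num)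
  have i123 := i122.sub iS (L := 2.37874104058) (U := 2.37910450848) (by norm_num)
  have i124 := c3.mulp i123 (L := 4.75748208116) (U := 4.75820901696) (by norm_num)
  have i125 := i124.mul iSD (L := (-1.52470213376)) (U := (-1.52180749097)) (by norm_num)
  have i126 := i121.sub i125 (L := 0.85735959561) (U := 0.86113791729) (by norm_num)
  have i127 := c3.mulp iSE (L := 0.59113320404) (U := 0.60181887634) (by norm_num)
  have i128 := i126.sub i127 (L := 0.25554071927) (U := 0.27000471325) (by norm_num)
  have iV : Iv V 0.23822449777 0.25174758988 := i113.quot i128 E3 (by norm_num)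
  obtain ⟨m2, m3⟩ := iμ
  obtain ⟨v2, v3⟩ := iV
  constructor
  · rw [abs_le]; constructor <;> norm_num <;> linarith
  · rw [abs_le]; constructor <;> norm_num <;> linarith

set_option maxHeartbeats 4000000 in
lemma bds_3 {q μ V : ℝ} (H : Sys 3 q μ V) : Bds 3 μ V := by
  obtain ⟨hq0, hq, m0, m1, V0, ζ, lm, δ, η, z, l, d, e, S, SL, SD, SE, Y, a, b, Y2, a2, b2, hζ, hlm, hδ, hη, hY, ha, hb, hY2,
    ha2, hb2, hz, hl, hd, he, hS, hSL, hSD, hSE, E1, E2, E3⟩ := H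
  rw [show hh 3 3 = 40 by simp [hh]] at hζ hlm hδ hη
  norm_num at hY hY2 hζ hlm hδ hη
  rw [hS] at E1
  have ha : a = 4 * Y * (1 + Y) := by rw [ha, aF]; norm_num
  have hb : b = 16 * Y * (1 + Y) * (1 + 2 * Y) := by rw [hb, bF]; norm_num
  have ha2 : a2 = 13 * Y2 * (1 + Y2) := by rw [ha2, aF]; norm_num
  have hb2 : b2 = 169 * Y2 * (1 + Y2) * (1 + 2 * Y2) := by rw [hb2, bF]; norm_num
  have E4 := mu_solved hSD hd E2
  have q0 : Iv q 0 0.6 := ⟨hq0.le, hq.le⟩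
  have tP : q ^ 40 ≤ 0.000000001337 := (q0.pow 40 (L := 0) (U := 0.000000001337) (by norm_num)).2
  have iζ : Iv ζ (-0.000000004038) 0.000000004038 := Iv.of_abs hζ (by linarith only [tP])
  have ilm : Iv lm (-0.00000016151) 0.00000016151 := Iv.of_abs hlm (by linarith only [tP])
  have iδ : Iv δ (-0.00000016151) 0.00000016151 := Iv.of_abs hδ (by linarith only [tP])
  have iη : Iv η (-0.000006460384) 0.000006460384 := Iv.of_abs hη (by linarith only [tP])
  have iY2 : Iv Y2 0 0.00130777745 := q0.geo 13 hY2 (by norm_num)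
  have c0 : Iv (1:ℝ) 1 1 := ⟨le_rfl, le_rfl⟩
  have i1 := c0.sub iζ (L := 0.99999999596) (U := 1.00000000404) (by norm_num)
  have i2 := iY2.mulp i1 (L := 0) (U := 0.00130777746) (by norm_num)
  have iz : Iv z 0 0.00130777746 := by rw [hz]; exact i2
  have q1 := Iv.step 4 0.5 0.5402185 q0 hY iz E1 0 0.1488971 (by norm_num) (by norm_num)
  have q2 := Iv.step 4 0.517218 0.5244106 q1 hY iz E1 0.0666666 0.0930972 (by norm_num) (by norm_num)
  have q3 := Iv.step 4 0.5200152 0.5213266 q2 hY iz E1 0.0770801 0.0818163 (by norm_num) (by norm_num)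
  have q4 := Iv.step 4 0.5205054 0.5207673 q3 hY iz E1 0.0788937 0.0797564 (by norm_num) (by norm_num)
  have tP : q ^ 40 ≤ 0.000000000005 := (q4.pow 40 (L := 0) (U := 0.000000000005) (by norm_num)).2
  have iζ : Iv ζ (-0.000000000016) 0.000000000016 := Iv.of_abs hζ (by linarith only [tP])
  have ilm : Iv lm (-0.000000000604) 0.000000000604 := Iv.of_abs hlm (by linarith only [tP])
  have iδ : Iv δ (-0.000000000604) 0.000000000604 := Iv.of_abs hδ (by linarith only [tP])
  have iη : Iv η (-0.00000002416) 0.00000002416 := Iv.of_abs hη (by linarith only [tP])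
  have iY2 : Iv Y2 0.00020588159 0.00020723265 := q4.geo 13 hY2 (by norm_num)
  have i3 := c0.sub iζ (L := 0.99999999998) (U := 1.00000000002) (by norm_num)
  have i4 := iY2.mulp i3 (L := 0.00020588158) (U := 0.00020723266) (by norm_num)
  have iz : Iv z 0.00020588158 0.00020723266 := by rw [hz]; exact i4
  have q5 := Iv.step 4 0.520616106 0.520662809 q4 hY iz E1 0.079215296 0.079387517 (by norm_num) (by norm_num)
  have q6 := Iv.step 4 0.520635823 0.520644177 q5 hY iz E1 0.079288055 0.079318768 (by norm_num) (by norm_num)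
  have q7 := Iv.step 4 0.520639337 0.520640856 q6 hY iz E1 0.07930102 0.079306514 (by norm_num) (by norm_num)
  have q8 := Iv.step 4 0.520639963 0.520640264 q7 hY iz E1 0.079303331 0.079304331 (by norm_num) (by norm_num)
  have q9 := Iv.step 4 0.520640074 0.520640158 q8 hY iz E1 0.079303742 0.079303941 (by norm_num) (by norm_num)
  have q10 := Iv.step 4 0.520640094 0.52064014 q9 hY iz E1 0.079303815 0.079303872 (by norm_num) (by norm_num)
  have tP : q ^ 40 ≤ 0.000000000005 := (q10.pow 40 (L := 0) (U := 0.000000000005) (by norm_num)).2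
  have iζ : Iv ζ (-0.000000000016) 0.000000000016 := Iv.of_abs hζ (by linarith only [tP])
  have ilm : Iv lm (-0.000000000604) 0.000000000604 := Iv.of_abs hlm (by linarith only [tP])
  have iδ : Iv δ (-0.000000000604) 0.000000000604 := Iv.of_abs hδ (by linarith only [tP])
  have iη : Iv η (-0.00000002416) 0.00000002416 := Iv.of_abs hη (by linarith only [tP])
  have iY2 : Iv Y2 0.00020657541 0.00020657566 := q10.geo 13 hY2 (by norm_num)
  have i5 := c0.sub iζ (L := 0.99999999998) (U := 1.00000000002) (by norm_num)
  have i6 := iY2.mulp i5 (L := 0.0002065754) (U := 0.00020657567) (by norm_num)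
  have iz : Iv z 0.0002065754 0.00020657567 := by rw [hz]; exact i6
  have iY : Iv Y 0.07930382894 0.0793038592 := q10.geo 4 hY (by norm_num)
  have c1 : Iv (4:ℝ) 4 4 := ⟨le_rfl, le_rfl⟩
  have i7 := c1.mulp iY (L := 0.31721531576) (U := 0.3172154368) (by norm_num)
  have i8 := c0.add iY (L := 1.07930382894) (U := 1.0793038592) (by norm_num)
  have i9 := i7.mulp i8 (L := 0.34237170489) (U := 0.34237184514) (by norm_num)
  have ia : Iv a 0.34237170489 0.34237184514 := by rw [ha]; exact i9
  have c2 : Iv (16:ℝ) 16 16 := ⟨le_rfl, le_rfl⟩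
  have i10 := c2.mulp iY (L := 1.26886126304) (U := 1.2688617472) (by norm_num)
  have i11 := c0.add iY (L := 1.07930382894) (U := 1.0793038592) (by norm_num)
  have i12 := i10.mulp i11 (L := 1.36948681959) (U := 1.36948738055) (by norm_num)
  have c3 : Iv (2:ℝ) 2 2 := ⟨le_rfl, le_rfl⟩
  have i13 := c3.mulp iY (L := 0.15860765788) (U := 0.1586077184) (by norm_num)
  have i14 := c0.add i13 (L := 1.15860765788) (U := 1.1586077184) (by norm_num)
  have i15 := i12.mulp i14 (L := 1.58669791654) (U := 1.58669864936) (by norm_num)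
  have ib : Iv b 1.58669791654 1.58669864936 := by rw [hb]; exact i15
  have c4 : Iv (13:ℝ) 13 13 := ⟨le_rfl, le_rfl⟩
  have i16 := c4.mulp iY2 (L := 0.00268548033) (U := 0.00268548358) (by norm_num)
  have i17 := c0.add iY2 (L := 1.00020657541) (U := 1.00020657566) (by norm_num)
  have i18 := i16.mulp i17 (L := 0.00268603508) (U := 0.00268603834) (by norm_num)
  have ia2 : Iv a2 0.00268603508 0.00268603834 := by rw [ha2]; exact i18
  have c5 : Iv (169:ℝ) 169 169 := ⟨le_rfl, le_rfl⟩
  have i19 := c5.mulp iY2 (L := 0.03491124429) (U := 0.03491128654) (by norm_num)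
  have i20 := c0.add iY2 (L := 1.00020657541) (U := 1.00020657566) (by norm_num)
  have i21 := i19.mulp i20 (L := 0.03491845609) (U := 0.03491849837) (by norm_num)
  have i22 := c3.mulp iY2 (L := 0.00041315082) (U := 0.00041315132) (by norm_num)
  have i23 := c0.add i22 (L := 1.00041315082) (U := 1.00041315132) (by norm_num)
  have i24 := i21.mulp i23 (L := 0.03493288267) (U := 0.034932925) (by norm_num)
  have ib2 : Iv b2 0.03493288267 0.034932925 := by rw [hb2]; exact i24
  have i25 := c0.sub iz (L := 0.99979342433) (U := 0.9997934246) (by norm_num)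
  have i26 := iY.mulp i25 (L := 0.07928744669) (U := 0.07928747698) (by norm_num)
  have iS : Iv S 0.07928744669 0.07928747698 := by rw [hS]; exact i26
  have i27 := c3.sub iS (L := 1.92071252302) (U := 1.92071255331) (by norm_num)
  have i28 := i27.sub ia (L := 1.57834067788) (U := 1.57834084842) (by norm_num)
  have i29 := iY.mulp ia2 (L := 0.00021301286) (U := 0.00021301321) (by norm_num)
  have i30 := c0.sub iζ (L := 0.99999999998) (U := 1.00000000002) (by norm_num)
  have i31 := i29.mulp i30 (L := 0.00021301285) (U := 0.00021301322) (by norm_num)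
  have i32 := i28.add i31 (L := 1.57855369073) (U := 1.57855386164) (by norm_num)
  have i33 := ia.mulp iz (L := 0.00007072557) (U := 0.0000707257) (by norm_num)
  have i34 := i32.add i33 (L := 1.5786244163) (U := 1.57862458734) (by norm_num)
  have c6 : Iv (3:ℝ) 3 3 := ⟨le_rfl, le_rfl⟩
  have i35 := c6.sub iS (L := 2.92071252302) (U := 2.92071255331) (by norm_num)
  have i36 := i35.mulp iS (L := 0.23157583846) (U := 0.23157592934) (by norm_num)
  have i37 := c0.sub i36 (L := 0.76842407066) (U := 0.76842416154) (by norm_num)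
  have i38 := iY2.mul iδ (L := (-0.00000000001)) (U := 0.00000000001) (by norm_num)
  have i39 := c0.add iY2 (L := 1.00020657541) (U := 1.00020657566) (by norm_num)
  have i40 := i39.mul iζ (L := (-0.00000000002)) (U := 0.00000000002) (by norm_num)
  have i41 := i38.add i40 (L := (-0.00000000003)) (U := 0.00000000003) (by norm_num)
  have i42 := iY.mul i41 (L := (-0.00000000001)) (U := 0.00000000001) (by norm_num)
  have i43 := i37.sub i42 (L := 0.76842407065) (U := 0.76842416155) (by norm_num)
  have i44 := c0.add iY (L := 1.07930382894) (U := 1.0793038592) (by norm_num)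
  have i45 := i44.mulp iz (L := 0.00022295762) (U := 0.00022295792) (by norm_num)
  have i46 := i43.add i45 (L := 0.76864702827) (U := 0.76864711947) (by norm_num)
  have iμ : Iv μ 0.48690932247 0.48690943301 := i34.quot i46 E4 (by norm_num)
  have hl : l = a2 - Y2 * lm - a2 * ζ := hl
  have i47 := iY2.mul ilm (L := (-0.00000000001)) (U := 0.00000000001) (by norm_num)
  have i48 := ia2.sub i47 (L := 0.00268603507) (U := 0.00268603835) (by norm_num)
  have i49 := ia2.mul iζ (L := (-0.00000000001)) (U := 0.00000000001) (by norm_num)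
  have i50 := i48.sub i49 (L := 0.00268603506) (U := 0.00268603836) (by norm_num)
  have il : Iv l 0.00268603506 0.00268603836 := by rw [hl]; exact i50
  have hd : d = 0 - μ * a2 - Y2 * δ - ((1 + Y2) - μ * a2) * ζ := by rw [hd]; ring
  have i51 := iμ.mulp ia2 (L := 0.00130785552) (U := 0.00130785741) (by norm_num)
  have c7 : Iv (0:ℝ) 0 0 := ⟨le_rfl, le_rfl⟩
  have i52 := c7.sub i51 (L := (-0.00130785741)) (U := (-0.00130785552)) (by norm_num)
  have i53 := iY2.mul iδ (L := (-0.00000000001)) (U := 0.00000000001) (by norm_num)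
  have i54 := i52.sub i53 (L := (-0.00130785742)) (U := (-0.00130785551)) (by norm_num)
  have i55 := c0.add iY2 (L := 1.00020657541) (U := 1.00020657566) (by norm_num)
  have i56 := iμ.mulp ia2 (L := 0.00130785552) (U := 0.00130785741) (by norm_num)
  have i57 := i55.sub i56 (L := 0.998898718) (U := 0.99889872014) (by norm_num)
  have i58 := i57.mul iζ (L := (-0.00000000002)) (U := 0.00000000002) (by norm_num)
  have i59 := i54.sub i58 (L := (-0.00130785744)) (U := (-0.00130785549)) (by norm_num)
  have id : Iv d (-0.00130785744) (-0.00130785549) := by rw [hd]; exact i59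
  have he : e = 0.5 * (μ ^ 2 * b2) - Y2 * η - ((1 + Y2) - μ * a2) * δ - 0.5 * ((1 + Y2) - 2 * μ * a2 + μ ^ 2 * b2) * ζ := by rw [he]; ring
  have i60 := iμ.pow 2 (L := 0.2370806883) (U := 0.23708079596) (by norm_num)
  have i61 := i60.mulp ib2 (L := 0.00828191186) (U := 0.00828192567) (by norm_num)
  have c8 : Iv (0.5:ℝ) 0.5 0.5 := ⟨le_rfl, le_rfl⟩
  have i62 := c8.mulp i61 (L := 0.00414095593) (U := 0.00414096284) (by norm_num)
  have i63 := iY2.mul iη (L := (-0.00000000001)) (U := 0.00000000001) (by norm_num)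
  have i64 := i62.sub i63 (L := 0.00414095592) (U := 0.00414096285) (by norm_num)
  have i65 := c0.add iY2 (L := 1.00020657541) (U := 1.00020657566) (by norm_num)
  have i66 := iμ.mulp ia2 (L := 0.00130785552) (U := 0.00130785741) (by norm_num)
  have i67 := i65.sub i66 (L := 0.998898718) (U := 0.99889872014) (by norm_num)
  have i68 := i67.mul iδ (L := (-0.00000000061)) (U := 0.00000000061) (by norm_num)
  have i69 := i64.sub i68 (L := 0.00414095531) (U := 0.00414096346) (by norm_num)
  have i70 := c0.add iY2 (L := 1.00020657541) (U := 1.00020657566) (by norm_num)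
  have i71 := c3.mulp iμ (L := 0.97381864494) (U := 0.97381886602) (by norm_num)
  have i72 := i71.mulp ia2 (L := 0.00261571104) (U := 0.00261571482) (by norm_num)
  have i73 := i70.sub i72 (L := 0.99759086059) (U := 0.99759086462) (by norm_num)
  have i74 := i60.mulp ib2 (L := 0.00828191186) (U := 0.00828192567) (by norm_num)
  have i75 := i73.add i74 (L := 1.00587277245) (U := 1.00587279029) (by norm_num)
  have i76 := c8.mulp i75 (L := 0.50293638622) (U := 0.50293639515) (by norm_num)
  have i77 := i76.mul iζ (L := (-0.00000000001)) (U := 0.00000000001) (by norm_num)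
  have i78 := i69.sub i77 (L := 0.0041409553) (U := 0.00414096347) (by norm_num)
  have ie : Iv e 0.0041409553 0.00414096347 := by rw [he]; exact i78
  have i79 := iY.mulp il (L := 0.00021301286) (U := 0.00021301321) (by norm_num)
  have i80 := ia.sub i79 (L := 0.34215869168) (U := 0.34215883228) (by norm_num)
  have i81 := ia.mulp iz (L := 0.00007072557) (U := 0.0000707257) (by norm_num)
  have i82 := i80.sub i81 (L := 0.34208796598) (U := 0.34208810671) (by norm_num)
  have iSL : Iv SL 0.34208796598 0.34208810671 := by rw [hSL]; exact i82
  have hSD : SD = 0 - μ * a - Y * d - ((1 + Y) - μ * a) * z := by rw [hSD]; ring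
  have i83 := iμ.mulp ia (L := 0.16670397486) (U := 0.166704081) (by norm_num)
  have i84 := c7.sub i83 (L := (-0.166704081)) (U := (-0.16670397486)) (by norm_num)
  have i85 := iY.mul id (L := (-0.00010371815)) (U := (-0.00010371794)) (by norm_num)
  have i86 := i84.sub i85 (L := (-0.16660036306)) (U := (-0.16660025671)) (by norm_num)
  have i87 := c0.add iY (L := 1.07930382894) (U := 1.0793038592) (by norm_num)
  have i88 := iμ.mulp ia (L := 0.16670397486) (U := 0.166704081) (by norm_num)
  have i89 := i87.sub i88 (L := 0.91259974794) (U := 0.91259988434) (by norm_num)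
  have i90 := i89.mulp iz (L := 0.00018852065) (U := 0.00018852094) (by norm_num)
  have i91 := i86.sub i90 (L := (-0.166788884)) (U := (-0.16678877736)) (by norm_num)
  have iSD : Iv SD (-0.166788884) (-0.16678877736) := by rw [hSD]; exact i91
  have hSE : SE = 0.5 * (μ ^ 2 * b) - Y * e - ((1 + Y) - μ * a) * d - 0.5 * ((1 + Y) - 2 * μ * a + μ ^ 2 * b) * z := by rw [hSE]; ring
  have i92 := i60.mulp ib (L := 0.37617543417) (U := 0.37617577874) (by norm_num)
  have i93 := c8.mulp i92 (L := 0.18808771708) (U := 0.18808788937) (by norm_num)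
  have i94 := iY.mulp ie (L := 0.00032839361) (U := 0.00032839439) (by norm_num)
  have i95 := i93.sub i94 (L := 0.18775932269) (U := 0.18775949576) (by norm_num)
  have i96 := c0.add iY (L := 1.07930382894) (U := 1.0793038592) (by norm_num)
  have i97 := iμ.mulp ia (L := 0.16670397486) (U := 0.166704081) (by norm_num)
  have i98 := i96.sub i97 (L := 0.91259974794) (U := 0.91259988434) (by norm_num)
  have i99 := i98.mul id (L := (-0.00119355055)) (U := (-0.00119354859)) (by norm_num)
  have i100 := i95.sub i99 (L := 0.18895287128) (U := 0.18895304631) (by norm_num)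
  have i101 := c0.add iY (L := 1.07930382894) (U := 1.0793038592) (by norm_num)
  have i102 := c3.mulp iμ (L := 0.97381864494) (U := 0.97381886602) (by norm_num)
  have i103 := i102.mulp ia (L := 0.33340794972) (U := 0.333408162) (by norm_num)
  have i104 := i101.sub i103 (L := 0.74589566694) (U := 0.74589590948) (by norm_num)
  have i105 := i60.mulp ib (L := 0.37617543417) (U := 0.37617577874) (by norm_num)
  have i106 := i104.add i105 (L := 1.12207110111) (U := 1.12207168822) (by norm_num)
  have i107 := c8.mulp i106 (L := 0.56103555055) (U := 0.56103584411) (by norm_num)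
  have i108 := i107.mulp iz (L := 0.00011589614) (U := 0.00011589636) (by norm_num)
  have i109 := i100.sub i108 (L := 0.18883697492) (U := 0.18883715017) (by norm_num)
  have iSE : Iv SE 0.18883697492 0.18883715017 := by rw [hSE]; exact i109
  have i110 := c3.sub iS (L := 1.92071252302) (U := 1.92071255331) (by norm_num)
  have i111 := i110.sub iSL (L := 1.57862441631) (U := 1.57862458733) (by norm_num)
  have i112 := c0.sub iμ (L := 0.51309056699) (U := 0.51309067753) (by norm_num)
  have i113 := i112.pow 2 (L := 0.26326192993) (U := 0.26326204337) (by norm_num)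
  have i114 := i60.add i113 (L := 0.50034261823) (U := 0.50034283933) (by norm_num)
  have i115 := c6.mulp iS (L := 0.23786234007) (U := 0.23786243094) (by norm_num)
  have c9 : Iv (6:ℝ) 6 6 := ⟨le_rfl, le_rfl⟩
  have i116 := c9.sub i115 (L := 5.76213756906) (U := 5.76213765993) (by norm_num)
  have i117 := i116.add i113 (L := 6.02539949899) (U := 6.0253997033) (by norm_num)
  have i118 := i117.mulp iS (L := 0.47773854156) (U := 0.47773874028) (by norm_num)
  have i119 := i114.sub i118 (L := 0.02260387795) (U := 0.02260429777) (by norm_num)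
  have i120 := c6.sub iμ (L := 2.51309056699) (U := 2.51309067753) (by norm_num)
  have i121 := i120.sub iS (L := 2.43380309001) (U := 2.43380323084) (by norm_num)
  have i122 := c3.mulp i121 (L := 4.86760618002) (U := 4.86760646168) (by norm_num)
  have i123 := i122.mul iSD (L := (-0.8118626495)) (U := (-0.81186208343)) (by norm_num)
  have i124 := i119.sub i123 (L := 0.83446596138) (U := 0.83446694727) (by norm_num)
  have i125 := c3.mulp iSE (L := 0.37767394984) (U := 0.37767430034) (by norm_num)
  have i126 := i124.sub i125 (L := 0.45679166104) (U := 0.45679299743) (by norm_num)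
  have iV : Iv V 0.28936053872 0.28936141663 := i111.quot i126 E3 (by norm_num)
  obtain ⟨m2, m3⟩ := iμ
  obtain ⟨v2, v3⟩ := iV
  constructor
  · rw [abs_le]; constructor <;> norm_num <;> linarith
  · rw [abs_le]; constructor <;> norm_num <;> linarith

set_option maxHeartbeats 4000000 in
lemma bds_4 {q μ V : ℝ} (H : Sys 4 q μ V) : Bds 4 μ V := by
  obtain ⟨hq0, hq, m0, m1, V0, ζ, lm, δ, η, z, l, d, e, S, SL, SD, SE, Y, a, b, Y2, a2, b2, hζ, hlm, hδ, hη, hY, ha, hb, hY2,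
    ha2, hb2, hz, hl, hd, he, hS, hSL, hSD, hSE, E1, E2, E3⟩ := H
  rw [show hh 4 3 = 85 by simp [hh]] at hζ hlm hδ hη
  norm_num at hY hY2 hζ hlm hδ hη
  rw [hS] at E1
  have ha : a = 5 * Y * (1 + Y) := by rw [ha, aF]; norm_num
  have hb : b = 25 * Y * (1 + Y) * (1 + 2 * Y) := by rw [hb, bF]; norm_num
  have ha2 : a2 = 21 * Y2 * (1 + Y2) := by rw [ha2, aF]; norm_num
  have hb2 : b2 = 441 * Y2 * (1 + Y2) * (1 + 2 * Y2) := by rw [hb2, bF]; norm_num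
  have E4 := mu_solved hSD hd E2
  have q0 : Iv q 0 0.6 := ⟨hq0.le, hq.le⟩
  have tP : q ^ 85 ≤ 0.000000000001 := (q0.pow 85 (L := 0) (U := 0.000000000001) (by norm_num)).2
  have iζ : Iv ζ (-0.000000000004) 0.000000000004 := Iv.of_abs hζ (by linarith only [tP])
  have ilm : Iv lm (-0.000000000257) 0.000000000257 := Iv.of_abs hlm (by linarith only [tP])
  have iδ : Iv δ (-0.000000000257) 0.000000000257 := Iv.of_abs hδ (by linarith only [tP])
  have iη : Iv η (-0.00000002182) 0.00000002182 := Iv.of_abs hη (by linarith only [tP])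
  have iY2 : Iv Y2 0 0.00002193744 := q0.geo 21 hY2 (by norm_num)
  have c0 : Iv (1:ℝ) 1 1 := ⟨le_rfl, le_rfl⟩
  have i1 := c0.sub iζ (L := 0.99999999999) (U := 1.00000000001) (by norm_num)
  have i2 := iY2.mulp i1 (L := 0) (U := 0.00002193745) (by norm_num)
  have iz : Iv z 0 0.00002193745 := by rw [hz]; exact i2
  have q1 := Iv.step 5 0.5 0.522006883 q0 hY iz E1 0 0.084316447 (by norm_num) (by norm_num)
  have q2 := Iv.step 5 0.508196538 0.510288088 q1 hY iz E1 0.032258064 0.040322664 (by norm_num) (by norm_num)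
  have q3 := Iv.step 5 0.50892795 0.509123534 q2 hY iz E1 0.03508609 0.035840157 (by norm_num) (by norm_num)
  have q4 := Iv.step 5 0.50899586 0.509014297 q3 hY iz E1 0.035348254 0.035418637 (by norm_num) (by norm_num)
  have q5 := Iv.step 5 0.509002187 0.509004108 q4 hY iz E1 0.035372678 0.035379313 (by norm_num) (by norm_num)
  have q6 := Iv.step 5 0.509002777 0.509003159 q5 hY iz E1 0.035374955 0.035375647 (by norm_num) (by norm_num)
  have tP : q ^ 85 ≤ 0.000000000001 := (q6.pow 85 (L := 0) (U := 0.000000000001) (by norm_num)).2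
  have iζ : Iv ζ (-0.000000000004) 0.000000000004 := Iv.of_abs hζ (by linarith only [tP])
  have ilm : Iv lm (-0.000000000257) 0.000000000257 := Iv.of_abs hlm (by linarith only [tP])
  have iδ : Iv δ (-0.000000000257) 0.000000000257 := Iv.of_abs hδ (by linarith only [tP])
  have iη : Iv η (-0.00000002182) 0.00000002182 := Iv.of_abs hη (by linarith only [tP])
  have iY2 : Iv Y2 0.00000069362 0.00000069364 := q6.geo 21 hY2 (by norm_num)
  have i3 := c0.sub iζ (L := 0.99999999999) (U := 1.00000000001) (by norm_num)
  have i4 := iY2.mulp i3 (L := 0.00000069361) (U := 0.00000069365) (by norm_num)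
  have iz : Iv z 0.00000069361 0.00000069365 := by rw [hz]; exact i4
  have iY : Iv Y 0.03537516737 0.03537530482 := q6.geo 5 hY (by norm_num)
  have c1 : Iv (5:ℝ) 5 5 := ⟨le_rfl, le_rfl⟩
  have i5 := c1.mulp iY (L := 0.17687583685) (U := 0.1768765241) (by norm_num)
  have i6 := c0.add iY (L := 1.03537516737) (U := 1.03537530482) (by norm_num)
  have i7 := i5.mulp i6 (L := 0.18313284918) (U := 0.18313358506) (by norm_num)
  have ia : Iv a 0.18313284918 0.18313358506 := by rw [ha]; exact i7
  have c2 : Iv (25:ℝ) 25 25 := ⟨le_rfl, le_rfl⟩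
  have i8 := c2.mulp iY (L := 0.88437918425) (U := 0.8843826205) (by norm_num)
  have i9 := c0.add iY (L := 1.03537516737) (U := 1.03537530482) (by norm_num)
  have i10 := i8.mulp i9 (L := 0.91566424591) (U := 0.91566792528) (by norm_num)
  have c3 : Iv (2:ℝ) 2 2 := ⟨le_rfl, le_rfl⟩
  have i11 := c3.mulp iY (L := 0.07075033474) (U := 0.07075060964) (by norm_num)
  have i12 := c0.add i11 (L := 1.07075033474) (U := 1.07075060964) (by norm_num)
  have i13 := i10.mulp i12 (L := 0.98044779781) (U := 0.98045198923) (by norm_num)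
  have ib : Iv b 0.98044779781 0.98045198923 := by rw [hb]; exact i13
  have c4 : Iv (21:ℝ) 21 21 := ⟨le_rfl, le_rfl⟩
  have i14 := c4.mulp iY2 (L := 0.00001456602) (U := 0.00001456644) (by norm_num)
  have i15 := c0.add iY2 (L := 1.00000069362) (U := 1.00000069364) (by norm_num)
  have i16 := i14.mulp i15 (L := 0.00001456603) (U := 0.00001456646) (by norm_num)
  have ia2 : Iv a2 0.00001456603 0.00001456646 := by rw [ha2]; exact i16
  have c5 : Iv (441:ℝ) 441 441 := ⟨le_rfl, le_rfl⟩
  have i17 := c5.mulp iY2 (L := 0.00030588642) (U := 0.00030589524) (by norm_num)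
  have i18 := c0.add iY2 (L := 1.00000069362) (U := 1.00000069364) (by norm_num)
  have i19 := i17.mulp i18 (L := 0.00030588663) (U := 0.00030589546) (by norm_num)
  have i20 := c3.mulp iY2 (L := 0.00000138724) (U := 0.00000138728) (by norm_num)
  have i21 := c0.add i20 (L := 1.00000138724) (U := 1.00000138728) (by norm_num)
  have i22 := i19.mulp i21 (L := 0.00030588705) (U := 0.00030589589) (by norm_num)
  have ib2 : Iv b2 0.00030588705 0.00030589589 := by rw [hb2]; exact i22
  have i23 := c0.sub iz (L := 0.99999930635) (U := 0.99999930639) (by norm_num)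
  have i24 := iY.mulp i23 (L := 0.03537514283) (U := 0.03537528029) (by norm_num)
  have iS : Iv S 0.03537514283 0.03537528029 := by rw [hS]; exact i24
  have i25 := c3.sub iS (L := 1.96462471971) (U := 1.96462485717) (by norm_num)
  have i26 := i25.sub ia (L := 1.78149113465) (U := 1.78149200799) (by norm_num)
  have i27 := iY.mulp ia2 (L := 0.00000051527) (U := 0.0000005153) (by norm_num)
  have i28 := c0.sub iζ (L := 0.99999999999) (U := 1.00000000001) (by norm_num)
  have i29 := i27.mulp i28 (L := 0.00000051526) (U := 0.00000051531) (by norm_num)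
  have i30 := i26.add i29 (L := 1.78149164991) (U := 1.7814925233) (by norm_num)
  have i31 := ia.mulp iz (L := 0.00000012702) (U := 0.00000012704) (by norm_num)
  have i32 := i30.add i31 (L := 1.78149177693) (U := 1.78149265034) (by norm_num)
  have c6 : Iv (3:ℝ) 3 3 := ⟨le_rfl, le_rfl⟩
  have i33 := c6.sub iS (L := 2.96462471971) (U := 2.96462485717) (by norm_num)
  have i34 := i33.mulp iS (L := 0.10487402289) (U := 0.10487443528) (by norm_num)
  have i35 := c0.sub i34 (L := 0.89512556472) (U := 0.89512597711) (by norm_num)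
  have i36 := iY2.mul iδ (L := (-0.00000000001)) (U := 0.00000000001) (by norm_num)
  have i37 := c0.add iY2 (L := 1.00000069362) (U := 1.00000069364) (by norm_num)
  have i38 := i37.mul iζ (L := (-0.00000000001)) (U := 0.00000000001) (by norm_num)
  have i39 := i36.add i38 (L := (-0.00000000002)) (U := 0.00000000002) (by norm_num)
  have i40 := iY.mul i39 (L := (-0.00000000001)) (U := 0.00000000001) (by norm_num)
  have i41 := i35.sub i40 (L := 0.89512556471) (U := 0.89512597712) (by norm_num)
  have i42 := c0.add iY (L := 1.03537516737) (U := 1.03537530482) (by norm_num)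
  have i43 := i42.mulp iz (L := 0.00000071814) (U := 0.00000071819) (by norm_num)
  have i44 := i41.add i43 (L := 0.89512628285) (U := 0.89512669531) (by norm_num)
  have iμ : Iv μ 0.50245858868 0.50245906656 := i32.quot i44 E4 (by norm_num)
  have hl : l = a2 - Y2 * lm - a2 * ζ := hl
  have i45 := iY2.mul ilm (L := (-0.00000000001)) (U := 0.00000000001) (by norm_num)
  have i46 := ia2.sub i45 (L := 0.00001456602) (U := 0.00001456647) (by norm_num)
  have i47 := ia2.mul iζ (L := (-0.00000000001)) (U := 0.00000000001) (by norm_num)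
  have i48 := i46.sub i47 (L := 0.00001456601) (U := 0.00001456648) (by norm_num)
  have il : Iv l 0.00001456601 0.00001456648 := by rw [hl]; exact i48
  have hd : d = 0 - μ * a2 - Y2 * δ - ((1 + Y2) - μ * a2) * ζ := by rw [hd]; ring
  have i49 := iμ.mulp ia2 (L := 0.00000731882) (U := 0.00000731905) (by norm_num)
  have c7 : Iv (0:ℝ) 0 0 := ⟨le_rfl, le_rfl⟩
  have i50 := c7.sub i49 (L := (-0.00000731905)) (U := (-0.00000731882)) (by norm_num)
  have i51 := iY2.mul iδ (L := (-0.00000000001)) (U := 0.00000000001) (by norm_num)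
  have i52 := i50.sub i51 (L := (-0.00000731906)) (U := (-0.00000731881)) (by norm_num)
  have i53 := c0.add iY2 (L := 1.00000069362) (U := 1.00000069364) (by norm_num)
  have i54 := iμ.mulp ia2 (L := 0.00000731882) (U := 0.00000731905) (by norm_num)
  have i55 := i53.sub i54 (L := 0.99999337457) (U := 0.99999337482) (by norm_num)
  have i56 := i55.mul iζ (L := (-0.00000000001)) (U := 0.00000000001) (by norm_num)
  have i57 := i52.sub i56 (L := (-0.00000731907)) (U := (-0.0000073188)) (by norm_num)
  have id : Iv d (-0.00000731907) (-0.0000073188) := by rw [hd]; exact i57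
  have he : e = 0.5 * (μ ^ 2 * b2) - Y2 * η - ((1 + Y2) - μ * a2) * δ - 0.5 * ((1 + Y2) - 2 * μ * a2 + μ ^ 2 * b2) * ζ := by rw [he]; ring
  have i58 := iμ.pow 2 (L := 0.25246463333) (U := 0.25246511357) (by norm_num)
  have i59 := i58.mulp ib2 (L := 0.00007722566) (U := 0.00007722805) (by norm_num)
  have c8 : Iv (0.5:ℝ) 0.5 0.5 := ⟨le_rfl, le_rfl⟩
  have i60 := c8.mulp i59 (L := 0.00003861283) (U := 0.00003861403) (by norm_num)
  have i61 := iY2.mul iη (L := (-0.00000000001)) (U := 0.00000000001) (by norm_num)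
  have i62 := i60.sub i61 (L := 0.00003861282) (U := 0.00003861404) (by norm_num)
  have i63 := c0.add iY2 (L := 1.00000069362) (U := 1.00000069364) (by norm_num)
  have i64 := iμ.mulp ia2 (L := 0.00000731882) (U := 0.00000731905) (by norm_num)
  have i65 := i63.sub i64 (L := 0.99999337457) (U := 0.99999337482) (by norm_num)
  have i66 := i65.mul iδ (L := (-0.00000000026)) (U := 0.00000000026) (by norm_num)
  have i67 := i62.sub i66 (L := 0.00003861256) (U := 0.0000386143) (by norm_num)
  have i68 := c0.add iY2 (L := 1.00000069362) (U := 1.00000069364) (by norm_num)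
  have i69 := c3.mulp iμ (L := 1.00491717736) (U := 1.00491813312) (by norm_num)
  have i70 := i69.mulp ia2 (L := 0.00001463765) (U := 0.0000146381) (by norm_num)
  have i71 := i68.sub i70 (L := 0.99998605552) (U := 0.99998605599) (by norm_num)
  have i72 := i58.mulp ib2 (L := 0.00007722566) (U := 0.00007722805) (by norm_num)
  have i73 := i71.add i72 (L := 1.00006328118) (U := 1.00006328404) (by norm_num)
  have i74 := c8.mulp i73 (L := 0.50003164059) (U := 0.50003164202) (by norm_num)
  have i75 := i74.mul iζ (L := (-0.00000000001)) (U := 0.00000000001) (by norm_num)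
  have i76 := i67.sub i75 (L := 0.00003861255) (U := 0.00003861431) (by norm_num)
  have ie : Iv e 0.00003861255 0.00003861431 := by rw [he]; exact i76
  have i77 := iY.mulp il (L := 0.00000051527) (U := 0.0000005153) (by norm_num)
  have i78 := ia.sub i77 (L := 0.18313233388) (U := 0.18313306979) (by norm_num)
  have i79 := ia.mulp iz (L := 0.00000012702) (U := 0.00000012704) (by norm_num)
  have i80 := i78.sub i79 (L := 0.18313220684) (U := 0.18313294277) (by norm_num)
  have iSL : Iv SL 0.18313220684 0.18313294277 := by rw [hSL]; exact i80
  have hSD : SD = 0 - μ * a - Y * d - ((1 + Y) - μ * a) * z := by rw [hSD]; ring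
  have i81 := iμ.mulp ia (L := 0.09201667293) (U := 0.09201713021) (by norm_num)
  have i82 := c7.sub i81 (L := (-0.09201713021)) (U := (-0.09201667293)) (by norm_num)
  have i83 := iY.mul id (L := (-0.00000025892)) (U := (-0.0000002589)) (by norm_num)
  have i84 := i82.sub i83 (L := (-0.09201687131)) (U := (-0.09201641401)) (by norm_num)
  have i85 := c0.add iY (L := 1.03537516737) (U := 1.03537530482) (by norm_num)
  have i86 := iμ.mulp ia (L := 0.09201667293) (U := 0.09201713021) (by norm_num)
  have i87 := i85.sub i86 (L := 0.94335803716) (U := 0.94335863189) (by norm_num)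
  have i88 := i87.mulp iz (L := 0.00000065432) (U := 0.00000065437) (by norm_num)
  have i89 := i84.sub i88 (L := (-0.09201752568)) (U := (-0.09201706833)) (by norm_num)
  have iSD : Iv SD (-0.09201752568) (-0.09201706833) := by rw [hSD]; exact i89
  have hSE : SE = 0.5 * (μ ^ 2 * b) - Y * e - ((1 + Y) - μ * a) * d - 0.5 * ((1 + Y) - 2 * μ * a + μ ^ 2 * b) * z := by rw [hSE]; ring
  have i90 := i58.mulp ib (L := 0.24752839377) (U := 0.24752992282) (by norm_num)
  have i91 := c8.mulp i90 (L := 0.12376419688) (U := 0.12376496141) (by norm_num)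
  have i92 := iY.mulp ie (L := 0.00000136592) (U := 0.000001366) (by norm_num)
  have i93 := i91.sub i92 (L := 0.12376283088) (U := 0.12376359549) (by norm_num)
  have i94 := c0.add iY (L := 1.03537516737) (U := 1.03537530482) (by norm_num)
  have i95 := iμ.mulp ia (L := 0.09201667293) (U := 0.09201713021) (by norm_num)
  have i96 := i94.sub i95 (L := 0.94335803716) (U := 0.94335863189) (by norm_num)
  have i97 := i96.mul id (L := (-0.00000690451)) (U := (-0.00000690424)) (by norm_num)
  have i98 := i93.sub i97 (L := 0.12376973512) (U := 0.1237705) (by norm_num)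
  have i99 := c0.add iY (L := 1.03537516737) (U := 1.03537530482) (by norm_num)
  have i100 := c3.mulp iμ (L := 1.00491717736) (U := 1.00491813312) (by norm_num)
  have i101 := i100.mulp ia (L := 0.18403334587) (U := 0.18403426042) (by norm_num)
  have i102 := i99.sub i101 (L := 0.85134090695) (U := 0.85134195895) (by norm_num)
  have i103 := i58.mulp ib (L := 0.24752839377) (U := 0.24752992282) (by norm_num)
  have i104 := i102.add i103 (L := 1.09886930072) (U := 1.09887188177) (by norm_num)
  have i105 := c8.mulp i104 (L := 0.54943465036) (U := 0.54943594089) (by norm_num)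
  have i106 := i105.mulp iz (L := 0.00000038109) (U := 0.00000038112) (by norm_num)
  have i107 := i98.sub i106 (L := 0.123769354) (U := 0.12377011891) (by norm_num)
  have iSE : Iv SE 0.123769354 0.12377011891 := by rw [hSE]; exact i107
  have i108 := c3.sub iS (L := 1.96462471971) (U := 1.96462485717) (by norm_num)
  have i109 := i108.sub iSL (L := 1.78149177694) (U := 1.78149265033) (by norm_num)
  have i110 := c0.sub iμ (L := 0.49754093344) (U := 0.49754141132) (by norm_num)
  have i111 := i110.pow 2 (L := 0.24754698044) (U := 0.24754745598) (by norm_num)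
  have i112 := i58.add i111 (L := 0.50001161377) (U := 0.50001256955) (by norm_num)
  have i113 := c6.mulp iS (L := 0.10612542849) (U := 0.10612584087) (by norm_num)
  have c9 : Iv (6:ℝ) 6 6 := ⟨le_rfl, le_rfl⟩
  have i114 := c9.sub i113 (L := 5.89387415913) (U := 5.89387457151) (by norm_num)
  have i115 := i114.add i111 (L := 6.14142113957) (U := 6.14142202749) (by norm_num)
  have i116 := i115.mulp iS (L := 0.21725364999) (U := 0.21725452561) (by norm_num)
  have i117 := i112.sub i116 (L := 0.28275708816) (U := 0.28275891956) (by norm_num)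
  have i118 := c6.sub iμ (L := 2.49754093344) (U := 2.49754141132) (by norm_num)
  have i119 := i118.sub iS (L := 2.46216565315) (U := 2.46216626849) (by norm_num)
  have i120 := c3.mulp i119 (L := 4.9243313063) (U := 4.92433253698) (by norm_num)
  have i121 := i120.mul iSD (L := (-0.45312489568)) (U := (-0.45312253029)) (by norm_num)
  have i122 := i117.sub i121 (L := 0.73587961845) (U := 0.73588381524) (by norm_num)
  have i123 := c3.mulp iSE (L := 0.247538708) (U := 0.24754023782) (by norm_num)
  have i124 := i122.sub i123 (L := 0.48833938063) (U := 0.48834510724) (by norm_num)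
  have iV : Iv V 0.27411810008 0.27412144898 := i109.quot i124 E3 (by norm_num)
  obtain ⟨m2, m3⟩ := iμ
  obtain ⟨v2, v3⟩ := iV
  constructor
  · rw [abs_le]; constructor <;> norm_num <;> linarith
  · rw [abs_le]; constructor <;> norm_num <;> linarith

set_option maxHeartbeats 4000000 in
lemma bds_5 {q μ V : ℝ} (H : Sys 5 q μ V) : Bds 5 μ V := by
  obtain ⟨hq0, hq, m0, m1, V0, ζ, lm, δ, η, z, l, d, e, S, SL, SD, SE, Y, a, b, Y2, a2, b2, hζ, hlm, hδ, hη, hY, ha, hb, hY2,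
    ha2, hb2, hz, hl, hd, he, hS, hSL, hSD, hSE, E1, E2, E3⟩ := H
  rw [show hh 5 3 = 156 by simp [hh]] at hζ hlm hδ hη
  norm_num at hY hY2 hζ hlm hδ hη
  rw [hS] at E1
  have ha : a = 6 * Y * (1 + Y) := by rw [ha, aF]; norm_num
  have hb : b = 36 * Y * (1 + Y) * (1 + 2 * Y) := by rw [hb, bF]; norm_num
  have ha2 : a2 = 31 * Y2 * (1 + Y2) := by rw [ha2, aF]; norm_num
  have hb2 : b2 = 961 * Y2 * (1 + Y2) * (1 + 2 * Y2) := by rw [hb2, bF]; norm_num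
  have E4 := mu_solved hSD hd E2
  have q0 : Iv q 0 0.6 := ⟨hq0.le, hq.le⟩
  have tP : q ^ 156 ≤ 0.000000000001 := (q0.pow 156 (L := 0) (U := 0.000000000001) (by norm_num)).2
  have iζ : Iv ζ (-0.000000000004) 0.000000000004 := Iv.of_abs hζ (by linarith only [tP])
  have ilm : Iv lm (-0.000000000472) 0.000000000472 := Iv.of_abs hlm (by linarith only [tP])
  have iδ : Iv δ (-0.000000000472) 0.000000000472 := Iv.of_abs hδ (by linarith only [tP])
  have iη : Iv η (-0.000000073495) 0.000000073495 := Iv.of_abs hη (by linarith only [tP])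
  have iY2 : Iv Y2 0 0.00000013265 := q0.geo 31 hY2 (by norm_num)
  have c0 : Iv (1:ℝ) 1 1 := ⟨le_rfl, le_rfl⟩
  have i1 := c0.sub iζ (L := 0.99999999999) (U := 1.00000000001) (by norm_num)
  have i2 := iY2.mulp i1 (L := 0) (U := 0.00000013266) (by norm_num)
  have iz : Iv z 0 0.00000013266 := by rw [hz]; exact i2
  have q1 := Iv.step 6 0.5 0.5125417198 q0 hY iz E1 0 0.0489393126 (by norm_num) (by norm_num)
  have q2 := Iv.step 6 0.5039999994 0.5046589594 q1 hY iz E1 0.0158730158 0.0184637932 (by norm_num) (by norm_num)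
  have q3 := Iv.step 6 0.5042008177 0.5042347208 q2 hY iz E1 0.0166632745 0.0167966249 (by norm_num) (by norm_num)
  have q4 := Iv.step 6 0.5042111246 0.5042128675 q3 hY iz E1 0.0167038171 0.0167106701 (by norm_num) (by norm_num)
  have q5 := Iv.step 6 0.5042116542 0.5042117444 q4 hY iz E1 0.0167059002 0.0167062526 (by norm_num) (by norm_num)
  have q6 := Iv.step 6 0.5042116814 0.5042116867 q5 hY iz E1 0.0167060073 0.0167060256 (by norm_num) (by norm_num)
  have tP : q ^ 156 ≤ 0.000000000001 := (q6.pow 156 (L := 0) (U := 0.000000000001) (by norm_num)).2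
  have iζ : Iv ζ (-0.000000000004) 0.000000000004 := Iv.of_abs hζ (by linarith only [tP])
  have ilm : Iv lm (-0.000000000472) 0.000000000472 := Iv.of_abs hlm (by linarith only [tP])
  have iδ : Iv δ (-0.000000000472) 0.000000000472 := Iv.of_abs hδ (by linarith only [tP])
  have iη : Iv η (-0.000000073495) 0.000000073495 := Iv.of_abs hη (by linarith only [tP])
  have iY2 : Iv Y2 0.0000000006 0.00000000061 := q6.geo 31 hY2 (by norm_num)
  have i3 := c0.sub iζ (L := 0.99999999999) (U := 1.00000000001) (by norm_num)
  have i4 := iY2.mulp i3 (L := 0.00000000059) (U := 0.00000000062) (by norm_num)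
  have iz : Iv z 0.00000000059 0.00000000062 := by rw [hz]; exact i4
  have iY : Iv Y 0.01670601281 0.01670601389 := q6.geo 6 hY (by norm_num)
  have c1 : Iv (6:ℝ) 6 6 := ⟨le_rfl, le_rfl⟩
  have i5 := c1.mulp iY (L := 0.10023607686) (U := 0.10023608334) (by norm_num)
  have i6 := c0.add iY (L := 1.01670601281) (U := 1.01670601389) (by norm_num)
  have i7 := i5.mulp i6 (L := 0.10191062204) (U := 0.10191062875) (by norm_num)
  have ia : Iv a 0.10191062204 0.10191062875 := by rw [ha]; exact i7
  have c2 : Iv (36:ℝ) 36 36 := ⟨le_rfl, le_rfl⟩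
  have i8 := c2.mulp iY (L := 0.60141646116) (U := 0.60141650004) (by norm_num)
  have i9 := c0.add iY (L := 1.01670601281) (U := 1.01670601389) (by norm_num)
  have i10 := i8.mulp i9 (L := 0.61146373226) (U := 0.61146377245) (by norm_num)
  have c3 : Iv (2:ℝ) 2 2 := ⟨le_rfl, le_rfl⟩
  have i11 := c3.mulp iY (L := 0.03341202562) (U := 0.03341202778) (by norm_num)
  have i12 := c0.add i11 (L := 1.03341202562) (U := 1.03341202778) (by norm_num)
  have i13 := i10.mulp i12 (L := 0.63189397414) (U := 0.63189401701) (by norm_num)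
  have ib : Iv b 0.63189397414 0.63189401701 := by rw [hb]; exact i13
  have c4 : Iv (31:ℝ) 31 31 := ⟨le_rfl, le_rfl⟩
  have i14 := c4.mulp iY2 (L := 0.0000000186) (U := 0.00000001891) (by norm_num)
  have i15 := c0.add iY2 (L := 1.0000000006) (U := 1.00000000061) (by norm_num)
  have i16 := i14.mulp i15 (L := 0.0000000186) (U := 0.00000001892) (by norm_num)
  have ia2 : Iv a2 0.0000000186 0.00000001892 := by rw [ha2]; exact i16
  have c5 : Iv (961:ℝ) 961 961 := ⟨le_rfl, le_rfl⟩
  have i17 := c5.mulp iY2 (L := 0.0000005766) (U := 0.00000058621) (by norm_num)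
  have i18 := c0.add iY2 (L := 1.0000000006) (U := 1.00000000061) (by norm_num)
  have i19 := i17.mulp i18 (L := 0.0000005766) (U := 0.00000058622) (by norm_num)
  have i20 := c3.mulp iY2 (L := 0.0000000012) (U := 0.00000000122) (by norm_num)
  have i21 := c0.add i20 (L := 1.0000000012) (U := 1.00000000122) (by norm_num)
  have i22 := i19.mulp i21 (L := 0.0000005766) (U := 0.00000058623) (by norm_num)
  have ib2 : Iv b2 0.0000005766 0.00000058623 := by rw [hb2]; exact i22
  have i23 := c0.sub iz (L := 0.99999999938) (U := 0.99999999941) (by norm_num)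
  have i24 := iY.mulp i23 (L := 0.01670601279) (U := 0.01670601389) (by norm_num)
  have iS : Iv S 0.01670601279 0.01670601389 := by rw [hS]; exact i24
  have i25 := c3.sub iS (L := 1.98329398611) (U := 1.98329398721) (by norm_num)
  have i26 := i25.sub ia (L := 1.88138335736) (U := 1.88138336517) (by norm_num)
  have i27 := iY.mulp ia2 (L := 0.00000000031) (U := 0.00000000032) (by norm_num)
  have i28 := c0.sub iζ (L := 0.99999999999) (U := 1.00000000001) (by norm_num)
  have i29 := i27.mulp i28 (L := 0.0000000003) (U := 0.00000000033) (by norm_num)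
  have i30 := i26.add i29 (L := 1.88138335766) (U := 1.8813833655) (by norm_num)
  have i31 := ia.mulp iz (L := 0.00000000006) (U := 0.00000000007) (by norm_num)
  have i32 := i30.add i31 (L := 1.88138335772) (U := 1.88138336557) (by norm_num)
  have c6 : Iv (3:ℝ) 3 3 := ⟨le_rfl, le_rfl⟩
  have i33 := c6.sub iS (L := 2.98329398611) (U := 2.98329398721) (by norm_num)
  have i34 := i33.mulp iS (L := 0.04983894748) (U := 0.04983895079) (by norm_num)
  have i35 := c0.sub i34 (L := 0.95016104921) (U := 0.95016105252) (by norm_num)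
  have i36 := iY2.mul iδ (L := (-0.00000000001)) (U := 0.00000000001) (by norm_num)
  have i37 := c0.add iY2 (L := 1.0000000006) (U := 1.00000000061) (by norm_num)
  have i38 := i37.mul iζ (L := (-0.00000000001)) (U := 0.00000000001) (by norm_num)
  have i39 := i36.add i38 (L := (-0.00000000002)) (U := 0.00000000002) (by norm_num)
  have i40 := iY.mul i39 (L := (-0.00000000001)) (U := 0.00000000001) (by norm_num)
  have i41 := i35.sub i40 (L := 0.9501610492) (U := 0.95016105253) (by norm_num)
  have i42 := c0.add iY (L := 1.01670601281) (U := 1.01670601389) (by norm_num)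
  have i43 := i42.mulp iz (L := 0.00000000059) (U := 0.00000000064) (by norm_num)
  have i44 := i41.add i43 (L := 0.95016104979) (U := 0.95016105317) (by norm_num)
  have iμ : Iv μ 0.50503319375 0.50503319766 := i32.quot i44 E4 (by norm_num)
  have hl : l = a2 - Y2 * lm - a2 * ζ := hl
  have i45 := iY2.mul ilm (L := (-0.00000000001)) (U := 0.00000000001) (by norm_num)
  have i46 := ia2.sub i45 (L := 0.00000001859) (U := 0.00000001893) (by norm_num)
  have i47 := ia2.mul iζ (L := (-0.00000000001)) (U := 0.00000000001) (by norm_num)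
  have i48 := i46.sub i47 (L := 0.00000001858) (U := 0.00000001894) (by norm_num)
  have il : Iv l 0.00000001858 0.00000001894 := by rw [hl]; exact i48
  have hd : d = 0 - μ * a2 - Y2 * δ - ((1 + Y2) - μ * a2) * ζ := by rw [hd]; ring
  have i49 := iμ.mulp ia2 (L := 0.00000000939) (U := 0.00000000956) (by norm_num)
  have c7 : Iv (0:ℝ) 0 0 := ⟨le_rfl, le_rfl⟩
  have i50 := c7.sub i49 (L := (-0.00000000956)) (U := (-0.00000000939)) (by norm_num)
  have i51 := iY2.mul iδ (L := (-0.00000000001)) (U := 0.00000000001) (by norm_num)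
  have i52 := i50.sub i51 (L := (-0.00000000957)) (U := (-0.00000000938)) (by norm_num)
  have i53 := c0.add iY2 (L := 1.0000000006) (U := 1.00000000061) (by norm_num)
  have i54 := iμ.mulp ia2 (L := 0.00000000939) (U := 0.00000000956) (by norm_num)
  have i55 := i53.sub i54 (L := 0.99999999104) (U := 0.99999999122) (by norm_num)
  have i56 := i55.mul iζ (L := (-0.00000000001)) (U := 0.00000000001) (by norm_num)
  have i57 := i52.sub i56 (L := (-0.00000000958)) (U := (-0.00000000937)) (by norm_num)
  have id : Iv d (-0.00000000958) (-0.00000000937) := by rw [hd]; exact i57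
  have he : e = 0.5 * (μ ^ 2 * b2) - Y2 * η - ((1 + Y2) - μ * a2) * δ - 0.5 * ((1 + Y2) - 2 * μ * a2 + μ ^ 2 * b2) * ζ := by rw [he]; ring
  have i58 := iμ.pow 2 (L := 0.25505852678) (U := 0.25505853074) (by norm_num)
  have i59 := i58.mulp ib2 (L := 0.00000014706) (U := 0.00000014953) (by norm_num)
  have c8 : Iv (0.5:ℝ) 0.5 0.5 := ⟨le_rfl, le_rfl⟩
  have i60 := c8.mulp i59 (L := 0.00000007353) (U := 0.00000007477) (by norm_num)
  have i61 := iY2.mul iη (L := (-0.00000000001)) (U := 0.00000000001) (by norm_num)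
  have i62 := i60.sub i61 (L := 0.00000007352) (U := 0.00000007478) (by norm_num)
  have i63 := c0.add iY2 (L := 1.0000000006) (U := 1.00000000061) (by norm_num)
  have i64 := iμ.mulp ia2 (L := 0.00000000939) (U := 0.00000000956) (by norm_num)
  have i65 := i63.sub i64 (L := 0.99999999104) (U := 0.99999999122) (by norm_num)
  have i66 := i65.mul iδ (L := (-0.00000000048)) (U := 0.00000000048) (by norm_num)
  have i67 := i62.sub i66 (L := 0.00000007304) (U := 0.00000007526) (by norm_num)
  have i68 := c0.add iY2 (L := 1.0000000006) (U := 1.00000000061) (by norm_num)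
  have i69 := c3.mulp iμ (L := 1.0100663875) (U := 1.01006639532) (by norm_num)
  have i70 := i69.mulp ia2 (L := 0.00000001878) (U := 0.00000001912) (by norm_num)
  have i71 := i68.sub i70 (L := 0.99999998148) (U := 0.99999998183) (by norm_num)
  have i72 := i58.mulp ib2 (L := 0.00000014706) (U := 0.00000014953) (by norm_num)
  have i73 := i71.add i72 (L := 1.00000012854) (U := 1.00000013136) (by norm_num)
  have i74 := c8.mulp i73 (L := 0.50000006427) (U := 0.50000006568) (by norm_num)
  have i75 := i74.mul iζ (L := (-0.00000000001)) (U := 0.00000000001) (by norm_num)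
  have i76 := i67.sub i75 (L := 0.00000007303) (U := 0.00000007527) (by norm_num)
  have ie : Iv e 0.00000007303 0.00000007527 := by rw [he]; exact i76
  have i77 := iY.mulp il (L := 0.00000000031) (U := 0.00000000032) (by norm_num)
  have i78 := ia.sub i77 (L := 0.10191062172) (U := 0.10191062844) (by norm_num)
  have i79 := ia.mulp iz (L := 0.00000000006) (U := 0.00000000007) (by norm_num)
  have i80 := i78.sub i79 (L := 0.10191062165) (U := 0.10191062838) (by norm_num)
  have iSL : Iv SL 0.10191062165 0.10191062838 := by rw [hSL]; exact i80
  have hSD : SD = 0 - μ * a - Y * d - ((1 + Y) - μ * a) * z := by rw [hSD]; ring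
  have i81 := iμ.mulp ia (L := 0.05146824692) (U := 0.05146825072) (by norm_num)
  have i82 := c7.sub i81 (L := (-0.05146825072)) (U := (-0.05146824692)) (by norm_num)
  have i83 := iY.mul id (L := (-0.00000000017)) (U := (-0.00000000015)) (by norm_num)
  have i84 := i82.sub i83 (L := (-0.05146825057)) (U := (-0.05146824675)) (by norm_num)
  have i85 := c0.add iY (L := 1.01670601281) (U := 1.01670601389) (by norm_num)
  have i86 := iμ.mulp ia (L := 0.05146824692) (U := 0.05146825072) (by norm_num)
  have i87 := i85.sub i86 (L := 0.96523776209) (U := 0.96523776697) (by norm_num)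
  have i88 := i87.mulp iz (L := 0.00000000056) (U := 0.0000000006) (by norm_num)
  have i89 := i84.sub i88 (L := (-0.05146825117)) (U := (-0.05146824731)) (by norm_num)
  have iSD : Iv SD (-0.05146825117) (-0.05146824731) := by rw [hSD]; exact i89
  have hSE : SE = 0.5 * (μ ^ 2 * b) - Y * e - ((1 + Y) - μ * a) * d - 0.5 * ((1 + Y) - 2 * μ * a + μ ^ 2 * b) * z := by rw [hSE]; ring
  have i90 := i58.mulp ib (L := 0.16116994612) (U := 0.16116995957) (by norm_num)
  have i91 := c8.mulp i90 (L := 0.08058497306) (U := 0.08058497979) (by norm_num)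
  have i92 := iY.mulp ie (L := 0.00000000122) (U := 0.00000000126) (by norm_num)
  have i93 := i91.sub i92 (L := 0.0805849718) (U := 0.08058497857) (by norm_num)
  have i94 := c0.add iY (L := 1.01670601281) (U := 1.01670601389) (by norm_num)
  have i95 := iμ.mulp ia (L := 0.05146824692) (U := 0.05146825072) (by norm_num)
  have i96 := i94.sub i95 (L := 0.96523776209) (U := 0.96523776697) (by norm_num)
  have i97 := i96.mul id (L := (-0.00000000925)) (U := (-0.00000000904)) (by norm_num)
  have i98 := i93.sub i97 (L := 0.08058498084) (U := 0.08058498782) (by norm_num)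
  have i99 := c0.add iY (L := 1.01670601281) (U := 1.01670601389) (by norm_num)
  have i100 := c3.mulp iμ (L := 1.0100663875) (U := 1.01006639532) (by norm_num)
  have i101 := i100.mulp ia (L := 0.10293649385) (U := 0.10293650143) (by norm_num)
  have i102 := i99.sub i101 (L := 0.91376951138) (U := 0.91376952004) (by norm_num)
  have i103 := i58.mulp ib (L := 0.16116994612) (U := 0.16116995957) (by norm_num)
  have i104 := i102.add i103 (L := 1.0749394575) (U := 1.07493947961) (by norm_num)
  have i105 := c8.mulp i104 (L := 0.53746972875) (U := 0.53746973981) (by norm_num)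
  have i106 := i105.mulp iz (L := 0.00000000031) (U := 0.00000000034) (by norm_num)
  have i107 := i98.sub i106 (L := 0.0805849805) (U := 0.08058498751) (by norm_num)
  have iSE : Iv SE 0.0805849805 0.08058498751 := by rw [hSE]; exact i107
  have i108 := c3.sub iS (L := 1.98329398611) (U := 1.98329398721) (by norm_num)
  have i109 := i108.sub iSL (L := 1.88138335773) (U := 1.88138336556) (by norm_num)
  have i110 := c0.sub iμ (L := 0.49496680234) (U := 0.49496680625) (by norm_num)
  have i111 := i110.pow 2 (L := 0.24499213541) (U := 0.24499213929) (by norm_num)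
  have i112 := i58.add i111 (L := 0.50005066219) (U := 0.50005067003) (by norm_num)
  have i113 := c6.mulp iS (L := 0.05011803837) (U := 0.05011804167) (by norm_num)
  have i114 := c1.sub i113 (L := 5.94988195833) (U := 5.94988196163) (by norm_num)
  have i115 := i114.add i111 (L := 6.19487409374) (U := 6.19487410092) (by norm_num)
  have i116 := i115.mulp iS (L := 0.10349164584) (U := 0.10349165278) (by norm_num)
  have i117 := i112.sub i116 (L := 0.39655900941) (U := 0.39655902419) (by norm_num)
  have i118 := c6.sub iμ (L := 2.49496680234) (U := 2.49496680625) (by norm_num)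
  have i119 := i118.sub iS (L := 2.47826078845) (U := 2.47826079346) (by norm_num)
  have i120 := c3.mulp i119 (L := 4.9565215769) (U := 4.95652158692) (by norm_num)
  have i121 := i120.mul iSD (L := (-0.25510349797)) (U := (-0.25510347831)) (by norm_num)
  have i122 := i117.sub i121 (L := 0.65166248772) (U := 0.65166252216) (by norm_num)
  have i123 := c3.mulp iSE (L := 0.161169961) (U := 0.16116997502) (by norm_num)
  have i124 := i122.sub i123 (L := 0.4904925127) (U := 0.49049256116) (by norm_num)
  have iV : Iv V 0.2607084349 0.26070846176 := i109.quot i124 E3 (by norm_num)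
  obtain ⟨m2, m3⟩ := iμ
  obtain ⟨v2, v3⟩ := iV
  constructor
  · rw [abs_le]; constructor <;> norm_num <;> linarith
  · rw [abs_le]; constructor <;> norm_num <;> linarith

set_option maxHeartbeats 4000000 in
lemma bds_6 {q μ V : ℝ} (H : Sys 6 q μ V) : Bds 6 μ V := by
  obtain ⟨hq0, hq, m0, m1, V0, ζ, lm, δ, η, z, l, d, e, S, SL, SD, SE, Y, a, b, Y2, a2, b2, hζ, hlm, hδ, hη, hY, ha, hb, hY2,
    ha2, hb2, hz, hl, hd, he, hS, hSL, hSD, hSE, E1, E2, E3⟩ := H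
  rw [show hh 6 3 = 259 by simp [hh]] at hζ hlm hδ hη
  norm_num at hY hY2 hζ hlm hδ hη
  rw [hS] at E1
  have ha : a = 7 * Y * (1 + Y) := by rw [ha, aF]; norm_num
  have hb : b = 49 * Y * (1 + Y) * (1 + 2 * Y) := by rw [hb, bF]; norm_num
  have ha2 : a2 = 43 * Y2 * (1 + Y2) := by rw [ha2, aF]; norm_num
  have hb2 : b2 = 1849 * Y2 * (1 + Y2) * (1 + 2 * Y2) := by rw [hb2, bF]; norm_num
  have E4 := mu_solved hSD hd E2
  have q0 : Iv q 0 0.6 := ⟨hq0.le, hq.le⟩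
  have tP : q ^ 259 ≤ 0.000000000001 := (pow_le_pow_of_le_one hq0.le (by linarith) (by norm_num : 100 ≤ 259)).trans (q0.pow 100 (L := 0) (U := 0.000000000001) (by norm_num)).2
  have iζ : Iv ζ (-0.000000000004) 0.000000000004 := Iv.of_abs hζ (by linarith only [tP])
  have ilm : Iv lm (-0.000000000783) 0.000000000783 := Iv.of_abs hlm (by linarith only [tP])
  have iδ : Iv δ (-0.000000000783) 0.000000000783 := Iv.of_abs hδ (by linarith only [tP])
  have iη : Iv η (-0.000000202585) 0.000000202585 := Iv.of_abs hη (by linarith only [tP])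
  have iY2 : Iv Y2 0 0.00000000029 := q0.geo 43 hY2 (by norm_num)
  have c0 : Iv (1:ℝ) 1 1 := ⟨le_rfl, le_rfl⟩
  have i1 := c0.sub iζ (L := 0.99999999999) (U := 1.00000000001) (by norm_num)
  have i2 := iY2.mulp i1 (L := 0) (U := 0.0000000003) (by norm_num)
  have iz : Iv z 0 0.0000000003 := by rw [hz]; exact i2
  have q1 := Iv.step 7 0.5 0.5073051461 q0 hY iz E1 0 0.0287998104 (by norm_num) (by norm_num)
  have q2 := Iv.step 7 0.5019762845 0.5021902567 q1 hY iz E1 0.0078740157 0.0087228162 (by norm_num) (by norm_num)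
  have q3 := Iv.step 7 0.5020322917 0.5020384378 q2 hY iz E1 0.0080962591 0.0081206443 (by norm_num) (by norm_num)
  have q4 := Iv.step 7 0.5020338989 0.5020340754 q3 hY iz E1 0.0081026358 0.0081033359 (by norm_num) (by norm_num)
  have q5 := Iv.step 7 0.502033945 0.5020339502 q4 hY iz E1 0.0081028188 0.008102839 (by norm_num) (by norm_num)
  have q6 := Iv.step 7 0.5020339463 0.5020339466 q5 hY iz E1 0.0081028241 0.0081028248 (by norm_num) (by norm_num)
  have tP : q ^ 259 ≤ 0.000000000001 := (pow_le_pow_of_le_one hq0.le (by linarith) (by norm_num : 100 ≤ 259)).trans (q6.pow 100 (L := 0) (U := 0.000000000001) (by norm_num)).2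
  have iζ : Iv ζ (-0.000000000004) 0.000000000004 := Iv.of_abs hζ (by linarith only [tP])
  have ilm : Iv lm (-0.000000000783) 0.000000000783 := Iv.of_abs hlm (by linarith only [tP])
  have iδ : Iv δ (-0.000000000783) 0.000000000783 := Iv.of_abs hδ (by linarith only [tP])
  have iη : Iv η (-0.000000202585) 0.000000202585 := Iv.of_abs hη (by linarith only [tP])
  have iY2 : Iv Y2 0 0.00000000001 := q6.geo 43 hY2 (by norm_num)
  have i3 := c0.sub iζ (L := 0.99999999999) (U := 1.00000000001) (by norm_num)
  have i4 := iY2.mulp i3 (L := 0) (U := 0.00000000002) (by norm_num)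
  have iz : Iv z 0 0.00000000002 := by rw [hz]; exact i4
  have iY : Iv Y 0.00810282426 0.0081028243 := q6.geo 7 hY (by norm_num)
  have c1 : Iv (7:ℝ) 7 7 := ⟨le_rfl, le_rfl⟩
  have i5 := c1.mulp iY (L := 0.05671976982) (U := 0.0567197701) (by norm_num)
  have i6 := c0.add iY (L := 1.00810282426) (U := 1.0081028243) (by norm_num)
  have i7 := i5.mulp i6 (L := 0.05717936014) (U := 0.05717936044) (by norm_num)
  have ia : Iv a 0.05717936014 0.05717936044 := by rw [ha]; exact i7
  have c2 : Iv (49:ℝ) 49 49 := ⟨le_rfl, le_rfl⟩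
  have i8 := c2.mulp iY (L := 0.39703838874) (U := 0.3970383907) (by norm_num)
  have i9 := c0.add iY (L := 1.00810282426) (U := 1.0081028243) (by norm_num)
  have i10 := i8.mulp i9 (L := 0.40025552102) (U := 0.40025552303) (by norm_num)
  have c3 : Iv (2:ℝ) 2 2 := ⟨le_rfl, le_rfl⟩
  have i11 := c3.mulp iY (L := 0.01620564852) (U := 0.0162056486) (by norm_num)
  have i12 := c0.add i11 (L := 1.01620564852) (U := 1.0162056486) (by norm_num)
  have i13 := i10.mulp i12 (L := 0.40674192131) (U := 0.40674192339) (by norm_num)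
  have ib : Iv b 0.40674192131 0.40674192339 := by rw [hb]; exact i13
  have c4 : Iv (43:ℝ) 43 43 := ⟨le_rfl, le_rfl⟩
  have i14 := c4.mulp iY2 (L := 0) (U := 0.00000000043) (by norm_num)
  have i15 := c0.add iY2 (L := 1) (U := 1.00000000001) (by norm_num)
  have i16 := i14.mulp i15 (L := 0) (U := 0.00000000044) (by norm_num)
  have ia2 : Iv a2 0 0.00000000044 := by rw [ha2]; exact i16
  have c5 : Iv (1849:ℝ) 1849 1849 := ⟨le_rfl, le_rfl⟩
  have i17 := c5.mulp iY2 (L := 0) (U := 0.00000001849) (by norm_num)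
  have i18 := c0.add iY2 (L := 1) (U := 1.00000000001) (by norm_num)
  have i19 := i17.mulp i18 (L := 0) (U := 0.0000000185) (by norm_num)
  have i20 := c3.mulp iY2 (L := 0) (U := 0.00000000002) (by norm_num)
  have i21 := c0.add i20 (L := 1) (U := 1.00000000002) (by norm_num)
  have i22 := i19.mulp i21 (L := 0) (U := 0.00000001851) (by norm_num)
  have ib2 : Iv b2 0 0.00000001851 := by rw [hb2]; exact i22
  have i23 := c0.sub iz (L := 0.99999999998) (U := 1) (by norm_num)
  have i24 := iY.mulp i23 (L := 0.00810282425) (U := 0.0081028243) (by norm_num)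
  have iS : Iv S 0.00810282425 0.0081028243 := by rw [hS]; exact i24
  have i25 := c3.sub iS (L := 1.9918971757) (U := 1.99189717575) (by norm_num)
  have i26 := i25.sub ia (L := 1.93471781526) (U := 1.93471781561) (by norm_num)
  have i27 := iY.mulp ia2 (L := 0) (U := 0.00000000001) (by norm_num)
  have i28 := c0.sub iζ (L := 0.99999999999) (U := 1.00000000001) (by norm_num)
  have i29 := i27.mulp i28 (L := 0) (U := 0.00000000002) (by norm_num)
  have i30 := i26.add i29 (L := 1.93471781526) (U := 1.93471781563) (by norm_num)
  have i31 := ia.mulp iz (L := 0) (U := 0.00000000001) (by norm_num)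
  have i32 := i30.add i31 (L := 1.93471781526) (U := 1.93471781564) (by norm_num)
  have c6 : Iv (3:ℝ) 3 3 := ⟨le_rfl, le_rfl⟩
  have i33 := c6.sub iS (L := 2.9918971757) (U := 2.99189717575) (by norm_num)
  have i34 := i33.mulp iS (L := 0.02424281698) (U := 0.02424281714) (by norm_num)
  have i35 := c0.sub i34 (L := 0.97575718286) (U := 0.97575718302) (by norm_num)
  have i36 := iY2.mul iδ (L := (-0.00000000001)) (U := 0.00000000001) (by norm_num)
  have i37 := c0.add iY2 (L := 1) (U := 1.00000000001) (by norm_num)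
  have i38 := i37.mul iζ (L := (-0.00000000001)) (U := 0.00000000001) (by norm_num)
  have i39 := i36.add i38 (L := (-0.00000000002)) (U := 0.00000000002) (by norm_num)
  have i40 := iY.mul i39 (L := (-0.00000000001)) (U := 0.00000000001) (by norm_num)
  have i41 := i35.sub i40 (L := 0.97575718285) (U := 0.97575718303) (by norm_num)
  have i42 := c0.add iY (L := 1.00810282426) (U := 1.0081028243) (by norm_num)
  have i43 := i42.mulp iz (L := 0) (U := 0.00000000003) (by norm_num)
  have i44 := i41.add i43 (L := 0.97575718285) (U := 0.97575718306) (by norm_num)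
  have iμ : Iv μ 0.50434082684 0.50434082706 := i32.quot i44 E4 (by norm_num)
  have hl : l = a2 - Y2 * lm - a2 * ζ := hl
  have i45 := iY2.mul ilm (L := (-0.00000000001)) (U := 0.00000000001) (by norm_num)
  have i46 := ia2.sub i45 (L := (-0.00000000001)) (U := 0.00000000045) (by norm_num)
  have i47 := ia2.mul iζ (L := (-0.00000000001)) (U := 0.00000000001) (by norm_num)
  have i48 := i46.sub i47 (L := (-0.00000000002)) (U := 0.00000000046) (by norm_num)
  have il : Iv l (-0.00000000002) 0.00000000046 := by rw [hl]; exact i48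
  have hd : d = 0 - μ * a2 - Y2 * δ - ((1 + Y2) - μ * a2) * ζ := by rw [hd]; ring
  have i49 := iμ.mulp ia2 (L := 0) (U := 0.00000000023) (by norm_num)
  have c7 : Iv (0:ℝ) 0 0 := ⟨le_rfl, le_rfl⟩
  have i50 := c7.sub i49 (L := (-0.00000000023)) (U := 0) (by norm_num)
  have i51 := iY2.mul iδ (L := (-0.00000000001)) (U := 0.00000000001) (by norm_num)
  have i52 := i50.sub i51 (L := (-0.00000000024)) (U := 0.00000000001) (by norm_num)
  have i53 := c0.add iY2 (L := 1) (U := 1.00000000001) (by norm_num)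
  have i54 := iμ.mulp ia2 (L := 0) (U := 0.00000000023) (by norm_num)
  have i55 := i53.sub i54 (L := 0.99999999977) (U := 1.00000000001) (by norm_num)
  have i56 := i55.mul iζ (L := (-0.00000000001)) (U := 0.00000000001) (by norm_num)
  have i57 := i52.sub i56 (L := (-0.00000000025)) (U := 0.00000000002) (by norm_num)
  have id : Iv d (-0.00000000025) 0.00000000002 := by rw [hd]; exact i57
  have he : e = 0.5 * (μ ^ 2 * b2) - Y2 * η - ((1 + Y2) - μ * a2) * δ - 0.5 * ((1 + Y2) - 2 * μ * a2 + μ ^ 2 * b2) * ζ := by rw [he]; ring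
  have i58 := iμ.pow 2 (L := 0.25435966961) (U := 0.25435966984) (by norm_num)
  have i59 := i58.mulp ib2 (L := 0) (U := 0.00000000471) (by norm_num)
  have c8 : Iv (0.5:ℝ) 0.5 0.5 := ⟨le_rfl, le_rfl⟩
  have i60 := c8.mulp i59 (L := 0) (U := 0.00000000236) (by norm_num)
  have i61 := iY2.mul iη (L := (-0.00000000001)) (U := 0.00000000001) (by norm_num)
  have i62 := i60.sub i61 (L := (-0.00000000001)) (U := 0.00000000237) (by norm_num)
  have i63 := c0.add iY2 (L := 1) (U := 1.00000000001) (by norm_num)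
  have i64 := iμ.mulp ia2 (L := 0) (U := 0.00000000023) (by norm_num)
  have i65 := i63.sub i64 (L := 0.99999999977) (U := 1.00000000001) (by norm_num)
  have i66 := i65.mul iδ (L := (-0.00000000079)) (U := 0.00000000079) (by norm_num)
  have i67 := i62.sub i66 (L := (-0.0000000008)) (U := 0.00000000316) (by norm_num)
  have i68 := c0.add iY2 (L := 1) (U := 1.00000000001) (by norm_num)
  have i69 := c3.mulp iμ (L := 1.00868165368) (U := 1.00868165412) (by norm_num)
  have i70 := i69.mulp ia2 (L := 0) (U := 0.00000000045) (by norm_num)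
  have i71 := i68.sub i70 (L := 0.99999999955) (U := 1.00000000001) (by norm_num)
  have i72 := i58.mulp ib2 (L := 0) (U := 0.00000000471) (by norm_num)
  have i73 := i71.add i72 (L := 0.99999999955) (U := 1.00000000472) (by norm_num)
  have i74 := c8.mulp i73 (L := 0.49999999977) (U := 0.50000000236) (by norm_num)
  have i75 := i74.mul iζ (L := (-0.00000000001)) (U := 0.00000000001) (by norm_num)
  have i76 := i67.sub i75 (L := (-0.00000000081)) (U := 0.00000000317) (by norm_num)
  have ie : Iv e (-0.00000000081) 0.00000000317 := by rw [he]; exact i76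
  have i77 := iY.mul il (L := (-0.00000000001)) (U := 0.00000000001) (by norm_num)
  have i78 := ia.sub i77 (L := 0.05717936013) (U := 0.05717936045) (by norm_num)
  have i79 := ia.mulp iz (L := 0) (U := 0.00000000001) (by norm_num)
  have i80 := i78.sub i79 (L := 0.05717936012) (U := 0.05717936045) (by norm_num)
  have iSL : Iv SL 0.05717936012 0.05717936045 := by rw [hSL]; exact i80
  have hSD : SD = 0 - μ * a - Y * d - ((1 + Y) - μ * a) * z := by rw [hSD]; ring
  have i81 := iμ.mulp ia (L := 0.02883788577) (U := 0.02883788594) (by norm_num)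
  have i82 := c7.sub i81 (L := (-0.02883788594)) (U := (-0.02883788577)) (by norm_num)
  have i83 := iY.mul id (L := (-0.00000000001)) (U := 0.00000000001) (by norm_num)
  have i84 := i82.sub i83 (L := (-0.02883788595)) (U := (-0.02883788576)) (by norm_num)
  have i85 := c0.add iY (L := 1.00810282426) (U := 1.0081028243) (by norm_num)
  have i86 := iμ.mulp ia (L := 0.02883788577) (U := 0.02883788594) (by norm_num)
  have i87 := i85.sub i86 (L := 0.97926493832) (U := 0.97926493853) (by norm_num)
  have i88 := i87.mulp iz (L := 0) (U := 0.00000000002) (by norm_num)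
  have i89 := i84.sub i88 (L := (-0.02883788597)) (U := (-0.02883788576)) (by norm_num)
  have iSD : Iv SD (-0.02883788597) (-0.02883788576) := by rw [hSD]; exact i89
  have hSE : SE = 0.5 * (μ ^ 2 * b) - Y * e - ((1 + Y) - μ * a) * d - 0.5 * ((1 + Y) - 2 * μ * a + μ ^ 2 * b) * z := by rw [hSE]; ring
  have i90 := i58.mulp ib (L := 0.10345874072) (U := 0.10345874135) (by norm_num)
  have i91 := c8.mulp i90 (L := 0.05172937036) (U := 0.05172937068) (by norm_num)
  have i92 := iY.mul ie (L := (-0.00000000001)) (U := 0.00000000003) (by norm_num)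
  have i93 := i91.sub i92 (L := 0.05172937033) (U := 0.05172937069) (by norm_num)
  have i94 := c0.add iY (L := 1.00810282426) (U := 1.0081028243) (by norm_num)
  have i95 := iμ.mulp ia (L := 0.02883788577) (U := 0.02883788594) (by norm_num)
  have i96 := i94.sub i95 (L := 0.97926493832) (U := 0.97926493853) (by norm_num)
  have i97 := i96.mul id (L := (-0.00000000025)) (U := 0.00000000002) (by norm_num)
  have i98 := i93.sub i97 (L := 0.05172937031) (U := 0.05172937094) (by norm_num)
  have i99 := c0.add iY (L := 1.00810282426) (U := 1.0081028243) (by norm_num)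
  have i100 := c3.mulp iμ (L := 1.00868165368) (U := 1.00868165412) (by norm_num)
  have i101 := i100.mulp ia (L := 0.05767577154) (U := 0.05767577188) (by norm_num)
  have i102 := i99.sub i101 (L := 0.95042705238) (U := 0.95042705276) (by norm_num)
  have i103 := i58.mulp ib (L := 0.10345874072) (U := 0.10345874135) (by norm_num)
  have i104 := i102.add i103 (L := 1.0538857931) (U := 1.05388579411) (by norm_num)
  have i105 := c8.mulp i104 (L := 0.52694289655) (U := 0.52694289706) (by norm_num)
  have i106 := i105.mulp iz (L := 0) (U := 0.00000000002) (by norm_num)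
  have i107 := i98.sub i106 (L := 0.05172937029) (U := 0.05172937094) (by norm_num)
  have iSE : Iv SE 0.05172937029 0.05172937094 := by rw [hSE]; exact i107
  have i108 := c3.sub iS (L := 1.9918971757) (U := 1.99189717575) (by norm_num)
  have i109 := i108.sub iSL (L := 1.93471781525) (U := 1.93471781563) (by norm_num)
  have i110 := c0.sub iμ (L := 0.49565917294) (U := 0.49565917316) (by norm_num)
  have i111 := i110.pow 2 (L := 0.24567801571) (U := 0.24567801594) (by norm_num)
  have i112 := i58.add i111 (L := 0.50003768532) (U := 0.50003768578) (by norm_num)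
  have i113 := c6.mulp iS (L := 0.02430847275) (U := 0.0243084729) (by norm_num)
  have c9 : Iv (6:ℝ) 6 6 := ⟨le_rfl, le_rfl⟩
  have i114 := c9.sub i113 (L := 5.9756915271) (U := 5.97569152725) (by norm_num)
  have i115 := i114.add i111 (L := 6.22136954281) (U := 6.22136954319) (by norm_num)
  have i116 := i115.mulp iS (L := 0.05041066399) (U := 0.05041066432) (by norm_num)
  have i117 := i112.sub i116 (L := 0.449627021) (U := 0.44962702179) (by norm_num)
  have i118 := c6.sub iμ (L := 2.49565917294) (U := 2.49565917316) (by norm_num)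
  have i119 := i118.sub iS (L := 2.48755634864) (U := 2.48755634891) (by norm_num)
  have i120 := c3.mulp i119 (L := 4.97511269728) (U := 4.97511269782) (by norm_num)
  have i121 := i120.mul iSD (L := (-0.14347173267)) (U := (-0.1434717316)) (by norm_num)
  have i122 := i117.sub i121 (L := 0.5930987526) (U := 0.59309875446) (by norm_num)
  have i123 := c3.mulp iSE (L := 0.10345874058) (U := 0.10345874188) (by norm_num)
  have i124 := i122.sub i123 (L := 0.48964001072) (U := 0.48964001388) (by norm_num)
  have iV : Iv V 0.2530808404 0.25308084209 := i109.quot i124 E3 (by norm_num)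
  obtain ⟨m2, m3⟩ := iμ
  obtain ⟨v2, v3⟩ := iV
  constructor
  · rw [abs_le]; constructor <;> norm_num <;> linarith
  · rw [abs_le]; constructor <;> norm_num <;> linarith

end

/-- For a uniformly random canonical `t`-ary tree with `n` internal
vertices, the number `d(T)` of distinct depths at which leaves occur is asymptotically
normal with mean `μ_d n + O(1)` and variance `σ_d² n + O(1)`, a local limit theorem
holds, and `μ_d`, `σ_d²` satisfy the stated estimates in `t` for all `t ≥ 2`. -/
theorem distinct_depths_asymptotically_normal (t : ℕ) (ht : 2 ≤ t) :
    ∃ μd σd : ℝ, 0 < σd ∧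
      |μd - (1/2 + ((t : ℝ) - 4)/2^(t+3) + (2*(t : ℝ)^2 - t - 14)/2^(2*t+5)
          + (9*(t : ℝ)^3 + 27*t^2 - 76*t - 144)/2^(3*t+8))|
        ≤ 0.06 * (t : ℝ)^4 / 2^(4*t) ∧
      |σd^2 - (1/4 + (-(t : ℝ)^2 + 9*t - 14)/2^(t+4)
          + (-4*(t : ℝ)^3 + 20*t^2 + 3*t - 54)/2^(2*t+6))|
        ≤ 0.056 * (t : ℝ)^4 / 2^(3*t) ∧
      (∃ C : ℝ, ∀ n : ℕ, 1 ≤ n →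
        |forestExp t 1 n (fun T => (T.distinctDepths : ℝ)) - μd * n| ≤ C) ∧
      (∃ C : ℝ, ∀ n : ℕ, 1 ≤ n →
        |forestVar t 1 n (fun T => (T.distinctDepths : ℝ)) - σd^2 * n| ≤ C) ∧
      (∀ x : ℝ, Filter.Tendsto
        (fun n : ℕ => forestProb t 1 n
          {T | ((T.distinctDepths : ℝ) - μd * n) / (σd * Real.sqrt n) ≤ x})
        Filter.atTop (nhds (stdGaussCDF x))) ∧
      (∀ ε : ℝ, 0 < ε → ∃ N : ℕ, ∀ n : ℕ, N ≤ n → ∀ k : ℤ,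
        |σd * Real.sqrt n * forestProb t 1 n {T | (T.distinctDepths : ℤ) = k}
            - stdGaussPDF (((k : ℝ) - μd * n) / (σd * Real.sqrt n))| ≤ ε) := by
  have B : Bds t (pd t ht).μ ((pd t ht).σ ^ 2) := by
    have H := sys_pd t ht
    rcases Nat.lt_or_ge t 7 with h | h
    · generalize q0 t ht = q at H
      generalize (pd t ht).μ = μ at H ⊢
      generalize (pd t ht).σ ^ 2 = V at H ⊢
      interval_cases t
      · exact bds_2 H
      · exact bds_3 H
      · exact bds_4 H
      · exact bds_5 H
      · exact bds_6 H
    · exact bds_large h H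
  obtain ⟨p1, p2, p3, p4⟩ := prob_claims t ht
  exact ⟨(pd t ht).μ, (pd t ht).σ, (pd t ht).σ_pos, B.1, B.2, p1, p2, p3, p4⟩

end
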